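/- Every weakly symmetric algebra of tubular type with non-singular Cartan matrix over an algebraically closed field K is tilting-discrete. -/

import Mathlib

/- Formalization of statements from
   "Report on the finiteness of silting objects"
   by T. Aihara, T. Honma, K. Miyamoto, Q. Wang. -/

open CategoryTheory CategoryTheory.Limits

universe u v w

noncomputable section
namespace PaperSilting
/-! ### Module-theoretic notions.

We model right `Λ`-modules as left modules over the opposite ring; all the
definitions below are stated for left modules over a ring `R` and are applied
with `R := Λᵐᵒᵖ`. -/

/-- The category of `R`-modules (in `Type 0`). -/
abbrev ModCat (R : Type) [Ring R] := ModuleCat.{0} R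

variable {R : Type} [Ring R]

/-- The module object `M` is finitely generated. -/
def IsFGMod {R : Type} [Ring R] (M : ModCat R) : Prop := Module.Finite R M

/-- Indecomposable module object. -/
def IsIndecMod {R : Type} [Ring R] (M : ModCat R) : Prop :=
  ¬ IsZero M ∧ ∀ A B : ModCat R, Nonempty (M ≅ A ⊞ B) → IsZero A ∨ IsZero B

/-- `N` belongs to `add M`, i.e. `N` is a direct summand of a finite direct sum
of copies of `M`. -/
def MemAddMod {R : Type} [Ring R] (N M : ModCat R) : Prop :=
  ∃ (k : ℕ) (g : N ⟶ ⨁ (fun _ : Fin k => M)) (h : (⨁ (fun _ : Fin k => M)) ⟶ N),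
    g ≫ h = 𝟙 N

/-- A basic module: it has no direct summand of the form `N ⊕ N` with `N ≠ 0`. -/
def IsBasicMod {R : Type} [Ring R] (M : ModCat R) : Prop :=
  ∀ N X : ModCat R, Nonempty (M ≅ (N ⊞ N) ⊞ X) → IsZero N

/-- `M` is τ-rigid, i.e. `Hom(M, τM) = 0`: there is a projective presentation
`P₁ → P₀ → M → 0` by finitely generated projectives such that
`Hom(P₀, M) → Hom(P₁, M)` is surjective (Adachi–Iyama–Reiten). -/
def IsTauRigidMod {R : Type} [Ring R] (M : ModCat R) : Prop :=
  ∃ (P₁ P₀ : ModCat R) (f : P₁ ⟶ P₀) (g : P₀ ⟶ M),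
    Projective P₁ ∧ Projective P₀ ∧ IsFGMod P₁ ∧ IsFGMod P₀ ∧
    Function.Surjective g ∧ Function.Exact f g ∧
    ∀ h : P₁ ⟶ M, ∃ k : P₀ ⟶ M, f ≫ k = h

/-- A τ-rigid pair `(M, P)`: `M` is a τ-rigid module and `P` is a finitely
generated projective with `Hom(P, M) = 0`. -/
def IsTauRigidPairMod {R : Type} [Ring R] (M P : ModCat R) : Prop :=
  IsFGMod M ∧ IsTauRigidMod M ∧ IsFGMod P ∧ Projective P ∧ ∀ f : P ⟶ M, f = 0

/-- `M` is a support τ-tilting module: `(M, P)` is a maximal τ-rigid pair for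
some projective `P` (Adachi–Iyama–Reiten; equivalently, `M` is the `0`-th
cohomology of a two-term silting complex in `K^b(proj)`). -/
def IsSupportTauTiltingMod {R : Type} [Ring R] (M : ModCat R) : Prop :=
  ∃ P : ModCat R, IsTauRigidPairMod M P ∧
    ∀ N Q : ModCat R, IsTauRigidPairMod (M ⊞ N) (P ⊞ Q) → MemAddMod N M ∧ MemAddMod Q P

/-- The ring `R` admits only finitely many basic support τ-tilting modules up
to isomorphism. -/
def IsTauTiltingFiniteRing (R : Type) [Ring R] : Prop :=
  ∃ (n : ℕ) (f : Fin n → ModCat R),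
    ∀ M : ModCat R, IsSupportTauTiltingMod M → IsBasicMod M → ∃ i, Nonempty (M ≅ f i)

/-- The ring `R` admits only finitely many finitely generated indecomposable
modules up to isomorphism. -/
def IsRepFiniteRing (R : Type) [Ring R] : Prop :=
  ∃ (n : ℕ) (f : Fin n → ModCat R),
    ∀ M : ModCat R, IsFGMod M → IsIndecMod M → ∃ i, Nonempty (M ≅ f i)

/-- `R` has exactly `n` isomorphism classes of basic support τ-tilting modules. -/
def SupportTauTiltingCount (R : Type) [Ring R] (n : ℕ) : Prop :=
  ∃ f : Fin n → ModCat R,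
    (∀ i, IsSupportTauTiltingMod (f i) ∧ IsBasicMod (f i)) ∧
    (∀ i j, Nonempty (f i ≅ f j) → i = j) ∧
    (∀ M : ModCat R, IsSupportTauTiltingMod M → IsBasicMod M → ∃ i, Nonempty (M ≅ f i))

/-- An algebra `Λ` is τ-tilting-finite (with respect to right modules,
i.e. left `Λᵐᵒᵖ`-modules). -/
def IsTauTiltingFinite (Λ : Type) [Ring Λ] : Prop := IsTauTiltingFiniteRing Λᵐᵒᵖ

/-- An algebra `Λ` is representation-finite (with respect to right modules). -/
def IsRepFinite (Λ : Type) [Ring Λ] : Prop := IsRepFiniteRing Λᵐᵒᵖ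
/-! ### Silting theory in triangulated categories. -/

open Pretriangulated

section Triangulated

variable {C : Type u} [Category.{v} C] [Preadditive C] [HasZeroObject C] [HasShift C ℤ]
  [∀ n : ℤ, (shiftFunctor C n).Additive] [Pretriangulated C]

/-- A class of objects of a triangulated category is thick: it is closed under
isomorphisms, shifts, cones and direct summands (retracts). -/
structure IsThickClass (P : C → Prop) : Prop where
  iso : ∀ {X Y : C}, (X ≅ Y) → P X → P Y
  shift : ∀ (X : C) (n : ℤ), P X → P (X⟦n⟧)
  cone : ∀ T ∈ distTriang C, P T.obj₁ → P T.obj₂ → P T.obj₃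
  retract : ∀ (X Y : C) (i : X ⟶ Y) (r : Y ⟶ X), i ≫ r = 𝟙 X → P Y → P X

/-- `X` belongs to the smallest thick subcategory containing `S`. -/
def InThick (S : Set C) (X : C) : Prop :=
  ∀ P : C → Prop, IsThickClass P → (∀ Y ∈ S, P Y) → P X

/-- A presilting object: `Hom(M, M[n]) = 0` for all `n > 0`. -/
def IsPresiltingObj (M : C) : Prop := ∀ n : ℤ, 0 < n → ∀ f : M ⟶ M⟦n⟧, f = 0

/-- A pretilting object: `Hom(M, M[n]) = 0` for all `n ≠ 0`. -/
def IsPretiltingObj (M : C) : Prop := ∀ n : ℤ, n ≠ 0 → ∀ f : M ⟶ M⟦n⟧, f = 0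

/-- A silting object of the triangulated category `C`. -/
def IsSiltingObj (M : C) : Prop := IsPresiltingObj M ∧ ∀ X : C, InThick {M} X

/-- A silting object of the thick subcategory of `C` determined by the class `S`. -/
def IsSiltingFor (S : C → Prop) (M : C) : Prop :=
  S M ∧ IsPresiltingObj M ∧ ∀ X : C, S X → InThick {M} X

/-- A tilting object of the thick subcategory of `C` determined by the class `S`. -/
def IsTiltingFor (S : C → Prop) (M : C) : Prop :=
  S M ∧ IsPretiltingObj M ∧ ∀ X : C, S X → InThick {M} X

/-- A basic object: it has no direct summand of the form `Y ⊕ Y` with `Y ≠ 0`. -/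
def IsBasicObj (M : C) : Prop :=
  ∀ (Y : C) (i₁ i₂ : Y ⟶ M) (p₁ p₂ : M ⟶ Y),
    i₁ ≫ p₁ = 𝟙 Y → i₂ ≫ p₂ = 𝟙 Y → i₁ ≫ p₂ = 0 → i₂ ≫ p₁ = 0 → IsZero Y

end Triangulated

/-! ### The homotopy category of complexes of modules; perfect complexes. -/

/-- The homotopy category of (unbounded) cochain complexes of `R`-modules.
Its full subcategory of bounded complexes of finitely generated projectives is
`K^b(proj R)`, and its full subcategory of right-bounded complexes of finitely
generated projectives with bounded cohomology is a model for `D^b(mod R)`. -/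
abbrev HtpyCat (R : Type) [Ring R] :=
  HomotopyCategory (ModuleCat.{0} R) (ComplexShape.up ℤ)

/-- The object of the homotopy category attached to a complex. -/
def ofComplex (R : Type) [Ring R] (P : CochainComplex (ModuleCat.{0} R) ℤ) : HtpyCat R :=
  (HomotopyCategory.quotient _ _).obj P

/-- A perfect object: isomorphic to a bounded complex of finitely generated
projective modules.  These are the objects of `K^b(proj R)`. -/
def IsPerfObj (R : Type) [Ring R] (X : HtpyCat R) : Prop :=
  ∃ P : CochainComplex (ModuleCat.{0} R) ℤ,
    (∀ i, Projective (P.X i) ∧ Module.Finite R (P.X i)) ∧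
    (∃ a b : ℤ, ∀ i, i < a ∨ b < i → IsZero (P.X i)) ∧
    Nonempty (X ≅ ofComplex R P)

/-- An object of (the standard model `K^{-,b}(proj R)` of) the bounded derived
category `D^b(mod R)`: isomorphic to a right-bounded complex of finitely
generated projective modules with bounded cohomology. -/
def IsDbObj (R : Type) [Ring R] (X : HtpyCat R) : Prop :=
  ∃ P : CochainComplex (ModuleCat.{0} R) ℤ,
    (∀ i, Projective (P.X i) ∧ Module.Finite R (P.X i)) ∧
    (∃ b : ℤ, ∀ i, b < i → IsZero (P.X i)) ∧
    (∃ a : ℤ, ∀ i, i < a → P.ExactAt i) ∧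
    Nonempty (X ≅ ofComplex R P)

/-- An object of the homotopy category presented by a complex of finitely
generated projectives concentrated in the `m` degrees `-m < i ≤ 0`. -/
def IsMTermObj (R : Type) [Ring R] (m : ℕ) (X : HtpyCat R) : Prop :=
  ∃ P : CochainComplex (ModuleCat.{0} R) ℤ,
    (∀ i, Projective (P.X i) ∧ Module.Finite R (P.X i)) ∧
    (∀ i : ℤ, 0 < i ∨ i ≤ -(m : ℤ) → IsZero (P.X i)) ∧
    Nonempty (X ≅ ofComplex R P)

/-- The stalk complex of the regular module `R`, placed in degree `0`. -/
def stalkRing (R : Type) [Ring R] : HtpyCat R :=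
  ofComplex R
    ((HomologicalComplex.single (ModuleCat.{0} R) (ComplexShape.up ℤ) 0).obj (ModuleCat.of R R))

/-- The regular module `R` has finite injective dimension: it admits a finite
injective coresolution. -/
def HasFiniteSelfInjDim (R : Type) [Ring R] : Prop :=
  ∃ (n : ℕ) (I : CochainComplex (ModuleCat.{0} R) ℤ)
    (φ : (HomologicalComplex.single (ModuleCat.{0} R) (ComplexShape.up ℤ) 0).obj
          (ModuleCat.of R R) ⟶ I),
    (∀ i, Injective (I.X i)) ∧ (∀ i : ℤ, i < 0 ∨ (n : ℤ) < i → IsZero (I.X i)) ∧ QuasiIso φ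

/-- For a selfinjective (more generally Iwanaga–Gorenstein) ring, the stable
category of Cohen–Macaulay modules is modelled by acyclic (equivalently,
totally acyclic) complexes of finitely generated projectives (Buchweitz). -/
def IsCMStableObj (R : Type) [Ring R] (X : HtpyCat R) : Prop :=
  ∃ P : CochainComplex (ModuleCat.{0} R) ℤ,
    (∀ i, Projective (P.X i) ∧ Module.Finite R (P.X i)) ∧
    (∀ i, P.ExactAt i) ∧ Nonempty (X ≅ ofComplex R P)

/-- `R` is tilting-discrete: for every `m > 0` there are only finitely many
basic `m`-term tilting objects in `K^b(proj R)` up to isomorphism. -/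
def IsTiltingDiscreteRing (R : Type) [Ring R] : Prop :=
  ∀ m : ℕ, 0 < m → ∃ (k : ℕ) (f : Fin k → HtpyCat R),
    ∀ X : HtpyCat R, IsTiltingFor (IsPerfObj R) X → IsMTermObj R m X → IsBasicObj X →
      ∃ i, Nonempty (X ≅ f i)

/-- A (selfinjective) algebra `Λ` is tilting-discrete (with respect to right modules). -/
def IsTiltingDiscrete (Λ : Type) [Ring Λ] : Prop := IsTiltingDiscreteRing Λᵐᵒᵖ
/-! ### The weakly symmetric algebras of tubular type `A₁(λ), …, A₁₆`
(Białkowski–Skowroński). -/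

/-- The defining relations of the algebra `A₁(λ)`, as relations on the free algebra on
the idempotents `e_1, …, e_3` and the arrows of its quiver. -/
def A1Rel (K : Type) [Field K] (l : K) : FreeAlgebra K (Fin 7) → FreeAlgebra K (Fin 7) → Prop := fun u v =>
  (u, v) ∈ ([
    (FreeAlgebra.ι K (0 : Fin 7) * FreeAlgebra.ι K (0 : Fin 7), FreeAlgebra.ι K (0 : Fin 7)),
    (FreeAlgebra.ι K (0 : Fin 7) * FreeAlgebra.ι K (1 : Fin 7), (0 : FreeAlgebra K (Fin 7))),
    (FreeAlgebra.ι K (0 : Fin 7) * FreeAlgebra.ι K (2 : Fin 7), (0 : FreeAlgebra K (Fin 7))),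
    (FreeAlgebra.ι K (1 : Fin 7) * FreeAlgebra.ι K (0 : Fin 7), (0 : FreeAlgebra K (Fin 7))),
    (FreeAlgebra.ι K (1 : Fin 7) * FreeAlgebra.ι K (1 : Fin 7), FreeAlgebra.ι K (1 : Fin 7)),
    (FreeAlgebra.ι K (1 : Fin 7) * FreeAlgebra.ι K (2 : Fin 7), (0 : FreeAlgebra K (Fin 7))),
    (FreeAlgebra.ι K (2 : Fin 7) * FreeAlgebra.ι K (0 : Fin 7), (0 : FreeAlgebra K (Fin 7))),
    (FreeAlgebra.ι K (2 : Fin 7) * FreeAlgebra.ι K (1 : Fin 7), (0 : FreeAlgebra K (Fin 7))),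
    (FreeAlgebra.ι K (2 : Fin 7) * FreeAlgebra.ι K (2 : Fin 7), FreeAlgebra.ι K (2 : Fin 7)),
    (FreeAlgebra.ι K (0 : Fin 7) + FreeAlgebra.ι K (1 : Fin 7) + FreeAlgebra.ι K (2 : Fin 7), 1),
    (FreeAlgebra.ι K (3 : Fin 7), FreeAlgebra.ι K (0 : Fin 7) * FreeAlgebra.ι K (3 : Fin 7) * FreeAlgebra.ι K (1 : Fin 7)),
    (FreeAlgebra.ι K (4 : Fin 7), FreeAlgebra.ι K (1 : Fin 7) * FreeAlgebra.ι K (4 : Fin 7) * FreeAlgebra.ι K (0 : Fin 7)),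
    (FreeAlgebra.ι K (5 : Fin 7), FreeAlgebra.ι K (1 : Fin 7) * FreeAlgebra.ι K (5 : Fin 7) * FreeAlgebra.ι K (2 : Fin 7)),
    (FreeAlgebra.ι K (6 : Fin 7), FreeAlgebra.ι K (2 : Fin 7) * FreeAlgebra.ι K (6 : Fin 7) * FreeAlgebra.ι K (1 : Fin 7)),
    (FreeAlgebra.ι K (3 : Fin 7) * FreeAlgebra.ι K (4 : Fin 7) * FreeAlgebra.ι K (3 : Fin 7), FreeAlgebra.ι K (3 : Fin 7) * FreeAlgebra.ι K (5 : Fin 7) * FreeAlgebra.ι K (6 : Fin 7)),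
    (FreeAlgebra.ι K (6 : Fin 7) * FreeAlgebra.ι K (4 : Fin 7) * FreeAlgebra.ι K (3 : Fin 7), algebraMap K (FreeAlgebra K (Fin 7)) l * (FreeAlgebra.ι K (6 : Fin 7) * FreeAlgebra.ι K (5 : Fin 7) * FreeAlgebra.ι K (6 : Fin 7))),
    (FreeAlgebra.ι K (4 : Fin 7) * FreeAlgebra.ι K (3 : Fin 7) * FreeAlgebra.ι K (4 : Fin 7), FreeAlgebra.ι K (5 : Fin 7) * FreeAlgebra.ι K (6 : Fin 7) * FreeAlgebra.ι K (4 : Fin 7)),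
    (FreeAlgebra.ι K (4 : Fin 7) * FreeAlgebra.ι K (3 : Fin 7) * FreeAlgebra.ι K (5 : Fin 7), algebraMap K (FreeAlgebra K (Fin 7)) l * (FreeAlgebra.ι K (5 : Fin 7) * FreeAlgebra.ι K (6 : Fin 7) * FreeAlgebra.ι K (5 : Fin 7)))
  ] : List ((FreeAlgebra K (Fin 7)) × (FreeAlgebra K (Fin 7))))

/-- the algebra `A₁(λ)`, presented by quiver and relations. -/
def A1 (K : Type) [Field K] (l : K) : Type := RingQuot (A1Rel K l)

instance (K : Type) [Field K] (l : K) : Ring (A1 K l) :=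
  inferInstanceAs (Ring (RingQuot (A1Rel K l)))

instance (K : Type) [Field K] (l : K) : Algebra K (A1 K l) :=
  inferInstanceAs (Algebra K (RingQuot (A1Rel K l)))

/-- The defining relations of the algebra `A₂(λ)`, as relations on the free algebra on
the idempotents `e_1, …, e_2` and the arrows of its quiver. -/
def A2Rel (K : Type) [Field K] (l : K) : FreeAlgebra K (Fin 6) → FreeAlgebra K (Fin 6) → Prop := fun u v =>
  (u, v) ∈ ([
    (FreeAlgebra.ι K (0 : Fin 6) * FreeAlgebra.ι K (0 : Fin 6), FreeAlgebra.ι K (0 : Fin 6)),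
    (FreeAlgebra.ι K (0 : Fin 6) * FreeAlgebra.ι K (1 : Fin 6), (0 : FreeAlgebra K (Fin 6))),
    (FreeAlgebra.ι K (1 : Fin 6) * FreeAlgebra.ι K (0 : Fin 6), (0 : FreeAlgebra K (Fin 6))),
    (FreeAlgebra.ι K (1 : Fin 6) * FreeAlgebra.ι K (1 : Fin 6), FreeAlgebra.ι K (1 : Fin 6)),
    (FreeAlgebra.ι K (0 : Fin 6) + FreeAlgebra.ι K (1 : Fin 6), 1),
    (FreeAlgebra.ι K (2 : Fin 6), FreeAlgebra.ι K (0 : Fin 6) * FreeAlgebra.ι K (2 : Fin 6) * FreeAlgebra.ι K (0 : Fin 6)),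
    (FreeAlgebra.ι K (3 : Fin 6), FreeAlgebra.ι K (1 : Fin 6) * FreeAlgebra.ι K (3 : Fin 6) * FreeAlgebra.ι K (1 : Fin 6)),
    (FreeAlgebra.ι K (4 : Fin 6), FreeAlgebra.ι K (0 : Fin 6) * FreeAlgebra.ι K (4 : Fin 6) * FreeAlgebra.ι K (1 : Fin 6)),
    (FreeAlgebra.ι K (5 : Fin 6), FreeAlgebra.ι K (1 : Fin 6) * FreeAlgebra.ι K (5 : Fin 6) * FreeAlgebra.ι K (0 : Fin 6)),
    (FreeAlgebra.ι K (2 : Fin 6) * FreeAlgebra.ι K (2 : Fin 6), FreeAlgebra.ι K (4 : Fin 6) * FreeAlgebra.ι K (5 : Fin 6)),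
    (algebraMap K (FreeAlgebra K (Fin 6)) l * (FreeAlgebra.ι K (3 : Fin 6) * FreeAlgebra.ι K (3 : Fin 6)), FreeAlgebra.ι K (5 : Fin 6) * FreeAlgebra.ι K (4 : Fin 6)),
    (FreeAlgebra.ι K (5 : Fin 6) * FreeAlgebra.ι K (2 : Fin 6), FreeAlgebra.ι K (3 : Fin 6) * FreeAlgebra.ι K (5 : Fin 6)),
    (FreeAlgebra.ι K (4 : Fin 6) * FreeAlgebra.ι K (3 : Fin 6), FreeAlgebra.ι K (2 : Fin 6) * FreeAlgebra.ι K (4 : Fin 6))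
  ] : List ((FreeAlgebra K (Fin 6)) × (FreeAlgebra K (Fin 6))))

/-- the algebra `A₂(λ)`, presented by quiver and relations. -/
def A2 (K : Type) [Field K] (l : K) : Type := RingQuot (A2Rel K l)

instance (K : Type) [Field K] (l : K) : Ring (A2 K l) :=
  inferInstanceAs (Ring (RingQuot (A2Rel K l)))

instance (K : Type) [Field K] (l : K) : Algebra K (A2 K l) :=
  inferInstanceAs (Algebra K (RingQuot (A2Rel K l)))

/-- The defining relations of the algebra `A₃` (the preprojective algebra of type `D₄`), as relations on the free algebra on
the idempotents `e_1, …, e_4` and the arrows of its quiver. -/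
def A3Rel (K : Type) [Field K] : FreeAlgebra K (Fin 10) → FreeAlgebra K (Fin 10) → Prop := fun u v =>
  (u, v) ∈ ([
    (FreeAlgebra.ι K (0 : Fin 10) * FreeAlgebra.ι K (0 : Fin 10), FreeAlgebra.ι K (0 : Fin 10)),
    (FreeAlgebra.ι K (0 : Fin 10) * FreeAlgebra.ι K (1 : Fin 10), (0 : FreeAlgebra K (Fin 10))),
    (FreeAlgebra.ι K (0 : Fin 10) * FreeAlgebra.ι K (2 : Fin 10), (0 : FreeAlgebra K (Fin 10))),
    (FreeAlgebra.ι K (0 : Fin 10) * FreeAlgebra.ι K (3 : Fin 10), (0 : FreeAlgebra K (Fin 10))),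
    (FreeAlgebra.ι K (1 : Fin 10) * FreeAlgebra.ι K (0 : Fin 10), (0 : FreeAlgebra K (Fin 10))),
    (FreeAlgebra.ι K (1 : Fin 10) * FreeAlgebra.ι K (1 : Fin 10), FreeAlgebra.ι K (1 : Fin 10)),
    (FreeAlgebra.ι K (1 : Fin 10) * FreeAlgebra.ι K (2 : Fin 10), (0 : FreeAlgebra K (Fin 10))),
    (FreeAlgebra.ι K (1 : Fin 10) * FreeAlgebra.ι K (3 : Fin 10), (0 : FreeAlgebra K (Fin 10))),
    (FreeAlgebra.ι K (2 : Fin 10) * FreeAlgebra.ι K (0 : Fin 10), (0 : FreeAlgebra K (Fin 10))),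
    (FreeAlgebra.ι K (2 : Fin 10) * FreeAlgebra.ι K (1 : Fin 10), (0 : FreeAlgebra K (Fin 10))),
    (FreeAlgebra.ι K (2 : Fin 10) * FreeAlgebra.ι K (2 : Fin 10), FreeAlgebra.ι K (2 : Fin 10)),
    (FreeAlgebra.ι K (2 : Fin 10) * FreeAlgebra.ι K (3 : Fin 10), (0 : FreeAlgebra K (Fin 10))),
    (FreeAlgebra.ι K (3 : Fin 10) * FreeAlgebra.ι K (0 : Fin 10), (0 : FreeAlgebra K (Fin 10))),
    (FreeAlgebra.ι K (3 : Fin 10) * FreeAlgebra.ι K (1 : Fin 10), (0 : FreeAlgebra K (Fin 10))),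
    (FreeAlgebra.ι K (3 : Fin 10) * FreeAlgebra.ι K (2 : Fin 10), (0 : FreeAlgebra K (Fin 10))),
    (FreeAlgebra.ι K (3 : Fin 10) * FreeAlgebra.ι K (3 : Fin 10), FreeAlgebra.ι K (3 : Fin 10)),
    (FreeAlgebra.ι K (0 : Fin 10) + FreeAlgebra.ι K (1 : Fin 10) + FreeAlgebra.ι K (2 : Fin 10) + FreeAlgebra.ι K (3 : Fin 10), 1),
    (FreeAlgebra.ι K (4 : Fin 10), FreeAlgebra.ι K (0 : Fin 10) * FreeAlgebra.ι K (4 : Fin 10) * FreeAlgebra.ι K (1 : Fin 10)),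
    (FreeAlgebra.ι K (5 : Fin 10), FreeAlgebra.ι K (1 : Fin 10) * FreeAlgebra.ι K (5 : Fin 10) * FreeAlgebra.ι K (0 : Fin 10)),
    (FreeAlgebra.ι K (6 : Fin 10), FreeAlgebra.ι K (1 : Fin 10) * FreeAlgebra.ι K (6 : Fin 10) * FreeAlgebra.ι K (2 : Fin 10)),
    (FreeAlgebra.ι K (7 : Fin 10), FreeAlgebra.ι K (2 : Fin 10) * FreeAlgebra.ι K (7 : Fin 10) * FreeAlgebra.ι K (1 : Fin 10)),
    (FreeAlgebra.ι K (8 : Fin 10), FreeAlgebra.ι K (1 : Fin 10) * FreeAlgebra.ι K (8 : Fin 10) * FreeAlgebra.ι K (3 : Fin 10)),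
    (FreeAlgebra.ι K (9 : Fin 10), FreeAlgebra.ι K (3 : Fin 10) * FreeAlgebra.ι K (9 : Fin 10) * FreeAlgebra.ι K (1 : Fin 10)),
    (FreeAlgebra.ι K (5 : Fin 10) * FreeAlgebra.ι K (4 : Fin 10) + FreeAlgebra.ι K (6 : Fin 10) * FreeAlgebra.ι K (7 : Fin 10) + FreeAlgebra.ι K (8 : Fin 10) * FreeAlgebra.ι K (9 : Fin 10), (0 : FreeAlgebra K (Fin 10))),
    (FreeAlgebra.ι K (4 : Fin 10) * FreeAlgebra.ι K (5 : Fin 10), (0 : FreeAlgebra K (Fin 10))),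
    (FreeAlgebra.ι K (7 : Fin 10) * FreeAlgebra.ι K (6 : Fin 10), (0 : FreeAlgebra K (Fin 10))),
    (FreeAlgebra.ι K (9 : Fin 10) * FreeAlgebra.ι K (8 : Fin 10), (0 : FreeAlgebra K (Fin 10)))
  ] : List ((FreeAlgebra K (Fin 10)) × (FreeAlgebra K (Fin 10))))

/-- the algebra `A₃` (the preprojective algebra of type `D₄`), presented by quiver and relations. -/
def A3 (K : Type) [Field K] : Type := RingQuot (A3Rel K)

instance (K : Type) [Field K] : Ring (A3 K) :=
  inferInstanceAs (Ring (RingQuot (A3Rel K)))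

instance (K : Type) [Field K] : Algebra K (A3 K) :=
  inferInstanceAs (Algebra K (RingQuot (A3Rel K)))

/-- The defining relations of the algebra `A₄`, as relations on the free algebra on
the idempotents `e_1, …, e_4` and the arrows of its quiver. -/
def A4Rel (K : Type) [Field K] : FreeAlgebra K (Fin 10) → FreeAlgebra K (Fin 10) → Prop := fun u v =>
  (u, v) ∈ ([
    (FreeAlgebra.ι K (0 : Fin 10) * FreeAlgebra.ι K (0 : Fin 10), FreeAlgebra.ι K (0 : Fin 10)),
    (FreeAlgebra.ι K (0 : Fin 10) * FreeAlgebra.ι K (1 : Fin 10), (0 : FreeAlgebra K (Fin 10))),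
    (FreeAlgebra.ι K (0 : Fin 10) * FreeAlgebra.ι K (2 : Fin 10), (0 : FreeAlgebra K (Fin 10))),
    (FreeAlgebra.ι K (0 : Fin 10) * FreeAlgebra.ι K (3 : Fin 10), (0 : FreeAlgebra K (Fin 10))),
    (FreeAlgebra.ι K (1 : Fin 10) * FreeAlgebra.ι K (0 : Fin 10), (0 : FreeAlgebra K (Fin 10))),
    (FreeAlgebra.ι K (1 : Fin 10) * FreeAlgebra.ι K (1 : Fin 10), FreeAlgebra.ι K (1 : Fin 10)),
    (FreeAlgebra.ι K (1 : Fin 10) * FreeAlgebra.ι K (2 : Fin 10), (0 : FreeAlgebra K (Fin 10))),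
    (FreeAlgebra.ι K (1 : Fin 10) * FreeAlgebra.ι K (3 : Fin 10), (0 : FreeAlgebra K (Fin 10))),
    (FreeAlgebra.ι K (2 : Fin 10) * FreeAlgebra.ι K (0 : Fin 10), (0 : FreeAlgebra K (Fin 10))),
    (FreeAlgebra.ι K (2 : Fin 10) * FreeAlgebra.ι K (1 : Fin 10), (0 : FreeAlgebra K (Fin 10))),
    (FreeAlgebra.ι K (2 : Fin 10) * FreeAlgebra.ι K (2 : Fin 10), FreeAlgebra.ι K (2 : Fin 10)),
    (FreeAlgebra.ι K (2 : Fin 10) * FreeAlgebra.ι K (3 : Fin 10), (0 : FreeAlgebra K (Fin 10))),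
    (FreeAlgebra.ι K (3 : Fin 10) * FreeAlgebra.ι K (0 : Fin 10), (0 : FreeAlgebra K (Fin 10))),
    (FreeAlgebra.ι K (3 : Fin 10) * FreeAlgebra.ι K (1 : Fin 10), (0 : FreeAlgebra K (Fin 10))),
    (FreeAlgebra.ι K (3 : Fin 10) * FreeAlgebra.ι K (2 : Fin 10), (0 : FreeAlgebra K (Fin 10))),
    (FreeAlgebra.ι K (3 : Fin 10) * FreeAlgebra.ι K (3 : Fin 10), FreeAlgebra.ι K (3 : Fin 10)),
    (FreeAlgebra.ι K (0 : Fin 10) + FreeAlgebra.ι K (1 : Fin 10) + FreeAlgebra.ι K (2 : Fin 10) + FreeAlgebra.ι K (3 : Fin 10), 1),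
    (FreeAlgebra.ι K (4 : Fin 10), FreeAlgebra.ι K (0 : Fin 10) * FreeAlgebra.ι K (4 : Fin 10) * FreeAlgebra.ι K (1 : Fin 10)),
    (FreeAlgebra.ι K (5 : Fin 10), FreeAlgebra.ι K (1 : Fin 10) * FreeAlgebra.ι K (5 : Fin 10) * FreeAlgebra.ι K (0 : Fin 10)),
    (FreeAlgebra.ι K (6 : Fin 10), FreeAlgebra.ι K (1 : Fin 10) * FreeAlgebra.ι K (6 : Fin 10) * FreeAlgebra.ι K (2 : Fin 10)),
    (FreeAlgebra.ι K (7 : Fin 10), FreeAlgebra.ι K (2 : Fin 10) * FreeAlgebra.ι K (7 : Fin 10) * FreeAlgebra.ι K (1 : Fin 10)),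
    (FreeAlgebra.ι K (8 : Fin 10), FreeAlgebra.ι K (1 : Fin 10) * FreeAlgebra.ι K (8 : Fin 10) * FreeAlgebra.ι K (3 : Fin 10)),
    (FreeAlgebra.ι K (9 : Fin 10), FreeAlgebra.ι K (3 : Fin 10) * FreeAlgebra.ι K (9 : Fin 10) * FreeAlgebra.ι K (1 : Fin 10)),
    (FreeAlgebra.ι K (5 : Fin 10) * FreeAlgebra.ι K (4 : Fin 10) + FreeAlgebra.ι K (6 : Fin 10) * FreeAlgebra.ι K (7 : Fin 10) + FreeAlgebra.ι K (8 : Fin 10) * FreeAlgebra.ι K (9 : Fin 10), (0 : FreeAlgebra K (Fin 10))),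
    (FreeAlgebra.ι K (4 : Fin 10) * FreeAlgebra.ι K (5 : Fin 10), (0 : FreeAlgebra K (Fin 10))),
    (FreeAlgebra.ι K (7 : Fin 10) * FreeAlgebra.ι K (8 : Fin 10), (0 : FreeAlgebra K (Fin 10))),
    (FreeAlgebra.ι K (9 : Fin 10) * FreeAlgebra.ι K (6 : Fin 10), (0 : FreeAlgebra K (Fin 10)))
  ] : List ((FreeAlgebra K (Fin 10)) × (FreeAlgebra K (Fin 10))))

/-- the algebra `A₄`, presented by quiver and relations. -/
def A4 (K : Type) [Field K] : Type := RingQuot (A4Rel K)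

instance (K : Type) [Field K] : Ring (A4 K) :=
  inferInstanceAs (Ring (RingQuot (A4Rel K)))

instance (K : Type) [Field K] : Algebra K (A4 K) :=
  inferInstanceAs (Algebra K (RingQuot (A4Rel K)))

/-- The defining relations of the algebra `A₅`, as relations on the free algebra on
the idempotents `e_1, …, e_2` and the arrows of its quiver. -/
def A5Rel (K : Type) [Field K] : FreeAlgebra K (Fin 5) → FreeAlgebra K (Fin 5) → Prop := fun u v =>
  (u, v) ∈ ([
    (FreeAlgebra.ι K (0 : Fin 5) * FreeAlgebra.ι K (0 : Fin 5), FreeAlgebra.ι K (0 : Fin 5)),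
    (FreeAlgebra.ι K (0 : Fin 5) * FreeAlgebra.ι K (1 : Fin 5), (0 : FreeAlgebra K (Fin 5))),
    (FreeAlgebra.ι K (1 : Fin 5) * FreeAlgebra.ι K (0 : Fin 5), (0 : FreeAlgebra K (Fin 5))),
    (FreeAlgebra.ι K (1 : Fin 5) * FreeAlgebra.ι K (1 : Fin 5), FreeAlgebra.ι K (1 : Fin 5)),
    (FreeAlgebra.ι K (0 : Fin 5) + FreeAlgebra.ι K (1 : Fin 5), 1),
    (FreeAlgebra.ι K (2 : Fin 5), FreeAlgebra.ι K (0 : Fin 5) * FreeAlgebra.ι K (2 : Fin 5) * FreeAlgebra.ι K (0 : Fin 5)),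
    (FreeAlgebra.ι K (3 : Fin 5), FreeAlgebra.ι K (0 : Fin 5) * FreeAlgebra.ι K (3 : Fin 5) * FreeAlgebra.ι K (1 : Fin 5)),
    (FreeAlgebra.ι K (4 : Fin 5), FreeAlgebra.ι K (1 : Fin 5) * FreeAlgebra.ι K (4 : Fin 5) * FreeAlgebra.ι K (0 : Fin 5)),
    (FreeAlgebra.ι K (2 : Fin 5) * FreeAlgebra.ι K (2 : Fin 5), FreeAlgebra.ι K (3 : Fin 5) * FreeAlgebra.ι K (4 : Fin 5)),
    (FreeAlgebra.ι K (4 : Fin 5) * FreeAlgebra.ι K (2 : Fin 5) * FreeAlgebra.ι K (3 : Fin 5), (0 : FreeAlgebra K (Fin 5)))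
  ] : List ((FreeAlgebra K (Fin 5)) × (FreeAlgebra K (Fin 5))))

/-- the algebra `A₅`, presented by quiver and relations. -/
def A5 (K : Type) [Field K] : Type := RingQuot (A5Rel K)

instance (K : Type) [Field K] : Ring (A5 K) :=
  inferInstanceAs (Ring (RingQuot (A5Rel K)))

instance (K : Type) [Field K] : Algebra K (A5 K) :=
  inferInstanceAs (Algebra K (RingQuot (A5Rel K)))

/-- The defining relations of the algebra `A₆`, as relations on the free algebra on
the idempotents `e_1, …, e_2` and the arrows of its quiver. -/
def A6Rel (K : Type) [Field K] : FreeAlgebra K (Fin 5) → FreeAlgebra K (Fin 5) → Prop := fun u v =>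
  (u, v) ∈ ([
    (FreeAlgebra.ι K (0 : Fin 5) * FreeAlgebra.ι K (0 : Fin 5), FreeAlgebra.ι K (0 : Fin 5)),
    (FreeAlgebra.ι K (0 : Fin 5) * FreeAlgebra.ι K (1 : Fin 5), (0 : FreeAlgebra K (Fin 5))),
    (FreeAlgebra.ι K (1 : Fin 5) * FreeAlgebra.ι K (0 : Fin 5), (0 : FreeAlgebra K (Fin 5))),
    (FreeAlgebra.ι K (1 : Fin 5) * FreeAlgebra.ι K (1 : Fin 5), FreeAlgebra.ι K (1 : Fin 5)),
    (FreeAlgebra.ι K (0 : Fin 5) + FreeAlgebra.ι K (1 : Fin 5), 1),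
    (FreeAlgebra.ι K (2 : Fin 5), FreeAlgebra.ι K (0 : Fin 5) * FreeAlgebra.ι K (2 : Fin 5) * FreeAlgebra.ι K (0 : Fin 5)),
    (FreeAlgebra.ι K (3 : Fin 5), FreeAlgebra.ι K (0 : Fin 5) * FreeAlgebra.ι K (3 : Fin 5) * FreeAlgebra.ι K (1 : Fin 5)),
    (FreeAlgebra.ι K (4 : Fin 5), FreeAlgebra.ι K (1 : Fin 5) * FreeAlgebra.ι K (4 : Fin 5) * FreeAlgebra.ι K (0 : Fin 5)),
    (FreeAlgebra.ι K (2 : Fin 5) * FreeAlgebra.ι K (2 : Fin 5) * FreeAlgebra.ι K (2 : Fin 5), FreeAlgebra.ι K (3 : Fin 5) * FreeAlgebra.ι K (4 : Fin 5)),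
    (FreeAlgebra.ι K (4 : Fin 5) * FreeAlgebra.ι K (3 : Fin 5), (0 : FreeAlgebra K (Fin 5))),
    (FreeAlgebra.ι K (4 : Fin 5) * FreeAlgebra.ι K (2 : Fin 5) * FreeAlgebra.ι K (2 : Fin 5), (0 : FreeAlgebra K (Fin 5))),
    (FreeAlgebra.ι K (2 : Fin 5) * FreeAlgebra.ι K (2 : Fin 5) * FreeAlgebra.ι K (3 : Fin 5), (0 : FreeAlgebra K (Fin 5)))
  ] : List ((FreeAlgebra K (Fin 5)) × (FreeAlgebra K (Fin 5))))

/-- the algebra `A₆`, presented by quiver and relations. -/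
def A6 (K : Type) [Field K] : Type := RingQuot (A6Rel K)

instance (K : Type) [Field K] : Ring (A6 K) :=
  inferInstanceAs (Ring (RingQuot (A6Rel K)))

instance (K : Type) [Field K] : Algebra K (A6 K) :=
  inferInstanceAs (Algebra K (RingQuot (A6Rel K)))

/-- The defining relations of the algebra `A₇`, as relations on the free algebra on
the idempotents `e_1, …, e_4` and the arrows of its quiver. -/
def A7Rel (K : Type) [Field K] : FreeAlgebra K (Fin 10) → FreeAlgebra K (Fin 10) → Prop := fun u v =>
  (u, v) ∈ ([
    (FreeAlgebra.ι K (0 : Fin 10) * FreeAlgebra.ι K (0 : Fin 10), FreeAlgebra.ι K (0 : Fin 10)),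
    (FreeAlgebra.ι K (0 : Fin 10) * FreeAlgebra.ι K (1 : Fin 10), (0 : FreeAlgebra K (Fin 10))),
    (FreeAlgebra.ι K (0 : Fin 10) * FreeAlgebra.ι K (2 : Fin 10), (0 : FreeAlgebra K (Fin 10))),
    (FreeAlgebra.ι K (0 : Fin 10) * FreeAlgebra.ι K (3 : Fin 10), (0 : FreeAlgebra K (Fin 10))),
    (FreeAlgebra.ι K (1 : Fin 10) * FreeAlgebra.ι K (0 : Fin 10), (0 : FreeAlgebra K (Fin 10))),
    (FreeAlgebra.ι K (1 : Fin 10) * FreeAlgebra.ι K (1 : Fin 10), FreeAlgebra.ι K (1 : Fin 10)),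
    (FreeAlgebra.ι K (1 : Fin 10) * FreeAlgebra.ι K (2 : Fin 10), (0 : FreeAlgebra K (Fin 10))),
    (FreeAlgebra.ι K (1 : Fin 10) * FreeAlgebra.ι K (3 : Fin 10), (0 : FreeAlgebra K (Fin 10))),
    (FreeAlgebra.ι K (2 : Fin 10) * FreeAlgebra.ι K (0 : Fin 10), (0 : FreeAlgebra K (Fin 10))),
    (FreeAlgebra.ι K (2 : Fin 10) * FreeAlgebra.ι K (1 : Fin 10), (0 : FreeAlgebra K (Fin 10))),
    (FreeAlgebra.ι K (2 : Fin 10) * FreeAlgebra.ι K (2 : Fin 10), FreeAlgebra.ι K (2 : Fin 10)),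
    (FreeAlgebra.ι K (2 : Fin 10) * FreeAlgebra.ι K (3 : Fin 10), (0 : FreeAlgebra K (Fin 10))),
    (FreeAlgebra.ι K (3 : Fin 10) * FreeAlgebra.ι K (0 : Fin 10), (0 : FreeAlgebra K (Fin 10))),
    (FreeAlgebra.ι K (3 : Fin 10) * FreeAlgebra.ι K (1 : Fin 10), (0 : FreeAlgebra K (Fin 10))),
    (FreeAlgebra.ι K (3 : Fin 10) * FreeAlgebra.ι K (2 : Fin 10), (0 : FreeAlgebra K (Fin 10))),
    (FreeAlgebra.ι K (3 : Fin 10) * FreeAlgebra.ι K (3 : Fin 10), FreeAlgebra.ι K (3 : Fin 10)),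
    (FreeAlgebra.ι K (0 : Fin 10) + FreeAlgebra.ι K (1 : Fin 10) + FreeAlgebra.ι K (2 : Fin 10) + FreeAlgebra.ι K (3 : Fin 10), 1),
    (FreeAlgebra.ι K (4 : Fin 10), FreeAlgebra.ι K (0 : Fin 10) * FreeAlgebra.ι K (4 : Fin 10) * FreeAlgebra.ι K (1 : Fin 10)),
    (FreeAlgebra.ι K (5 : Fin 10), FreeAlgebra.ι K (1 : Fin 10) * FreeAlgebra.ι K (5 : Fin 10) * FreeAlgebra.ι K (0 : Fin 10)),
    (FreeAlgebra.ι K (6 : Fin 10), FreeAlgebra.ι K (1 : Fin 10) * FreeAlgebra.ι K (6 : Fin 10) * FreeAlgebra.ι K (2 : Fin 10)),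
    (FreeAlgebra.ι K (7 : Fin 10), FreeAlgebra.ι K (2 : Fin 10) * FreeAlgebra.ι K (7 : Fin 10) * FreeAlgebra.ι K (1 : Fin 10)),
    (FreeAlgebra.ι K (8 : Fin 10), FreeAlgebra.ι K (2 : Fin 10) * FreeAlgebra.ι K (8 : Fin 10) * FreeAlgebra.ι K (3 : Fin 10)),
    (FreeAlgebra.ι K (9 : Fin 10), FreeAlgebra.ι K (3 : Fin 10) * FreeAlgebra.ι K (9 : Fin 10) * FreeAlgebra.ι K (2 : Fin 10)),
    (FreeAlgebra.ι K (5 : Fin 10) * FreeAlgebra.ι K (4 : Fin 10), FreeAlgebra.ι K (6 : Fin 10) * FreeAlgebra.ι K (7 : Fin 10)),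
    (FreeAlgebra.ι K (7 : Fin 10) * FreeAlgebra.ι K (6 : Fin 10), FreeAlgebra.ι K (8 : Fin 10) * FreeAlgebra.ι K (9 : Fin 10)),
    (FreeAlgebra.ι K (4 : Fin 10) * FreeAlgebra.ι K (6 : Fin 10) * FreeAlgebra.ι K (8 : Fin 10), (0 : FreeAlgebra K (Fin 10))),
    (FreeAlgebra.ι K (9 : Fin 10) * FreeAlgebra.ι K (7 : Fin 10) * FreeAlgebra.ι K (5 : Fin 10), (0 : FreeAlgebra K (Fin 10)))
  ] : List ((FreeAlgebra K (Fin 10)) × (FreeAlgebra K (Fin 10))))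

/-- the algebra `A₇`, presented by quiver and relations. -/
def A7 (K : Type) [Field K] : Type := RingQuot (A7Rel K)

instance (K : Type) [Field K] : Ring (A7 K) :=
  inferInstanceAs (Ring (RingQuot (A7Rel K)))

instance (K : Type) [Field K] : Algebra K (A7 K) :=
  inferInstanceAs (Algebra K (RingQuot (A7Rel K)))

/-- The defining relations of the algebra `A₈`, as relations on the free algebra on
the idempotents `e_1, …, e_4` and the arrows of its quiver. -/
def A8Rel (K : Type) [Field K] : FreeAlgebra K (Fin 10) → FreeAlgebra K (Fin 10) → Prop := fun u v =>
  (u, v) ∈ ([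
    (FreeAlgebra.ι K (0 : Fin 10) * FreeAlgebra.ι K (0 : Fin 10), FreeAlgebra.ι K (0 : Fin 10)),
    (FreeAlgebra.ι K (0 : Fin 10) * FreeAlgebra.ι K (1 : Fin 10), (0 : FreeAlgebra K (Fin 10))),
    (FreeAlgebra.ι K (0 : Fin 10) * FreeAlgebra.ι K (2 : Fin 10), (0 : FreeAlgebra K (Fin 10))),
    (FreeAlgebra.ι K (0 : Fin 10) * FreeAlgebra.ι K (3 : Fin 10), (0 : FreeAlgebra K (Fin 10))),
    (FreeAlgebra.ι K (1 : Fin 10) * FreeAlgebra.ι K (0 : Fin 10), (0 : FreeAlgebra K (Fin 10))),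
    (FreeAlgebra.ι K (1 : Fin 10) * FreeAlgebra.ι K (1 : Fin 10), FreeAlgebra.ι K (1 : Fin 10)),
    (FreeAlgebra.ι K (1 : Fin 10) * FreeAlgebra.ι K (2 : Fin 10), (0 : FreeAlgebra K (Fin 10))),
    (FreeAlgebra.ι K (1 : Fin 10) * FreeAlgebra.ι K (3 : Fin 10), (0 : FreeAlgebra K (Fin 10))),
    (FreeAlgebra.ι K (2 : Fin 10) * FreeAlgebra.ι K (0 : Fin 10), (0 : FreeAlgebra K (Fin 10))),
    (FreeAlgebra.ι K (2 : Fin 10) * FreeAlgebra.ι K (1 : Fin 10), (0 : FreeAlgebra K (Fin 10))),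
    (FreeAlgebra.ι K (2 : Fin 10) * FreeAlgebra.ι K (2 : Fin 10), FreeAlgebra.ι K (2 : Fin 10)),
    (FreeAlgebra.ι K (2 : Fin 10) * FreeAlgebra.ι K (3 : Fin 10), (0 : FreeAlgebra K (Fin 10))),
    (FreeAlgebra.ι K (3 : Fin 10) * FreeAlgebra.ι K (0 : Fin 10), (0 : FreeAlgebra K (Fin 10))),
    (FreeAlgebra.ι K (3 : Fin 10) * FreeAlgebra.ι K (1 : Fin 10), (0 : FreeAlgebra K (Fin 10))),
    (FreeAlgebra.ι K (3 : Fin 10) * FreeAlgebra.ι K (2 : Fin 10), (0 : FreeAlgebra K (Fin 10))),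
    (FreeAlgebra.ι K (3 : Fin 10) * FreeAlgebra.ι K (3 : Fin 10), FreeAlgebra.ι K (3 : Fin 10)),
    (FreeAlgebra.ι K (0 : Fin 10) + FreeAlgebra.ι K (1 : Fin 10) + FreeAlgebra.ι K (2 : Fin 10) + FreeAlgebra.ι K (3 : Fin 10), 1),
    (FreeAlgebra.ι K (4 : Fin 10), FreeAlgebra.ι K (0 : Fin 10) * FreeAlgebra.ι K (4 : Fin 10) * FreeAlgebra.ι K (1 : Fin 10)),
    (FreeAlgebra.ι K (5 : Fin 10), FreeAlgebra.ι K (1 : Fin 10) * FreeAlgebra.ι K (5 : Fin 10) * FreeAlgebra.ι K (2 : Fin 10)),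
    (FreeAlgebra.ι K (6 : Fin 10), FreeAlgebra.ι K (2 : Fin 10) * FreeAlgebra.ι K (6 : Fin 10) * FreeAlgebra.ι K (3 : Fin 10)),
    (FreeAlgebra.ι K (7 : Fin 10), FreeAlgebra.ι K (3 : Fin 10) * FreeAlgebra.ι K (7 : Fin 10) * FreeAlgebra.ι K (0 : Fin 10)),
    (FreeAlgebra.ι K (8 : Fin 10), FreeAlgebra.ι K (0 : Fin 10) * FreeAlgebra.ι K (8 : Fin 10) * FreeAlgebra.ι K (2 : Fin 10)),
    (FreeAlgebra.ι K (9 : Fin 10), FreeAlgebra.ι K (2 : Fin 10) * FreeAlgebra.ι K (9 : Fin 10) * FreeAlgebra.ι K (0 : Fin 10)),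
    (FreeAlgebra.ι K (8 : Fin 10) * FreeAlgebra.ι K (9 : Fin 10) * FreeAlgebra.ι K (8 : Fin 10), FreeAlgebra.ι K (4 : Fin 10) * FreeAlgebra.ι K (5 : Fin 10)),
    (FreeAlgebra.ι K (9 : Fin 10) * FreeAlgebra.ι K (8 : Fin 10) * FreeAlgebra.ι K (9 : Fin 10), FreeAlgebra.ι K (6 : Fin 10) * FreeAlgebra.ι K (7 : Fin 10)),
    (FreeAlgebra.ι K (5 : Fin 10) * FreeAlgebra.ι K (9 : Fin 10) * FreeAlgebra.ι K (8 : Fin 10), (0 : FreeAlgebra K (Fin 10))),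
    (FreeAlgebra.ι K (7 : Fin 10) * FreeAlgebra.ι K (8 : Fin 10) * FreeAlgebra.ι K (9 : Fin 10), (0 : FreeAlgebra K (Fin 10))),
    (FreeAlgebra.ι K (9 : Fin 10) * FreeAlgebra.ι K (8 : Fin 10) * FreeAlgebra.ι K (6 : Fin 10), (0 : FreeAlgebra K (Fin 10))),
    (FreeAlgebra.ι K (8 : Fin 10) * FreeAlgebra.ι K (9 : Fin 10) * FreeAlgebra.ι K (4 : Fin 10), (0 : FreeAlgebra K (Fin 10))),
    (FreeAlgebra.ι K (5 : Fin 10) * FreeAlgebra.ι K (6 : Fin 10), (0 : FreeAlgebra K (Fin 10))),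
    (FreeAlgebra.ι K (7 : Fin 10) * FreeAlgebra.ι K (4 : Fin 10), (0 : FreeAlgebra K (Fin 10)))
  ] : List ((FreeAlgebra K (Fin 10)) × (FreeAlgebra K (Fin 10))))

/-- the algebra `A₈`, presented by quiver and relations. -/
def A8 (K : Type) [Field K] : Type := RingQuot (A8Rel K)

instance (K : Type) [Field K] : Ring (A8 K) :=
  inferInstanceAs (Ring (RingQuot (A8Rel K)))

instance (K : Type) [Field K] : Algebra K (A8 K) :=
  inferInstanceAs (Algebra K (RingQuot (A8Rel K)))

/-- The defining relations of the algebra `A₉`, as relations on the free algebra on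
the idempotents `e_1, …, e_4` and the arrows of its quiver. -/
def A9Rel (K : Type) [Field K] : FreeAlgebra K (Fin 10) → FreeAlgebra K (Fin 10) → Prop := fun u v =>
  (u, v) ∈ ([
    (FreeAlgebra.ι K (0 : Fin 10) * FreeAlgebra.ι K (0 : Fin 10), FreeAlgebra.ι K (0 : Fin 10)),
    (FreeAlgebra.ι K (0 : Fin 10) * FreeAlgebra.ι K (1 : Fin 10), (0 : FreeAlgebra K (Fin 10))),
    (FreeAlgebra.ι K (0 : Fin 10) * FreeAlgebra.ι K (2 : Fin 10), (0 : FreeAlgebra K (Fin 10))),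
    (FreeAlgebra.ι K (0 : Fin 10) * FreeAlgebra.ι K (3 : Fin 10), (0 : FreeAlgebra K (Fin 10))),
    (FreeAlgebra.ι K (1 : Fin 10) * FreeAlgebra.ι K (0 : Fin 10), (0 : FreeAlgebra K (Fin 10))),
    (FreeAlgebra.ι K (1 : Fin 10) * FreeAlgebra.ι K (1 : Fin 10), FreeAlgebra.ι K (1 : Fin 10)),
    (FreeAlgebra.ι K (1 : Fin 10) * FreeAlgebra.ι K (2 : Fin 10), (0 : FreeAlgebra K (Fin 10))),
    (FreeAlgebra.ι K (1 : Fin 10) * FreeAlgebra.ι K (3 : Fin 10), (0 : FreeAlgebra K (Fin 10))),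
    (FreeAlgebra.ι K (2 : Fin 10) * FreeAlgebra.ι K (0 : Fin 10), (0 : FreeAlgebra K (Fin 10))),
    (FreeAlgebra.ι K (2 : Fin 10) * FreeAlgebra.ι K (1 : Fin 10), (0 : FreeAlgebra K (Fin 10))),
    (FreeAlgebra.ι K (2 : Fin 10) * FreeAlgebra.ι K (2 : Fin 10), FreeAlgebra.ι K (2 : Fin 10)),
    (FreeAlgebra.ι K (2 : Fin 10) * FreeAlgebra.ι K (3 : Fin 10), (0 : FreeAlgebra K (Fin 10))),
    (FreeAlgebra.ι K (3 : Fin 10) * FreeAlgebra.ι K (0 : Fin 10), (0 : FreeAlgebra K (Fin 10))),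
    (FreeAlgebra.ι K (3 : Fin 10) * FreeAlgebra.ι K (1 : Fin 10), (0 : FreeAlgebra K (Fin 10))),
    (FreeAlgebra.ι K (3 : Fin 10) * FreeAlgebra.ι K (2 : Fin 10), (0 : FreeAlgebra K (Fin 10))),
    (FreeAlgebra.ι K (3 : Fin 10) * FreeAlgebra.ι K (3 : Fin 10), FreeAlgebra.ι K (3 : Fin 10)),
    (FreeAlgebra.ι K (0 : Fin 10) + FreeAlgebra.ι K (1 : Fin 10) + FreeAlgebra.ι K (2 : Fin 10) + FreeAlgebra.ι K (3 : Fin 10), 1),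
    (FreeAlgebra.ι K (4 : Fin 10), FreeAlgebra.ι K (0 : Fin 10) * FreeAlgebra.ι K (4 : Fin 10) * FreeAlgebra.ι K (1 : Fin 10)),
    (FreeAlgebra.ι K (5 : Fin 10), FreeAlgebra.ι K (1 : Fin 10) * FreeAlgebra.ι K (5 : Fin 10) * FreeAlgebra.ι K (2 : Fin 10)),
    (FreeAlgebra.ι K (6 : Fin 10), FreeAlgebra.ι K (2 : Fin 10) * FreeAlgebra.ι K (6 : Fin 10) * FreeAlgebra.ι K (1 : Fin 10)),
    (FreeAlgebra.ι K (7 : Fin 10), FreeAlgebra.ι K (2 : Fin 10) * FreeAlgebra.ι K (7 : Fin 10) * FreeAlgebra.ι K (3 : Fin 10)),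
    (FreeAlgebra.ι K (8 : Fin 10), FreeAlgebra.ι K (3 : Fin 10) * FreeAlgebra.ι K (8 : Fin 10) * FreeAlgebra.ι K (2 : Fin 10)),
    (FreeAlgebra.ι K (9 : Fin 10), FreeAlgebra.ι K (3 : Fin 10) * FreeAlgebra.ι K (9 : Fin 10) * FreeAlgebra.ι K (0 : Fin 10)),
    (FreeAlgebra.ι K (9 : Fin 10) * FreeAlgebra.ι K (4 : Fin 10), FreeAlgebra.ι K (8 : Fin 10) * FreeAlgebra.ι K (6 : Fin 10)),
    (FreeAlgebra.ι K (7 : Fin 10) * FreeAlgebra.ι K (8 : Fin 10), FreeAlgebra.ι K (6 : Fin 10) * FreeAlgebra.ι K (5 : Fin 10)),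
    (FreeAlgebra.ι K (4 : Fin 10) * FreeAlgebra.ι K (5 : Fin 10) * FreeAlgebra.ι K (6 : Fin 10), (0 : FreeAlgebra K (Fin 10))),
    (FreeAlgebra.ι K (8 : Fin 10) * FreeAlgebra.ι K (7 : Fin 10) * FreeAlgebra.ι K (9 : Fin 10), (0 : FreeAlgebra K (Fin 10))),
    (FreeAlgebra.ι K (5 : Fin 10) * FreeAlgebra.ι K (7 : Fin 10) * FreeAlgebra.ι K (8 : Fin 10) * FreeAlgebra.ι K (7 : Fin 10), (0 : FreeAlgebra K (Fin 10)))
  ] : List ((FreeAlgebra K (Fin 10)) × (FreeAlgebra K (Fin 10))))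

/-- the algebra `A₉`, presented by quiver and relations. -/
def A9 (K : Type) [Field K] : Type := RingQuot (A9Rel K)

instance (K : Type) [Field K] : Ring (A9 K) :=
  inferInstanceAs (Ring (RingQuot (A9Rel K)))

instance (K : Type) [Field K] : Algebra K (A9 K) :=
  inferInstanceAs (Algebra K (RingQuot (A9Rel K)))

/-- The defining relations of the algebra `A₁₀`, as relations on the free algebra on
the idempotents `e_1, …, e_4` and the arrows of its quiver. -/
def A10Rel (K : Type) [Field K] : FreeAlgebra K (Fin 9) → FreeAlgebra K (Fin 9) → Prop := fun u v =>
  (u, v) ∈ ([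
    (FreeAlgebra.ι K (0 : Fin 9) * FreeAlgebra.ι K (0 : Fin 9), FreeAlgebra.ι K (0 : Fin 9)),
    (FreeAlgebra.ι K (0 : Fin 9) * FreeAlgebra.ι K (1 : Fin 9), (0 : FreeAlgebra K (Fin 9))),
    (FreeAlgebra.ι K (0 : Fin 9) * FreeAlgebra.ι K (2 : Fin 9), (0 : FreeAlgebra K (Fin 9))),
    (FreeAlgebra.ι K (0 : Fin 9) * FreeAlgebra.ι K (3 : Fin 9), (0 : FreeAlgebra K (Fin 9))),
    (FreeAlgebra.ι K (1 : Fin 9) * FreeAlgebra.ι K (0 : Fin 9), (0 : FreeAlgebra K (Fin 9))),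
    (FreeAlgebra.ι K (1 : Fin 9) * FreeAlgebra.ι K (1 : Fin 9), FreeAlgebra.ι K (1 : Fin 9)),
    (FreeAlgebra.ι K (1 : Fin 9) * FreeAlgebra.ι K (2 : Fin 9), (0 : FreeAlgebra K (Fin 9))),
    (FreeAlgebra.ι K (1 : Fin 9) * FreeAlgebra.ι K (3 : Fin 9), (0 : FreeAlgebra K (Fin 9))),
    (FreeAlgebra.ι K (2 : Fin 9) * FreeAlgebra.ι K (0 : Fin 9), (0 : FreeAlgebra K (Fin 9))),
    (FreeAlgebra.ι K (2 : Fin 9) * FreeAlgebra.ι K (1 : Fin 9), (0 : FreeAlgebra K (Fin 9))),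
    (FreeAlgebra.ι K (2 : Fin 9) * FreeAlgebra.ι K (2 : Fin 9), FreeAlgebra.ι K (2 : Fin 9)),
    (FreeAlgebra.ι K (2 : Fin 9) * FreeAlgebra.ι K (3 : Fin 9), (0 : FreeAlgebra K (Fin 9))),
    (FreeAlgebra.ι K (3 : Fin 9) * FreeAlgebra.ι K (0 : Fin 9), (0 : FreeAlgebra K (Fin 9))),
    (FreeAlgebra.ι K (3 : Fin 9) * FreeAlgebra.ι K (1 : Fin 9), (0 : FreeAlgebra K (Fin 9))),
    (FreeAlgebra.ι K (3 : Fin 9) * FreeAlgebra.ι K (2 : Fin 9), (0 : FreeAlgebra K (Fin 9))),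
    (FreeAlgebra.ι K (3 : Fin 9) * FreeAlgebra.ι K (3 : Fin 9), FreeAlgebra.ι K (3 : Fin 9)),
    (FreeAlgebra.ι K (0 : Fin 9) + FreeAlgebra.ι K (1 : Fin 9) + FreeAlgebra.ι K (2 : Fin 9) + FreeAlgebra.ι K (3 : Fin 9), 1),
    (FreeAlgebra.ι K (4 : Fin 9), FreeAlgebra.ι K (0 : Fin 9) * FreeAlgebra.ι K (4 : Fin 9) * FreeAlgebra.ι K (1 : Fin 9)),
    (FreeAlgebra.ι K (5 : Fin 9), FreeAlgebra.ι K (1 : Fin 9) * FreeAlgebra.ι K (5 : Fin 9) * FreeAlgebra.ι K (0 : Fin 9)),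
    (FreeAlgebra.ι K (6 : Fin 9), FreeAlgebra.ι K (1 : Fin 9) * FreeAlgebra.ι K (6 : Fin 9) * FreeAlgebra.ι K (2 : Fin 9)),
    (FreeAlgebra.ι K (7 : Fin 9), FreeAlgebra.ι K (2 : Fin 9) * FreeAlgebra.ι K (7 : Fin 9) * FreeAlgebra.ι K (3 : Fin 9)),
    (FreeAlgebra.ι K (8 : Fin 9), FreeAlgebra.ι K (3 : Fin 9) * FreeAlgebra.ι K (8 : Fin 9) * FreeAlgebra.ι K (1 : Fin 9)),
    (FreeAlgebra.ι K (8 : Fin 9) * FreeAlgebra.ι K (5 : Fin 9) * FreeAlgebra.ι K (4 : Fin 9), FreeAlgebra.ι K (8 : Fin 9) * FreeAlgebra.ι K (6 : Fin 9) * FreeAlgebra.ι K (7 : Fin 9) * FreeAlgebra.ι K (8 : Fin 9)),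
    (FreeAlgebra.ι K (5 : Fin 9) * FreeAlgebra.ι K (4 : Fin 9) * FreeAlgebra.ι K (6 : Fin 9), FreeAlgebra.ι K (6 : Fin 9) * FreeAlgebra.ι K (7 : Fin 9) * FreeAlgebra.ι K (8 : Fin 9) * FreeAlgebra.ι K (6 : Fin 9)),
    (FreeAlgebra.ι K (4 : Fin 9) * FreeAlgebra.ι K (5 : Fin 9), (0 : FreeAlgebra K (Fin 9))),
    (FreeAlgebra.ι K (7 : Fin 9) * FreeAlgebra.ι K (8 : Fin 9) * FreeAlgebra.ι K (6 : Fin 9) * FreeAlgebra.ι K (7 : Fin 9) * FreeAlgebra.ι K (8 : Fin 9) * FreeAlgebra.ι K (6 : Fin 9) * FreeAlgebra.ι K (7 : Fin 9), (0 : FreeAlgebra K (Fin 9)))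
  ] : List ((FreeAlgebra K (Fin 9)) × (FreeAlgebra K (Fin 9))))

/-- the algebra `A₁₀`, presented by quiver and relations. -/
def A10 (K : Type) [Field K] : Type := RingQuot (A10Rel K)

instance (K : Type) [Field K] : Ring (A10 K) :=
  inferInstanceAs (Ring (RingQuot (A10Rel K)))

instance (K : Type) [Field K] : Algebra K (A10 K) :=
  inferInstanceAs (Algebra K (RingQuot (A10Rel K)))

/-- The defining relations of the algebra `A₁₁`, as relations on the free algebra on
the idempotents `e_1, …, e_4` and the arrows of its quiver. -/
def A11Rel (K : Type) [Field K] : FreeAlgebra K (Fin 10) → FreeAlgebra K (Fin 10) → Prop := fun u v =>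
  (u, v) ∈ ([
    (FreeAlgebra.ι K (0 : Fin 10) * FreeAlgebra.ι K (0 : Fin 10), FreeAlgebra.ι K (0 : Fin 10)),
    (FreeAlgebra.ι K (0 : Fin 10) * FreeAlgebra.ι K (1 : Fin 10), (0 : FreeAlgebra K (Fin 10))),
    (FreeAlgebra.ι K (0 : Fin 10) * FreeAlgebra.ι K (2 : Fin 10), (0 : FreeAlgebra K (Fin 10))),
    (FreeAlgebra.ι K (0 : Fin 10) * FreeAlgebra.ι K (3 : Fin 10), (0 : FreeAlgebra K (Fin 10))),
    (FreeAlgebra.ι K (1 : Fin 10) * FreeAlgebra.ι K (0 : Fin 10), (0 : FreeAlgebra K (Fin 10))),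
    (FreeAlgebra.ι K (1 : Fin 10) * FreeAlgebra.ι K (1 : Fin 10), FreeAlgebra.ι K (1 : Fin 10)),
    (FreeAlgebra.ι K (1 : Fin 10) * FreeAlgebra.ι K (2 : Fin 10), (0 : FreeAlgebra K (Fin 10))),
    (FreeAlgebra.ι K (1 : Fin 10) * FreeAlgebra.ι K (3 : Fin 10), (0 : FreeAlgebra K (Fin 10))),
    (FreeAlgebra.ι K (2 : Fin 10) * FreeAlgebra.ι K (0 : Fin 10), (0 : FreeAlgebra K (Fin 10))),
    (FreeAlgebra.ι K (2 : Fin 10) * FreeAlgebra.ι K (1 : Fin 10), (0 : FreeAlgebra K (Fin 10))),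
    (FreeAlgebra.ι K (2 : Fin 10) * FreeAlgebra.ι K (2 : Fin 10), FreeAlgebra.ι K (2 : Fin 10)),
    (FreeAlgebra.ι K (2 : Fin 10) * FreeAlgebra.ι K (3 : Fin 10), (0 : FreeAlgebra K (Fin 10))),
    (FreeAlgebra.ι K (3 : Fin 10) * FreeAlgebra.ι K (0 : Fin 10), (0 : FreeAlgebra K (Fin 10))),
    (FreeAlgebra.ι K (3 : Fin 10) * FreeAlgebra.ι K (1 : Fin 10), (0 : FreeAlgebra K (Fin 10))),
    (FreeAlgebra.ι K (3 : Fin 10) * FreeAlgebra.ι K (2 : Fin 10), (0 : FreeAlgebra K (Fin 10))),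
    (FreeAlgebra.ι K (3 : Fin 10) * FreeAlgebra.ι K (3 : Fin 10), FreeAlgebra.ι K (3 : Fin 10)),
    (FreeAlgebra.ι K (0 : Fin 10) + FreeAlgebra.ι K (1 : Fin 10) + FreeAlgebra.ι K (2 : Fin 10) + FreeAlgebra.ι K (3 : Fin 10), 1),
    (FreeAlgebra.ι K (4 : Fin 10), FreeAlgebra.ι K (0 : Fin 10) * FreeAlgebra.ι K (4 : Fin 10) * FreeAlgebra.ι K (1 : Fin 10)),
    (FreeAlgebra.ι K (5 : Fin 10), FreeAlgebra.ι K (1 : Fin 10) * FreeAlgebra.ι K (5 : Fin 10) * FreeAlgebra.ι K (0 : Fin 10)),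
    (FreeAlgebra.ι K (6 : Fin 10), FreeAlgebra.ι K (1 : Fin 10) * FreeAlgebra.ι K (6 : Fin 10) * FreeAlgebra.ι K (2 : Fin 10)),
    (FreeAlgebra.ι K (7 : Fin 10), FreeAlgebra.ι K (2 : Fin 10) * FreeAlgebra.ι K (7 : Fin 10) * FreeAlgebra.ι K (1 : Fin 10)),
    (FreeAlgebra.ι K (8 : Fin 10), FreeAlgebra.ι K (2 : Fin 10) * FreeAlgebra.ι K (8 : Fin 10) * FreeAlgebra.ι K (3 : Fin 10)),
    (FreeAlgebra.ι K (9 : Fin 10), FreeAlgebra.ι K (3 : Fin 10) * FreeAlgebra.ι K (9 : Fin 10) * FreeAlgebra.ι K (2 : Fin 10)),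
    (FreeAlgebra.ι K (7 : Fin 10) * FreeAlgebra.ι K (5 : Fin 10) * FreeAlgebra.ι K (4 : Fin 10), FreeAlgebra.ι K (7 : Fin 10) * FreeAlgebra.ι K (6 : Fin 10) * FreeAlgebra.ι K (7 : Fin 10)),
    (FreeAlgebra.ι K (5 : Fin 10) * FreeAlgebra.ι K (4 : Fin 10) * FreeAlgebra.ι K (6 : Fin 10), FreeAlgebra.ι K (6 : Fin 10) * FreeAlgebra.ι K (7 : Fin 10) * FreeAlgebra.ι K (6 : Fin 10)),
    (FreeAlgebra.ι K (4 : Fin 10) * FreeAlgebra.ι K (5 : Fin 10), (0 : FreeAlgebra K (Fin 10))),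
    (FreeAlgebra.ι K (9 : Fin 10) * FreeAlgebra.ι K (7 : Fin 10), (0 : FreeAlgebra K (Fin 10))),
    (FreeAlgebra.ι K (6 : Fin 10) * FreeAlgebra.ι K (8 : Fin 10), (0 : FreeAlgebra K (Fin 10))),
    (FreeAlgebra.ι K (7 : Fin 10) * FreeAlgebra.ι K (6 : Fin 10) * FreeAlgebra.ι K (7 : Fin 10) * FreeAlgebra.ι K (6 : Fin 10), FreeAlgebra.ι K (8 : Fin 10) * FreeAlgebra.ι K (9 : Fin 10))
  ] : List ((FreeAlgebra K (Fin 10)) × (FreeAlgebra K (Fin 10))))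

/-- the algebra `A₁₁`, presented by quiver and relations. -/
def A11 (K : Type) [Field K] : Type := RingQuot (A11Rel K)

instance (K : Type) [Field K] : Ring (A11 K) :=
  inferInstanceAs (Ring (RingQuot (A11Rel K)))

instance (K : Type) [Field K] : Algebra K (A11 K) :=
  inferInstanceAs (Algebra K (RingQuot (A11Rel K)))

/-- The defining relations of the algebra `A₁₂`, as relations on the free algebra on
the idempotents `e_1, …, e_3` and the arrows of its quiver. -/
def A12Rel (K : Type) [Field K] : FreeAlgebra K (Fin 7) → FreeAlgebra K (Fin 7) → Prop := fun u v =>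
  (u, v) ∈ ([
    (FreeAlgebra.ι K (0 : Fin 7) * FreeAlgebra.ι K (0 : Fin 7), FreeAlgebra.ι K (0 : Fin 7)),
    (FreeAlgebra.ι K (0 : Fin 7) * FreeAlgebra.ι K (1 : Fin 7), (0 : FreeAlgebra K (Fin 7))),
    (FreeAlgebra.ι K (0 : Fin 7) * FreeAlgebra.ι K (2 : Fin 7), (0 : FreeAlgebra K (Fin 7))),
    (FreeAlgebra.ι K (1 : Fin 7) * FreeAlgebra.ι K (0 : Fin 7), (0 : FreeAlgebra K (Fin 7))),
    (FreeAlgebra.ι K (1 : Fin 7) * FreeAlgebra.ι K (1 : Fin 7), FreeAlgebra.ι K (1 : Fin 7)),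
    (FreeAlgebra.ι K (1 : Fin 7) * FreeAlgebra.ι K (2 : Fin 7), (0 : FreeAlgebra K (Fin 7))),
    (FreeAlgebra.ι K (2 : Fin 7) * FreeAlgebra.ι K (0 : Fin 7), (0 : FreeAlgebra K (Fin 7))),
    (FreeAlgebra.ι K (2 : Fin 7) * FreeAlgebra.ι K (1 : Fin 7), (0 : FreeAlgebra K (Fin 7))),
    (FreeAlgebra.ι K (2 : Fin 7) * FreeAlgebra.ι K (2 : Fin 7), FreeAlgebra.ι K (2 : Fin 7)),
    (FreeAlgebra.ι K (0 : Fin 7) + FreeAlgebra.ι K (1 : Fin 7) + FreeAlgebra.ι K (2 : Fin 7), 1),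
    (FreeAlgebra.ι K (3 : Fin 7), FreeAlgebra.ι K (0 : Fin 7) * FreeAlgebra.ι K (3 : Fin 7) * FreeAlgebra.ι K (1 : Fin 7)),
    (FreeAlgebra.ι K (4 : Fin 7), FreeAlgebra.ι K (1 : Fin 7) * FreeAlgebra.ι K (4 : Fin 7) * FreeAlgebra.ι K (2 : Fin 7)),
    (FreeAlgebra.ι K (5 : Fin 7), FreeAlgebra.ι K (2 : Fin 7) * FreeAlgebra.ι K (5 : Fin 7) * FreeAlgebra.ι K (0 : Fin 7)),
    (FreeAlgebra.ι K (6 : Fin 7), FreeAlgebra.ι K (0 : Fin 7) * FreeAlgebra.ι K (6 : Fin 7) * FreeAlgebra.ι K (2 : Fin 7)),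
    (FreeAlgebra.ι K (6 : Fin 7) * FreeAlgebra.ι K (5 : Fin 7) * FreeAlgebra.ι K (6 : Fin 7), FreeAlgebra.ι K (3 : Fin 7) * FreeAlgebra.ι K (4 : Fin 7)),
    (FreeAlgebra.ι K (4 : Fin 7) * FreeAlgebra.ι K (5 : Fin 7) * FreeAlgebra.ι K (3 : Fin 7), (0 : FreeAlgebra K (Fin 7))),
    (FreeAlgebra.ι K (5 : Fin 7) * FreeAlgebra.ι K (6 : Fin 7) * FreeAlgebra.ι K (5 : Fin 7) * FreeAlgebra.ι K (6 : Fin 7) * FreeAlgebra.ι K (5 : Fin 7) * FreeAlgebra.ι K (6 : Fin 7) * FreeAlgebra.ι K (5 : Fin 7), (0 : FreeAlgebra K (Fin 7)))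
  ] : List ((FreeAlgebra K (Fin 7)) × (FreeAlgebra K (Fin 7))))

/-- the algebra `A₁₂`, presented by quiver and relations. -/
def A12 (K : Type) [Field K] : Type := RingQuot (A12Rel K)

instance (K : Type) [Field K] : Ring (A12 K) :=
  inferInstanceAs (Ring (RingQuot (A12Rel K)))

instance (K : Type) [Field K] : Algebra K (A12 K) :=
  inferInstanceAs (Algebra K (RingQuot (A12Rel K)))

/-- The defining relations of the algebra `A₁₃`, as relations on the free algebra on
the idempotents `e_1, …, e_3` and the arrows of its quiver. -/
def A13Rel (K : Type) [Field K] : FreeAlgebra K (Fin 8) → FreeAlgebra K (Fin 8) → Prop := fun u v =>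
  (u, v) ∈ ([
    (FreeAlgebra.ι K (0 : Fin 8) * FreeAlgebra.ι K (0 : Fin 8), FreeAlgebra.ι K (0 : Fin 8)),
    (FreeAlgebra.ι K (0 : Fin 8) * FreeAlgebra.ι K (1 : Fin 8), (0 : FreeAlgebra K (Fin 8))),
    (FreeAlgebra.ι K (0 : Fin 8) * FreeAlgebra.ι K (2 : Fin 8), (0 : FreeAlgebra K (Fin 8))),
    (FreeAlgebra.ι K (1 : Fin 8) * FreeAlgebra.ι K (0 : Fin 8), (0 : FreeAlgebra K (Fin 8))),
    (FreeAlgebra.ι K (1 : Fin 8) * FreeAlgebra.ι K (1 : Fin 8), FreeAlgebra.ι K (1 : Fin 8)),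
    (FreeAlgebra.ι K (1 : Fin 8) * FreeAlgebra.ι K (2 : Fin 8), (0 : FreeAlgebra K (Fin 8))),
    (FreeAlgebra.ι K (2 : Fin 8) * FreeAlgebra.ι K (0 : Fin 8), (0 : FreeAlgebra K (Fin 8))),
    (FreeAlgebra.ι K (2 : Fin 8) * FreeAlgebra.ι K (1 : Fin 8), (0 : FreeAlgebra K (Fin 8))),
    (FreeAlgebra.ι K (2 : Fin 8) * FreeAlgebra.ι K (2 : Fin 8), FreeAlgebra.ι K (2 : Fin 8)),
    (FreeAlgebra.ι K (0 : Fin 8) + FreeAlgebra.ι K (1 : Fin 8) + FreeAlgebra.ι K (2 : Fin 8), 1),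
    (FreeAlgebra.ι K (3 : Fin 8), FreeAlgebra.ι K (1 : Fin 8) * FreeAlgebra.ι K (3 : Fin 8) * FreeAlgebra.ι K (1 : Fin 8)),
    (FreeAlgebra.ι K (4 : Fin 8), FreeAlgebra.ι K (0 : Fin 8) * FreeAlgebra.ι K (4 : Fin 8) * FreeAlgebra.ι K (1 : Fin 8)),
    (FreeAlgebra.ι K (5 : Fin 8), FreeAlgebra.ι K (1 : Fin 8) * FreeAlgebra.ι K (5 : Fin 8) * FreeAlgebra.ι K (0 : Fin 8)),
    (FreeAlgebra.ι K (6 : Fin 8), FreeAlgebra.ι K (1 : Fin 8) * FreeAlgebra.ι K (6 : Fin 8) * FreeAlgebra.ι K (2 : Fin 8)),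
    (FreeAlgebra.ι K (7 : Fin 8), FreeAlgebra.ι K (2 : Fin 8) * FreeAlgebra.ι K (7 : Fin 8) * FreeAlgebra.ι K (1 : Fin 8)),
    (FreeAlgebra.ι K (3 : Fin 8) * FreeAlgebra.ι K (3 : Fin 8), FreeAlgebra.ι K (5 : Fin 8) * FreeAlgebra.ι K (4 : Fin 8)),
    (FreeAlgebra.ι K (4 : Fin 8) * FreeAlgebra.ι K (6 : Fin 8), (0 : FreeAlgebra K (Fin 8))),
    (FreeAlgebra.ι K (4 : Fin 8) * FreeAlgebra.ι K (5 : Fin 8), (0 : FreeAlgebra K (Fin 8))),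
    (FreeAlgebra.ι K (7 : Fin 8) * FreeAlgebra.ι K (5 : Fin 8), (0 : FreeAlgebra K (Fin 8))),
    (FreeAlgebra.ι K (7 : Fin 8) * FreeAlgebra.ι K (3 : Fin 8), (0 : FreeAlgebra K (Fin 8))),
    (FreeAlgebra.ι K (3 : Fin 8) * FreeAlgebra.ι K (6 : Fin 8), (0 : FreeAlgebra K (Fin 8))),
    (FreeAlgebra.ι K (3 : Fin 8) * FreeAlgebra.ι K (3 : Fin 8) * FreeAlgebra.ι K (3 : Fin 8), FreeAlgebra.ι K (6 : Fin 8) * FreeAlgebra.ι K (7 : Fin 8))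
  ] : List ((FreeAlgebra K (Fin 8)) × (FreeAlgebra K (Fin 8))))

/-- the algebra `A₁₃`, presented by quiver and relations. -/
def A13 (K : Type) [Field K] : Type := RingQuot (A13Rel K)

instance (K : Type) [Field K] : Ring (A13 K) :=
  inferInstanceAs (Ring (RingQuot (A13Rel K)))

instance (K : Type) [Field K] : Algebra K (A13 K) :=
  inferInstanceAs (Algebra K (RingQuot (A13Rel K)))

/-- The defining relations of the algebra `A₁₄`, as relations on the free algebra on
the idempotents `e_1, …, e_3` and the arrows of its quiver. -/
def A14Rel (K : Type) [Field K] : FreeAlgebra K (Fin 7) → FreeAlgebra K (Fin 7) → Prop := fun u v =>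
  (u, v) ∈ ([
    (FreeAlgebra.ι K (0 : Fin 7) * FreeAlgebra.ι K (0 : Fin 7), FreeAlgebra.ι K (0 : Fin 7)),
    (FreeAlgebra.ι K (0 : Fin 7) * FreeAlgebra.ι K (1 : Fin 7), (0 : FreeAlgebra K (Fin 7))),
    (FreeAlgebra.ι K (0 : Fin 7) * FreeAlgebra.ι K (2 : Fin 7), (0 : FreeAlgebra K (Fin 7))),
    (FreeAlgebra.ι K (1 : Fin 7) * FreeAlgebra.ι K (0 : Fin 7), (0 : FreeAlgebra K (Fin 7))),
    (FreeAlgebra.ι K (1 : Fin 7) * FreeAlgebra.ι K (1 : Fin 7), FreeAlgebra.ι K (1 : Fin 7)),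
    (FreeAlgebra.ι K (1 : Fin 7) * FreeAlgebra.ι K (2 : Fin 7), (0 : FreeAlgebra K (Fin 7))),
    (FreeAlgebra.ι K (2 : Fin 7) * FreeAlgebra.ι K (0 : Fin 7), (0 : FreeAlgebra K (Fin 7))),
    (FreeAlgebra.ι K (2 : Fin 7) * FreeAlgebra.ι K (1 : Fin 7), (0 : FreeAlgebra K (Fin 7))),
    (FreeAlgebra.ι K (2 : Fin 7) * FreeAlgebra.ι K (2 : Fin 7), FreeAlgebra.ι K (2 : Fin 7)),
    (FreeAlgebra.ι K (0 : Fin 7) + FreeAlgebra.ι K (1 : Fin 7) + FreeAlgebra.ι K (2 : Fin 7), 1),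
    (FreeAlgebra.ι K (3 : Fin 7), FreeAlgebra.ι K (0 : Fin 7) * FreeAlgebra.ι K (3 : Fin 7) * FreeAlgebra.ι K (1 : Fin 7)),
    (FreeAlgebra.ι K (4 : Fin 7), FreeAlgebra.ι K (1 : Fin 7) * FreeAlgebra.ι K (4 : Fin 7) * FreeAlgebra.ι K (0 : Fin 7)),
    (FreeAlgebra.ι K (5 : Fin 7), FreeAlgebra.ι K (1 : Fin 7) * FreeAlgebra.ι K (5 : Fin 7) * FreeAlgebra.ι K (2 : Fin 7)),
    (FreeAlgebra.ι K (6 : Fin 7), FreeAlgebra.ι K (2 : Fin 7) * FreeAlgebra.ι K (6 : Fin 7) * FreeAlgebra.ι K (1 : Fin 7)),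
    (FreeAlgebra.ι K (4 : Fin 7) * FreeAlgebra.ι K (3 : Fin 7), FreeAlgebra.ι K (5 : Fin 7) * FreeAlgebra.ι K (6 : Fin 7) * FreeAlgebra.ι K (5 : Fin 7) * FreeAlgebra.ι K (6 : Fin 7)),
    (FreeAlgebra.ι K (3 : Fin 7) * FreeAlgebra.ι K (5 : Fin 7) * FreeAlgebra.ι K (6 : Fin 7) * FreeAlgebra.ι K (5 : Fin 7), (0 : FreeAlgebra K (Fin 7))),
    (FreeAlgebra.ι K (6 : Fin 7) * FreeAlgebra.ι K (5 : Fin 7) * FreeAlgebra.ι K (6 : Fin 7) * FreeAlgebra.ι K (4 : Fin 7), (0 : FreeAlgebra K (Fin 7))),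
    (FreeAlgebra.ι K (3 : Fin 7) * FreeAlgebra.ι K (4 : Fin 7), (0 : FreeAlgebra K (Fin 7)))
  ] : List ((FreeAlgebra K (Fin 7)) × (FreeAlgebra K (Fin 7))))

/-- the algebra `A₁₄`, presented by quiver and relations. -/
def A14 (K : Type) [Field K] : Type := RingQuot (A14Rel K)

instance (K : Type) [Field K] : Ring (A14 K) :=
  inferInstanceAs (Ring (RingQuot (A14Rel K)))

instance (K : Type) [Field K] : Algebra K (A14 K) :=
  inferInstanceAs (Algebra K (RingQuot (A14Rel K)))

/-- The defining relations of the algebra `A₁₅`, as relations on the free algebra on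
the idempotents `e_1, …, e_3` and the arrows of its quiver. -/
def A15Rel (K : Type) [Field K] : FreeAlgebra K (Fin 8) → FreeAlgebra K (Fin 8) → Prop := fun u v =>
  (u, v) ∈ ([
    (FreeAlgebra.ι K (0 : Fin 8) * FreeAlgebra.ι K (0 : Fin 8), FreeAlgebra.ι K (0 : Fin 8)),
    (FreeAlgebra.ι K (0 : Fin 8) * FreeAlgebra.ι K (1 : Fin 8), (0 : FreeAlgebra K (Fin 8))),
    (FreeAlgebra.ι K (0 : Fin 8) * FreeAlgebra.ι K (2 : Fin 8), (0 : FreeAlgebra K (Fin 8))),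
    (FreeAlgebra.ι K (1 : Fin 8) * FreeAlgebra.ι K (0 : Fin 8), (0 : FreeAlgebra K (Fin 8))),
    (FreeAlgebra.ι K (1 : Fin 8) * FreeAlgebra.ι K (1 : Fin 8), FreeAlgebra.ι K (1 : Fin 8)),
    (FreeAlgebra.ι K (1 : Fin 8) * FreeAlgebra.ι K (2 : Fin 8), (0 : FreeAlgebra K (Fin 8))),
    (FreeAlgebra.ι K (2 : Fin 8) * FreeAlgebra.ι K (0 : Fin 8), (0 : FreeAlgebra K (Fin 8))),
    (FreeAlgebra.ι K (2 : Fin 8) * FreeAlgebra.ι K (1 : Fin 8), (0 : FreeAlgebra K (Fin 8))),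
    (FreeAlgebra.ι K (2 : Fin 8) * FreeAlgebra.ι K (2 : Fin 8), FreeAlgebra.ι K (2 : Fin 8)),
    (FreeAlgebra.ι K (0 : Fin 8) + FreeAlgebra.ι K (1 : Fin 8) + FreeAlgebra.ι K (2 : Fin 8), 1),
    (FreeAlgebra.ι K (3 : Fin 8), FreeAlgebra.ι K (0 : Fin 8) * FreeAlgebra.ι K (3 : Fin 8) * FreeAlgebra.ι K (0 : Fin 8)),
    (FreeAlgebra.ι K (4 : Fin 8), FreeAlgebra.ι K (0 : Fin 8) * FreeAlgebra.ι K (4 : Fin 8) * FreeAlgebra.ι K (1 : Fin 8)),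
    (FreeAlgebra.ι K (5 : Fin 8), FreeAlgebra.ι K (1 : Fin 8) * FreeAlgebra.ι K (5 : Fin 8) * FreeAlgebra.ι K (2 : Fin 8)),
    (FreeAlgebra.ι K (6 : Fin 8), FreeAlgebra.ι K (2 : Fin 8) * FreeAlgebra.ι K (6 : Fin 8) * FreeAlgebra.ι K (0 : Fin 8)),
    (FreeAlgebra.ι K (7 : Fin 8), FreeAlgebra.ι K (0 : Fin 8) * FreeAlgebra.ι K (7 : Fin 8) * FreeAlgebra.ι K (2 : Fin 8)),
    (FreeAlgebra.ι K (5 : Fin 8) * FreeAlgebra.ι K (6 : Fin 8) * FreeAlgebra.ι K (3 : Fin 8), (0 : FreeAlgebra K (Fin 8))),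
    (FreeAlgebra.ι K (3 : Fin 8) * FreeAlgebra.ι K (3 : Fin 8), FreeAlgebra.ι K (7 : Fin 8) * FreeAlgebra.ι K (6 : Fin 8)),
    (FreeAlgebra.ι K (6 : Fin 8) * FreeAlgebra.ι K (7 : Fin 8), (0 : FreeAlgebra K (Fin 8))),
    (FreeAlgebra.ι K (3 : Fin 8) * FreeAlgebra.ι K (4 : Fin 8), (0 : FreeAlgebra K (Fin 8))),
    (FreeAlgebra.ι K (3 : Fin 8) * FreeAlgebra.ι K (7 : Fin 8), FreeAlgebra.ι K (4 : Fin 8) * FreeAlgebra.ι K (5 : Fin 8))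
  ] : List ((FreeAlgebra K (Fin 8)) × (FreeAlgebra K (Fin 8))))

/-- the algebra `A₁₅`, presented by quiver and relations. -/
def A15 (K : Type) [Field K] : Type := RingQuot (A15Rel K)

instance (K : Type) [Field K] : Ring (A15 K) :=
  inferInstanceAs (Ring (RingQuot (A15Rel K)))

instance (K : Type) [Field K] : Algebra K (A15 K) :=
  inferInstanceAs (Algebra K (RingQuot (A15Rel K)))

/-- The defining relations of the algebra `A₁₆`, as relations on the free algebra on
the idempotents `e_1, …, e_3` and the arrows of its quiver. -/
def A16Rel (K : Type) [Field K] : FreeAlgebra K (Fin 8) → FreeAlgebra K (Fin 8) → Prop := fun u v =>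
  (u, v) ∈ ([
    (FreeAlgebra.ι K (0 : Fin 8) * FreeAlgebra.ι K (0 : Fin 8), FreeAlgebra.ι K (0 : Fin 8)),
    (FreeAlgebra.ι K (0 : Fin 8) * FreeAlgebra.ι K (1 : Fin 8), (0 : FreeAlgebra K (Fin 8))),
    (FreeAlgebra.ι K (0 : Fin 8) * FreeAlgebra.ι K (2 : Fin 8), (0 : FreeAlgebra K (Fin 8))),
    (FreeAlgebra.ι K (1 : Fin 8) * FreeAlgebra.ι K (0 : Fin 8), (0 : FreeAlgebra K (Fin 8))),
    (FreeAlgebra.ι K (1 : Fin 8) * FreeAlgebra.ι K (1 : Fin 8), FreeAlgebra.ι K (1 : Fin 8)),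
    (FreeAlgebra.ι K (1 : Fin 8) * FreeAlgebra.ι K (2 : Fin 8), (0 : FreeAlgebra K (Fin 8))),
    (FreeAlgebra.ι K (2 : Fin 8) * FreeAlgebra.ι K (0 : Fin 8), (0 : FreeAlgebra K (Fin 8))),
    (FreeAlgebra.ι K (2 : Fin 8) * FreeAlgebra.ι K (1 : Fin 8), (0 : FreeAlgebra K (Fin 8))),
    (FreeAlgebra.ι K (2 : Fin 8) * FreeAlgebra.ι K (2 : Fin 8), FreeAlgebra.ι K (2 : Fin 8)),
    (FreeAlgebra.ι K (0 : Fin 8) + FreeAlgebra.ι K (1 : Fin 8) + FreeAlgebra.ι K (2 : Fin 8), 1),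
    (FreeAlgebra.ι K (3 : Fin 8), FreeAlgebra.ι K (0 : Fin 8) * FreeAlgebra.ι K (3 : Fin 8) * FreeAlgebra.ι K (0 : Fin 8)),
    (FreeAlgebra.ι K (4 : Fin 8), FreeAlgebra.ι K (1 : Fin 8) * FreeAlgebra.ι K (4 : Fin 8) * FreeAlgebra.ι K (0 : Fin 8)),
    (FreeAlgebra.ι K (5 : Fin 8), FreeAlgebra.ι K (2 : Fin 8) * FreeAlgebra.ι K (5 : Fin 8) * FreeAlgebra.ι K (1 : Fin 8)),
    (FreeAlgebra.ι K (6 : Fin 8), FreeAlgebra.ι K (0 : Fin 8) * FreeAlgebra.ι K (6 : Fin 8) * FreeAlgebra.ι K (2 : Fin 8)),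
    (FreeAlgebra.ι K (7 : Fin 8), FreeAlgebra.ι K (2 : Fin 8) * FreeAlgebra.ι K (7 : Fin 8) * FreeAlgebra.ι K (0 : Fin 8)),
    (FreeAlgebra.ι K (3 : Fin 8) * FreeAlgebra.ι K (6 : Fin 8) * FreeAlgebra.ι K (5 : Fin 8), (0 : FreeAlgebra K (Fin 8))),
    (FreeAlgebra.ι K (3 : Fin 8) * FreeAlgebra.ι K (3 : Fin 8), FreeAlgebra.ι K (6 : Fin 8) * FreeAlgebra.ι K (7 : Fin 8)),
    (FreeAlgebra.ι K (7 : Fin 8) * FreeAlgebra.ι K (6 : Fin 8), (0 : FreeAlgebra K (Fin 8))),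
    (FreeAlgebra.ι K (4 : Fin 8) * FreeAlgebra.ι K (3 : Fin 8), (0 : FreeAlgebra K (Fin 8))),
    (FreeAlgebra.ι K (7 : Fin 8) * FreeAlgebra.ι K (3 : Fin 8), FreeAlgebra.ι K (5 : Fin 8) * FreeAlgebra.ι K (4 : Fin 8))
  ] : List ((FreeAlgebra K (Fin 8)) × (FreeAlgebra K (Fin 8))))

/-- the algebra `A₁₆`, presented by quiver and relations. -/
def A16 (K : Type) [Field K] : Type := RingQuot (A16Rel K)

instance (K : Type) [Field K] : Ring (A16 K) :=
  inferInstanceAs (Ring (RingQuot (A16Rel K)))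

instance (K : Type) [Field K] : Algebra K (A16 K) :=
  inferInstanceAs (Algebra K (RingQuot (A16Rel K)))
/-- Morita equivalence of two algebras: their (right) module categories are
equivalent. -/
def MoritaEquivalent (Λ Γ : Type) [Ring Λ] [Ring Γ] : Prop :=
  Nonempty (ModuleCat.{0} Λᵐᵒᵖ ≌ ModuleCat.{0} Γᵐᵒᵖ)

/-- `Λ` is a weakly symmetric algebra of tubular type with non-singular Cartan
matrix over `K`: by the Białkowski–Skowroński classification these are, up to
Morita equivalence, exactly the algebras `A₁(λ), A₂(λ)` (`λ ∈ K \ {0,1}`),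
`A₃, …, A₁₆`. -/
def IsWeaklySymmetricTubularNonsingular (K : Type) [Field K] (Λ : Type) [Ring Λ] : Prop :=
  (∃ l : K, l ≠ 0 ∧ l ≠ 1 ∧ MoritaEquivalent Λ (A1 K l)) ∨
  (∃ l : K, l ≠ 0 ∧ l ≠ 1 ∧ MoritaEquivalent Λ (A2 K l)) ∨
  MoritaEquivalent Λ (A3 K) ∨ MoritaEquivalent Λ (A4 K) ∨ MoritaEquivalent Λ (A5 K) ∨
  MoritaEquivalent Λ (A6 K) ∨ MoritaEquivalent Λ (A7 K) ∨ MoritaEquivalent Λ (A8 K) ∨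
  MoritaEquivalent Λ (A9 K) ∨ MoritaEquivalent Λ (A10 K) ∨ MoritaEquivalent Λ (A11 K) ∨
  MoritaEquivalent Λ (A12 K) ∨ MoritaEquivalent Λ (A13 K) ∨ MoritaEquivalent Λ (A14 K) ∨
  MoritaEquivalent Λ (A15 K) ∨ MoritaEquivalent Λ (A16 K)

set_option linter.unusedSectionVars false

/-! ### Vanishing of morphism groups along distinguished triangles -/

section HomZero

variable {C : Type u} [Category.{v} C] [Preadditive C] [HasZeroObject C] [HasShift C ℤ]
  [∀ n : ℤ, (shiftFunctor C n).Additive] [Pretriangulated C]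

/-- `Hom(X, Y[k]) = 0`. -/
def HomZero (X Y : C) (k : ℤ) : Prop := ∀ f : X ⟶ Y⟦k⟧, f = 0

lemma HomZero.zero {X Y : C} (h : HomZero X Y 0) (f : X ⟶ Y) : f = 0 := by
  have := h (f ≫ (shiftFunctorZero C ℤ).inv.app Y)
  rw [← cancel_mono ((shiftFunctorZero C ℤ).inv.app Y), this, zero_comp]

lemma HomZero.shift {X Y : C} {k : ℤ} (h : HomZero X Y k) (m : ℤ) {l : ℤ} (hl : k + m = l) :
    HomZero (X⟦m⟧) Y l := fun f => by
  obtain ⟨g, hg⟩ := (shiftFunctor C m).map_surjective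
    (f ≫ (shiftFunctorAdd' C k m l hl).hom.app Y)
  rw [← cancel_mono ((shiftFunctorAdd' C k m l hl).hom.app Y), ← hg, h g]; simp

lemma HomZero.unshift {X Y : C} {m l : ℤ} (h : HomZero (X⟦m⟧) Y l) {k : ℤ} (hl : k + m = l) :
    HomZero X Y k := fun f => by
  apply (shiftFunctor C m).map_injective
  have := h ((shiftFunctor C m).map f ≫ (shiftFunctorAdd' C k m l hl).inv.app Y)
  rw [← cancel_mono ((shiftFunctorAdd' C k m l hl).inv.app Y), this]; simp

lemma HomZero.target_shift {X Y : C} {l : ℤ} (h : HomZero X Y l) (m : ℤ) {k : ℤ}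
    (hl : m + k = l) : HomZero X (Y⟦m⟧) k := fun f => by
  rw [← cancel_mono ((shiftFunctorAdd' C m k l hl).inv.app Y), zero_comp]; exact h _

variable {T : Triangle C} (hT : T ∈ distTriang C)
include hT

lemma HomZero.right₃ {X : C} {k l : ℤ} (hl : k + 1 = l)
    (h₂ : HomZero X T.obj₂ k) (h₁ : HomZero X T.obj₁ l) : HomZero X T.obj₃ k := fun f => by
  obtain ⟨g, rfl⟩ := Triangle.coyoneda_exact₃ _ (Triangle.shift_distinguished T hT k) f
    ((h₁.target_shift k hl) _)
  rw [h₂ g]; exact zero_comp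

lemma HomZero.right₁ {X : C} {k l : ℤ} (hl : k + 1 = l)
    (h₃ : HomZero X T.obj₃ k) (h₂ : HomZero X T.obj₂ l) : HomZero X T.obj₁ l := fun f => by
  rw [← cancel_mono ((shiftFunctorAdd' C k 1 l hl).hom.app _), zero_comp]
  obtain ⟨g, hg⟩ := Triangle.coyoneda_exact₁ _ (Triangle.shift_distinguished T hT k)
    (f ≫ (shiftFunctorAdd' C k 1 l hl).hom.app _) ((h₂.target_shift k hl) _)
  refine hg.trans ?_
  rw [h₃ g]; exact zero_comp

lemma HomZero.left₃ {Y : C} {k l : ℤ} (hl : k + 1 = l)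
    (h₂ : HomZero T.obj₂ Y l) (h₁ : HomZero T.obj₁ Y k) : HomZero T.obj₃ Y l := fun f => by
  obtain ⟨g, rfl⟩ := Triangle.yoneda_exact₃ T hT f (h₂ _)
  rw [h₁.shift 1 hl g, comp_zero]

lemma HomZero.left₁ {Y : C} {k l : ℤ} (hl : k + 1 = l)
    (h₂ : HomZero T.obj₂ Y k) (h₃ : HomZero T.obj₃ Y l) : HomZero T.obj₁ Y k := by
  refine HomZero.unshift (m := 1) (fun f => ?_) hl
  obtain ⟨g, rfl⟩ := Triangle.yoneda_exact₂ _ (rot_of_distTriang _ (rot_of_distTriang _ hT)) f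
    (h₃ _)
  have h2 : HomZero (T.obj₂⟦(1 : ℤ)⟧) Y l := h₂.shift 1 hl
  rw [h2 g]; exact comp_zero

/-- If all morphisms `X ⟶ T.obj₃` lift to `T.obj₂`, the connecting map vanishes. -/
lemma HomZero.right₁_of_lift {X : C} (h : ∀ f : X ⟶ T.obj₃, ∃ g, f = g ≫ T.mor₂)
    (h₂ : HomZero X T.obj₂ 1) : HomZero X T.obj₁ 1 := fun f => by
  obtain ⟨g, rfl⟩ := Triangle.coyoneda_exact₁ T hT f (h₂ _)
  obtain ⟨g', rfl⟩ := h g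
  rw [Category.assoc, comp_distTriang_mor_zero₂₃ T hT, comp_zero]

/-- If all morphisms `T.obj₁ ⟶ Y` extend to `T.obj₂`, the connecting map vanishes. -/
lemma HomZero.left₃_of_extend {Y : C} (h : ∀ f : T.obj₁ ⟶ Y, ∃ g, f = T.mor₁ ≫ g)
    (h₂ : HomZero T.obj₂ Y 1) : HomZero T.obj₃ Y 1 := fun f => by
  obtain ⟨g, rfl⟩ := Triangle.yoneda_exact₃ T hT f (h₂ _)
  obtain ⟨g₀, rfl⟩ := (shiftFunctor C (1 : ℤ)).map_surjective g
  obtain ⟨g₁, rfl⟩ := h g₀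
  rw [Functor.map_comp, comp_distTriang_mor_zero₃₁_assoc T hT, zero_comp]

end HomZero

section Biproduct

variable {C : Type u} [Category.{v} C] [Preadditive C] [HasShift C ℤ]
  [∀ n : ℤ, (shiftFunctor C n).Additive] [HasFiniteBiproducts C]
  {J : Type} [Finite J] {F : J → C}

lemma HomZero.biproduct_right {X : C} {k : ℤ} (h : ∀ j, HomZero X (F j) k) :
    HomZero X (⨁ F) k := fun f => by
  have := Fintype.ofFinite J
  have : f = ∑ j, f ≫ (biproduct.π F j)⟦k⟧' ≫ (biproduct.ι F j)⟦k⟧' := by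
    conv_lhs => rw [← Category.comp_id f, ← CategoryTheory.Functor.map_id, ← biproduct.total, Functor.map_sum,
      Preadditive.comp_sum]
    simp only [Functor.map_comp]
  rw [this]
  refine Finset.sum_eq_zero fun j _ => ?_
  rw [← Category.assoc, h j (f ≫ _), zero_comp]

lemma HomZero.biproduct_left {Y : C} {k : ℤ} (h : ∀ j, HomZero (F j) Y k) :
    HomZero (⨁ F) Y k := fun f => by
  refine biproduct.hom_ext' _ _ fun j => ?_
  rw [h j (biproduct.ι F j ≫ f), comp_zero]

end Biproduct

/-! ### Dimension counts along exact sequences -/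

section LinearAlgebra

variable {K : Type*} [Field K]

lemma finite_of_exact {V₁ V₂ V₃ : Type*} [AddCommGroup V₁] [AddCommGroup V₂] [AddCommGroup V₃]
    [Module K V₁] [Module K V₂] [Module K V₃] [Module.Finite K V₁] [Module.Finite K V₃]
    (f : V₁ →ₗ[K] V₂) (g : V₂ →ₗ[K] V₃) (h : ∀ x, g x = 0 → ∃ y, f y = x) :
    Module.Finite K V₂ := by
  refine ⟨Submodule.fg_of_fg_map_of_fg_inf_ker g (IsNoetherian.noetherian _) ?_⟩
  have : (⊤ ⊓ LinearMap.ker g : Submodule K V₂) = (LinearMap.range f ⊓ LinearMap.ker g) := by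
    ext x
    simp only [Submodule.mem_inf, Submodule.mem_top, true_and, LinearMap.mem_range,
      LinearMap.mem_ker]
    exact ⟨fun hx => ⟨h x hx, hx⟩, fun hx => hx.2⟩
  rw [this]
  exact isNoetherian_submodule.1 inferInstance _ inf_le_left

lemma finrank_of_exact {V₁ V₂ V₃ : Type*} [AddCommGroup V₁] [AddCommGroup V₂] [AddCommGroup V₃]
    [Module K V₁] [Module K V₂] [Module K V₃] [Module.Finite K V₂]
    (f : V₁ →ₗ[K] V₂) (g : V₂ →ₗ[K] V₃) (h : Function.Exact f g) :
    Module.finrank K V₂ =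
      Module.finrank K (LinearMap.range f) + Module.finrank K (LinearMap.range g) := by
  rw [← LinearMap.finrank_range_add_finrank_ker g, LinearMap.exact_iff.1 h, add_comm]

/-- The alternating sum of dimensions of a six term exact sequence vanishes. -/
lemma finrank_six_term {V₁ V₂ V₃ V₄ V₅ V₆ : Type*} [AddCommGroup V₁] [AddCommGroup V₂]
    [AddCommGroup V₃] [AddCommGroup V₄] [AddCommGroup V₅] [AddCommGroup V₆] [Module K V₁]
    [Module K V₂] [Module K V₃] [Module K V₄] [Module K V₅] [Module K V₆] [Module.Finite K V₁]
    [Module.Finite K V₂] [Module.Finite K V₃] [Module.Finite K V₄] [Module.Finite K V₅]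
    (f₁ : V₁ →ₗ[K] V₂) (f₂ : V₂ →ₗ[K] V₃) (f₃ : V₃ →ₗ[K] V₄) (f₄ : V₄ →ₗ[K] V₅)
    (f₅ : V₅ →ₗ[K] V₆) (h₁ : Function.Injective f₁) (h₂ : Function.Exact f₁ f₂)
    (h₃ : Function.Exact f₂ f₃) (h₄ : Function.Exact f₃ f₄) (h₅ : Function.Exact f₄ f₅)
    (h₆ : Function.Surjective f₅) :
    (Module.finrank K V₆ : ℤ) - Module.finrank K V₃ = (Module.finrank K V₅ - Module.finrank K V₂)
      - (Module.finrank K V₄ - Module.finrank K V₁) := by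
  have e₁ := LinearMap.finrank_range_of_inj h₁
  have e₂ := finrank_of_exact f₁ f₂ h₂
  have e₃ := finrank_of_exact f₂ f₃ h₃
  have e₄ := finrank_of_exact f₃ f₄ h₄
  have e₅ := finrank_of_exact f₄ f₅ h₅
  have e₆ : Module.finrank K (LinearMap.range f₅) = Module.finrank K V₆ := by
    rw [LinearMap.range_eq_top.2 h₆, finrank_top]
  omega

end LinearAlgebra

section Dimensions

variable (K : Type w) [Field K] {C : Type u} [Category.{v} C] [Preadditive C] [Linear K C]
  [HasZeroObject C] [HasShift C ℤ] [∀ n : ℤ, (shiftFunctor C n).Additive]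
  [∀ n : ℤ, (shiftFunctor C n).Linear K] [Pretriangulated C]

/-- All graded pieces of `Hom(X, Y[*])` are finite dimensional. -/
def FinHom (X Y : C) : Prop := ∀ k : ℤ, Module.Finite K (X ⟶ Y⟦k⟧)

/-- `dim Hom(X, Y) - dim Hom(X, Y[-1])`. -/
def euler (X Y : C) : ℤ :=
  (Module.finrank K (X ⟶ Y) : ℤ) - Module.finrank K (X ⟶ Y⟦(-1 : ℤ)⟧)

/-- The linear isomorphism `Hom(X, Y[k]) ≃ Hom(X[m], Y[l])` for `k + m = l`. -/
def shiftHomEquiv (X Y : C) {k m l : ℤ} (h : k + m = l) : (X ⟶ Y⟦k⟧) ≃ₗ[K] (X⟦m⟧ ⟶ Y⟦l⟧) :=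
  LinearEquiv.ofBijective
    ((Linear.rightComp K _ ((shiftFunctorAdd' C k m l h).inv.app Y)).comp
      ((shiftFunctor C m).mapLinearMap K (X := X) (Y := Y⟦k⟧)))
    ⟨fun f g hfg => by
      have := (cancel_mono ((shiftFunctorAdd' C k m l h).inv.app Y)).1 hfg
      exact (shiftFunctor C m).map_injective this, fun f => by
      obtain ⟨g, hg⟩ := (shiftFunctor C m).map_surjective
        (f ≫ (shiftFunctorAdd' C k m l h).hom.app Y)
      exact ⟨g, by simp [hg]⟩⟩

/-- The linear isomorphism `Hom(X, Y) ≃ Hom(X, Y[0])`. -/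
def homShiftZeroEquiv (X Y : C) : (X ⟶ Y) ≃ₗ[K] (X ⟶ Y⟦(0 : ℤ)⟧) :=
  LinearEquiv.ofBijective (Linear.rightComp K _ ((shiftFunctorZero C ℤ).inv.app Y))
    ⟨fun _ _ hfg => (cancel_mono ((shiftFunctorZero C ℤ).inv.app Y)).1 hfg,
      fun f => ⟨f ≫ (shiftFunctorZero C ℤ).hom.app Y, by simp⟩⟩

/-- The linear isomorphism `Hom(X, Y[l]) ≃ Hom(X, Y[m][k])` for `m + k = l`. -/
def homShiftAddEquiv (X Y : C) {m k l : ℤ} (h : m + k = l) : (X ⟶ Y⟦l⟧) ≃ₗ[K] (X ⟶ Y⟦m⟧⟦k⟧) :=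
  LinearEquiv.ofBijective (Linear.rightComp K _ ((shiftFunctorAdd' C m k l h).hom.app Y))
    ⟨fun _ _ hfg => (cancel_mono ((shiftFunctorAdd' C m k l h).hom.app Y)).1 hfg,
      fun f => ⟨f ≫ (shiftFunctorAdd' C m k l h).inv.app Y, by simp⟩⟩

variable {K}

lemma FinHom.zero {X Y : C} (h : FinHom K X Y) : Module.Finite K (X ⟶ Y) :=
  have := h 0
  Module.Finite.equiv (homShiftZeroEquiv K X Y).symm

lemma FinHom.source_shift {X Y : C} (h : FinHom K X Y) (m : ℤ) : FinHom K (X⟦m⟧) Y := fun l =>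
  have := h (l - m)
  Module.Finite.equiv (shiftHomEquiv K X Y (sub_add_cancel l m))

lemma FinHom.target_shift {X Y : C} (h : FinHom K X Y) (m : ℤ) : FinHom K X (Y⟦m⟧) := fun l =>
  have := h (m + l)
  Module.Finite.equiv (homShiftAddEquiv K X Y rfl)

lemma FinHom.of_homZero {X Y : C} (h₀ : Module.Finite K (X ⟶ Y))
    (h : ∀ k : ℤ, k ≠ 0 → HomZero X Y k) : FinHom K X Y := fun k => by
  by_cases hk : k = 0
  · subst hk; exact Module.Finite.equiv (homShiftZeroEquiv K X Y)
  · have : Subsingleton (X ⟶ Y⟦k⟧) := ⟨fun f g => by rw [h k hk f, h k hk g]⟩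
    infer_instance

variable {T : Triangle C} (hT : T ∈ distTriang C)
include hT

lemma FinHom.right₂ {X : C} (h₁ : FinHom K X T.obj₁) (h₃ : FinHom K X T.obj₃) :
    FinHom K X T.obj₂ := fun k => by
  have : Module.Finite K (X ⟶ ((Triangle.shiftFunctor C k).obj T).obj₁) := h₁ k
  have : Module.Finite K (X ⟶ ((Triangle.shiftFunctor C k).obj T).obj₃) := h₃ k
  refine finite_of_exact (Linear.rightComp K X (((Triangle.shiftFunctor C k).obj T).mor₁))
    (Linear.rightComp K X (((Triangle.shiftFunctor C k).obj T).mor₂)) fun f hf => ?_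
  obtain ⟨g, hg⟩ := Triangle.coyoneda_exact₂ _ (Triangle.shift_distinguished T hT k) f hf
  exact ⟨g, hg.symm⟩

lemma FinHom.left₂ {Y : C} (h₁ : FinHom K T.obj₁ Y) (h₃ : FinHom K T.obj₃ Y) :
    FinHom K T.obj₂ Y := fun k => by
  have := h₁ k
  have := h₃ k
  refine finite_of_exact (Linear.leftComp K _ T.mor₂) (Linear.leftComp K _ T.mor₁) fun f hf => ?_
  obtain ⟨g, hg⟩ := Triangle.yoneda_exact₂ _ hT f hf
  exact ⟨g, hg.symm⟩

lemma FinHom.right₁ {X : C} (h₂ : FinHom K X T.obj₂) (h₃ : FinHom K X T.obj₃) :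
    FinHom K X T.obj₁ :=
  FinHom.right₂ (inv_rot_of_distTriang _ hT) (h₃.target_shift (-1)) h₂

lemma FinHom.left₃ {Y : C} (h₁ : FinHom K T.obj₁ Y) (h₂ : FinHom K T.obj₂ Y) :
    FinHom K T.obj₃ Y :=
  FinHom.left₂ (rot_of_distTriang _ hT) h₂ (h₁.source_shift 1)

omit hT in
lemma exact_rightComp {T : Triangle C} (hT : T ∈ distTriang C) (X : C) :
    Function.Exact (Linear.rightComp K X T.mor₁) (Linear.rightComp K X T.mor₂) := fun f =>
  ⟨fun hf => (T.coyoneda_exact₂ hT f hf).imp fun _ h => h.symm, by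
    rintro ⟨g, rfl⟩
    simp [comp_distTriang_mor_zero₁₂ T hT]⟩

omit hT in
lemma exact_leftComp {T : Triangle C} (hT : T ∈ distTriang C) (Y : C) :
    Function.Exact (Linear.leftComp K Y T.mor₂) (Linear.leftComp K Y T.mor₁) := fun f =>
  ⟨fun hf => (T.yoneda_exact₂ hT f hf).imp fun _ h => h.symm, by
    rintro ⟨g, rfl⟩
    simp [comp_distTriang_mor_zero₁₂_assoc T hT]⟩

lemma euler_right {X : C} (h₁ : FinHom K X T.obj₁) (h₂ : FinHom K X T.obj₂)
    (h₃ : FinHom K X T.obj₃) (v₃ : HomZero X T.obj₃ (-2)) (v₁ : HomZero X T.obj₁ 1) :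
    euler K X T.obj₃ = euler K X T.obj₂ - euler K X T.obj₁ := by
  have := h₁.zero; have := h₂.zero; have := h₁ (-1); have := h₂ (-1); have := h₃ (-1)
  have t₁ := inv_rot_of_distTriang _ hT
  have t₂ := inv_rot_of_distTriang _ t₁
  have t₃ := inv_rot_of_distTriang _ t₂
  have t₄ := inv_rot_of_distTriang _ t₃
  refine finrank_six_term (Linear.rightComp K X T.invRotate.invRotate.invRotate.mor₁)
    (Linear.rightComp K X T.invRotate.invRotate.mor₁) (Linear.rightComp K X T.invRotate.mor₁)
    (Linear.rightComp K X T.mor₁) (Linear.rightComp K X T.mor₂) ?_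
    (exact_rightComp t₃ X) (exact_rightComp t₂ X) (exact_rightComp t₁ X) (exact_rightComp hT X) ?_
  · refine (injective_iff_map_eq_zero _).2 fun f hf => ?_
    obtain ⟨g, hg⟩ := Triangle.coyoneda_exact₂ _ t₄ f hf
    rw [hg, show g = 0 from v₃.target_shift (-1) (by norm_num) g]; exact zero_comp
  · intro f
    obtain ⟨g, hg⟩ := Triangle.coyoneda_exact₃ _ hT f (v₁ _)
    exact ⟨g, hg.symm⟩

lemma exists_extend {Y : C} (f : T.obj₁ ⟶ Y) (h : T.mor₃ ≫ f⟦(1 : ℤ)⟧' = 0) :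
    ∃ g : T.obj₂ ⟶ Y, f = T.mor₁ ≫ g := by
  have t₂ := rot_of_distTriang _ (rot_of_distTriang _ hT)
  obtain ⟨g, hg⟩ := Triangle.yoneda_exact₂ _ t₂ (f⟦(1 : ℤ)⟧') h
  obtain ⟨g', hg'⟩ : ∃ g' : T.obj₂ ⟶ Y, g'⟦(1 : ℤ)⟧' = g := (shiftFunctor C (1 : ℤ)).map_surjective g
  refine ⟨-g', (shiftFunctor C (1 : ℤ)).map_injective ?_⟩
  rw [hg, ← hg', Functor.map_comp, Functor.map_neg, Preadditive.comp_neg]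
  exact Preadditive.neg_comp _ _

lemma HomZero.extend {Y : C} (h : HomZero T.obj₃ Y 1) (f : T.obj₁ ⟶ Y) :
    ∃ g : T.obj₂ ⟶ Y, f = T.mor₁ ≫ g :=
  exists_extend hT f (h _)

omit hT in
lemma finrank_source_shift (X Y : C) :
    Module.finrank K (X⟦(1 : ℤ)⟧ ⟶ Y) = Module.finrank K (X ⟶ Y⟦(-1 : ℤ)⟧) :=
  (((homShiftZeroEquiv K (X⟦(1 : ℤ)⟧) Y).trans
    (shiftHomEquiv K X Y (show (-1 : ℤ) + 1 = 0 by norm_num)).symm)).finrank_eq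

lemma euler_left {Y : C} (h₁ : FinHom K T.obj₁ Y) (h₂ : FinHom K T.obj₂ Y)
    (h₃ : FinHom K T.obj₃ Y) (v₁ : HomZero T.obj₁ Y (-2)) (v₃ : HomZero T.obj₃ Y 1) :
    euler K T.obj₃ Y = euler K T.obj₂ Y - euler K T.obj₁ Y := by
  have : Module.Finite K (T.obj₂ ⟶ Y) := h₂.zero
  have : Module.Finite K (T.rotate.obj₂ ⟶ Y) := h₃.zero
  have : Module.Finite K (T.rotate.rotate.obj₂ ⟶ Y) := (h₁.source_shift 1).zero
  have : Module.Finite K (T.rotate.rotate.rotate.obj₂ ⟶ Y) := (h₂.source_shift 1).zero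
  have : Module.Finite K (T.rotate.rotate.rotate.obj₃ ⟶ Y) := (h₃.source_shift 1).zero
  have t₁ := rot_of_distTriang _ hT
  have t₂ := rot_of_distTriang _ t₁
  have t₃ := rot_of_distTriang _ t₂
  have t₄ := rot_of_distTriang _ t₃
  have key := finrank_six_term (Linear.leftComp K Y T.rotate.rotate.rotate.mor₂)
    (Linear.leftComp K Y T.rotate.rotate.mor₂) (Linear.leftComp K Y T.rotate.mor₂)
    (Linear.leftComp K Y T.mor₂) (Linear.leftComp K Y T.mor₁) ?_
    (exact_leftComp t₃ Y) (exact_leftComp t₂ Y) (exact_leftComp t₁ Y) (exact_leftComp hT Y) ?_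
  · have e₁ := finrank_source_shift (K := K) T.obj₁ Y
    have e₂ := finrank_source_shift (K := K) T.obj₂ Y
    have e₃ := finrank_source_shift (K := K) T.obj₃ Y
    simp only [euler]
    change (Module.finrank K (T.obj₁ ⟶ Y) : ℤ) - Module.finrank K (T.obj₁⟦(1 : ℤ)⟧ ⟶ Y)
      = (Module.finrank K (T.obj₂ ⟶ Y) - Module.finrank K (T.obj₂⟦(1 : ℤ)⟧ ⟶ Y))
      - (Module.finrank K (T.obj₃ ⟶ Y) - Module.finrank K (T.obj₃⟦(1 : ℤ)⟧ ⟶ Y)) at key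
    rw [e₁, e₂, e₃] at key
    linarith
  · refine (injective_iff_map_eq_zero _).2 fun f hf => ?_
    obtain ⟨g, hg⟩ := Triangle.yoneda_exact₂ _ t₄ f hf
    have h4 : HomZero (T.obj₁⟦(1 : ℤ)⟧⟦(1 : ℤ)⟧) Y 0 :=
      (v₁.shift 1 (l := -1) (by norm_num)).shift 1 (by norm_num)
    rw [hg, h4.zero g]; exact comp_zero
  · intro f
    obtain ⟨g, hg⟩ := HomZero.extend hT v₃ f
    exact ⟨g, hg.symm⟩

end Dimensions

/-! ### Tilting families and minimal approximations -/

section Approximation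

variable (K : Type w) [Field K] {C : Type u} [Category.{v} C] [Preadditive C] [Linear K C]
  [HasZeroObject C] [HasShift C ℤ] [∀ n : ℤ, (shiftFunctor C n).Additive]
  [∀ n : ℤ, (shiftFunctor C n).Linear K] [Pretriangulated C]

/-- The products of `N` elements of `R`. -/
inductive RadPow {n : ℕ} {Q : Fin n → C} (R : ∀ a b, (Q a ⟶ Q b) → Prop) :
    ℕ → ∀ a b, (Q a ⟶ Q b) → Prop
  | zero {a b : Fin n} (u : Q a ⟶ Q b) : RadPow R 0 a b u
  | succ {N : ℕ} {a b c : Fin n} (r : Q a ⟶ Q b) (u : Q b ⟶ Q c) :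
      R a b r → RadPow R N b c u → RadPow R (N + 1) a c (r ≫ u)

/-- A family of objects without selfextensions whose morphism spaces are finite dimensional and
carry a nilpotent radical with local endomorphism rings. -/
structure TiltingFamily {n : ℕ} (Q : Fin n → C) where
  /-- membership in the radical -/
  rad : ∀ a b, (Q a ⟶ Q b) → Prop
  rad_or_isIso : ∀ a b u, rad a b u ∨ IsIso u
  /-- a bound for the nilpotency degree of the radical -/
  nilp : ℕ
  rad_nil : ∀ a b u, RadPow rad nilp a b u → u = 0
  vanish : ∀ a b (k : ℤ), k ≠ 0 → HomZero (Q a) (Q b) k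
  finite : ∀ a b, Module.Finite K (Q a ⟶ Q b)
  not_isZero : ∀ a, ¬ IsZero (Q a)

variable {K} {n : ℕ} {Q : Fin n → C}

lemma shift_coyoneda_exact₂ {T : Triangle C} (hT : T ∈ distTriang C) {X : C} (l : ℤ)
    (f : X ⟶ T.obj₂⟦l⟧) (h : f ≫ T.mor₂⟦l⟧' = 0) : ∃ g : X ⟶ T.obj₁⟦l⟧, f = g ≫ T.mor₁⟦l⟧' := by
  obtain ⟨g, hg⟩ := Triangle.coyoneda_exact₂ _ (Triangle.shift_distinguished T hT l) f
    (show f ≫ (l.negOnePow • T.mor₂⟦l⟧') = 0 by rw [Linear.comp_units_smul, h, smul_zero])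
  refine ⟨l.negOnePow • (show X ⟶ T.obj₁⟦l⟧ from g), ?_⟩
  rw [Linear.units_smul_comp, ← Linear.comp_units_smul]
  exact hg

lemma shift_coyoneda_exact₃ {T : Triangle C} (hT : T ∈ distTriang C) {X : C} (l : ℤ)
    (f : X ⟶ T.obj₃⟦l⟧) (h : HomZero X T.obj₁ (l + 1)) :
    ∃ g : X ⟶ T.obj₂⟦l⟧, f = g ≫ T.mor₂⟦l⟧' := by
  obtain ⟨g, hg⟩ := Triangle.coyoneda_exact₃ _ (Triangle.shift_distinguished T hT l) f
    ((h.target_shift l rfl) _)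
  refine ⟨l.negOnePow • (show X ⟶ T.obj₂⟦l⟧ from g), ?_⟩
  rw [Linear.units_smul_comp, ← Linear.comp_units_smul]
  exact hg

/-- `Hom(Q, Z[k]) = 0` for `k > 0`. -/
def Ge (Q : Fin n → C) (Z : C) : Prop := ∀ a, ∀ k : ℤ, 0 < k → HomZero (Q a) Z k

/-- The degrees of morphisms from `X` to objects `Z` with `Q ≥ Z` are bounded above. -/
def BoundedFrom (Q : Fin n → C) (X : C) : Prop :=
  ∃ N : ℤ, ∀ Z, Ge Q Z → ∀ k, N ≤ k → HomZero X Z k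

/-- A minimal right approximation of `Z` by the family `Q`. -/
structure MinApprox (D : TiltingFamily K Q) (Z : C) where
  /-- the number of summands -/
  m : ℕ
  /-- the labels of the summands -/
  c : Fin m → Fin n
  /-- the components of the approximation -/
  w : ∀ s, Q (c s) ⟶ Z
  gen : ∀ a (f : Q a ⟶ Z), ∃ u : ∀ s, Q a ⟶ Q (c s), f = ∑ s, u s ≫ w s
  rad : ∀ a (u : ∀ s, Q a ⟶ Q (c s)), ∑ s, u s ≫ w s = 0 → ∀ s, D.rad a (c s) (u s)

lemma exists_gen {Z : C} (h : ∀ a, Module.Finite K (Q a ⟶ Z)) :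
    ∃ (m : ℕ) (c : Fin m → Fin n) (w : ∀ s, Q (c s) ⟶ Z),
      ∀ a (f : Q a ⟶ Z), ∃ u : ∀ s, Q a ⟶ Q (c s), f = ∑ s, u s ≫ w s := by
  let ι := Σ a, Module.Free.ChooseBasisIndex K (Q a ⟶ Z)
  let e := Fintype.equivFin ι
  refine ⟨Fintype.card ι, fun s => (e.symm s).1,
    fun s => Module.Free.chooseBasis K (Q (e.symm s).1 ⟶ Z) (e.symm s).2, fun a f => ?_⟩
  let b := Module.Free.chooseBasis K (Q a ⟶ Z)
  let u : ∀ i : ι, Q a ⟶ Q i.1 := fun i =>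
    if h : i.1 = a then b.repr f (h ▸ i.2) • eqToHom (by rw [h]) else 0
  refine ⟨fun s => u (e.symm s), ?_⟩
  rw [Equiv.sum_comp e.symm (fun i : ι => u i ≫ Module.Free.chooseBasis K (Q i.1 ⟶ Z) i.2),
    Fintype.sum_sigma, Finset.sum_eq_single a]
  · conv_lhs => rw [← b.sum_repr f]
    refine Finset.sum_congr rfl fun i _ => ?_
    simp [u, b]
  · intro c _ hc
    refine Finset.sum_eq_zero fun i _ => ?_
    simp [u, hc]
  · simp

lemma exists_minApprox (D : TiltingFamily K Q) {Z : C} (h : ∀ a, Module.Finite K (Q a ⟶ Z)) :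
    Nonempty (MinApprox D Z) := by
  classical
  have hex := exists_gen (K := K) (Q := Q) h
  obtain ⟨c, w, hg⟩ := Nat.find_spec hex
  refine ⟨⟨Nat.find hex, c, w, hg, fun a u hu s => ?_⟩⟩
  refine (D.rad_or_isIso _ _ (u s)).resolve_right fun hs => ?_
  obtain ⟨m, hm⟩ : ∃ m, Nat.find hex = m + 1 :=
    Nat.exists_eq_succ_of_ne_zero (by rintro h0; exact Fin.elim0 (Fin.cast h0 s))
  have hlt : m < Nat.find hex := by omega
  refine Nat.find_min hex hlt ?_
  clear hlt
  revert c w hg u s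
  rw [hm]
  intro c w hg u hu s hs
  refine ⟨fun j => c (s.succAbove j), fun j => w (s.succAbove j), fun b f => ?_⟩
  obtain ⟨x, rfl⟩ := hg b f
  refine ⟨fun j => x (s.succAbove j) - x s ≫ inv (u s) ≫ u (s.succAbove j), ?_⟩
  have hws : w s = - ∑ j, inv (u s) ≫ u (s.succAbove j) ≫ w (s.succAbove j) := by
    rw [Fin.sum_univ_succAbove _ s] at hu
    rw [← Preadditive.comp_sum, ← cancel_epi (u s), Preadditive.comp_neg, IsIso.hom_inv_id_assoc]
    exact eq_neg_of_add_eq_zero_left hu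
  rw [Fin.sum_univ_succAbove _ s, hws, Preadditive.comp_neg, Preadditive.comp_sum,
    neg_add_eq_sub, ← Finset.sum_sub_distrib]
  refine Finset.sum_congr rfl fun j _ => ?_
  simp [Preadditive.sub_comp]

/-- The source of a minimal approximation. -/
abbrev MinApprox.obj {D : TiltingFamily K Q} {Z : C} (A : MinApprox D Z) : C :=
  ⨁ fun s => Q (A.c s)

/-- A minimal approximation as a morphism. -/
abbrev MinApprox.map {D : TiltingFamily K Q} {Z : C} (A : MinApprox D Z) : A.obj ⟶ Z :=
  biproduct.desc A.w

section

variable {D : TiltingFamily K Q} {Z : C} (A : MinApprox D Z)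

lemma MinApprox.lift (a : Fin n) (f : Q a ⟶ Z) : ∃ g : Q a ⟶ A.obj, f = g ≫ A.map := by
  obtain ⟨u, rfl⟩ := A.gen a f
  exact ⟨biproduct.lift u, by simp [biproduct.lift_desc]⟩

lemma MinApprox.rad_of_comp_eq_zero {a : Fin n} (g : Q a ⟶ A.obj) (h : g ≫ A.map = 0) (s : Fin A.m) :
    D.rad a (A.c s) (g ≫ biproduct.π _ s) := by
  refine A.rad a (fun s => g ≫ biproduct.π _ s) ?_ s
  rw [← h, MinApprox.map, biproduct.desc_eq, Preadditive.comp_sum]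
  simp

lemma TiltingFamily.finHom (D : TiltingFamily K Q) (a b : Fin n) : FinHom K (Q a) (Q b) :=
  FinHom.of_homZero (D.finite a b) (D.vanish a b)

lemma FinHom.biproduct_right {X : C} {J : Type} [Finite J] {F : J → C}
    (h : ∀ j, FinHom K X (F j)) : FinHom K X (⨁ F) := fun k => by
  have := Fintype.ofFinite J
  have := fun j => h j k
  let φ : (X ⟶ (⨁ F)⟦k⟧) →ₗ[K] ∀ j, X ⟶ (F j)⟦k⟧ :=
    LinearMap.pi fun j => Linear.rightComp K X ((biproduct.π F j)⟦k⟧')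
  refine Module.Finite.of_injective φ ((injective_iff_map_eq_zero φ).2 fun f hf => ?_)
  have : f = ∑ j, f ≫ (biproduct.π F j)⟦k⟧' ≫ (biproduct.ι F j)⟦k⟧' := by
    conv_lhs => rw [← Category.comp_id f, ← CategoryTheory.Functor.map_id, ← biproduct.total,
      Functor.map_sum, Preadditive.comp_sum]
    simp only [Functor.map_comp]
  rw [this]
  refine Finset.sum_eq_zero fun j _ => ?_
  have hj : f ≫ (biproduct.π F j)⟦k⟧' = 0 := congrFun hf j
  rw [← Category.assoc, hj, zero_comp]

lemma FinHom.biproduct_left {Y : C} {J : Type} [Finite J] {F : J → C}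
    (h : ∀ j, FinHom K (F j) Y) : FinHom K (⨁ F) Y := fun k => by
  have := fun j => h j k
  let φ : (⨁ F ⟶ Y⟦k⟧) →ₗ[K] ∀ j, F j ⟶ Y⟦k⟧ :=
    LinearMap.pi fun j => Linear.leftComp K _ (biproduct.ι F j)
  exact Module.Finite.of_injective φ ((injective_iff_map_eq_zero φ).2 fun f hf =>
    biproduct.hom_ext' _ _ fun j => by
      have hj : biproduct.ι F j ≫ f = 0 := congrFun hf j
      rw [hj, comp_zero])

/-- The cocone of a minimal approximation is again bounded above by `Q`. -/
lemma MinApprox.exists_triangle (hZ : Ge Q Z) (hf : ∀ a, FinHom K (Q a) Z) :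
    ∃ (Z' : C) (f : Z' ⟶ A.obj) (h : Z ⟶ Z'⟦(1 : ℤ)⟧),
      Triangle.mk f A.map h ∈ distTriang C ∧ Ge Q Z' ∧ ∀ a, FinHom K (Q a) Z' := by
  obtain ⟨Z', f, h, hT⟩ := distinguished_cocone_triangle₁ A.map
  refine ⟨Z', f, h, hT, fun a k hk => ?_, fun a => FinHom.right₁ hT
    (FinHom.biproduct_right fun s => D.finHom _ _) (hf a)⟩
  have h₂ : ∀ k : ℤ, 0 < k → HomZero (Q a) A.obj k := fun k hk =>
    HomZero.biproduct_right fun s => D.vanish _ _ k hk.ne'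
  obtain rfl | hk1 : k = 1 ∨ 1 < k := by omega
  · exact HomZero.right₁_of_lift hT (A.lift a) (h₂ 1 one_pos)
  · exact HomZero.right₁ hT (k := k - 1) (by ring) (hZ a _ (by omega)) (h₂ k hk)

lemma homZero_of_homZero_family (D : TiltingFamily K Q) {X : C} (hb : BoundedFrom Q X) {l : ℤ}
    (hX : ∀ a, ∀ k : ℤ, l < k → HomZero X (Q a) k) {Z : C} (hZ : Ge Q Z)
    (hf : ∀ a, FinHom K (Q a) Z) {k : ℤ} (hk : l < k) : HomZero X Z k := by
  obtain ⟨N, hN⟩ := hb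
  suffices H : ∀ (d : ℕ) (Z : C), Ge Q Z → (∀ a, FinHom K (Q a) Z) → ∀ k : ℤ, l < k → N - d ≤ k →
      HomZero X Z k from H (N - k).toNat Z hZ hf k hk (by have := Int.self_le_toNat (N - k); omega)
  intro d
  induction d with
  | zero => exact fun Z hZ _ k _ h => hN Z hZ k (by simpa using h)
  | succ d ih =>
    intro Z hZ hf k hk h
    obtain ⟨A⟩ := exists_minApprox D (Z := Z) (fun a => (hf a).zero)
    obtain ⟨Z', f, g, hT, hZ', hf'⟩ := A.exists_triangle hZ hf
    exact HomZero.right₃ hT rfl (HomZero.biproduct_right fun s => hX _ k hk)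
      (ih Z' hZ' hf' (k + 1) (by omega) (by push_cast at h; omega))

/-- A family of morphisms each of which is a combination of the others with radical
coefficients vanishes. -/
lemma eq_zero_of_rad_combination (D : TiltingFamily K Q) (F : C ⥤ C) [F.Additive] {X : C}
    (S : ∀ a, (X ⟶ F.obj (Q a)) → Prop)
    (hS : ∀ a g, S a g → ∃ (m : ℕ) (c : Fin m → Fin n) (g' : ∀ s, X ⟶ F.obj (Q (c s)))
      (r : ∀ s, Q (c s) ⟶ Q a), g = ∑ s, g' s ≫ F.map (r s) ∧
        ∀ s, S (c s) (g' s) ∧ D.rad _ _ (r s)) {a : Fin n} {g : X ⟶ F.obj (Q a)} (hg : S a g) :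
    g = 0 := by
  have key : ∀ N, g ∈ AddSubgroup.closure {x : X ⟶ F.obj (Q a) |
      ∃ (b : Fin n) (g' : X ⟶ F.obj (Q b)) (u : Q b ⟶ Q a), S b g' ∧ RadPow D.rad N b a u ∧
        x = g' ≫ F.map u} := by
    intro N
    induction N with
    | zero => exact AddSubgroup.subset_closure ⟨a, g, 𝟙 _, hg, .zero _, by simp⟩
    | succ N ih =>
      refine (AddSubgroup.closure_le _).2 ?_ ih
      rintro x ⟨b, g', u, hg', hu, rfl⟩
      obtain ⟨m, c, g'', r, rfl, h⟩ := hS b g' hg'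
      rw [Preadditive.sum_comp]
      refine AddSubgroup.sum_mem _ fun s _ => AddSubgroup.subset_closure
        ⟨c s, g'' s, r s ≫ u, (h s).1, .succ _ _ (h s).2 hu, by simp⟩
  have : ∀ x ∈ AddSubgroup.closure {x : X ⟶ F.obj (Q a) |
      ∃ (b : Fin n) (g' : X ⟶ F.obj (Q b)) (u : Q b ⟶ Q a), S b g' ∧ RadPow D.rad D.nilp b a u ∧
        x = g' ≫ F.map u}, x = 0 := by
    intro x hx
    refine (AddSubgroup.closure_le (⊥ : AddSubgroup _)).2 ?_ hx
    rintro _ ⟨b, g', u, -, hu, rfl⟩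
    simp [D.rad_nil _ _ u hu]
  exact this g (key _)

/-- If every summand of `Q` occurs in a minimal approximation of an object `Y` with
`Hom(X, Y[l]) = 0`, then `Hom(X, Q[l]) = 0`. -/
lemma homZero_family_of_occurs (D : TiltingFamily K Q) {X : C} (hb : BoundedFrom Q X) {l : ℤ}
    (hX : ∀ a, ∀ k : ℤ, l < k → HomZero X (Q a) k)
    (h : ∀ a, ∃ Y, Ge Q Y ∧ (∀ a, FinHom K (Q a) Y) ∧ HomZero X Y l ∧
      ∃ A : MinApprox D Y, ∃ s, A.c s = a) (a : Fin n) : HomZero X (Q a) l := by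
  refine fun g => eq_zero_of_rad_combination D (shiftFunctor C l) (fun _ _ => True) ?_ trivial
  clear g a
  intro a g _
  obtain ⟨Y, hY, hf, hXY, A, s, rfl⟩ := h a
  obtain ⟨Y', i, j, hT, hY', hf'⟩ := A.exists_triangle hY hf
  obtain ⟨A'⟩ := exists_minApprox D (Z := Y') (fun a => (hf' a).zero)
  obtain ⟨Y'', i', j', hT', hY'', hf''⟩ := A'.exists_triangle hY' hf'
  obtain ⟨p, hp⟩ : ∃ p : X ⟶ Y'⟦l⟧, g ≫ (biproduct.ι (fun s => Q (A.c s)) s)⟦l⟧' =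
      p ≫ i⟦l⟧' := shift_coyoneda_exact₂ hT _ _ (hXY _)
  obtain ⟨q, hq⟩ : ∃ q : X ⟶ A'.obj⟦l⟧, p = q ≫ (A'.map)⟦l⟧' :=
    shift_coyoneda_exact₃ hT' _ _
      (homZero_of_homZero_family D hb hX hY'' hf'' (lt_add_one l))
  refine ⟨A'.m, A'.c, fun t => q ≫ (biproduct.π _ t)⟦l⟧', fun t => A'.w t ≫ i ≫ biproduct.π _ s,
    ?_, fun t => ⟨trivial, ?_⟩⟩
  · have : g = (g ≫ (biproduct.ι (fun s => Q (A.c s)) s)⟦l⟧') ≫ (biproduct.π _ s)⟦l⟧' := by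
      rw [Category.assoc, ← Functor.map_comp, biproduct.ι_π_self]; simp
    rw [this, hp, hq, MinApprox.map, biproduct.desc_eq, Functor.map_sum, Preadditive.comp_sum,
      Preadditive.sum_comp, Preadditive.sum_comp]
    simp
  · beta_reduce
    rw [← Category.assoc]
    refine A.rad_of_comp_eq_zero _ ?_ s
    rw [Category.assoc, show i ≫ A.map = 0 from comp_distTriang_mor_zero₁₂ _ hT, comp_zero]

/-- An object `Z` with `Q ≥ Z ≥ Q` is a direct sum of members of `Q`. -/
lemma MinApprox.isIso_map (hb : BoundedFrom Q Z) (hZ : Ge Q Z) (hf : ∀ a, FinHom K (Q a) Z)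
    (hX : ∀ a, ∀ k : ℤ, 0 < k → HomZero Z (Q a) k) : IsIso A.map := by
  obtain ⟨Z', i, j, hT, hZ', hf'⟩ := A.exists_triangle hZ hf
  obtain ⟨σ, hσ⟩ : ∃ σ : Z ⟶ A.obj, 𝟙 Z = σ ≫ A.map :=
    Triangle.coyoneda_exact₃ _ hT (𝟙 Z) (homZero_of_homZero_family D hb hX hZ' hf' one_pos _)
  let ε : A.obj ⟶ A.obj := 𝟙 _ - A.map ≫ σ
  have h0 : ε ≫ A.map = 0 := by simp [ε, Preadditive.sub_comp, ← hσ]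
  have hε : ε ≫ ε = ε := by
    rw [show ε ≫ ε = ε ≫ (𝟙 _ - A.map ≫ σ) from rfl, Preadditive.comp_sub, reassoc_of% h0]
    simp
  have : ε = 0 := by
    refine biproduct.hom_ext _ _ fun s => ?_
    rw [zero_comp]
    refine eq_zero_of_rad_combination D (𝟭 C) (fun a g => ∃ s, ∃ h : A.c s = a,
      g = (ε ≫ biproduct.π _ s) ≫ eqToHom (by rw [h]; rfl)) ?_ ⟨s, rfl, by simp⟩
    rintro a g ⟨s, rfl, rfl⟩
    refine ⟨A.m, A.c, fun t => ε ≫ biproduct.π _ t, fun t => biproduct.ι (fun s => Q (A.c s)) t ≫ ε ≫ biproduct.π _ s,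
      ?_, fun t => ⟨⟨t, rfl, by simp⟩, ?_⟩⟩
    · have : ε ≫ biproduct.π _ s = ε ≫ 𝟙 A.obj ≫ ε ≫ biproduct.π _ s := by
        rw [Category.id_comp, reassoc_of% hε]
      refine (Category.comp_id _).trans (this.trans ?_)
      rw [← biproduct.total, Preadditive.sum_comp, Preadditive.comp_sum]
      simp
    · beta_reduce
      rw [← Category.assoc]
      exact A.rad_of_comp_eq_zero _ (by rw [Category.assoc, h0, comp_zero]) s
  exact ⟨σ, (sub_eq_zero.1 this).symm, hσ.symm⟩

lemma MinApprox.c_injective_of_isBasicObj (hi : IsIso A.map) (hb : IsBasicObj Z) :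
    Function.Injective A.c := by
  intro s t hst
  by_contra hne
  refine D.not_isZero (A.c s) (hb _ (biproduct.ι (fun s => Q (A.c s)) s ≫ A.map)
    (eqToHom (by rw [hst]) ≫ biproduct.ι (fun s => Q (A.c s)) t ≫ A.map)
    (inv A.map ≫ biproduct.π _ s)
    (inv A.map ≫ biproduct.π (fun s => Q (A.c s)) t ≫ eqToHom (by rw [hst])) ?_ ?_ ?_ ?_)
  · rw [Category.assoc, IsIso.hom_inv_id_assoc, biproduct.ι_π_self]
  · rw [Category.assoc, Category.assoc, IsIso.hom_inv_id_assoc, biproduct.ι_π_self_assoc]; simp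
  · rw [Category.assoc, IsIso.hom_inv_id_assoc, biproduct.ι_π_ne_assoc _ hne, zero_comp]
  · rw [Category.assoc, Category.assoc, IsIso.hom_inv_id_assoc,
      biproduct.ι_π_ne _ (Ne.symm hne), comp_zero]

end

end Approximation

/-! ### Reduction along mutations -/

/-- Up to isomorphism only finitely many objects satisfy `P`. -/
def FinIso {C : Type u} [Category.{v} C] (P : C → Prop) : Prop :=
  ∃ (k : ℕ) (f : Fin k → C), ∀ X, P X → ∃ i, Nonempty (X ≅ f i)

lemma FinIso.of_finite {C : Type u} [Category.{v} C] {P : C → Prop} {ι : Type*} [Finite ι]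
    (f : ι → C) (h : ∀ X, P X → ∃ i, Nonempty (X ≅ f i)) : FinIso P := by
  obtain ⟨k, ⟨e⟩⟩ := Finite.exists_equiv_fin ι
  refine ⟨k, f ∘ e.symm, fun X hX => ?_⟩
  obtain ⟨i, hi⟩ := h X hX
  exact ⟨e i, by simpa using hi⟩

lemma FinIso.iUnion {C : Type u} [Category.{v} C] {ι : Type*} [Finite ι] {P : ι → C → Prop}
    (h : ∀ i, FinIso (P i)) : FinIso fun X => ∃ i, P i X := by
  choose k f hf using h
  refine FinIso.of_finite (fun x : Σ i, Fin (k i) => f x.1 x.2) fun X ⟨i, hi⟩ => ?_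
  obtain ⟨j, hj⟩ := hf i X hi
  exact ⟨⟨i, j⟩, hj⟩

lemma FinIso.or {C : Type u} [Category.{v} C] {P P' : C → Prop}
    (h : FinIso P) (h' : FinIso P') : FinIso fun X => P X ∨ P' X := by
  obtain ⟨k, f, hf⟩ := h
  obtain ⟨k', f', hf'⟩ := h'
  refine FinIso.of_finite (Sum.elim f f') fun X hX => ?_
  rcases hX with hX | hX
  · obtain ⟨j, hj⟩ := hf X hX
    exact ⟨Sum.inl j, hj⟩
  · obtain ⟨j, hj⟩ := hf' X hX
    exact ⟨Sum.inr j, hj⟩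

lemma FinIso.mono {C : Type u} [Category.{v} C] {P P' : C → Prop}
    (h : FinIso P) (hP : ∀ X, P' X → P X) : FinIso P' := by
  obtain ⟨k, f, hf⟩ := h
  exact ⟨k, f, fun X hX => hf X (hP X hX)⟩

/-- The combinatorial data of mutations of families with `n` members: Cartan matrices, targets of
mutations, approximations and the action on coordinate vectors. -/
structure MutSystem (n : ℕ) (S : Type) where
  /-- the Cartan matrix -/
  cart : S → Fin n → Fin n → ℕ
  /-- the target of a mutation -/
  nxt : S → Fin n → S
  /-- sources of the maps defining the mutated objects -/
  src : S → Fin n → Fin n → List (Fin n)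
  /-- targets of the maps defining the mutated objects -/
  tgt : S → Fin n → Fin n → List (Fin n)
  /-- the action on coordinates -/
  act : S → Fin n → (Fin n → ℤ) → Fin n → ℤ

/-- Mutating at vertices with non-positive coordinate stops after at most `N` steps. -/
def MutSystem.Stops {n : ℕ} {S : Type} (M : MutSystem n S) : ℕ → S → (Fin n → ℤ) → Prop
  | 0, _, v => ∀ i, 0 < v i
  | N + 1, s, v => ∀ i, v i ≤ 0 → M.Stops N (M.nxt s i) (M.act s i v)

section Mutation

variable {K : Type w} [Field K] {C : Type u} [Category.{v} C] [Preadditive C] [Linear K C]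
  [HasZeroObject C] [HasShift C ℤ] [∀ n : ℤ, (shiftFunctor C n).Additive]
  [∀ n : ℤ, (shiftFunctor C n).Linear K] [Pretriangulated C] {n : ℕ} {Q Q' : Fin n → C}

lemma HomZero.of_iso_left {X X' Y : C} (e : X ≅ X') {k : ℤ} (h : HomZero X Y k) :
    HomZero X' Y k := fun f => by
  rw [← cancel_epi e.hom, h (e.hom ≫ f), comp_zero]

lemma HomZero.of_iso_right {X Y Y' : C} (e : Y ≅ Y') {k : ℤ} (h : HomZero X Y k) :
    HomZero X Y' k := fun f => by
  rw [← cancel_mono (e.inv⟦k⟧'), zero_comp]; exact h _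

lemma HomZero.of_biproduct_left {J : Type} [Finite J] {F : J → C} {Y : C} {k : ℤ}
    (h : HomZero (⨁ F) Y k) (j : J) : HomZero (F j) Y k := fun f => by
  classical
  have := Fintype.ofFinite J
  rw [← Category.id_comp f, ← biproduct.ι_π_self F j, Category.assoc, h (biproduct.π F j ≫ f),
    comp_zero]

/-- The direct sum of the members of `Q` labelled by a list. -/
abbrev listSum (Q : Fin n → C) (l : List (Fin n)) : C := ⨁ fun s : Fin l.length => Q (l.get s)

/-- `Q'` is obtained from `Q` by replacing `Q i` by cones of maps `Q i ⟶ P`. -/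
structure IsMutation (Q Q' : Fin n → C) (i : Fin n) (a b : Fin n → List (Fin n)) : Prop where
  tri : ∀ x, ∃ (f : listSum Q (a x) ⟶ listSum Q (b x)) (g : listSum Q (b x) ⟶ Q' x)
    (h : Q' x ⟶ (listSum Q (a x))⟦(1 : ℤ)⟧), Triangle.mk f g h ∈ distTriang C
  src : ∀ x, ∀ c ∈ a x, c = i
  tgt : ∀ x, ∀ c ∈ b x, c ≠ i
  old : ∀ c, c ≠ i → ∃ y, Nonempty (Q' y ≅ Q c)
  new : ∃ x, a x = [i]

namespace IsMutation

variable {i : Fin n} {a b : Fin n → List (Fin n)} (m : IsMutation Q Q' i a b)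
include m

lemma ge_of_ge {Z : C} (h : Ge Q' Z) : Ge Q Z := by
  have hc : ∀ c, c ≠ i → ∀ k : ℤ, 0 < k → HomZero (Q c) Z k := fun c hc k hk => by
    obtain ⟨y, ⟨e⟩⟩ := m.old c hc
    exact (h y k hk).of_iso_left e
  intro c k hk
  by_cases hci : c = i
  · subst hci
    obtain ⟨x, hx⟩ := m.new
    obtain ⟨f, g, j, hT⟩ := m.tri x
    have h₁ : HomZero (listSum Q (a x)) Z k := HomZero.left₁ hT rfl
      (HomZero.biproduct_left fun s => hc _ (m.tgt x _ (List.get_mem _ _)) k hk)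
      (h x (k + 1) (by omega))
    rw [hx] at h₁
    exact h₁.of_biproduct_left (⟨0, by simp⟩ : Fin [c].length)
  · exact hc c hci k hk

lemma boundedFrom {X : C} (h : BoundedFrom Q X) : BoundedFrom Q' X := by
  obtain ⟨N, hN⟩ := h
  exact ⟨N, fun Z hZ => hN Z (m.ge_of_ge hZ)⟩

lemma homZero_left {Z : C} {k l : ℤ} (hl : k + 1 = l) (h : ∀ a, HomZero (Q a) Z k)
    (h' : ∀ a, HomZero (Q a) Z l) (x : Fin n) : HomZero (Q' x) Z l := by
  obtain ⟨f, g, j, hT⟩ := m.tri x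
  exact HomZero.left₃ hT hl (HomZero.biproduct_left fun s => h' _)
    (HomZero.biproduct_left fun s => h _)

lemma homZero_right {X : C} {k l : ℤ} (hl : k + 1 = l) (h : ∀ a, HomZero X (Q a) k)
    (h' : ∀ a, HomZero X (Q a) l) (x : Fin n) : HomZero X (Q' x) k := by
  obtain ⟨f, g, j, hT⟩ := m.tri x
  exact HomZero.right₃ hT hl (HomZero.biproduct_right fun s => h _)
    (HomZero.biproduct_right fun s => h' _)

lemma finHom {Z : C} (h : ∀ a, FinHom K (Q a) Z) (x : Fin n) : FinHom K (Q' x) Z := by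
  obtain ⟨f, g, j, hT⟩ := m.tri x
  exact FinHom.left₃ hT (FinHom.biproduct_left fun s => h _) (FinHom.biproduct_left fun s => h _)

lemma ge (D : TiltingFamily K Q) (D' : TiltingFamily K Q') {Z : C} (hZ : Ge Q Z)
    (A : MinApprox D Z) (hA : ∀ s, A.c s ≠ i) : Ge Q' Z := by
  intro x k hk
  obtain rfl | hk1 : k = 1 ∨ 1 < k := by omega
  · obtain ⟨f, g, j, hT⟩ := m.tri x
    refine HomZero.left₃_of_extend hT (fun p => ?_)
      (HomZero.biproduct_left fun s => hZ _ 1 one_pos)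
    change listSum Q (a x) ⟶ Z at p
    choose q hq using fun s : Fin (a x).length => A.lift _
      (biproduct.ι (fun s : Fin (a x).length => Q ((a x).get s)) s ≫ p)
    have hp : p = biproduct.desc q ≫ A.map :=
      biproduct.hom_ext' _ _ fun s => by rw [biproduct.ι_desc_assoc, hq]
    have h0 : HomZero (Q' x) A.obj 1 := HomZero.biproduct_right fun s => by
      obtain ⟨y, ⟨e⟩⟩ := m.old _ (hA s)
      exact (D'.vanish x y 1 one_ne_zero).of_iso_right e
    obtain ⟨r, hr⟩ := HomZero.extend hT h0 (biproduct.desc q)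
    exact ⟨r ≫ A.map, by rw [hp, hr]; exact Category.assoc _ _ _⟩
  · exact m.homZero_left (k := k - 1) (by ring) (fun a => hZ a _ (by omega)) (fun a => hZ a _ hk) x

end IsMutation

/-- `Q ≥ T ≥ Q[l]`, with finiteness conditions. -/
structure Below (K : Type w) [Field K] [Linear K C] (Q : Fin n → C) (l : ℤ) (T : C) : Prop where
  ge : Ge Q T
  fin : ∀ a, FinHom K (Q a) T
  le : ∀ a, ∀ k : ℤ, l < k → HomZero T (Q a) k
  bdd : BoundedFrom Q T

lemma Below.mutation {l : ℤ} {T : C} (h : Below K Q l T) {i : Fin n} {a b : Fin n → List (Fin n)}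
    (m : IsMutation Q Q' i a b) (D : TiltingFamily K Q) (D' : TiltingFamily K Q')
    (A : MinApprox D T) (hA : ∀ s, A.c s ≠ i) : Below K Q' l T where
  ge := m.ge D D' h.ge A hA
  fin := m.finHom h.fin
  le x k hk := m.homZero_right rfl (fun a => h.le a k hk) (fun a => h.le a _ (by omega)) x
  bdd := m.boundedFrom h.bdd

lemma euler_eq_finrank (D : TiltingFamily K Q) (a b : Fin n) :
    euler K (Q a) (Q b) = Module.finrank K (Q a ⟶ Q b) := by
  have : Subsingleton (Q a ⟶ (Q b)⟦(-1 : ℤ)⟧) :=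
    ⟨fun f g => by rw [D.vanish a b _ (by norm_num) f, D.vanish a b _ (by norm_num) g]⟩
  simp [euler, Module.finrank_zero_of_subsingleton]

lemma euler_biproduct_right {X : C} {J : Type} [Fintype J] {F : J → C}
    (h : ∀ j, FinHom K X (F j)) : euler K X (⨁ F) = ∑ j, euler K X (F j) := by
  have := fun j => (h j).zero
  have := fun j => h j (-1)
  let φ₀ : (X ⟶ ⨁ F) ≃ₗ[K] ∀ j, X ⟶ F j :=
    LinearEquiv.ofBijective (LinearMap.pi fun j => Linear.rightComp K X (biproduct.π F j))
      ⟨fun f g hfg => biproduct.hom_ext _ _ fun j => congrFun hfg j,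
        fun f => ⟨biproduct.lift f, funext fun j => biproduct.lift_π f j⟩⟩
  let φ₁ : (X ⟶ (⨁ F)⟦(-1 : ℤ)⟧) ≃ₗ[K] ∀ j, X ⟶ (F j)⟦(-1 : ℤ)⟧ :=
    LinearEquiv.ofBijective
      (LinearMap.pi fun j => Linear.rightComp K X ((biproduct.π F j)⟦(-1 : ℤ)⟧'))
      ⟨(injective_iff_map_eq_zero _).2 fun f hf => by
        have : f = ∑ j, f ≫ (biproduct.π F j)⟦(-1 : ℤ)⟧' ≫ (biproduct.ι F j)⟦(-1 : ℤ)⟧' := by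
          conv_lhs => rw [← Category.comp_id f, ← CategoryTheory.Functor.map_id,
            ← biproduct.total, Functor.map_sum, Preadditive.comp_sum]
          simp only [Functor.map_comp]
        rw [this]
        refine Finset.sum_eq_zero fun j _ => ?_
        have hj : f ≫ (biproduct.π F j)⟦(-1 : ℤ)⟧' = 0 := congrFun hf j
        rw [← Category.assoc, hj, zero_comp],
      fun f => ⟨∑ j, f j ≫ (biproduct.ι F j)⟦(-1 : ℤ)⟧', funext fun j => by
        classical
        change (∑ j, f j ≫ (biproduct.ι F j)⟦(-1 : ℤ)⟧') ≫ (biproduct.π F j)⟦(-1 : ℤ)⟧' = f j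
        rw [Preadditive.sum_comp, Finset.sum_eq_single j]
        · rw [Category.assoc, ← Functor.map_comp, biproduct.ι_π_self]; simp
        · intro k _ hk
          rw [Category.assoc, ← Functor.map_comp, biproduct.ι_π_ne _ hk, Functor.map_zero,
            comp_zero]
        · simp⟩⟩
  rw [euler, φ₀.finrank_eq, φ₁.finrank_eq, Module.finrank_pi_fintype, Module.finrank_pi_fintype]
  simp [euler]

lemma euler_biproduct_left {Y : C} {J : Type} [Fintype J] {F : J → C}
    (h : ∀ j, FinHom K (F j) Y) : euler K (⨁ F) Y = ∑ j, euler K (F j) Y := by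
  have := fun j => (h j).zero
  have := fun j => h j (-1)
  have φ : ∀ Z, (⨁ F ⟶ Z) ≃ₗ[K] ∀ j, F j ⟶ Z := fun Z =>
    LinearEquiv.ofBijective (LinearMap.pi fun j => Linear.leftComp K Z (biproduct.ι F j))
      ⟨fun f g hfg => biproduct.hom_ext' _ _ fun j => congrFun hfg j,
        fun f => ⟨biproduct.desc f, funext fun j => biproduct.ι_desc f j⟩⟩
  rw [euler, (φ _).finrank_eq, (φ _).finrank_eq, Module.finrank_pi_fintype,
    Module.finrank_pi_fintype]
  simp [euler]

lemma euler_of_iso {X Y Y' : C} (e : Y ≅ Y') : euler K X Y = euler K X Y' := by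
  rw [euler, euler, ((Linear.homCongr K (Iso.refl X) e)).finrank_eq,
    ((Linear.homCongr K (Iso.refl X) ((shiftFunctor C (-1 : ℤ)).mapIso e))).finrank_eq]

/-- An object `Y` with `Q ≥ Y ≥ Q[1]` whose class has coordinates `v`. -/
structure IsTwoTerm (K : Type w) [Field K] [Linear K C] (Q : Fin n → C)
    (cart : Fin n → Fin n → ℕ) (v : Fin n → ℤ) (Y : C) : Prop where
  van : ∀ a, ∀ k : ℤ, k ≠ 0 → k ≠ -1 → HomZero (Q a) Y k
  fin : ∀ a, FinHom K (Q a) Y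
  le : ∀ a, ∀ k : ℤ, 1 < k → HomZero Y (Q a) k
  bdd : BoundedFrom Q Y
  class_eq : ∀ a, euler K (Q a) Y = ∑ b, (cart a b : ℤ) * v b

lemma IsTwoTerm.ge {cart : Fin n → Fin n → ℕ} {v : Fin n → ℤ} {Y : C}
    (h : IsTwoTerm K Q cart v Y) : Ge Q Y := fun a k hk => h.van a k (by omega) (by omega)

lemma isTwoTerm_shift (D : TiltingFamily K Q) {cart : Fin n → Fin n → ℕ}
    (hc : ∀ a b, Module.finrank K (Q a ⟶ Q b) = cart a b) :
    IsTwoTerm K Q cart (fun _ => -1) (⨁ fun a => (Q a)⟦(1 : ℤ)⟧) where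
  van a k _ h1 := HomZero.biproduct_right fun b =>
    (D.vanish a b (1 + k) (by omega)).target_shift 1 rfl
  fin a := FinHom.biproduct_right fun b => (D.finHom a b).target_shift 1
  le a k hk := HomZero.biproduct_left fun b =>
    (D.vanish b a (k - 1) (by omega)).shift 1 (by ring)
  bdd := ⟨2, fun Z hZ k hk => HomZero.biproduct_left fun b =>
    (hZ b (k - 1) (by omega)).shift 1 (by ring)⟩
  class_eq a := by
    rw [euler_biproduct_right fun b => (D.finHom a b).target_shift 1]
    refine Finset.sum_congr rfl fun b _ => ?_
    have : Subsingleton (Q a ⟶ (Q b)⟦(1 : ℤ)⟧) :=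
      ⟨fun f g => by rw [D.vanish a b _ (by norm_num) f, D.vanish a b _ (by norm_num) g]⟩
    rw [euler, Module.finrank_zero_of_subsingleton, ← hc,
      ← (homShiftAddEquiv K (Q a) (Q b) (show (1 : ℤ) + -1 = 0 by norm_num)).finrank_eq,
      ← (homShiftZeroEquiv K (Q a) (Q b)).finrank_eq]
    simp

lemma IsTwoTerm.mutation {cart cart' : Fin n → Fin n → ℕ} {v v' : Fin n → ℤ} {Y : C}
    (h : IsTwoTerm K Q cart v Y) {i : Fin n} {a b : Fin n → List (Fin n)}
    (m : IsMutation Q Q' i a b) (D : TiltingFamily K Q) (D' : TiltingFamily K Q')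
    (A : MinApprox D Y) (hA : ∀ s, A.c s ≠ i)
    (hv : ∀ x, ∑ y, (cart' x y : ℤ) * v' y =
      ((b x).map fun c => ∑ d, (cart c d : ℤ) * v d).sum -
      ((a x).map fun c => ∑ d, (cart c d : ℤ) * v d).sum) :
    IsTwoTerm K Q' cart' v' Y := by
  have hge := m.ge D D' h.ge A hA
  refine ⟨fun x k h0 h1 => ?_, m.finHom h.fin, fun x k hk =>
    m.homZero_right rfl (fun a => h.le a k hk) (fun a => h.le a _ (by omega)) x,
    m.boundedFrom h.bdd, fun x => ?_⟩
  · rcases lt_or_ge 0 k with hk | hk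
    · exact hge x k hk
    · exact m.homZero_left (k := k - 1) (by ring) (fun a => h.van a _ (by omega) (by omega))
        (fun a => h.van a _ h0 h1) x
  · obtain ⟨f, g, j, hT⟩ := m.tri x
    have e := euler_left (K := K) hT (Y := Y) (FinHom.biproduct_left fun s => h.fin _)
      (FinHom.biproduct_left fun s => h.fin _) (m.finHom h.fin x)
      (HomZero.biproduct_left fun s => h.van _ _ (by norm_num) (by norm_num)) (hge x 1 one_pos)
    refine e.trans ?_
    rw [hv]
    have hs : ∀ l : List (Fin n), euler K (listSum Q l) Y =
        (l.map fun c => ∑ d, (cart c d : ℤ) * v d).sum := fun l => by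
      rw [euler_biproduct_left fun s => h.fin _, ← Fin.sum_univ_fun_getElem]
      exact Finset.sum_congr rfl fun s _ => h.class_eq _
    exact congrArg₂ _ (hs _) (hs _)

lemma IsTwoTerm.nonpos_of_not_occurs {cart : Fin n → Fin n → ℕ} {v : Fin n → ℤ} {Y : C}
    (h : IsTwoTerm K Q cart v Y) (D : TiltingFamily K Q)
    (hc : ∀ a b, Module.finrank K (Q a ⟶ Q b) = cart a b)
    (hinj : ∀ v : Fin n → ℤ, (∀ a, ∑ b, (cart a b : ℤ) * v b = 0) → v = 0)
    (A : MinApprox D Y) {i : Fin n} (hA : ∀ s, A.c s ≠ i) : v i ≤ 0 := by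
  classical
  obtain ⟨Y', f, j, hT, hY', hf'⟩ := A.exists_triangle h.ge h.fin
  obtain ⟨A'⟩ := exists_minApprox D (Z := Y') (fun a => (hf' a).zero)
  have hb : BoundedFrom Q Y' := by
    obtain ⟨N, hN⟩ := h.bdd
    exact ⟨max 1 N, fun Z hZ k hk => HomZero.left₁ hT rfl
      (HomZero.biproduct_left fun s => hZ _ k (by have := le_max_left 1 N; omega))
      (hN Z hZ (k + 1) (by have := le_max_right 1 N; omega))⟩
  have hi := A'.isIso_map hb hY' hf' fun a k hk => HomZero.left₁ hT rfl
    (HomZero.biproduct_left fun s => D.vanish _ _ k hk.ne') (h.le a (k + 1) (by omega))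
  have hsum : ∀ (m : ℕ) (c : Fin m → Fin n) (a : Fin n), euler K (Q a) (⨁ fun s => Q (c s)) =
      ∑ b, (cart a b : ℤ) * (Finset.univ.filter fun s => c s = b).card := fun m c a => by
    rw [euler_biproduct_right fun s => D.finHom _ _]
    simp_rw [euler_eq_finrank D, hc]
    rw [← Finset.sum_fiberwise (s := Finset.univ) (g := c)]
    refine Finset.sum_congr rfl fun b _ => ?_
    rw [Finset.sum_congr rfl (g := fun _ => (cart a b : ℤ))
      (fun s hs => by rw [(Finset.mem_filter.1 hs).2])]
    simp [mul_comm]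
  have key : (fun b => v b - ((Finset.univ.filter fun s => A.c s = b).card -
      (Finset.univ.filter fun s => A'.c s = b).card : ℤ)) = 0 := by
    refine hinj _ fun a => ?_
    have e := euler_right (K := K) hT (X := Q a) (hf' a)
      (FinHom.biproduct_right fun s => D.finHom _ _) (h.fin a)
      (h.van a _ (by norm_num) (by norm_num)) (hY' a 1 one_pos)
    have e1 : euler K (Q a) Y = euler K (Q a) A.obj - euler K (Q a) Y' := e
    rw [h.class_eq, ← euler_of_iso (asIso A'.map), hsum, hsum] at e1
    simp only [mul_sub, Finset.sum_sub_distrib]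
    linarith
  have hv := congrFun key i
  have h0 : (Finset.univ.filter fun s => A.c s = i) = ∅ :=
    Finset.filter_eq_empty_iff.2 fun s _ => hA s
  simp only [h0, Finset.card_empty, Pi.zero_apply] at hv
  omega

/-- Finiteness of presilting objects between `Q` and `Q[l]`, for families closed under mutation
such that the mutations between `Q` and `Q[1]` stop. -/
theorem finIso_of_mutSystem {S : Type} (M : MutSystem n S) (Typ : S → (Fin n → C) → Prop)
    (hD : ∀ s Q, Typ s Q → Nonempty (TiltingFamily K Q))
    (hc : ∀ s Q, Typ s Q → ∀ a b, Module.finrank K (Q a ⟶ Q b) = M.cart s a b)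
    (hinj : ∀ s, ∀ v : Fin n → ℤ, (∀ a, ∑ b, (M.cart s a b : ℤ) * v b = 0) → v = 0)
    (hm : ∀ s Q, Typ s Q → ∀ i, ∃ Q', Typ (M.nxt s i) Q' ∧
      IsMutation Q Q' i (M.src s i) (M.tgt s i))
    (hact : ∀ s i v x, ∑ y, (M.cart (M.nxt s i) x y : ℤ) * M.act s i v y =
      ((M.tgt s i x).map fun c => ∑ d, (M.cart s c d : ℤ) * v d).sum -
      ((M.src s i x).map fun c => ∑ d, (M.cart s c d : ℤ) * v d).sum)
    (h_stops : ∀ s, ∃ N, M.Stops N s fun _ => -1) (l : ℕ) (s : S) (Q : Fin n → C) (hQ : Typ s Q) :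
    FinIso fun T : C => Below K Q l T ∧ IsPresiltingObj T ∧ IsBasicObj T := by
  induction l generalizing s Q with
  | zero =>
    obtain ⟨D⟩ := hD s Q hQ
    refine FinIso.of_finite (ι := Σ m : Fin (n + 1), (Fin m → Fin n))
      (fun x => ⨁ fun s => Q (x.2 s)) fun T ⟨hT, _, hb⟩ => ?_
    obtain ⟨A⟩ := exists_minApprox D (Z := T) (fun a => (hT.fin a).zero)
    have hi := A.isIso_map hT.bdd hT.ge hT.fin fun a k hk => hT.le a k (by simpa using hk)
    have hinj := A.c_injective_of_isBasicObj hi hb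
    have hm : A.m ≤ n := by simpa using Fintype.card_le_of_injective _ hinj
    exact ⟨⟨⟨A.m, by omega⟩, A.c⟩, ⟨(asIso A.map).symm⟩⟩
  | succ l ih =>
    suffices H : ∀ (N : ℕ) (s : S) (v : Fin n → ℤ) (Q : Fin n → C), Typ s Q → M.Stops N s v →
        ∀ Y : C, IsTwoTerm K Q (M.cart s) v Y → FinIso fun T : C => Below K Q (l + 1 : ℕ) T ∧
          HomZero T Y (l + 1 : ℕ) ∧ IsPresiltingObj T ∧ IsBasicObj T by
      obtain ⟨N, hN⟩ := h_stops s
      obtain ⟨D⟩ := hD s Q hQ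
      refine (H N s _ Q hQ hN _ (isTwoTerm_shift D (hc s Q hQ))).mono fun T ⟨h₁, h₂, h₃⟩ =>
        ⟨h₁, HomZero.biproduct_right fun a => (h₁.le a (1 + (l + 1 : ℕ)) (by omega)).target_shift 1
          rfl, h₂, h₃⟩
    have drop : ∀ s Q, Typ s Q → ∀ D : TiltingFamily K Q, ∀ Y : C, Ge Q Y →
        (∀ a, FinHom K (Q a) Y) → ∀ B : MinApprox D Y, ∀ T : C, Below K Q (l + 1 : ℕ) T →
        HomZero T Y (l + 1 : ℕ) → IsPresiltingObj T → ∀ A : MinApprox D T,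
        (∀ i, (∃ s, A.c s = i) ∨ ∃ s, B.c s = i) → Below K Q l T := by
      intro s Q hQ D Y hY hf B T hT hTY hp A hAB
      refine ⟨hT.ge, hT.fin, fun a k hk => ?_, hT.bdd⟩
      rcases eq_or_ne k (l + 1 : ℕ) with rfl | hk'
      · refine homZero_family_of_occurs D hT.bdd hT.le (fun i => ?_) a
        rcases hAB i with h | h
        · exact ⟨T, hT.ge, hT.fin, fun f => hp _ (by omega) f, A, h⟩
        · exact ⟨Y, hY, hf, hTY, B, h⟩
      · exact hT.le a k (by push_cast at hk' ⊢; omega)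
    intro N
    induction N with
    | zero =>
      intro s v Q hQ hv Y hY
      obtain ⟨D⟩ := hD s Q hQ
      obtain ⟨B⟩ := exists_minApprox D (Z := Y) (fun a => (hY.fin a).zero)
      refine (ih s Q hQ).mono fun T ⟨hT, hTY, hp, hb⟩ => ⟨?_, hp, hb⟩
      obtain ⟨A⟩ := exists_minApprox D (Z := T) (fun a => (hT.fin a).zero)
      refine drop s Q hQ D Y hY.ge hY.fin B T hT hTY hp A fun i => Or.inr ?_
      by_contra hi
      push Not at hi
      exact (hv i).not_ge (hY.nonpos_of_not_occurs D (hc s Q hQ) (hinj s) B hi)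
    | succ N ihN =>
      intro s v Q hQ hv Y hY
      obtain ⟨D⟩ := hD s Q hQ
      obtain ⟨B⟩ := exists_minApprox D (Z := Y) (fun a => (hY.fin a).zero)
      choose Q' hQ' hmut using hm s Q hQ
      have D' := fun i => hD _ _ (hQ' i)
      let I := {i : Fin n // ∀ s, B.c s ≠ i}
      have hY' : ∀ i : I, IsTwoTerm K (Q' i) (M.cart (M.nxt s i)) (M.act s i v) Y := fun i =>
        hY.mutation (hmut i) D (D' i).some B i.2 (hact s i v)
      have hv' : ∀ i : I, M.Stops N (M.nxt s i) (M.act s i v) := fun i =>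
        hv i (hY.nonpos_of_not_occurs D (hc s Q hQ) (hinj s) B i.2)
      refine ((ih s Q hQ).or (FinIso.iUnion fun i : I =>
        ihN _ _ (Q' i) (hQ' i) (hv' i) Y (hY' i))).mono fun T ⟨hT, hTY, hp, hb⟩ => ?_
      obtain ⟨A⟩ := exists_minApprox D (Z := T) (fun a => (hT.fin a).zero)
      by_cases h : ∀ i, (∃ s, A.c s = i) ∨ ∃ s, B.c s = i
      · exact Or.inl ⟨drop s Q hQ D Y hY.ge hY.fin B T hT hTY hp A h, hp, hb⟩
      · push Not at h
        obtain ⟨i, hA, hB⟩ := h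
        exact Or.inr ⟨⟨i, hB⟩, hT.mutation (hmut i) D (D' i).some A hA, hTY, hp, hb⟩

end Mutation

/-! ### Functorial cones -/

section FillSystem

/-- A choice of cones for a family of morphisms, together with a relation describing which
morphisms of cones are induced by which commutative squares. -/
structure FillSystem (K : Type w) [Field K] {C : Type u} [Category.{v} C] [Preadditive C]
    [Linear K C] [HasZeroObject C] [HasShift C ℤ] [∀ n : ℤ, (shiftFunctor C n).Additive]
    [Pretriangulated C] {ι : Type} {A B : ι → C} (f : ∀ x, A x ⟶ B x) where
  /-- the cones -/
  X : ι → C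
  /-- the maps to the cones -/
  g : ∀ x, B x ⟶ X x
  /-- the connecting maps -/
  h : ∀ x, X x ⟶ (A x)⟦(1 : ℤ)⟧
  dist : ∀ x, Triangle.mk (f x) (g x) (h x) ∈ distTriang C
  /-- the relation between squares and morphisms of cones -/
  G : ∀ x y, (A x ⟶ A y) → (B x ⟶ B y) → (X x ⟶ X y) → Prop
  comm₁ : ∀ {x y p q φ}, G x y p q φ → f x ≫ q = p ≫ f y
  comm₂ : ∀ {x y p q φ}, G x y p q φ → g x ≫ φ = q ≫ g y
  comm₃ : ∀ {x y p q φ}, G x y p q φ → φ ≫ h y = h x ≫ p⟦(1 : ℤ)⟧'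
  add : ∀ {x y p q φ p' q' φ'}, G x y p q φ → G x y p' q' φ' → G x y (p + p') (q + q') (φ + φ')
  smul : ∀ {x y p q φ} (r : K), G x y p q φ → G x y (r • p) (r • q) (r • φ)
  comp : ∀ {x y z p q φ p' q' φ'}, G x y p q φ → G y z p' q' φ' →
    G x z (p ≫ p') (q ≫ q') (φ ≫ φ')
  id : ∀ x, G x x (𝟙 _) (𝟙 _) (𝟙 _)
  total : ∀ {x y} (p : A x ⟶ A y) (q : B x ⟶ B y), f x ≫ q = p ≫ f y → ∃ φ, G x y p q φ
  lift : ∀ {x y} (ψ : X x ⟶ B y), G x y 0 (g x ≫ ψ) (ψ ≫ g y)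
  htpy : ∀ {x y} (w : B x ⟶ A y), G x y (f x ≫ w) (w ≫ f y) 0
  uniq : ∀ {x y φ}, HomZero (A x) (B y) (-1) → G x y 0 0 φ → φ = 0

end FillSystem

section Homotopy

open CochainComplex HomComplex

variable (K : Type w) [Field K] {V : Type u} [Category.{v} V] [Preadditive V] [HasZeroObject V]
  [HasBinaryBiproducts V] [Linear K V]

local notation "𝒬" => HomotopyCategory.quotient V (ComplexShape.up ℤ)

/-- The connecting map of a mapping cone. -/
def coneδ {K₁ L₁ : CochainComplex V ℤ} (f : K₁ ⟶ L₁) : mappingCone f ⟶ K₁⟦(1 : ℤ)⟧ :=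
  (mappingCone.triangle f).mor₃

/-- The morphisms of mapping cones which are compatible on the nose with representatives of the
given morphisms. -/
def IsFill {K₁ L₁ K₂ L₂ : CochainComplex V ℤ} (f₁ : K₁ ⟶ L₁) (f₂ : K₂ ⟶ L₂)
    (p : (𝒬).obj K₁ ⟶ (𝒬).obj K₂) (q : (𝒬).obj L₁ ⟶ (𝒬).obj L₂)
    (φ : (𝒬).obj (mappingCone f₁) ⟶ (𝒬).obj (mappingCone f₂)) : Prop :=
  ∃ (p₀ : K₁ ⟶ K₂) (q₀ : L₁ ⟶ L₂) (φ₀ : mappingCone f₁ ⟶ mappingCone f₂)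
    (η : Cochain K₁ L₂ (-1)), (𝒬).map p₀ = p ∧ (𝒬).map q₀ = q ∧ (𝒬).map φ₀ = φ ∧
    mappingCone.inr f₁ ≫ φ₀ = q₀ ≫ mappingCone.inr f₂ ∧
    φ₀ ≫ coneδ f₂ = coneδ f₁ ≫ p₀⟦(1 : ℤ)⟧' ∧
    (mappingCone.inl f₁).comp (Cochain.ofHom φ₀) (add_zero (-1)) =
      (Cochain.ofHom p₀).comp (mappingCone.inl f₂) (zero_add (-1)) +
        η.comp (Cochain.ofHom (mappingCone.inr f₂)) (add_zero (-1))

lemma coneTriangle_distinguished {K₁ L₁ : CochainComplex V ℤ} (f : K₁ ⟶ L₁) :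
    Triangle.mk ((𝒬).map f) ((𝒬).map (mappingCone.inr f))
      ((𝒬).map (coneδ f) ≫ ((𝒬).commShiftIso (1 : ℤ)).hom.app K₁) ∈
        distTriang (HomotopyCategory V (ComplexShape.up ℤ)) :=
  HomotopyCategory.mappingCone_triangleh_distinguished f

lemma cochain_ofHom_smul {F G : CochainComplex V ℤ} (r : K) (f : F ⟶ G) :
    Cochain.ofHom (r • f) = r • Cochain.ofHom f := by
  ext p
  simp

namespace IsFill

lemma δ_eq_of_inl_comp {K₁ L₁ K₂ L₂ : CochainComplex V ℤ} {f₁ : K₁ ⟶ L₁} {f₂ : K₂ ⟶ L₂}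
    {p₀ : K₁ ⟶ K₂} {q₀ : L₁ ⟶ L₂} {φ₀ : mappingCone f₁ ⟶ mappingCone f₂} {η : Cochain K₁ L₂ (-1)}
    (h₁ : mappingCone.inr f₁ ≫ φ₀ = q₀ ≫ mappingCone.inr f₂)
    (h₃ : (mappingCone.inl f₁).comp (Cochain.ofHom φ₀) (add_zero (-1)) =
      (Cochain.ofHom p₀).comp (mappingCone.inl f₂) (zero_add (-1)) +
        η.comp (Cochain.ofHom (mappingCone.inr f₂)) (add_zero (-1))) :
    δ (-1) 0 η = Cochain.ofHom (f₁ ≫ q₀) - Cochain.ofHom (p₀ ≫ f₂) := by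
  have e := congrArg (δ (-1) 0) h₃
  simp only [δ_comp_zero_cochain _ _ _ (neg_add_cancel 1), mappingCone.δ_inl, δ_add, δ_ofHom_comp,
    δ_ofHom, Cochain.comp_zero, zero_add, ← Cochain.ofHom_comp, Category.assoc, h₁] at e
  have e' := congrArg (fun z => z.comp (mappingCone.snd f₂) (add_zero 0)) e
  simp [Cochain.ofHom_comp] at e'
  rw [eq_sub_iff_add_eq', Cochain.ofHom_comp, Cochain.ofHom_comp]
  exact e'.symm

lemma comm₁ {K₁ L₁ K₂ L₂ : CochainComplex V ℤ} {f₁ : K₁ ⟶ L₁} {f₂ : K₂ ⟶ L₂}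
    {p : (𝒬).obj K₁ ⟶ (𝒬).obj K₂} {q : (𝒬).obj L₁ ⟶ (𝒬).obj L₂}
    {φ : (𝒬).obj (mappingCone f₁) ⟶ (𝒬).obj (mappingCone f₂)} (h : IsFill f₁ f₂ p q φ) :
    (𝒬).map f₁ ≫ q = p ≫ (𝒬).map f₂ := by
  obtain ⟨p₀, q₀, φ₀, η, rfl, rfl, rfl, h₁, h₂, h₃⟩ := h
  rw [← Functor.map_comp, ← Functor.map_comp]
  refine HomotopyCategory.eq_of_homotopy _ _ ((Cochain.equivHomotopy _ _).symm ⟨η, ?_⟩)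
  rw [δ_eq_of_inl_comp h₁ h₃, sub_add_cancel]

lemma comm₂ {K₁ L₁ K₂ L₂ : CochainComplex V ℤ} {f₁ : K₁ ⟶ L₁} {f₂ : K₂ ⟶ L₂}
    {p : (𝒬).obj K₁ ⟶ (𝒬).obj K₂} {q : (𝒬).obj L₁ ⟶ (𝒬).obj L₂}
    {φ : (𝒬).obj (mappingCone f₁) ⟶ (𝒬).obj (mappingCone f₂)} (h : IsFill f₁ f₂ p q φ) :
    (𝒬).map (mappingCone.inr f₁) ≫ φ = q ≫ (𝒬).map (mappingCone.inr f₂) := by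
  obtain ⟨p₀, q₀, φ₀, η, rfl, rfl, rfl, h₁, h₂, h₃⟩ := h
  rw [← Functor.map_comp, ← Functor.map_comp, h₁]

lemma comm₃ {K₁ L₁ K₂ L₂ : CochainComplex V ℤ} {f₁ : K₁ ⟶ L₁} {f₂ : K₂ ⟶ L₂}
    {p : (𝒬).obj K₁ ⟶ (𝒬).obj K₂} {q : (𝒬).obj L₁ ⟶ (𝒬).obj L₂}
    {φ : (𝒬).obj (mappingCone f₁) ⟶ (𝒬).obj (mappingCone f₂)} (h : IsFill f₁ f₂ p q φ) :
    φ ≫ (𝒬).map (coneδ f₂) ≫ ((𝒬).commShiftIso (1 : ℤ)).hom.app K₂ =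
      ((𝒬).map (coneδ f₁) ≫ ((𝒬).commShiftIso (1 : ℤ)).hom.app K₁) ≫ p⟦(1 : ℤ)⟧' := by
  obtain ⟨p₀, q₀, φ₀, η, rfl, rfl, rfl, h₁, h₂, h₃⟩ := h
  rw [← Functor.map_comp_assoc, h₂, Functor.map_comp_assoc, Category.assoc]
  congr 1
  exact ((𝒬).commShiftIso (1 : ℤ)).hom.naturality p₀

lemma add {K₁ L₁ K₂ L₂ : CochainComplex V ℤ} {f₁ : K₁ ⟶ L₁} {f₂ : K₂ ⟶ L₂}
    {p p' : (𝒬).obj K₁ ⟶ (𝒬).obj K₂} {q q' : (𝒬).obj L₁ ⟶ (𝒬).obj L₂}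
    {φ φ' : (𝒬).obj (mappingCone f₁) ⟶ (𝒬).obj (mappingCone f₂)} (h : IsFill f₁ f₂ p q φ) (h' : IsFill f₁ f₂ p' q' φ') :
    IsFill f₁ f₂ (p + p') (q + q') (φ + φ') := by
  obtain ⟨p₀, q₀, φ₀, η, rfl, rfl, rfl, h₁, h₂, h₃⟩ := h
  obtain ⟨p₀', q₀', φ₀', η', rfl, rfl, rfl, h₁', h₂', h₃'⟩ := h'
  refine ⟨p₀ + p₀', q₀ + q₀', φ₀ + φ₀', η + η', Functor.map_add _, Functor.map_add _,
    Functor.map_add _, ?_, ?_, ?_⟩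
  · rw [Preadditive.comp_add, Preadditive.add_comp, h₁, h₁']
  · rw [Functor.map_add, Preadditive.comp_add, Preadditive.add_comp, h₂, h₂']
  · rw [Cochain.ofHom_add, Cochain.ofHom_add, Cochain.add_comp, Cochain.comp_add, Cochain.add_comp,
      h₃, h₃']
    abel

lemma smul {K₁ L₁ K₂ L₂ : CochainComplex V ℤ} {f₁ : K₁ ⟶ L₁} {f₂ : K₂ ⟶ L₂}
    {p : (𝒬).obj K₁ ⟶ (𝒬).obj K₂} {q : (𝒬).obj L₁ ⟶ (𝒬).obj L₂}
    {φ : (𝒬).obj (mappingCone f₁) ⟶ (𝒬).obj (mappingCone f₂)} (r : K) (h : IsFill f₁ f₂ p q φ) : IsFill f₁ f₂ (r • p) (r • q) (r • φ) := by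
  obtain ⟨p₀, q₀, φ₀, η, rfl, rfl, rfl, h₁, h₂, h₃⟩ := h
  refine ⟨r • p₀, r • q₀, r • φ₀, r • η, Functor.map_smul _ _ _, Functor.map_smul _ _ _,
    Functor.map_smul _ _ _, ?_, ?_, ?_⟩
  · rw [Linear.comp_smul, Linear.smul_comp, h₁]
  · rw [Functor.map_smul, Linear.comp_smul, Linear.smul_comp, h₂]
  · rw [cochain_ofHom_smul, cochain_ofHom_smul, Cochain.smul_comp, Cochain.comp_smul,
      Cochain.smul_comp, h₃, smul_add]

lemma comp {K₁ L₁ K₂ L₂ K₃ L₃ : CochainComplex V ℤ} {f₁ : K₁ ⟶ L₁} {f₂ : K₂ ⟶ L₂}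
    {f₃ : K₃ ⟶ L₃} {p : (𝒬).obj K₁ ⟶ (𝒬).obj K₂} {q : (𝒬).obj L₁ ⟶ (𝒬).obj L₂}
    {φ : (𝒬).obj (mappingCone f₁) ⟶ (𝒬).obj (mappingCone f₂)} {p' : (𝒬).obj K₂ ⟶ (𝒬).obj K₃} {q' : (𝒬).obj L₂ ⟶ (𝒬).obj L₃}
    {φ' : (𝒬).obj (mappingCone f₂) ⟶ (𝒬).obj (mappingCone f₃)}
    (h : IsFill f₁ f₂ p q φ) (h' : IsFill f₂ f₃ p' q' φ') :
    IsFill f₁ f₃ (p ≫ p') (q ≫ q') (φ ≫ φ') := by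
  obtain ⟨p₀, q₀, φ₀, η, rfl, rfl, rfl, h₁, h₂, h₃⟩ := h
  obtain ⟨p₀', q₀', φ₀', η', rfl, rfl, rfl, h₁', h₂', h₃'⟩ := h'
  refine ⟨p₀ ≫ p₀', q₀ ≫ q₀', φ₀ ≫ φ₀', (Cochain.ofHom p₀).comp η' (zero_add (-1)) +
    η.comp (Cochain.ofHom q₀') (add_zero (-1)), Functor.map_comp _ _ _,
    Functor.map_comp _ _ _, Functor.map_comp _ _ _, ?_, ?_, ?_⟩
  · rw [reassoc_of% h₁, h₁', Category.assoc]
  · rw [Functor.map_comp, Category.assoc, h₂', reassoc_of% h₂]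
  · rw [Cochain.ofHom_comp, Cochain.ofHom_comp, ← Cochain.comp_assoc_of_third_is_zero_cochain, h₃,
      Cochain.add_comp, Cochain.comp_assoc_of_third_is_zero_cochain, h₃',
      Cochain.comp_assoc_of_third_is_zero_cochain, ← Cochain.ofHom_comp, h₁', Cochain.comp_add,
      Cochain.add_comp, Cochain.ofHom_comp]
    simp only [Cochain.comp_assoc_of_third_is_zero_cochain,
      Cochain.comp_assoc_of_first_is_zero_cochain]
    abel

lemma id {K₁ L₁ : CochainComplex V ℤ} (f₁ : K₁ ⟶ L₁) : IsFill f₁ f₁ (𝟙 _) (𝟙 _) (𝟙 _) := by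
  refine ⟨𝟙 _, 𝟙 _, 𝟙 _, 0, CategoryTheory.Functor.map_id _ _, CategoryTheory.Functor.map_id _ _,
    CategoryTheory.Functor.map_id _ _, by simp, ?_, by simp⟩
  rw [CategoryTheory.Functor.map_id, Category.id_comp, Category.comp_id]

lemma total {K₁ L₁ K₂ L₂ : CochainComplex V ℤ} {f₁ : K₁ ⟶ L₁} {f₂ : K₂ ⟶ L₂}
    (p : (𝒬).obj K₁ ⟶ (𝒬).obj K₂) (q : (𝒬).obj L₁ ⟶ (𝒬).obj L₂)
    (h : (𝒬).map f₁ ≫ q = p ≫ (𝒬).map f₂) : ∃ φ, IsFill f₁ f₂ p q φ := by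
  obtain ⟨p₀, rfl⟩ := (𝒬).map_surjective p
  obtain ⟨q₀, rfl⟩ := (𝒬).map_surjective q
  rw [← Functor.map_comp, ← Functor.map_comp] at h
  let H := HomotopyCategory.homotopyOfEq _ _ h
  exact ⟨_, p₀, q₀, mappingCone.mapOfHomotopy H, ((Cochain.equivHomotopy _ _) H).1, rfl, rfl, rfl,
    mappingCone.triangleMapOfHomotopy_comm₂ H, mappingCone.triangleMapOfHomotopy_comm₃ H,
    by simp [mappingCone.mapOfHomotopy]⟩

lemma lift {K₁ L₁ K₂ L₂ : CochainComplex V ℤ} {f₁ : K₁ ⟶ L₁} {f₂ : K₂ ⟶ L₂}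
    (ψ : (𝒬).obj (mappingCone f₁) ⟶ (𝒬).obj L₂) :
    IsFill f₁ f₂ 0 ((𝒬).map (mappingCone.inr f₁) ≫ ψ) (ψ ≫ (𝒬).map (mappingCone.inr f₂)) := by
  obtain ⟨ψ₀, rfl⟩ := (𝒬).map_surjective ψ
  have h0 : mappingCone.inr f₂ ≫ coneδ f₂ = 0 := mappingCone.inr_triangleδ f₂
  refine ⟨0, mappingCone.inr f₁ ≫ ψ₀, ψ₀ ≫ mappingCone.inr f₂,
    (mappingCone.inl f₁).comp (Cochain.ofHom ψ₀) (add_zero (-1)), Functor.map_zero _ _ _,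
    Functor.map_comp _ _ _, Functor.map_comp _ _ _, by simp, ?_, ?_⟩
  · rw [Category.assoc, h0, Functor.map_zero, comp_zero, comp_zero]
  · rw [Cochain.ofHom_comp, Cochain.comp_assoc_of_third_is_zero_cochain]
    simp

lemma htpy {K₁ L₁ K₂ L₂ : CochainComplex V ℤ} {f₁ : K₁ ⟶ L₁} {f₂ : K₂ ⟶ L₂}
    (w : (𝒬).obj L₁ ⟶ (𝒬).obj K₂) :
    IsFill f₁ f₂ ((𝒬).map f₁ ≫ w) (w ≫ (𝒬).map f₂) 0 := by
  obtain ⟨w₀, rfl⟩ := (𝒬).map_surjective w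
  have comm : f₁ ≫ w₀ ≫ f₂ = (f₁ ≫ w₀) ≫ f₂ := by rw [Category.assoc]
  refine ⟨f₁ ≫ w₀, w₀ ≫ f₂, mappingCone.mapOfHomotopy (Homotopy.ofEq comm),
    ((Cochain.equivHomotopy _ _) (Homotopy.ofEq comm)).1, Functor.map_comp _ _ _,
    Functor.map_comp _ _ _, ?_, mappingCone.triangleMapOfHomotopy_comm₂ _,
    mappingCone.triangleMapOfHomotopy_comm₃ _, by simp [mappingCone.mapOfHomotopy]⟩
  rw [HomotopyCategory.quotient_map_eq_zero_iff]
  refine ⟨mappingCone.descHomotopy _ _ _ 0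
    ((Cochain.ofHom w₀).comp (mappingCone.inl f₂) (zero_add (-1))) ?_ ?_⟩
  · simp [mappingCone.mapOfHomotopy]
  · simp [mappingCone.mapOfHomotopy]

lemma uniq {K₁ L₁ K₂ L₂ : CochainComplex V ℤ} {f₁ : K₁ ⟶ L₁} {f₂ : K₂ ⟶ L₂}
    {φ : (𝒬).obj (mappingCone f₁) ⟶ (𝒬).obj (mappingCone f₂)}
    (hz : HomZero ((𝒬).obj K₁) ((𝒬).obj L₂) (-1)) (h : IsFill f₁ f₂ 0 0 φ) : φ = 0 := by
  obtain ⟨p₀, q₀, φ₀, η, hp, hq, rfl, h₁, -, h₃⟩ := h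
  rw [HomotopyCategory.quotient_map_eq_zero_iff] at hp hq
  obtain ⟨hp⟩ := hp
  obtain ⟨hq⟩ := hq
  obtain ⟨γp, hγp⟩ := Cochain.equivHomotopy _ _ hp
  obtain ⟨γq, hγq⟩ := Cochain.equivHomotopy _ _ hq
  simp only [Cochain.ofHom_zero, add_zero] at hγp hγq
  have hη := δ_eq_of_inl_comp h₁ h₃
  let ζ : Cochain K₁ L₂ (-1) := η - (Cochain.ofHom f₁).comp γq (zero_add (-1)) +
    γp.comp (Cochain.ofHom f₂) (add_zero (-1))
  have hζ : δ (-1) 0 ζ = 0 := by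
    simp [ζ, hη, hγp, hγq]
  obtain ⟨θ, hθ⟩ : ∃ θ : Cochain K₁ L₂ (-2), δ (-2) (-1) θ = ζ := by
    have := (CohomologyClass.toHom_mk_eq_zero_iff (Cocycle.mk ζ 0 (by norm_num) hζ)).1 (by
        rw [← cancel_mono (((𝒬).commShiftIso (-1 : ℤ)).hom.app L₂), zero_comp]
        exact hz _)
    rw [mem_coboundaries_iff _ (-2) (by norm_num)] at this
    exact this
  rw [HomotopyCategory.quotient_map_eq_zero_iff]
  refine ⟨mappingCone.descHomotopy _ _ _
    (mappingCone.liftCochain f₂ (-γp) θ (by norm_num))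
    (γq.comp (Cochain.ofHom (mappingCone.inr f₂)) (add_zero (-1))) ?_ ?_⟩
  · rw [mappingCone.δ_liftCochain _ _ _ _ 0 (by norm_num), h₃, hθ]
    simp [ζ, hγp]
    abel
  · rw [h₁]
    simp [hγq]

end IsFill

section

variable {ι : Type} {A B : ι → HomotopyCategory V (ComplexShape.up ℤ)} (f : ∀ x, A x ⟶ B x)

/-- A chain map representing a morphism of the homotopy category. -/
def repr {A B : HomotopyCategory V (ComplexShape.up ℤ)} (f : A ⟶ B) : A.as ⟶ B.as :=
  ((𝒬).map_surjective (X := A.as) (Y := B.as) f).choose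

lemma quotient_map_repr {A B : HomotopyCategory V (ComplexShape.up ℤ)} (f : A ⟶ B) :
    (𝒬).map (repr f) = f :=
  ((𝒬).map_surjective (X := A.as) (Y := B.as) f).choose_spec

/-- Mapping cones form a fill system. -/
def homotopyFillSystem : FillSystem K f where
  X x := (𝒬).obj (mappingCone (repr (f x)))
  g x := (𝒬).map (mappingCone.inr (repr (f x)))
  h x := (𝒬).map (coneδ (repr (f x))) ≫ ((𝒬).commShiftIso (1 : ℤ)).hom.app (A x).as
  dist x := by
    have := coneTriangle_distinguished (repr (f x))
    rwa [quotient_map_repr] at this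
  G x y p q φ := IsFill (repr (f x)) (repr (f y)) p q φ
  comm₁ h := by
    have := IsFill.comm₁ h
    rwa [quotient_map_repr, quotient_map_repr] at this
  comm₂ h := h.comm₂
  comm₃ h := h.comm₃
  add := IsFill.add
  smul := IsFill.smul K
  comp := IsFill.comp
  id x := IsFill.id _
  total p q h := IsFill.total p q (by rw [quotient_map_repr, quotient_map_repr]; exact h)
  lift ψ := IsFill.lift ψ
  htpy w := by
    have := IsFill.htpy (f₁ := repr (f _)) (f₂ := repr (f _)) w
    rwa [quotient_map_repr, quotient_map_repr] at this
  uniq hz h := IsFill.uniq hz h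

end

end Homotopy

/-! ### Morphisms between cones -/

namespace FillSystem

variable {K : Type w} [Field K] {C : Type u} [Category.{v} C] [Preadditive C]
  [Linear K C] [HasZeroObject C] [HasShift C ℤ] [∀ n : ℤ, (shiftFunctor C n).Additive]
  [Pretriangulated C] {ι : Type} {A B : ι → C} {f : ∀ x, A x ⟶ B x} (F : FillSystem K f)

lemma f_g (x : ι) : f x ≫ F.g x = 0 := comp_distTriang_mor_zero₁₂ _ (F.dist x)

lemma G_zero (x y : ι) : F.G x y 0 0 0 := by simpa using F.lift (0 : F.X x ⟶ B y)

lemma G_neg {x y : ι} {p : A x ⟶ A y} {q : B x ⟶ B y} {φ : F.X x ⟶ F.X y} (h : F.G x y p q φ) :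
    F.G x y (-p) (-q) (-φ) := by simpa using F.smul (-1) h

lemma G_sub {x y : ι} {p p' : A x ⟶ A y} {q q' : B x ⟶ B y} {φ φ' : F.X x ⟶ F.X y}
    (h : F.G x y p q φ) (h' : F.G x y p' q' φ') : F.G x y (p - p') (q - q') (φ - φ') := by
  simpa [sub_eq_add_neg] using F.add h (F.G_neg h')

/-- Every morphism of cones is induced by a commutative square. -/
lemma exists_G {x y : ι} (hBA : HomZero (B x) (A y) 1) (φ : F.X x ⟶ F.X y) :
    ∃ p q, f x ≫ q = p ≫ f y ∧ F.G x y p q φ := by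
  obtain ⟨q, hq⟩ : ∃ q : B x ⟶ B y, F.g x ≫ φ = q ≫ F.g y :=
    Triangle.coyoneda_exact₃ _ (F.dist y) (F.g x ≫ φ) (hBA _)
  obtain ⟨p, hp, hp'⟩ : ∃ p : A x ⟶ A y, f x ≫ q = p ≫ f y ∧
      F.h x ≫ p⟦(1 : ℤ)⟧' = φ ≫ F.h y :=
    complete_distinguished_triangle_morphism₁ _ _ (F.dist x) (F.dist y) q φ hq
  obtain ⟨ψ, hψ⟩ := F.total p q hp
  obtain ⟨r, hr⟩ : ∃ r : F.X x ⟶ B y, φ - ψ = r ≫ F.g y := by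
    refine Triangle.coyoneda_exact₃ _ (F.dist y) (φ - ψ) ?_
    change (φ - ψ) ≫ F.h y = 0
    rw [Preadditive.sub_comp, F.comm₃ hψ, hp', sub_self]
  refine ⟨p, q + F.g x ≫ r, ?_, ?_⟩
  · rw [Preadditive.comp_add, reassoc_of% (F.f_g x), zero_comp, add_zero, hp]
  · have := F.add hψ (F.lift (x := x) (y := y) r)
    rwa [← hr, add_zero, add_sub_cancel] at this

/-- A square inducing the zero morphism of cones is null-homotopic. -/
lemma exists_htpy {x y : ι} (hAB : HomZero (A x) (B y) (-1)) {p : A x ⟶ A y} {q : B x ⟶ B y}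
    (h : F.G x y p q 0) : ∃ w : B x ⟶ A y, p = f x ≫ w ∧ q = w ≫ f y := by
  obtain ⟨w, hw⟩ : ∃ w : B x ⟶ A y, q = w ≫ f y := by
    refine Triangle.coyoneda_exact₂ _ (F.dist y) q ?_
    have := F.comm₂ h
    rw [comp_zero] at this
    exact this.symm
  have h₁ : F.G x y (p - f x ≫ w) 0 0 := by
    have := F.G_sub h (F.htpy w)
    rwa [← hw, sub_self, sub_self] at this
  obtain ⟨w₂, hw₂⟩ : ∃ w₂ : B x ⟶ A y, p - f x ≫ w = f x ≫ w₂ := by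
    refine exists_extend (F.dist x) (p - f x ≫ w) ?_
    have := F.comm₃ h₁
    rw [zero_comp] at this
    exact this.symm
  have h₂ : F.G x y 0 (w₂ ≫ f y) 0 := by
    have := F.G_sub (F.htpy w₂) h₁
    rwa [← hw₂, sub_self, sub_self, sub_zero] at this
  obtain ⟨r, hr⟩ : ∃ r : F.X x ⟶ B y, w₂ ≫ f y = F.g x ≫ r := by
    refine Triangle.yoneda_exact₂ _ (F.dist x) (w₂ ≫ f y) ?_
    change f x ≫ w₂ ≫ f y = 0
    rw [← Category.assoc, ← hw₂, ← F.comm₁ h₁, comp_zero]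
  have hrg : r ≫ F.g y = 0 := by
    refine F.uniq hAB ?_
    have := F.G_sub (F.lift (x := x) (y := y) r) h₂
    rwa [hr, sub_self, sub_self, sub_zero] at this
  obtain ⟨s, hs⟩ : ∃ s : F.X x ⟶ A y, r = s ≫ f y := Triangle.coyoneda_exact₂ _ (F.dist y) r hrg
  refine ⟨w + (w₂ - F.g x ≫ s), ?_, ?_⟩
  · rw [Preadditive.comp_add, Preadditive.comp_sub, reassoc_of% (F.f_g x), zero_comp, sub_zero,
      ← hw₂, add_sub_cancel]
  · rw [Preadditive.add_comp, Preadditive.sub_comp, Category.assoc, ← hs, hr, sub_self, add_zero,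
      hw]

lemma homZero {x y : ι} (hAA : ∀ k : ℤ, k ≠ 0 → HomZero (A x) (A y) k)
    (hAB : ∀ k : ℤ, k ≠ 0 → HomZero (A x) (B y) k) (hBA : ∀ k : ℤ, k ≠ 0 → HomZero (B x) (A y) k)
    (hBB : ∀ k : ℤ, k ≠ 0 → HomZero (B x) (B y) k)
    (hsurj : ∀ r : A x ⟶ B y, ∃ p q, r = p ≫ f y - f x ≫ q)
    (hinj : ∀ w : B x ⟶ A y, f x ≫ w = 0 → w ≫ f y = 0 → w = 0) (k : ℤ) (hk : k ≠ 0) :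
    HomZero (F.X x) (F.X y) k := by
  have hA : ∀ k : ℤ, k ≠ 0 → k ≠ -1 → HomZero (A x) (F.X y) k := fun k h0 h1 =>
    HomZero.right₃ (F.dist y) rfl (hAB k h0) (hAA (k + 1) (by omega))
  have hB : ∀ k : ℤ, k ≠ 0 → k ≠ -1 → HomZero (B x) (F.X y) k := fun k h0 h1 =>
    HomZero.right₃ (F.dist y) rfl (hBB k h0) (hBA (k + 1) (by omega))
  by_cases h1 : k = 1
  · subst h1
    refine HomZero.left₃_of_extend (F.dist x) (fun e => ?_) (hB 1 (by norm_num) (by norm_num))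
    change A x ⟶ F.X y at e
    obtain ⟨e', he'⟩ : ∃ e' : A x ⟶ B y, e = e' ≫ F.g y :=
      Triangle.coyoneda_exact₃ _ (F.dist y) e (hAA 1 one_ne_zero _)
    obtain ⟨p, q, rfl⟩ := hsurj e'
    refine ⟨-(q ≫ F.g y), ?_⟩
    change e = f x ≫ (-(q ≫ F.g y))
    rw [he', Preadditive.sub_comp, Category.assoc, F.f_g, comp_zero, zero_sub, Category.assoc,
      Preadditive.comp_neg]
  by_cases h2 : k = -1
  · subst h2
    have t₁ := inv_rot_of_distTriang _ (F.dist y)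
    have t₂ := inv_rot_of_distTriang _ t₁
    have hθ : ∀ θ : B x ⟶ (F.X y)⟦(-1 : ℤ)⟧, f x ≫ θ = 0 → θ = 0 := fun θ hθ => by
      let j : (F.X y)⟦(-1 : ℤ)⟧ ⟶ A y := (Triangle.mk (f y) (F.g y) (F.h y)).invRotate.mor₁
      have hw : θ ≫ j = 0 := hinj _ (by rw [reassoc_of% hθ, zero_comp])
        (by rw [Category.assoc, show j ≫ f y = 0 from comp_distTriang_mor_zero₁₂ _ t₁, comp_zero])
      obtain ⟨θ', h'⟩ := Triangle.coyoneda_exact₂ _ t₂ θ hw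
      rw [h', hBB (-1) (by norm_num) θ']
      exact zero_comp
    intro φ
    have h0 : F.g x ≫ φ = 0 := hθ _ (by rw [← Category.assoc, F.f_g, zero_comp])
    obtain ⟨ε, hε⟩ := Triangle.yoneda_exact₃ _ (F.dist x) φ h0
    rw [hε, (hA (-2) (by norm_num) (by norm_num)).shift 1 (by norm_num) ε]
    exact comp_zero
  · exact HomZero.left₃ (F.dist x) (k := k - 1) (by ring) (hB k hk h2)
      (hA (k - 1) (by omega) (by omega))

end FillSystem

/-! ### Formal linear combinations of words and elimination -/

/-- Words in the arrows of a quiver. -/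
abbrev Word := List ℕ

/-- Equality test for words. -/
def weq : Word → Word → Bool
  | [], [] => true
  | a :: u, b :: v => match Nat.beq a b with
    | true => weq u v
    | false => false
  | _, _ => false

lemma weq_iff : ∀ {u v : Word}, weq u v = true ↔ u = v
  | [], [] => by simp [weq]
  | a :: u, b :: v => by
    have ih := weq_iff (u := u) (v := v)
    rcases h : Nat.beq a b with _ | _
    · have : a ≠ b := fun e => by subst e; simp at h
      simp [weq, h, this]
    · have : a = b := Nat.eq_of_beq_eq_true h
      simp [weq, this, ih]
  | [], _ :: _ => by simp [weq]
  | _ :: _, [] => by simp [weq]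

/-- The operations on coefficients used in computations. -/
structure Coef (α : Type) where
  /-- one -/
  one : α
  /-- addition -/
  add : α → α → α
  /-- multiplication -/
  mul : α → α → α
  /-- negation -/
  neg : α → α
  /-- a sufficient test for being invertible -/
  nz : α → Bool
  /-- a sufficient test for being zero -/
  isz : α → Bool

/-- The evaluation `ev` of coefficients is compatible with the operations. -/
structure Coef.IsEval {α : Type} (R : Coef α) {K : Type w} [Field K] (ev : α → K) : Prop where
  one : ev R.one = 1
  add : ∀ x y, ev (R.add x y) = ev x + ev y
  mul : ∀ x y, ev (R.mul x y) = ev x * ev y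
  neg : ∀ x, ev (R.neg x) = - ev x
  nz : ∀ x, R.nz x = true → ev x ≠ 0
  isz : ∀ x, R.isz x = true → ev x = 0

/-- Formal linear combinations of words. -/
abbrev LC (α : Type) := List (α × Word)

section Eval

variable {α : Type} {K : Type w} [Field K] {M : Type*} [AddCommGroup M] [Module K M]

/-- The evaluation of a formal linear combination. -/
def evalL (ev : α → K) (β : Word → M) (p : LC α) : M := (p.map fun t => ev t.1 • β t.2).sum

variable (ev : α → K) (β : Word → M)

@[simp] lemma evalL_nil : evalL ev β [] = 0 := rfl

@[simp] lemma evalL_cons (t : α × Word) (p : LC α) :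
    evalL ev β (t :: p) = ev t.1 • β t.2 + evalL ev β p := by simp [evalL]

@[simp] lemma evalL_append (p q : LC α) : evalL ev β (p ++ q) = evalL ev β p + evalL ev β q := by
  simp [evalL]

lemma evalL_flatMap {ι : Type*} (l : List ι) (g : ι → LC α) :
    evalL ev β (l.flatMap g) = (l.map fun i => evalL ev β (g i)).sum := by
  induction l with
  | nil => rfl
  | cons i l ih => simp [ih]

lemma map_evalL {M' : Type*} [AddCommGroup M'] [Module K M'] (φ : M →ₗ[K] M') (p : LC α) :
    φ (evalL ev β p) = evalL ev (fun w => φ (β w)) p := by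
  induction p with
  | nil => simp
  | cons t p ih => simp [ih]

lemma evalL_congr {β' : Word → M} {p : LC α} (h : ∀ t ∈ p, β t.2 = β' t.2) :
    evalL ev β p = evalL ev β' p := by
  induction p with
  | nil => rfl
  | cons t p ih =>
    rw [evalL_cons, evalL_cons, ih fun t ht => h t (List.mem_cons_of_mem _ ht),
      h t List.mem_cons_self]

lemma evalL_mem (S : Submodule K M) {p : LC α} (h : ∀ t ∈ p, β t.2 ∈ S) : evalL ev β p ∈ S := by
  induction p with
  | nil => exact S.zero_mem
  | cons t p ih =>
    rw [evalL_cons]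
    exact S.add_mem (S.smul_mem _ (h t List.mem_cons_self))
      (ih fun t ht => h t (List.mem_cons_of_mem _ ht))

variable (R : Coef α)

/-- Multiplication of a formal linear combination by a coefficient. -/
def scaleL (c : α) (p : LC α) : LC α := p.map fun t => (R.mul c t.1, t.2)

/-- Insertion of a term, merging equal words. -/
def insL (c : α) (w : Word) : LC α → LC α
  | [] => [(c, w)]
  | t :: p => match weq w t.2 with
    | true => match R.isz (R.add c t.1) with
      | true => p
      | false => (R.add c t.1, w) :: p
    | false => t :: insL c w p

/-- Merging of equal words. -/
def normL : LC α → LC α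
  | [] => []
  | t :: p => insL R t.1 t.2 (normL p)

/-- The coefficient of a word in a linear combination. -/
def coefL (w : Word) : LC α → Option α
  | [] => none
  | t :: p => match weq w t.2 with
    | true => match coefL w p with
      | none => some t.1
      | some c => some (R.add t.1 c)
    | false => coefL w p

variable {R ev} (hR : R.IsEval ev)
include hR

lemma evalL_scaleL (c : α) (p : LC α) : evalL ev β (scaleL R c p) = ev c • evalL ev β p := by
  induction p with
  | nil => simp [scaleL]
  | cons t p ih =>
    rw [show scaleL R c (t :: p) = (R.mul c t.1, t.2) :: scaleL R c p from rfl]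
    simp [ih, hR.mul, mul_smul]

lemma evalL_insL (c : α) (w : Word) (p : LC α) :
    evalL ev β (insL R c w p) = ev c • β w + evalL ev β p := by
  induction p with
  | nil => simp [insL]
  | cons t p ih =>
    rw [insL]
    split
    · rename_i h
      split
      · rename_i h'
        have := hR.isz _ h'
        rw [hR.add] at this
        rw [evalL_cons, ← weq_iff.1 h, ← add_assoc, ← add_smul, this, zero_smul, zero_add]
      · rw [evalL_cons, evalL_cons, hR.add, add_smul, ← weq_iff.1 h, add_assoc]
    · rw [evalL_cons, evalL_cons, ih, add_left_comm]

lemma evalL_normL (p : LC α) : evalL ev β (normL R p) = evalL ev β p := by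
  induction p with
  | nil => rfl
  | cons t p ih => rw [normL, evalL_insL β hR, ih, evalL_cons]

lemma coefL_eq (w : Word) (p : LC α) :
    evalL ev (fun v => Finsupp.single v (1 : K)) p w = ((coefL R w p).map ev).getD 0 := by
  induction p with
  | nil => rfl
  | cons t p ih =>
    rw [evalL_cons, Finsupp.add_apply, ih, coefL, Finsupp.smul_apply]
    split
    · rename_i h
      rw [weq_iff.1 h, Finsupp.single_eq_same]
      cases coefL R t.2 p <;> simp [hR.add]
    · rename_i h
      have : w ≠ t.2 := fun e => by rw [weq_iff.2 e] at h; cases h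
      rw [Finsupp.single_eq_of_ne this, smul_zero, zero_add]

end Eval

section Elimination

variable {α : Type} (R : Coef α)

/-- A word with invertible coefficient in `v`, searched among the terms of a list. -/
def pivotL (v : LC α) : LC α → Option (α × Word)
  | [] => none
  | t :: p => match R.nz t.1 with
    | true => match coefL R t.2 v with
      | none => pivotL v p
      | some c => match R.nz c with
        | true => some (c, t.2)
        | false => pivotL v p
    | false => pivotL v p

/-- Subtraction of a multiple of `r` which cancels the coefficient of the pivot. -/
def cancelL (piv : α × Word) (r v : LC α) : LC α :=
  match coefL R piv.2 v with
  | none => v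
  | some c => normL R (scaleL R piv.1 v ++ scaleL R (R.neg c) r)

/-- Reduction modulo rows in echelon form. -/
def reduceL : List ((α × Word) × LC α) → LC α → LC α
  | [], v => v
  | e :: E, v => reduceL E (cancelL R e.1 e.2 v)

/-- Rows in echelon form obtained from `E` and the given rows; a row is dropped if no pivot is
found. -/
def echL : List ((α × Word) × LC α) → List (LC α) → List ((α × Word) × LC α)
  | E, [] => E
  | E, r :: rs =>
    match reduceL R E (normL R r) with
    | v => match pivotL R v v with
      | none => echL E rs
      | some t => echL (E ++ [(t, v)]) rs

/-- Rows in echelon form. -/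
def IsEch {K : Type w} [Field K] (ev : α → K) (E : List ((α × Word) × LC α)) : Prop :=
  (∀ e ∈ E, evalL ev (fun v => Finsupp.single v (1 : K)) e.2 e.1.2 = ev e.1.1 ∧ ev e.1.1 ≠ 0) ∧
    E.Pairwise fun e e' => evalL ev (fun v => Finsupp.single v (1 : K)) e'.2 e.1.2 = 0

variable {R} {K : Type w} [Field K] {ev : α → K} (hR : R.IsEval ev)
  {M : Type*} [AddCommGroup M] [Module K M] (β : Word → M)

local notation "crd" => evalL ev (fun v => Finsupp.single v (1 : K))

lemma linearCombination_crd (p : LC α) :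
    Finsupp.linearCombination K β (crd p) = evalL ev β p := by
  rw [map_evalL]
  congr 1
  funext w
  simp

include hR

lemma pivotL_eq {v p : LC α} {t : α × Word} (h : pivotL R v p = some t) :
    crd v t.2 = ev t.1 ∧ ev t.1 ≠ 0 := by
  induction p with
  | nil => cases h
  | cons s p ih =>
    rw [pivotL] at h
    split at h
    · split at h
      · exact ih h
      · rename_i c hc
        split at h
        · rename_i hz
          cases h
          exact ⟨by rw [coefL_eq hR]; simp [hc], hR.nz _ hz⟩
        · exact ih h
    · exact ih h

lemma cancelL_eq (piv : α × Word) (r v : LC α) (h : ev piv.1 ≠ 0) :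
    ∃ a : K, a ≠ 0 ∧ ∃ b : K, evalL ev β (cancelL R piv r v) =
      a • evalL ev β v + b • evalL ev β r := by
  unfold cancelL
  split
  · exact ⟨1, one_ne_zero, 0, by simp⟩
  · rename_i c _
    exact ⟨ev piv.1, h, - ev c, by
      rw [evalL_normL β hR, evalL_append, evalL_scaleL β hR, evalL_scaleL β hR, hR.neg]⟩

lemma cancelL_pivot (piv : α × Word) (r v : LC α) (h : crd r piv.2 = ev piv.1) :
    crd (cancelL R piv r v) piv.2 = 0 := by
  unfold cancelL
  split
  · rename_i h'
    rw [coefL_eq hR, h']; rfl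
  · rename_i c h'
    rw [evalL_normL _ hR, evalL_append, evalL_scaleL _ hR, evalL_scaleL _ hR, hR.neg,
      Finsupp.add_apply, Finsupp.smul_apply, Finsupp.smul_apply, h, coefL_eq hR, h']
    simp [mul_comm]

lemma reduceL_eq {E : List ((α × Word) × LC α)} (hE : ∀ e ∈ E, ev e.1.1 ≠ 0) (v : LC α) :
    ∃ a : K, a ≠ 0 ∧ ∃ s ∈ Submodule.span K {x | ∃ e ∈ E, evalL ev β e.2 = x},
      evalL ev β (reduceL R E v) = a • evalL ev β v + s := by
  induction E generalizing v with
  | nil => exact ⟨1, one_ne_zero, 0, Submodule.zero_mem _, by simp [reduceL]⟩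
  | cons e E ih =>
    obtain ⟨a, ha, s, hs, h⟩ := ih (fun e he => hE e (List.mem_cons_of_mem _ he))
      (cancelL R e.1 e.2 v)
    obtain ⟨a', ha', b, h'⟩ := cancelL_eq hR β e.1 e.2 v (hE e List.mem_cons_self)
    refine ⟨a * a', mul_ne_zero ha ha', (a * b) • evalL ev β e.2 + s,
      Submodule.add_mem _ (Submodule.smul_mem _ _ (Submodule.subset_span
        ⟨e, List.mem_cons_self, rfl⟩)) (Submodule.span_mono ?_ hs), ?_⟩
    · rintro x ⟨e, he, rfl⟩
      exact ⟨e, List.mem_cons_of_mem _ he, rfl⟩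
    · rw [reduceL, h, h', smul_add, smul_smul, smul_smul, add_assoc]

lemma reduceL_apply_eq_zero {E : List ((α × Word) × LC α)} (hE : ∀ e ∈ E, ev e.1.1 ≠ 0)
    {k : Word} (hk : ∀ e ∈ E, crd e.2 k = 0) {v : LC α} (hv : crd v k = 0) :
    crd (reduceL R E v) k = 0 := by
  induction E generalizing v with
  | nil => exact hv
  | cons e E ih =>
    refine ih (fun e he => hE e (List.mem_cons_of_mem _ he))
      (fun e he => hk e (List.mem_cons_of_mem _ he)) ?_
    obtain ⟨a, -, b, h⟩ := cancelL_eq hR (fun v => Finsupp.single v (1 : K)) e.1 e.2 v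
      (hE e List.mem_cons_self)
    rw [h, Finsupp.add_apply, Finsupp.smul_apply, Finsupp.smul_apply, hv,
      hk e List.mem_cons_self, smul_zero, smul_zero, add_zero]

lemma reduceL_pivot {E : List ((α × Word) × LC α)} (hE : IsEch ev E) (v : LC α) :
    ∀ e ∈ E, crd (reduceL R E v) e.1.2 = 0 := by
  induction E generalizing v with
  | nil => simp
  | cons e E ih =>
    obtain ⟨h₁, h₂⟩ := hE
    rw [List.pairwise_cons] at h₂
    intro e' he'
    rcases List.mem_cons.1 he' with rfl | he'
    · exact reduceL_apply_eq_zero hR (fun e he => (h₁ e (List.mem_cons_of_mem _ he)).2) h₂.1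
        (cancelL_pivot hR _ _ _ (h₁ e' List.mem_cons_self).1)
    · exact ih ⟨fun e he => h₁ e (List.mem_cons_of_mem _ he), h₂.2⟩ _ _ he'

lemma echL_isEch {E : List ((α × Word) × LC α)} (hE : IsEch ev E) (rs : List (LC α)) :
    IsEch ev (echL R E rs) := by
  induction rs generalizing E with
  | nil => exact hE
  | cons r rs ih =>
    rw [echL]
    split
    · exact ih hE
    · rename_i t ht
      refine ih ⟨fun e he => ?_, ?_⟩
      · rcases List.mem_append.1 he with he | he
        · exact hE.1 e he
        · rw [List.mem_singleton.1 he]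
          exact pivotL_eq hR ht
      · rw [List.pairwise_append]
        refine ⟨hE.2, List.pairwise_singleton _ _, fun e he e' he' => ?_⟩
        rw [List.mem_singleton.1 he']
        exact reduceL_pivot hR hE _ e he

lemma echL_mem {E : List ((α × Word) × LC α)} (hE : IsEch ev E) (rs : List (LC α))
    (S : Submodule K M) (h : ∀ e ∈ E, evalL ev β e.2 ∈ S) (h' : ∀ r ∈ rs, evalL ev β r ∈ S) :
    ∀ e ∈ echL R E rs, evalL ev β e.2 ∈ S := by
  induction rs generalizing E with
  | nil => exact h
  | cons r rs ih =>
    have h'' : ∀ r ∈ rs, evalL ev β r ∈ S := fun r hr => h' r (List.mem_cons_of_mem _ hr)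
    have hE' := echL_isEch hR hE [r]
    rw [echL] at hE' ⊢
    split
    · exact ih hE h h''
    · rename_i t ht
      simp only [ht] at hE'
      refine ih hE' (fun e he => ?_) h''
      rcases List.mem_append.1 he with he | he
      · exact h e he
      · rw [List.mem_singleton.1 he]
        obtain ⟨a, -, s, hs, h₁⟩ := reduceL_eq hR β (fun e he => (hE.1 e he).2) (normL R r)
        change evalL ev β (reduceL R E (normL R r)) ∈ S
        rw [h₁, evalL_normL β hR]
        refine S.add_mem (S.smul_mem _ (h' r List.mem_cons_self)) (Submodule.span_le.2 ?_ hs)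
        rintro x ⟨e, he, rfl⟩
        exact h e he

/-- A combination reducing to zero is in the span of the rows. -/
lemma mem_span_of_reduceL (rs : List (LC α)) (v : LC α)
    (h : (normL R (reduceL R (echL R [] rs) v)).all (fun t => R.isz t.1) = true) :
    evalL ev β v ∈ Submodule.span K {x | ∃ r ∈ rs, evalL ev β r = x} := by
  have h0 : IsEch ev ([] : List ((α × Word) × LC α)) := ⟨by simp, List.Pairwise.nil⟩
  obtain ⟨a, ha, s, hs, h₁⟩ := reduceL_eq hR β
    (fun e he => ((echL_isEch hR h0 rs).1 e he).2) v
  have h₂ : evalL ev β (reduceL R (echL R [] rs) v) = 0 := by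
    rw [← evalL_normL β hR]
    rw [List.all_eq_true] at h
    revert h
    generalize normL R (reduceL R (echL R [] rs) v) = p
    intro h
    induction p with
    | nil => rfl
    | cons t p ih =>
      rw [evalL_cons, ih (fun t ht => h t (List.mem_cons_of_mem _ ht)),
        hR.isz _ (h t List.mem_cons_self), zero_smul, add_zero]
  rw [h₂] at h₁
  have h₃ : evalL ev β v = (-a⁻¹) • s := by
    rw [eq_comm, add_eq_zero_iff_eq_neg] at h₁
    rw [neg_smul, ← smul_neg, ← h₁, smul_smul, inv_mul_cancel₀ ha, one_smul]
  rw [h₃]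
  refine Submodule.smul_mem _ _ (Submodule.span_le.2 ?_ hs)
  rintro x ⟨e, he, rfl⟩
  exact echL_mem hR β h0 rs (Submodule.span K {x | ∃ r ∈ rs, evalL ev β r = x}) (by simp)
    (fun r hr => Submodule.subset_span ⟨r, hr, rfl⟩) e he

omit hR in
lemma IsEch.linearIndependent {E : List ((α × Word) × LC α)} (hE : IsEch ev E) :
    LinearIndependent K fun i : Fin E.length => crd (E.get i).2 := by
  induction E with
  | nil =>
    have : IsEmpty (Fin ([] : List ((α × Word) × LC α)).length) := Fin.isEmpty
    exact linearIndependent_empty_type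
  | cons e E ih =>
    obtain ⟨h₁, h₂⟩ := hE
    rw [List.pairwise_cons] at h₂
    have h := ih ⟨fun e he => h₁ e (List.mem_cons_of_mem _ he), h₂.2⟩
    have : (fun i : Fin (e :: E).length => crd ((e :: E).get i).2) =
        (Fin.cons (crd e.2) fun i : Fin E.length => crd (E.get i).2) := by
      funext i
      refine Fin.cases rfl (fun i => rfl) i
    rw [this]
    refine linearIndependent_finCons.2 ⟨h, fun hmem => ?_⟩
    have hle : Submodule.span K (Set.range fun i : Fin E.length => crd (E.get i).2) ≤
        LinearMap.ker (Finsupp.lapply (R := K) (M := K) e.1.2) := by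
      rw [Submodule.span_le]
      rintro _ ⟨i, rfl⟩
      exact h₂.1 _ (List.get_mem _ _)
    have h₃ := h₁ e List.mem_cons_self
    exact h₃.2 (h₃.1 ▸ hle hmem)

lemma length_echL_le_finrank {B : List Word} (hβ : LinearIndepOn K β {k | k ∈ B})
    (rs : List (LC α)) (hB : rs.all (fun r => r.all fun t => B.any (weq t.2)) = true) :
    (echL R [] rs).length ≤
      Module.finrank K (Submodule.span K (Set.range fun i : Fin rs.length =>
        evalL ev β (rs.get i))) := by
  have h0 : IsEch ev ([] : List ((α × Word) × LC α)) := ⟨by simp, List.Pairwise.nil⟩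
  have h₁ := (echL_isEch hR h0 rs).linearIndependent
  have hs : ∀ e ∈ echL R [] rs, crd e.2 ∈ Finsupp.supported K K {k | k ∈ B} := by
    refine echL_mem hR _ h0 rs _ (by simp) fun r hr => evalL_mem _ _ _ fun t ht => ?_
    refine Finsupp.single_mem_supported _ _ ?_
    obtain ⟨k, hk, hk'⟩ := List.any_eq_true.1 (List.all_eq_true.1 (List.all_eq_true.1 hB r hr) t ht)
    exact (weq_iff.1 hk') ▸ hk
  have h₂ : LinearIndependent K fun i : Fin (echL R [] rs).length =>
      evalL ev β ((echL R [] rs).get i).2 := by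
    have := h₁.map (f := Finsupp.linearCombination K β) (by
      refine (linearIndepOn_iff_disjoint.1 hβ).mono_left (Submodule.span_le.2 ?_)
      rintro _ ⟨i, rfl⟩
      exact hs _ (List.get_mem _ _))
    exact (funext fun i => (linearCombination_crd β _) : (Finsupp.linearCombination K β ∘ fun i :
      Fin (echL R [] rs).length => crd ((echL R [] rs).get i).2) = _) ▸ this
  have h₃ := linearIndependent_iff_card_eq_finrank_span.1 h₂
  rw [Fintype.card_fin] at h₃
  conv_lhs => rw [h₃]
  have : Module.Finite K (Submodule.span K (Set.range fun i : Fin rs.length =>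
      evalL ev β (rs.get i))) := Module.Finite.span_of_finite _ (Set.finite_range _)
  refine Submodule.finrank_mono (Submodule.span_le.2 ?_)
  rintro _ ⟨i, rfl⟩
  refine echL_mem hR β h0 rs _ (by simp) (fun r hr => ?_) _ (List.get_mem _ _)
  obtain ⟨j, rfl⟩ := List.get_of_mem hr
  exact Submodule.subset_span ⟨j, rfl⟩

end Elimination

/-! ### Families of objects with prescribed endomorphism algebra -/

/-- A quiver with a list of distinguished nonempty words. -/
structure Quiv (n : ℕ) where
  /-- the source of an arrow -/
  src : ℕ → Fin n
  /-- the target of an arrow -/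
  tgt : ℕ → Fin n
  /-- the nontrivial words of the basis -/
  basis : List Word

namespace Quiv

variable {n : ℕ} (q : Quiv n)

/-- Test whether a word is a path from `a` to `b`. -/
def isPath (a b : Fin n) : Word → Bool
  | [] => Nat.beq a.1 b.1
  | k :: w => match Nat.beq (q.src k).1 a.1 with
    | true => isPath (q.tgt k) b w
    | false => false

/-- The basis words from `a` to `b`. -/
def bas (a b : Fin n) : List Word :=
  (match Nat.beq a.1 b.1 with
    | true => [[]]
    | false => []) ++ q.basis.filter (q.isPath a b)

lemma isPath_nil {a b : Fin n} : q.isPath a b [] = true ↔ a = b := by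
  rw [isPath, Fin.ext_iff]
  exact Nat.beq_eq ▸ Iff.rfl

lemma isPath_cons {a b : Fin n} {k : ℕ} {w : Word} :
    q.isPath a b (k :: w) = true ↔ q.src k = a ∧ q.isPath (q.tgt k) b w = true := by
  rw [isPath]
  rcases h : Nat.beq (q.src k).1 a.1 with _ | _
  · have : q.src k ≠ a := fun e => by rw [e] at h; simp at h
    simp [this]
  · have : q.src k = a := Fin.ext (Nat.eq_of_beq_eq_true h)
    simp [this]

lemma isPath_append {a b : Fin n} {u v : Word} :
    q.isPath a b (u ++ v) = true ↔ ∃ c, q.isPath a c u = true ∧ q.isPath c b v = true := by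
  induction u generalizing a with
  | nil => exact ⟨fun h => ⟨a, q.isPath_nil.2 rfl, h⟩, fun ⟨c, h, h'⟩ => q.isPath_nil.1 h ▸ h'⟩
  | cons k u ih =>
    rw [List.cons_append, isPath_cons, ih]
    simp only [isPath_cons]
    exact ⟨fun ⟨h, c, h₁, h₂⟩ => ⟨c, ⟨h, h₁⟩, h₂⟩, fun ⟨c, ⟨h, h₁⟩, h₂⟩ => ⟨h, c, h₁, h₂⟩⟩

lemma isPath_tgt_unique {a b c : Fin n} {u : Word} (h : q.isPath a b u = true)
    (h' : q.isPath a c u = true) : b = c := by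
  induction u generalizing a with
  | nil => exact (q.isPath_nil.1 h).symm.trans (q.isPath_nil.1 h')
  | cons k u ih => exact ih (q.isPath_cons.1 h).2 (q.isPath_cons.1 h').2

lemma isPath_src_unique {a b c : Fin n} {u : Word} (h : q.isPath a c u = true)
    (h' : q.isPath b c u = true) : a = b := by
  cases u with
  | nil => exact (q.isPath_nil.1 h).trans (q.isPath_nil.1 h').symm
  | cons k u => exact (q.isPath_cons.1 h).1.symm.trans (q.isPath_cons.1 h').1

lemma isPath_of_mem_bas {a b : Fin n} {w : Word} (h : w ∈ q.bas a b) : q.isPath a b w = true := by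
  rw [bas, List.mem_append] at h
  rcases h with h | h
  · rcases e : Nat.beq a.1 b.1 with _ | _
    · rw [e] at h; cases h
    · rw [e] at h
      rw [List.mem_singleton.1 h]
      exact e
  · exact (List.mem_filter.1 h).2

lemma nil_mem_bas (a : Fin n) : [] ∈ q.bas a a := by
  rw [bas, show Nat.beq a.1 a.1 = true by simp]
  simp

end Quiv

/-- The rules with evaluated coefficients. -/
def mapRules {α : Type} {K : Type w} (ev : α → K) (rules : List (Word × LC α)) :
    List (Word × List (K × Word)) :=
  rules.map fun r => (r.1, r.2.map fun t => (ev t.1, t.2))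

/-- The family `Q` has no selfextensions, and its morphisms are spanned by the paths of a quiver
subject to the given rewriting rules, with the prescribed basis. -/
structure HasType (K : Type w) [Field K] {C : Type u} [Category.{v} C] [Preadditive C] [Linear K C]
    [HasShift C ℤ] {n : ℕ} (q : Quiv n) (rules : List (Word × List (K × Word)))
    (Q : Fin n → C) where
  /-- the morphism attached to a word -/
  β : ∀ a b, Word → (Q a ⟶ Q b)
  nil : ∀ a, β a a [] = 𝟙 _
  zero : ∀ a b w, ¬ q.isPath a b w = true → β a b w = 0
  mul : ∀ a b c u v, q.isPath a b u = true → q.isPath b c v = true →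
    β a b u ≫ β b c v = β a c (u ++ v)
  rule : ∀ r ∈ rules, ∀ a b, q.isPath a b r.1 = true →
    β a b r.1 = (r.2.map fun t => t.1 • β a b t.2).sum
  indep : ∀ a b, LinearIndependent K fun i : Fin (q.bas a b).length => β a b ((q.bas a b).get i)
  span : ∀ a b, ⊤ ≤ Submodule.span K
    (Set.range fun i : Fin (q.bas a b).length => β a b ((q.bas a b).get i))
  vanish : ∀ a b (k : ℤ), k ≠ 0 → HomZero (Q a) (Q b) k

section Rewriting

/-- Removal of a prefix. -/
def stripPrefix : Word → Word → Option Word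
  | [], w => some w
  | _ :: _, [] => none
  | a :: u, b :: v => match Nat.beq a b with
    | true => stripPrefix u v
    | false => none

lemma stripPrefix_eq : ∀ {l w v : Word}, stripPrefix l w = some v → w = l ++ v
  | [], w, v, h => by cases h; rfl
  | _ :: _, [], v, h => by cases h
  | a :: u, b :: v', v, h => by
    rw [stripPrefix] at h
    split at h
    · rename_i h'
      rw [Nat.eq_of_beq_eq_true h', stripPrefix_eq h]; rfl
    · cases h

variable {α : Type}

/-- The first rule applicable at the beginning of a word. -/
def firstRule (w : Word) : List (Word × LC α) → Option (LC α × Word)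
  | [] => none
  | r :: rs => match stripPrefix r.1 w with
    | some v => some (r.2, v)
    | none => firstRule w rs

lemma firstRule_eq {w : Word} {rules : List (Word × LC α)} {r : LC α} {v : Word}
    (h : firstRule w rules = some (r, v)) : ∃ l, (l, r) ∈ rules ∧ w = l ++ v := by
  induction rules with
  | nil => cases h
  | cons s rs ih =>
    rw [firstRule] at h
    split at h
    · rename_i h'
      cases h
      exact ⟨s.1, List.mem_cons_self, stripPrefix_eq h'⟩
    · obtain ⟨l, h₁, h₂⟩ := ih h
      exact ⟨l, List.mem_cons_of_mem _ h₁, h₂⟩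

/-- One step of rewriting. -/
def stepW (rules : List (Word × LC α)) : Word → Option (LC α)
  | [] => none
  | a :: w => match firstRule (a :: w) rules with
    | some (r, v) => some (r.map fun t => (t.1, t.2 ++ v))
    | none => match stepW rules w with
      | some p => some (p.map fun t => (t.1, a :: t.2))
      | none => none

lemma stepW_eq {rules : List (Word × LC α)} {w : Word} {p : LC α} (h : stepW rules w = some p) :
    ∃ l r u v, (l, r) ∈ rules ∧ w = u ++ l ++ v ∧ p = r.map fun t => (t.1, u ++ t.2 ++ v) := by
  induction w generalizing p with
  | nil => cases h
  | cons a w ih =>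
    rw [stepW] at h
    split at h
    · rename_i h'
      cases h
      obtain ⟨l, h₁, h₂⟩ := firstRule_eq h'
      exact ⟨l, _, [], _, h₁, h₂, rfl⟩
    · split at h
      · rename_i h'
        cases h
        obtain ⟨l, r, u, v, h₁, h₂, rfl⟩ := ih h'
        exact ⟨l, r, a :: u, v, h₁, by rw [h₂]; rfl, by simp⟩
      · cases h

variable {n : ℕ} (q : Quiv n) (R : Coef α) (rules : List (Word × LC α))

/-- The normal form of a path, computed with bounded recursion depth. -/
def nfW (a b : Fin n) : ℕ → Word → LC α
  | 0, w => [(R.one, w)]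
  | k + 1, w => match q.isPath a b w with
    | false => []
    | true => match stepW rules w with
      | none => [(R.one, w)]
      | some p => p.flatMap fun t => scaleL R t.1 (nfW a b k t.2)

/-- The product of linear combinations of paths. -/
def mulL (a c b : Fin n) (p p' : LC α) : LC α :=
  p.flatMap fun s => match q.isPath a c s.2 with
    | true => p'.flatMap fun t => scaleL R (R.mul s.1 t.1) (nfW q R rules a b 20 (s.2 ++ t.2))
    | false => []

end Rewriting

namespace HasType

variable {K : Type w} [Field K] {C : Type u} [Category.{v} C] [Preadditive C] [Linear K C]
    [HasShift C ℤ] {n : ℕ} {q : Quiv n} {Q : Fin n → C}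

section

variable {rules : List (Word × List (K × Word))} (h : HasType K q rules Q)

lemma comp_of_left {a c b : Fin n} {u : Word} (hu : q.isPath a c u = true) (v : Word) :
    h.β a c u ≫ h.β c b v = h.β a b (u ++ v) := by
  by_cases hv : q.isPath c b v = true
  · exact h.mul _ _ _ _ _ hu hv
  · rw [h.zero c b v hv, comp_zero, h.zero]
    intro h'
    obtain ⟨d, h₁, h₂⟩ := q.isPath_append.1 h'
    exact hv (q.isPath_tgt_unique h₁ hu ▸ h₂)

lemma comp_of_right {a c b : Fin n} (u : Word) {v : Word} (hv : q.isPath c b v = true) :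
    h.β a c u ≫ h.β c b v = h.β a b (u ++ v) := by
  by_cases hu : q.isPath a c u = true
  · exact h.mul _ _ _ _ _ hu hv
  · rw [h.zero a c u hu, zero_comp, h.zero]
    intro h'
    obtain ⟨d, h₁, h₂⟩ := q.isPath_append.1 h'
    exact hu (q.isPath_src_unique h₂ hv ▸ h₁)

/-- The basis of a space of morphisms. -/
def basis (a b : Fin n) : Module.Basis (Fin (q.bas a b).length) K (Q a ⟶ Q b) :=
  Module.Basis.mk (h.indep a b) (h.span a b)

lemma basis_apply (a b : Fin n) (i : Fin (q.bas a b).length) :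
    h.basis a b i = h.β a b ((q.bas a b).get i) := Module.Basis.mk_apply _ _ _

include h in
lemma finite (a b : Fin n) : Module.Finite K (Q a ⟶ Q b) := Module.Finite.of_basis (h.basis a b)

include h in
lemma finrank_eq (a b : Fin n) : Module.finrank K (Q a ⟶ Q b) = (q.bas a b).length := by
  rw [Module.finrank_eq_card_basis (h.basis a b), Fintype.card_fin]

end

variable {α : Type} {R : Coef α} {ev : α → K} {rules : List (Word × LC α)}
  (h : HasType K q (mapRules ev rules) Q) (hR : R.IsEval ev)

lemma rule_evalL {l : Word} {r : LC α} (hr : (l, r) ∈ rules) {a b : Fin n}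
    (hl : q.isPath a b l = true) : h.β a b l = evalL ev (h.β a b) r := by
  have := h.rule _ (List.mem_map_of_mem hr) a b hl
  rw [this, evalL, List.map_map]
  rfl

include hR in
lemma evalL_nfW (a b : Fin n) (k : ℕ) (w : Word) :
    evalL ev (h.β a b) (nfW q R rules a b k w) = h.β a b w := by
  induction k generalizing w with
  | zero => simp [nfW, hR.one]
  | succ k ih =>
    rw [nfW]
    split
    · rename_i hw
      rw [h.zero a b w (by rw [hw]; exact Bool.false_ne_true)]; rfl
    · rename_i hw
      split
      · simp [hR.one]
      · rename_i p hp
        obtain ⟨l, r, u, v, h₁, rfl, rfl⟩ := stepW_eq hp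
        obtain ⟨d, hd, hv⟩ := q.isPath_append.1 hw
        obtain ⟨c, hu, hl⟩ := q.isPath_append.1 hd
        rw [← h.comp_of_right (u ++ l) hv, ← h.comp_of_left hu l, h.rule_evalL h₁ hl,
          evalL_flatMap]
        generalize r = r
        induction r with
        | nil => simp
        | cons t r ih' =>
          rw [List.map_cons, List.map_cons, List.sum_cons, ih', evalL_scaleL _ hR, ih, evalL_cons,
            Preadditive.comp_add, Preadditive.add_comp, Linear.comp_smul, Linear.smul_comp,
            h.comp_of_left hu, h.comp_of_right _ hv]

include hR in
lemma evalL_mulL (a c b : Fin n) (p p' : LC α) :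
    evalL ev (h.β a b) (mulL q R rules a c b p p') =
      evalL ev (h.β a c) p ≫ evalL ev (h.β c b) p' := by
  rw [mulL, evalL_flatMap]
  induction p with
  | nil => simp
  | cons s p ih =>
    rw [List.map_cons, List.sum_cons, ih, evalL_cons, Preadditive.add_comp]
    congr 1
    split
    · rename_i hs
      rw [evalL_flatMap]
      clear ih
      induction p' with
      | nil => simp
      | cons t p' ih' =>
        rw [List.map_cons, List.sum_cons, ih', evalL_scaleL _ hR, h.evalL_nfW hR, evalL_cons,
          Preadditive.comp_add, Linear.comp_smul, Linear.smul_comp, Linear.smul_comp,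
          h.comp_of_left hs, smul_smul, hR.mul, mul_comm]
    · rename_i hs
      rw [h.zero a c s.2 (by rw [hs]; exact Bool.false_ne_true), smul_zero, zero_comp]; rfl

/-- The weight of a word. -/
def wtW (wt : ℕ → ℕ) : Word → ℕ
  | [] => 0
  | k :: w => wt k + wtW wt w

variable (q R rules) in
/-- Test whether the product of basis words only involves basis words of larger weight. -/
def wtCheck (wt : ℕ → ℕ) (N : ℕ) : Bool :=
  q.basis.all (fun w => Nat.ble 1 (wtW wt w) && Nat.ble (wtW wt w + 1) N) && Nat.ble 1 N &&
  (List.finRange n).all fun a => (List.finRange n).all fun b => (List.finRange n).all fun c =>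
    (q.bas a b).all fun u => match u with
      | [] => true
      | _ :: _ => (q.bas b c).all fun v => (nfW q R rules a c 20 (u ++ v)).all fun t =>
        Nat.ble (wtW wt u + wtW wt v) (wtW wt t.2) && (q.bas a c).any (weq t.2)

/-- The morphisms of weight at least `m`. -/
def radM (wt : ℕ → ℕ) (m : ℕ) (a b : Fin n) : Submodule K (Q a ⟶ Q b) :=
  Submodule.span K {x | ∃ w ∈ q.bas a b, m ≤ wtW wt w ∧ h.β a b w = x}

lemma radM_zero (wt : ℕ → ℕ) (a b : Fin n) : h.radM wt 0 a b = ⊤ := by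
  rw [eq_top_iff]
  refine (h.span a b).trans (Submodule.span_mono ?_)
  rintro _ ⟨i, rfl⟩
  exact ⟨_, List.get_mem _ _, Nat.zero_le _, rfl⟩

lemma mem_bas_cases (q : Quiv n) {a b : Fin n} {w : Word} (hw : w ∈ q.bas a b) :
    (a = b ∧ w = []) ∨ w ∈ q.basis := by
  rw [Quiv.bas, List.mem_append] at hw
  rcases hw with hw | hw
  · rcases e : Nat.beq a.1 b.1 with _ | _
    · rw [e] at hw; cases hw
    · rw [e] at hw
      exact Or.inl ⟨Fin.ext (Nat.eq_of_beq_eq_true e), List.mem_singleton.1 hw⟩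
  · exact Or.inr (List.mem_filter.1 hw).1

variable {wt : ℕ → ℕ} {N : ℕ}

lemma wtCheck_basis (hw : wtCheck q R rules wt N = true) {w : Word} (h : w ∈ q.basis) :
    1 ≤ wtW wt w ∧ wtW wt w < N := by
  simp only [wtCheck, Bool.and_eq_true, List.all_eq_true] at hw
  exact ⟨Nat.le_of_ble_eq_true (hw.1.1 w h).1, Nat.le_of_ble_eq_true (hw.1.1 w h).2⟩

lemma wtCheck_pos (hw : wtCheck q R rules wt N = true) : 1 ≤ N := by
  simp only [wtCheck, Bool.and_eq_true] at hw
  exact Nat.le_of_ble_eq_true hw.1.2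

include hR in
lemma radM_comp (hw : wtCheck q R rules wt N = true) {a b c : Fin n} {m : ℕ} {r : Q a ⟶ Q b}
    {u : Q b ⟶ Q c} (hr : r ∈ h.radM wt 1 a b) (hu : u ∈ h.radM wt m b c) :
    r ≫ u ∈ h.radM wt (m + 1) a c := by
  have key : ∀ w ∈ q.bas a b, 1 ≤ wtW wt w → ∀ w' ∈ q.bas b c, m ≤ wtW wt w' →
      h.β a b w ≫ h.β b c w' ∈ h.radM wt (m + 1) a c := by
    intro w hw₁ hw₂ w' hw₃ hw₄
    rw [h.comp_of_left (q.isPath_of_mem_bas hw₁), ← h.evalL_nfW hR a c 20]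
    refine evalL_mem _ _ _ fun t ht => ?_
    simp only [wtCheck, Bool.and_eq_true, List.all_eq_true] at hw
    have := hw.2 a (List.mem_finRange a) b (List.mem_finRange b) c (List.mem_finRange c) w hw₁
    cases w with
    | nil => simp [wtW] at hw₂
    | cons k w =>
      rw [List.all_eq_true] at this
      have := List.all_eq_true.1 (this w' hw₃) t ht
      rw [Bool.and_eq_true] at this
      have h₁ := Nat.le_of_ble_eq_true this.1
      obtain ⟨z, hz, hz'⟩ := List.any_eq_true.1 this.2
      rw [weq_iff] at hz'
      exact Submodule.subset_span ⟨t.2, hz' ▸ hz, by omega, rfl⟩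
  have h₁ : ∀ w ∈ q.bas a b, 1 ≤ wtW wt w → h.β a b w ≫ u ∈ h.radM wt (m + 1) a c := by
    intro w hw₁ hw₂
    have : h.radM wt m b c ≤ (h.radM wt (m + 1) a c).comap (Linear.leftComp K (Q c) (h.β a b w)) := by
      refine Submodule.span_le.2 ?_
      rintro _ ⟨w', h₁, h₂, rfl⟩
      exact key w hw₁ hw₂ w' h₁ h₂
    exact this hu
  have : h.radM wt 1 a b ≤ (h.radM wt (m + 1) a c).comap (Linear.rightComp K (Q a) u) := by
    refine Submodule.span_le.2 ?_
    rintro _ ⟨w, hw₁, hw₂, rfl⟩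
    exact h₁ w hw₁ hw₂
  exact this hr

include hR in
lemma radM_of_radPow (hw : wtCheck q R rules wt N = true) {m : ℕ} {a b : Fin n} {u : Q a ⟶ Q b}
    (hu : RadPow (fun a b x => x ∈ h.radM wt 1 a b) m a b u) : u ∈ h.radM wt m a b := by
  induction hu with
  | zero u => rw [h.radM_zero]; trivial
  | succ r u hr _ ih => exact h.radM_comp hR hw hr ih

lemma radM_eq_zero (hw : wtCheck q R rules wt N = true) {a b : Fin n} {u : Q a ⟶ Q b}
    (hu : u ∈ h.radM wt N a b) : u = 0 := by
  have : h.radM wt N a b ≤ ⊥ := by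
    refine Submodule.span_le.2 ?_
    rintro _ ⟨w, h₁, h₂, rfl⟩
    have := wtCheck_pos hw
    rcases mem_bas_cases q h₁ with ⟨-, rfl⟩ | h₁
    · simp [wtW] at h₂; omega
    · have := (wtCheck_basis hw h₁).2; omega
  exact (Submodule.mem_bot K).1 (this hu)

lemma rad_of_ne (hw : wtCheck q R rules wt N = true) {a b : Fin n} (hab : a ≠ b)
    (u : Q a ⟶ Q b) : u ∈ h.radM wt 1 a b := by
  refine Submodule.span_le.2 ?_ (h.span a b trivial : u ∈ _)
  rintro _ ⟨i, rfl⟩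
  rcases mem_bas_cases q (List.get_mem (q.bas a b) i) with ⟨e, -⟩ | hw'
  · exact absurd e hab
  · exact Submodule.subset_span ⟨_, List.get_mem _ _, (wtCheck_basis hw hw').1, rfl⟩

lemma exists_sub_mem_rad (hw : wtCheck q R rules wt N = true) {a : Fin n} (u : Q a ⟶ Q a) :
    ∃ c : K, u - c • 𝟙 (Q a) ∈ h.radM wt 1 a a := by
  have hu := (h.span a a trivial : u ∈ _)
  induction hu using Submodule.span_induction with
  | mem x hx =>
    obtain ⟨i, rfl⟩ := hx
    rcases mem_bas_cases q (List.get_mem (q.bas a a) i) with ⟨-, hw'⟩ | hw'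
    · refine ⟨1, ?_⟩
      change h.β a a ((q.bas a a).get i) - _ ∈ _
      rw [hw', h.nil, one_smul, sub_self]
      exact Submodule.zero_mem _
    · refine ⟨0, ?_⟩
      rw [zero_smul, sub_zero]
      exact Submodule.subset_span ⟨_, List.get_mem _ _, (wtCheck_basis hw hw').1, rfl⟩
  | zero => exact ⟨0, by simp⟩
  | add x y _ _ hx hy =>
    obtain ⟨c, hc⟩ := hx
    obtain ⟨d, hd⟩ := hy
    refine ⟨c + d, ?_⟩
    have := Submodule.add_mem _ hc hd
    rwa [sub_add_sub_comm, ← add_smul] at this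
  | smul r x _ hx =>
    obtain ⟨c, hc⟩ := hx
    refine ⟨r * c, ?_⟩
    have := Submodule.smul_mem _ r hc
    rwa [smul_sub, smul_smul] at this

include hR in
/-- A family with prescribed endomorphism algebra is a tilting family. -/
def tiltingFamily [HasZeroObject C] (hw : wtCheck q R rules wt N = true) : TiltingFamily K Q where
  rad a b x := x ∈ h.radM wt 1 a b
  rad_or_isIso a b u := by
    by_cases e : a = b
    swap
    · exact Or.inl (h.rad_of_ne hw e u)
    subst e
    obtain ⟨c, hu⟩ := h.exists_sub_mem_rad hw u
    by_cases hc : c = 0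
    · left
      rwa [hc, zero_smul, sub_zero] at hu
    · right
      set r : End (Q a) := u - c • 𝟙 (Q a) with hr
      have hpow : ∀ m : ℕ, (r ^ m : End (Q a)) ∈ h.radM wt m a a := by
        intro m
        induction m with
        | zero => rw [h.radM_zero]; trivial
        | succ m ih => rw [pow_succ]; exact h.radM_comp hR hw hu ih
      have hnil : IsNilpotent r := ⟨N, h.radM_eq_zero hw (hpow N)⟩
      have hunit : IsUnit (c • (1 : End (Q a)) + r) := by
        have hc' : IsUnit (c • (1 : End (Q a))) := by
          refine ⟨⟨c • 1, c⁻¹ • 1, ?_, ?_⟩, rfl⟩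
          · rw [smul_mul_smul_comm, mul_inv_cancel₀ hc, one_smul, one_mul]
          · rw [smul_mul_smul_comm, inv_mul_cancel₀ hc, one_smul, one_mul]
        exact hnil.isUnit_add_left_of_commute hc' (by
          change r * (c • 1) = (c • 1) * r
          rw [mul_smul_comm, smul_mul_assoc, mul_one, one_mul])
      have : c • (1 : End (Q a)) + r = u := by
        rw [hr]
        exact add_sub_cancel _ _
      rw [this] at hunit
      exact (isUnit_iff_isIso u).1 hunit
  nilp := N
  rad_nil a b u hu := h.radM_eq_zero hw (h.radM_of_radPow hR hw hu)
  vanish := h.vanish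
  finite := h.finite
  not_isZero a hz := by
    obtain ⟨i, hi⟩ := List.get_of_mem (q.nil_mem_bas a)
    have := (h.indep a a).ne_zero i
    rw [hi, h.nil] at this
    exact this ((IsZero.iff_id_eq_zero _).1 hz)

end HasType

/-! ### Verification of mutations -/

/-- Matrices of linear combinations of words. -/
abbrev FMat (α : Type) {n : ℕ} (a b : List (Fin n)) := Fin a.length → Fin b.length → LC α

/-- The data describing the mutated family and its arrows: cones of maps `f x` between direct sums
of the old objects, and commutative squares. -/
structure MutData (α : Type) (n : ℕ) where
  /-- labels of the source of `f x` -/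
  a : Fin n → List (Fin n)
  /-- labels of the target of `f x` -/
  b : Fin n → List (Fin n)
  /-- the maps -/
  f : ∀ x, FMat α (a x) (b x)
  /-- source components of the squares -/
  p : ℕ → ∀ x y, FMat α (a x) (a y)
  /-- target components of the squares -/
  q : ℕ → ∀ x y, FMat α (b x) (b y)

section Formal

variable {α : Type} {n : ℕ} (Γ : Quiv n) (R : Coef α) (rules : List (Word × LC α))

/-- The product of formal matrices. -/
def mulM {a b c : List (Fin n)} (M : FMat α a b) (N : FMat α b c) : FMat α a c := fun s u =>
  normL R ((List.finRange b.length).flatMap fun r =>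
    mulL Γ R rules (a.get s) (b.get r) (c.get u) (M s r) (N r u))

/-- The formal identity matrix. -/
def idM (a b : List (Fin n)) : FMat α a b := fun s u => match Nat.beq s.1 u.1 with
  | true => [(R.one, [])]
  | false => []

/-- A formal matrix with one nonzero entry. -/
def unitM {a b : List (Fin n)} (s : Fin a.length) (u : Fin b.length) (w : Word) : FMat α a b :=
  fun s' u' => match Nat.beq s.1 s'.1 with
  | true => match Nat.beq u.1 u'.1 with
    | true => [(R.one, w)]
    | false => []
  | false => []

/-- The list of all positions of a matrix together with a basis word. -/
def slots (a b : List (Fin n)) : List ((Fin a.length × Fin b.length) × Word) :=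
  (List.finRange a.length).flatMap fun s => (List.finRange b.length).flatMap fun u =>
    (Γ.bas (a.get s) (b.get u)).map fun w => ((s, u), w)

/-- A formal matrix as a row vector. -/
def rowM (tag : ℕ) {a b : List (Fin n)} (M : FMat α a b) : LC α :=
  (List.finRange a.length).flatMap fun s => (List.finRange b.length).flatMap fun u =>
    (M s u).map fun t => (t.1, tag :: s.1 :: u.1 :: t.2)

/-- The basis of the row vectors. -/
def keysM (tag : ℕ) (a b : List (Fin n)) : List Word :=
  (slots Γ a b).map fun z => tag :: z.1.1.1 :: z.1.2.1 :: z.2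

namespace MutData

variable (D : MutData α n) (Γ' : Quiv n)

/-- The source component of the square attached to a word. -/
def wordP (x y : Fin n) : Word → FMat α (D.a x) (D.a y)
  | [] => idM R _ _
  | k :: w => mulM Γ R rules (D.p k x (Γ'.tgt k)) (wordP (Γ'.tgt k) y w)

/-- The target component of the square attached to a word. -/
def wordQ (x y : Fin n) : Word → FMat α (D.b x) (D.b y)
  | [] => idM R _ _
  | k :: w => mulM Γ R rules (D.q k x (Γ'.tgt k)) (wordQ (Γ'.tgt k) y w)

/-- The square attached to a word as a row vector. -/
def wordRow (x y : Fin n) (w : Word) : LC α :=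
  rowM 0 (D.wordP Γ R rules Γ' x y w) ++ rowM 1 (D.wordQ Γ R rules Γ' x y w)

/-- The null-homotopic squares. -/
def htpyRows (x y : Fin n) : List (LC α) :=
  (slots Γ (D.b x) (D.a y)).map fun z =>
    rowM 0 (mulM Γ R rules (D.f x) (unitM R z.1.1 z.1.2 z.2)) ++
    rowM 1 (mulM Γ R rules (unitM R z.1.1 z.1.2 z.2) (D.f y))

/-- The coboundaries from the source to the target. -/
def cobRows (x y : Fin n) : List (LC α) :=
  ((slots Γ (D.a x) (D.a y)).map fun z =>
    rowM 0 (mulM Γ R rules (unitM R z.1.1 z.1.2 z.2) (D.f y))) ++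
  ((slots Γ (D.b x) (D.b y)).map fun z =>
    rowM 0 (mulM Γ R rules (D.f x) (unitM R z.1.1 z.1.2 z.2)))

/-- The rows spanning the commutative squares. -/
def allRows (x y : Fin n) : List (LC α) :=
  D.htpyRows Γ R rules x y ++ (Γ'.bas x y).map (D.wordRow Γ R rules Γ' x y)

/-- All terms have zero coefficient. -/
def allZero (p : LC α) : Bool := p.all fun t => R.isz t.1

/-- The square attached to an arrow commutes. -/
def commCheck (k : ℕ) : Bool :=
  match Γ'.src k with
  | x => match Γ'.tgt k with
    | y => allZero R (normL R (rowM 0 (mulM Γ R rules (D.f x) (D.q k x y)) ++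
        scaleL R (R.neg R.one) (rowM 0 (mulM Γ R rules (D.p k x y) (D.f y)))))

/-- The squares attached to basis words form a basis modulo null-homotopic squares, and the
coboundary is surjective. -/
def basisCheck (x y : Fin n) : Bool :=
  (D.allRows Γ R rules Γ' x y).all (fun r => r.all fun t =>
    (keysM Γ 0 (D.a x) (D.a y) ++ keysM Γ 1 (D.b x) (D.b y)).any (weq t.2)) &&
  (D.cobRows Γ R rules x y).all (fun r => r.all fun t =>
    (keysM Γ 0 (D.a x) (D.b y)).any (weq t.2)) &&
  Nat.beq (echL R [] (D.allRows Γ R rules Γ' x y)).length (D.allRows Γ R rules Γ' x y).length &&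
  Nat.ble (keysM Γ 0 (D.a x) (D.b y)).length (echL R [] (D.cobRows Γ R rules x y)).length &&
  Nat.ble ((keysM Γ 0 (D.a x) (D.a y)).length + (keysM Γ 1 (D.b x) (D.b y)).length)
    ((D.allRows Γ R rules Γ' x y).length + (keysM Γ 0 (D.a x) (D.b y)).length)

/-- The rewriting rules hold up to homotopy. -/
def ruleCheck (r : Word × LC α) (x y : Fin n) : Bool :=
  match Γ'.isPath x y r.1 with
  | false => true
  | true => allZero R (normL R (reduceL R (echL R [] (D.htpyRows Γ R rules x y))
      (normL R (D.wordRow Γ R rules Γ' x y r.1 ++ r.2.flatMap fun t => match Γ'.isPath x y t.2 with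
        | true => scaleL R (R.neg t.1) (D.wordRow Γ R rules Γ' x y t.2)
        | false => []))))

/-- Verification of a mutation. -/
def check (rules' : List (Word × LC α)) (N : ℕ) : Bool :=
  (List.range N).all (D.commCheck Γ R rules Γ') &&
  (List.finRange n).all fun x => (List.finRange n).all fun y =>
    D.basisCheck Γ R rules Γ' x y && rules'.all fun r => D.ruleCheck Γ R rules Γ' r x y

end MutData

end Formal

/-- The mutation data at the vertex `i` given by a left approximation and a renumbering of the
vertices. -/
def mkMut {α : Type} {n : ℕ} (i : Fin n) (perm : Fin n → Fin n) (R : Coef α)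
    (app : List (Fin n × Word)) (p : List (LC α)) (q : List (List (List (LC α)))) :
    MutData α n where
  a x := match Nat.beq (perm x).1 i.1 with
    | true => [i]
    | false => []
  b x := match Nat.beq (perm x).1 i.1 with
    | true => app.map Prod.fst
    | false => [perm x]
  f _ _ u := [(R.one, (app.map Prod.snd).getD u.1 [])]
  p k _ _ _ _ := (List.replicate n [] ++ p).getD k []
  q k _ _ s u := (((List.replicate n [] ++ q).getD k []).getD s.1 []).getD u.1 []

/-- Integer coefficients. -/
def intCoef : Coef ℤ where
  one := 1
  add := Int.add
  mul := Int.mul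
  neg := Int.neg
  nz c := match c with
    | Int.ofNat m => Nat.beq m 1
    | Int.negSucc m => Nat.beq m 0
  isz c := match c with
    | Int.ofNat m => Nat.beq m 0
    | Int.negSucc _ => false


section Matrices

variable {K : Type w} [Field K] {C : Type u} [Category.{v} C] [Preadditive C] [Linear K C]
  [HasZeroObject C] [HasShift C ℤ] [∀ n : ℤ, (shiftFunctor C n).Additive]
  [∀ n : ℤ, (shiftFunctor C n).Linear K] [Pretriangulated C] {n : ℕ}

variable (K) in
/-- Morphisms between finite direct sums are matrices. -/
def matEquiv (Q : Fin n → C) (a b : List (Fin n)) :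
    (∀ z : Fin a.length × Fin b.length, Q (a.get z.1) ⟶ Q (b.get z.2)) ≃ₗ[K]
      (listSum Q a ⟶ listSum Q b) where
  toFun m := biproduct.matrix fun s u => m (s, u)
  map_add' m m' := by ext; simp
  map_smul' r m := by ext; simp
  invFun f z := biproduct.components f z.1 z.2
  left_inv m := by funext z; exact biproduct.matrix_components _ _ _
  right_inv f := biproduct.components_matrix f

lemma matEquiv_apply_π {Q : Fin n → C} {a b : List (Fin n)}
    (m : ∀ z : Fin a.length × Fin b.length, Q (a.get z.1) ⟶ Q (b.get z.2)) (s : Fin a.length)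
    (u : Fin b.length) :
    biproduct.ι (fun s => Q (a.get s)) s ≫ matEquiv K Q a b m ≫
      biproduct.π (fun u => Q (b.get u)) u = m (s, u) := by
  simp [matEquiv]

lemma matEquiv_comp {Q : Fin n → C} {a b c : List (Fin n)}
    (m : ∀ z : Fin a.length × Fin b.length, Q (a.get z.1) ⟶ Q (b.get z.2))
    (m' : ∀ z : Fin b.length × Fin c.length, Q (b.get z.1) ⟶ Q (c.get z.2)) :
    matEquiv K Q a b m ≫ matEquiv K Q b c m' =
      matEquiv K Q a c fun z => ∑ r, m (z.1, r) ≫ m' (r, z.2) := by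
  refine biproduct.hom_ext' _ _ fun s => biproduct.hom_ext _ _ fun u => ?_
  rw [Category.assoc _ (matEquiv K Q a c _), matEquiv_apply_π]
  simp [matEquiv, biproduct.lift_desc]

variable {α : Type} {R : Coef α} {ev : α → K} {rules : List (Word × LC α)} {Γ : Quiv n}
  {Q : Fin n → C} (h : HasType K Γ (mapRules ev rules) Q)

namespace HasType

/-- The morphism defined by a formal matrix. -/
def homM {a b : List (Fin n)} (M : FMat α a b) : listSum Q a ⟶ listSum Q b :=
  matEquiv K Q a b fun z => evalL ev (h.β _ _) (M z.1 z.2)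

variable (hR : R.IsEval ev)

include hR in
lemma homM_mulM {a b c : List (Fin n)} (M : FMat α a b) (N : FMat α b c) :
    h.homM (mulM Γ R rules M N) = h.homM M ≫ h.homM N := by
  rw [homM, homM, homM, matEquiv_comp]
  congr 1
  funext z
  rw [mulM, evalL_normL _ hR, evalL_flatMap, Fin.sum_univ_def]
  congr 1
  refine List.map_congr_left fun r _ => ?_
  exact h.evalL_mulL hR _ _ _ _ _

include hR in
lemma homM_idM (a : List (Fin n)) : h.homM (idM R a a) = 𝟙 (listSum Q a) := by
  refine biproduct.hom_ext' _ _ fun s => biproduct.hom_ext _ _ fun u => ?_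
  rw [homM, Category.assoc, matEquiv_apply_π, Category.comp_id]
  dsimp only [idM]
  by_cases hsu : s = u
  · subst hsu
    rw [show Nat.beq s.1 s.1 = true by simp, biproduct.ι_π_self]
    simp only [evalL_cons, evalL_nil, hR.one, one_smul, add_zero]
    exact h.nil _
  · have : Nat.beq s.1 u.1 = false := by
      rw [Bool.eq_false_iff]
      exact fun e => hsu (Fin.ext (Nat.eq_of_beq_eq_true e))
    rw [this, biproduct.ι_π_ne _ hsu]
    rfl

/-- The matrix attached to a key. -/
def keyMat (tag : ℕ) (a b : List (Fin n)) (key : Word) :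
    ∀ z : Fin a.length × Fin b.length, Q (a.get z.1) ⟶ Q (b.get z.2) := fun z =>
  if key.take 3 = [tag, z.1.1, z.2.1] then h.β _ _ (key.drop 3) else 0

/-- The morphism attached to a key. -/
def keyHom (tag : ℕ) (a b : List (Fin n)) (key : Word) : listSum Q a ⟶ listSum Q b :=
  matEquiv K Q a b (h.keyMat tag a b key)

lemma evalL_keyHom_rowM (tag : ℕ) {a b : List (Fin n)} (M : FMat α a b) :
    evalL ev (h.keyHom tag a b) (rowM tag M) = h.homM M := by
  have h₁ : evalL ev (h.keyMat tag a b) (rowM tag M) = fun z => evalL ev (h.β _ _) (M z.1 z.2) := by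
    funext z
    have hz : ∀ p : LC α, evalL ev (h.keyMat tag a b) p z =
        evalL ev (fun k => h.keyMat tag a b k z) p :=
      fun p => map_evalL ev (h.keyMat tag a b) (LinearMap.proj z :
        (∀ z : Fin a.length × Fin b.length, Q (a.get z.1) ⟶ Q (b.get z.2)) →ₗ[K] _) p
    have hm : ∀ s u, evalL ev (fun k => h.keyMat tag a b k z)
        ((M s u).map fun t => (t.1, tag :: s.1 :: u.1 :: t.2)) =
        if (s, u) = z then evalL ev (h.β _ _) (M z.1 z.2) else 0 := by
      intro s u
      by_cases hsu : (s, u) = z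
      · subst hsu
        rw [if_pos rfl, evalL, evalL, List.map_map]
        congr 1
        refine List.map_congr_left fun t _ => ?_
        simp [keyMat]
      · rw [if_neg hsu, evalL, List.map_map]
        refine List.sum_eq_zero fun x hx => ?_
        obtain ⟨t, -, rfl⟩ := List.mem_map.1 hx
        have : ¬ (s.1 = z.1.1 ∧ u.1 = z.2.1) := fun e =>
          hsu (Prod.ext (Fin.ext e.1) (Fin.ext e.2))
        simp [keyMat, this]
    rw [hz, rowM, evalL_flatMap, ← Fin.sum_univ_def, Finset.sum_eq_single z.1]
    · rw [evalL_flatMap, ← Fin.sum_univ_def, Finset.sum_eq_single z.2]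
      · rw [hm, if_pos rfl]
      · intro u _ hu
        rw [hm, if_neg fun e => hu (congrArg Prod.snd e)]
      · simp
    · intro s _ hs
      rw [evalL_flatMap, ← Fin.sum_univ_def]
      refine Finset.sum_eq_zero fun u _ => ?_
      rw [hm, if_neg fun e => hs (congrArg Prod.fst e)]
    · simp
  rw [homM, ← h₁]
  exact (map_evalL ev _ (matEquiv K Q a b).toLinearMap _).symm

lemma evalL_keyHom_rowM_ne {tag tag' : ℕ} (ht : tag ≠ tag') {a b c d : List (Fin n)}
    (M : FMat α c d) : evalL ev (h.keyHom tag a b) (rowM tag' M) = 0 := by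
  refine (Submodule.mem_bot K).1 (evalL_mem _ _ _ fun t ht' => ?_)
  rw [rowM, List.mem_flatMap] at ht'
  obtain ⟨s, -, ht'⟩ := ht'
  rw [List.mem_flatMap] at ht'
  obtain ⟨u, -, ht'⟩ := ht'
  obtain ⟨t', -, rfl⟩ := List.mem_map.1 ht'
  have : h.keyMat tag a b (tag' :: s.1 :: u.1 :: t'.2) = 0 := by
    funext z
    simp [keyMat, ht.symm]
  simp [keyHom, this]

include hR in
lemma homM_unitM (tag : ℕ) {a b : List (Fin n)} (s : Fin a.length) (u : Fin b.length) (w : Word) :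
    h.homM (unitM R s u w) = h.keyHom tag a b (tag :: s.1 :: u.1 :: w) := by
  rw [homM, keyHom]
  congr 1
  funext z
  dsimp only [unitM, keyMat]
  by_cases hs : s = z.1
  · by_cases hu : u = z.2
    · rw [hs, hu, show Nat.beq z.1.1 z.1.1 = true by simp, show Nat.beq z.2.1 z.2.1 = true by simp]
      simp [hR.one]
    · have : Nat.beq u.1 z.2.1 = false := by
        rw [Bool.eq_false_iff]
        exact fun e => hu (Fin.ext (Nat.eq_of_beq_eq_true e))
      have hu' : ¬ u.1 = z.2.1 := fun e => hu (Fin.ext e)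
      rw [hs, show Nat.beq z.1.1 z.1.1 = true by simp, this]
      simp [hu']
  · have : Nat.beq s.1 z.1.1 = false := by
      rw [Bool.eq_false_iff]
      exact fun e => hs (Fin.ext (Nat.eq_of_beq_eq_true e))
    have hs' : ¬ s.1 = z.1.1 := fun e => hs (Fin.ext e)
    rw [this]
    simp [hs']

/-- The index set of the basis of a space of matrices. -/
abbrev KeyIdx (Γ : Quiv n) (a b : List (Fin n)) :=
  Σ z : Fin a.length × Fin b.length, Fin (Γ.bas (a.get z.1) (b.get z.2)).length

/-- The key of an index. -/
def keyOf (Γ : Quiv n) (tag : ℕ) (a b : List (Fin n)) (j : KeyIdx Γ a b) : Word :=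
  tag :: j.1.1.1 :: j.1.2.1 :: (Γ.bas (a.get j.1.1) (b.get j.1.2)).get j.2

/-- The basis of a space of matrices. -/
def matBasis (a b : List (Fin n)) : Module.Basis (KeyIdx Γ a b) K (listSum Q a ⟶ listSum Q b) :=
  (Pi.basis fun z : Fin a.length × Fin b.length =>
    h.basis (a.get z.1) (b.get z.2)).map (matEquiv K Q a b)

lemma matBasis_apply (tag : ℕ) {a b : List (Fin n)} (j : KeyIdx Γ a b) :
    h.matBasis a b j = h.keyHom tag a b (keyOf Γ tag a b j) := by
  rw [matBasis, Module.Basis.map_apply, Pi.basis_apply, keyHom]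
  congr 1
  funext z
  by_cases hz : z = j.1
  · subst hz
    rw [Pi.single_eq_same, h.basis_apply]
    simp [keyMat, keyOf]
  · rw [Pi.single_eq_of_ne hz]
    have : ¬ (j.1.1.1 = z.1.1 ∧ j.1.2.1 = z.2.1) := fun e =>
      hz (Prod.ext (Fin.ext e.1.symm) (Fin.ext e.2.symm))
    simp [keyMat, keyOf, this]

lemma keyHom_keyOf_ne {tag tag' : ℕ} (ht : tag ≠ tag') {a b c d : List (Fin n)}
    (j : KeyIdx Γ c d) : h.keyHom tag a b (keyOf Γ tag' c d j) = 0 := by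
  have : h.keyMat tag a b (keyOf Γ tag' c d j) = 0 := by
    funext z
    simp [keyMat, keyOf, ht.symm]
  simp [keyHom, this]

lemma mem_keysM {tag : ℕ} {a b : List (Fin n)} {k : Word} :
    k ∈ keysM Γ tag a b ↔ ∃ j, keyOf Γ tag a b j = k := by
  simp only [keysM, slots, List.mem_map, List.mem_flatMap]
  constructor
  · rintro ⟨z, ⟨s, -, u, -, w, hw, rfl⟩, rfl⟩
    obtain ⟨i, rfl⟩ := List.get_of_mem hw
    exact ⟨⟨(s, u), i⟩, rfl⟩
  · rintro ⟨j, rfl⟩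
    exact ⟨_, ⟨j.1.1, List.mem_finRange _, j.1.2, List.mem_finRange _, _, List.get_mem _ _, rfl⟩, rfl⟩

end HasType

/-- A basis labelled by the members of a list of keys. -/
lemma keys_basis {M : Type*} [AddCommGroup M] [Module K M] {ι : Type} [Fintype ι]
    (b : Module.Basis ι K M) {bv : Word → M} {key : ι → Word} (hb : ∀ j, b j = bv (key j))
    {B : List Word} (hB : ∀ k, k ∈ B ↔ ∃ j, key j = k) :
    LinearIndepOn K bv {k | k ∈ B} ∧ Module.finrank K M ≤ B.length := by
  classical
  have hinj : Function.Injective key := fun i j e => b.injective (by rw [hb, hb, e])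
  have hs : {k | k ∈ B} = Set.range key := Set.ext hB
  constructor
  · rw [hs, linearIndepOn_range_iff hinj]
    convert b.linearIndependent using 1
    funext j
    exact (hb j).symm
  · rw [Module.finrank_eq_card_basis b, ← Finset.card_univ, ← Finset.card_image_of_injective _ hinj]
    refine le_trans (Finset.card_le_card ?_) (List.toFinset_card_le B)
    intro k hk
    rw [List.mem_toFinset, hB]
    obtain ⟨j, -, hj⟩ := Finset.mem_image.1 hk
    exact ⟨j, hj⟩

end Matrices

namespace FillSystem

variable {K : Type w} [Field K] {C : Type u} [Category.{v} C] [Preadditive C]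
  [Linear K C] [HasZeroObject C] [HasShift C ℤ] [∀ n : ℤ, (shiftFunctor C n).Additive]
  [Pretriangulated C] {ι : Type} {A B : ι → C}

/-- The square defined by a homotopy. -/
def dH (K : Type w) [Field K] [Linear K C] (f : ∀ x, A x ⟶ B x) (x y : ι) :
    (B x ⟶ A y) →ₗ[K] (A x ⟶ A y) × (B x ⟶ B y) :=
  LinearMap.prod (Linear.leftComp K (A y) (f x)) (Linear.rightComp K (B x) (f y))

/-- The defect of commutativity of a square. -/
def dC (K : Type w) [Field K] [Linear K C] (f : ∀ x, A x ⟶ B x) (x y : ι) :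
    (A x ⟶ A y) × (B x ⟶ B y) →ₗ[K] (A x ⟶ B y) :=
  (Linear.rightComp K (A x) (f y)).comp (LinearMap.fst K _ _) -
    (Linear.leftComp K (B y) (f x)).comp (LinearMap.snd K _ _)

variable {f : ∀ x, A x ⟶ B x} (F : FillSystem K f)

lemma dC_apply (x y : ι) (z : (A x ⟶ A y) × (B x ⟶ B y)) :
    dC K f x y z = z.1 ≫ f y - f x ≫ z.2 := rfl

lemma dH_apply (x y : ι) (z : B x ⟶ A y) : dH K f x y z = (f x ≫ z, z ≫ f y) := rfl

lemma G_sum {x y : ι} {κ : Type} (s : Finset κ) (c : κ → K)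
    {P : κ → (A x ⟶ A y) × (B x ⟶ B y)} {φ : κ → (F.X x ⟶ F.X y)}
    (hG : ∀ j, F.G x y (P j).1 (P j).2 (φ j)) :
    F.G x y (∑ j ∈ s, c j • P j).1 (∑ j ∈ s, c j • P j).2 (∑ j ∈ s, c j • φ j) := by
  classical
  induction s using Finset.induction with
  | empty => simpa using F.G_zero x y
  | insert j s hj ih =>
    rw [Finset.sum_insert hj, Finset.sum_insert hj]
    exact F.add (F.smul (c j) (hG j)) ih

lemma eq_zero_of_dH {x y : ι} (hAB : HomZero (A x) (B y) (-1)) {w : B x ⟶ A y}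
    {φ : F.X x ⟶ F.X y} (h : F.G x y (dH K f x y w).1 (dH K f x y w).2 φ) : φ = 0 := by
  refine F.uniq hAB ?_
  have := F.G_sub h (F.htpy w)
  rwa [sub_zero, show (dH K f x y w).1 = f x ≫ w from rfl,
    show (dH K f x y w).2 = w ≫ f y from rfl, sub_self, sub_self] at this

lemma mem_span_dH {x y : ι} {κ : Type} {W : κ → (B x ⟶ A y)}
    (hW : ⊤ ≤ Submodule.span K (Set.range W)) :
    Submodule.span K (Set.range fun j => dH K f x y (W j)) = LinearMap.range (dH K f x y) := by
  rw [← Function.comp_def, Set.range_comp, ← Submodule.map_span, top_le_iff.1 hW,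
    Submodule.map_top]

/-- A criterion for squares to induce a basis of the morphisms of cones. -/
lemma basis_of_squares {x y : ι} [Module.Finite K (A x ⟶ A y)] [Module.Finite K (B x ⟶ B y)]
    (hBA : HomZero (B x) (A y) 1) (hAB : HomZero (A x) (B y) (-1))
    {κ κ' : Type} [Fintype κ] [Fintype κ'] {W : κ → (B x ⟶ A y)}
    (hW : ⊤ ≤ Submodule.span K (Set.range W)) {P : κ' → (A x ⟶ A y) × (B x ⟶ B y)}
    {φ : κ' → (F.X x ⟶ F.X y)} (hG : ∀ j, F.G x y (P j).1 (P j).2 (φ j))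
    (hli : LinearIndependent K (Sum.elim (fun j => dH K f x y (W j)) P))
    (hsurj : LinearMap.range (dC K f x y) = ⊤)
    (hdim : Module.finrank K ((A x ⟶ A y) × (B x ⟶ B y)) ≤
      Fintype.card κ + Fintype.card κ' + Module.finrank K (A x ⟶ B y)) :
    LinearIndependent K φ ∧ ⊤ ≤ Submodule.span K (Set.range φ) ∧
      ∀ w : B x ⟶ A y, f x ≫ w = 0 → w ≫ f y = 0 → w = 0 := by
  have hli' := linearIndependent_sum.1 hli
  refine ⟨?_, ?_, ?_⟩
  · rw [Fintype.linearIndependent_iff]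
    intro c hc
    have h₁ := F.G_sum Finset.univ c hG
    rw [hc] at h₁
    obtain ⟨w, hw₁, hw₂⟩ := F.exists_htpy hAB h₁
    have h₂ : ∑ j, c j • P j = dH K f x y w := Prod.ext hw₁ hw₂
    have h₃ : dH K f x y w ∈ Submodule.span K (Set.range fun j => dH K f x y (W j)) := by
      rw [mem_span_dH hW]
      exact ⟨w, rfl⟩
    have h₄ : ∑ j, c j • P j ∈ Submodule.span K (Set.range P) :=
      Submodule.sum_mem _ fun j _ => Submodule.smul_mem _ _ (Submodule.subset_span ⟨j, rfl⟩)
    have h₅ : ∑ j, c j • P j = 0 := Submodule.disjoint_def.1 hli'.2.2 _ (h₂ ▸ h₃) h₄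
    exact Fintype.linearIndependent_iff.1 hli'.2.1 c h₅
  · intro ψ _
    obtain ⟨p, q, hpq, hψ⟩ := F.exists_G hBA ψ
    have hle : Submodule.span K (Set.range (Sum.elim (fun j => dH K f x y (W j)) P)) ≤
        LinearMap.ker (dC K f x y) := by
      refine Submodule.span_le.2 ?_
      rintro _ ⟨j | j, rfl⟩
      · change dC K f x y (dH K f x y (W j)) = 0
        rw [dC_apply, dH_apply, Category.assoc, sub_self]
      · change dC K f x y (P j) = 0
        rw [dC_apply, F.comm₁ (hG j), sub_self]
    have hr := LinearMap.finrank_range_add_finrank_ker (dC K f x y)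
    have hfin : Module.Finite K (A x ⟶ B y) :=
      Module.Finite.of_surjective (dC K f x y) (LinearMap.range_eq_top.1 hsurj)
    rw [hsurj, finrank_top] at hr
    have heq := Submodule.eq_of_le_of_finrank_le hle (by
      have := finrank_span_eq_card hli
      rw [Fintype.card_sum] at this
      omega)
    have hmem : (p, q) ∈ LinearMap.ker (dC K f x y) := by
      change dC K f x y (p, q) = 0
      rw [dC_apply, hpq, sub_self]
    rw [← heq, Set.Sum.elim_range, Submodule.span_union, mem_span_dH hW, Submodule.mem_sup] at hmem
    obtain ⟨_, ⟨w, rfl⟩, b, hb, hab⟩ := hmem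
    obtain ⟨c, rfl⟩ := (Submodule.mem_span_range_iff_exists_fun K).1 hb
    have h₁ := F.G_sub hψ (F.G_sum Finset.univ c hG)
    have h₂ : p - (∑ j, c j • P j).1 = (dH K f x y w).1 := by
      exact sub_eq_iff_eq_add.2 (congrArg Prod.fst hab).symm
    have h₃ : q - (∑ j, c j • P j).2 = (dH K f x y w).2 := by
      exact sub_eq_iff_eq_add.2 (congrArg Prod.snd hab).symm
    rw [h₂, h₃] at h₁
    rw [sub_eq_zero.1 (F.eq_zero_of_dH hAB h₁)]
    exact Submodule.sum_mem _ fun j _ => Submodule.smul_mem _ _ (Submodule.subset_span ⟨j, rfl⟩)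
  · intro w h₁ h₂
    obtain ⟨c, rfl⟩ := (Submodule.mem_span_range_iff_exists_fun K).1 (hW (trivial : w ∈ _))
    have h₃ : dH K f x y (∑ j, c j • W j) = 0 := Prod.ext h₁ h₂
    rw [map_sum] at h₃
    simp only [map_smul] at h₃
    have := Fintype.linearIndependent_iff.1 hli'.1 c h₃
    simp [this]

end FillSystem

section WordMorphisms

variable {K : Type w} [Field K] {C : Type u} [Category.{v} C] [Preadditive C]
  [Linear K C] [HasZeroObject C] [HasShift C ℤ] [∀ n : ℤ, (shiftFunctor C n).Additive]
  [Pretriangulated C] {n : ℕ} (Γ : Quiv n) {X : Fin n → C} (φ : ∀ (_ : ℕ) x y, X x ⟶ X y)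

/-- The composite along a word. -/
def wordHom (x y : Fin n) : Word → (X x ⟶ X y)
  | [] => if e : x = y then eqToHom (by rw [e]) else 0
  | k :: w => if Γ.src k = x then φ k x (Γ.tgt k) ≫ wordHom (Γ.tgt k) y w else 0

lemma wordHom_nil (x : Fin n) : wordHom Γ φ x x [] = 𝟙 _ := by simp [wordHom]

lemma wordHom_zero (x y : Fin n) (w : Word) (h : ¬ Γ.isPath x y w = true) :
    wordHom Γ φ x y w = 0 := by
  induction w generalizing x with
  | nil =>
    rw [Γ.isPath_nil] at h
    rw [wordHom, dif_neg h]
  | cons k w ih =>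
    rw [Γ.isPath_cons, not_and] at h
    rw [wordHom]
    split
    · rename_i hk
      rw [ih _ (h hk), comp_zero]
    · rfl

lemma wordHom_mul (x y z : Fin n) (u v : Word) (hu : Γ.isPath x y u = true) :
    wordHom Γ φ x y u ≫ wordHom Γ φ y z v = wordHom Γ φ x z (u ++ v) := by
  induction u generalizing x with
  | nil =>
    obtain rfl := Γ.isPath_nil.1 hu
    rw [wordHom_nil, Category.id_comp]; rfl
  | cons k u ih =>
    rw [Γ.isPath_cons] at hu
    rw [List.cons_append, wordHom, wordHom, if_pos hu.1, if_pos hu.1, Category.assoc, ih _ hu.2]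

end WordMorphisms

lemma evalL_prodMk {α : Type} {K : Type w} [Field K] {M N : Type*} [AddCommGroup M] [Module K M]
    [AddCommGroup N] [Module K N] (ev : α → K) (β : Word → M) (γ : Word → N) (p : LC α) :
    evalL ev (fun k => (β k, γ k)) p = (evalL ev β p, evalL ev γ p) := by
  induction p with
  | nil => rfl
  | cons t p ih => simp [ih]

namespace MutData

variable {K : Type w} [Field K] {C : Type u} [Category.{v} C] [Preadditive C] [Linear K C]
  [HasZeroObject C] [HasShift C ℤ] [∀ n : ℤ, (shiftFunctor C n).Additive]
  [∀ n : ℤ, (shiftFunctor C n).Linear K] [Pretriangulated C] {n : ℕ}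
  {α : Type} {R : Coef α} {ev : α → K} (hR : R.IsEval ev) {rules : List (Word × LC α)} {Γ : Quiv n}
  {Q : Fin n → C} (h : HasType K Γ (mapRules ev rules) Q) (D : MutData α n) (Γ' : Quiv n)

/-- The maps whose cones are the mutated objects. -/
def map (x : Fin n) : listSum Q (D.a x) ⟶ listSum Q (D.b x) := h.homM (D.f x)

/-- The square attached to a word. -/
def wordSquare (R : Coef α) (x y : Fin n) (w : Word) :
    (listSum Q (D.a x) ⟶ listSum Q (D.a y)) × (listSum Q (D.b x) ⟶ listSum Q (D.b y)) :=
  (h.homM (D.wordP Γ R rules Γ' x y w), h.homM (D.wordQ Γ R rules Γ' x y w))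

/-- The square attached to a key. -/
def keySquare (x y : Fin n) (k : Word) :
    (listSum Q (D.a x) ⟶ listSum Q (D.a y)) × (listSum Q (D.b x) ⟶ listSum Q (D.b y)) :=
  (h.keyHom 0 _ _ k, h.keyHom 1 _ _ k)

lemma evalL_keySquare (x y : Fin n) (M : FMat α (D.a x) (D.a y)) (N : FMat α (D.b x) (D.b y)) :
    evalL ev (D.keySquare h x y) (rowM 0 M ++ rowM 1 N) = (h.homM M, h.homM N) := by
  refine (evalL_prodMk ev _ _ _).trans (Prod.ext ?_ ?_)
  · dsimp only
    rw [evalL_append, h.evalL_keyHom_rowM, h.evalL_keyHom_rowM_ne (by norm_num), add_zero]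
  · dsimp only
    rw [evalL_append, h.evalL_keyHom_rowM, h.evalL_keyHom_rowM_ne (by norm_num), zero_add]

/-- The basis of the space of squares. -/
def squareBasis (x y : Fin n) : Module.Basis
    (HasType.KeyIdx Γ (D.a x) (D.a y) ⊕ HasType.KeyIdx Γ (D.b x) (D.b y)) K
    ((listSum Q (D.a x) ⟶ listSum Q (D.a y)) × (listSum Q (D.b x) ⟶ listSum Q (D.b y))) :=
  (h.matBasis _ _).prod (h.matBasis _ _)

lemma squareBasis_keys (x y : Fin n) :
    LinearIndepOn K (D.keySquare h x y)
      {k | k ∈ keysM Γ 0 (D.a x) (D.a y) ++ keysM Γ 1 (D.b x) (D.b y)} ∧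
    Module.finrank K
      ((listSum Q (D.a x) ⟶ listSum Q (D.a y)) × (listSum Q (D.b x) ⟶ listSum Q (D.b y))) ≤
      (keysM Γ 0 (D.a x) (D.a y) ++ keysM Γ 1 (D.b x) (D.b y)).length := by
  refine keys_basis (D.squareBasis h x y)
    (key := Sum.elim (HasType.keyOf Γ 0 _ _) (HasType.keyOf Γ 1 _ _)) ?_ fun k => ?_
  · rintro (j | j)
    · refine Prod.ext ?_ ?_
      · rw [squareBasis, Module.Basis.prod_apply_inl_fst]
        exact h.matBasis_apply 0 j
      · rw [squareBasis, Module.Basis.prod_apply_inl_snd]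
        exact (h.keyHom_keyOf_ne (by norm_num) j).symm
    · refine Prod.ext ?_ ?_
      · rw [squareBasis, Module.Basis.prod_apply_inr_fst]
        exact (h.keyHom_keyOf_ne (by norm_num) j).symm
      · rw [squareBasis, Module.Basis.prod_apply_inr_snd]
        exact h.matBasis_apply 1 j
  · rw [List.mem_append, HasType.mem_keysM, HasType.mem_keysM]
    simp

/-- The homotopy attached to a position and a basis word. -/
def slotHom (a b : List (Fin n)) (j : Fin (slots Γ a b).length) : listSum Q a ⟶ listSum Q b :=
  h.keyHom 0 a b (0 :: ((slots Γ a b).get j).1.1.1 :: ((slots Γ a b).get j).1.2.1 ::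
    ((slots Γ a b).get j).2)

lemma span_slotHom (a b : List (Fin n)) :
    ⊤ ≤ Submodule.span K (Set.range (slotHom h a b)) := by
  rw [← (h.matBasis a b).span_eq]
  refine Submodule.span_mono ?_
  rintro _ ⟨j, rfl⟩
  rw [h.matBasis_apply 0 j]
  have := (HasType.mem_keysM (tag := 0)).2 ⟨j, rfl⟩
  rw [keysM, List.mem_map] at this
  obtain ⟨z, hz, hz'⟩ := this
  obtain ⟨i, rfl⟩ := List.get_of_mem hz
  exact ⟨i, by rw [slotHom, hz']⟩

include hR

lemma htpyRows_eq (x y : Fin n) :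
    {v | ∃ r ∈ D.htpyRows Γ R rules x y, evalL ev (D.keySquare h x y) r = v} =
      Set.range fun j => FillSystem.dH K (D.map h) x y (slotHom h (D.b x) (D.a y) j) := by
  have key : ∀ z : (Fin (D.b x).length × Fin (D.a y).length) × Word, evalL ev (D.keySquare h x y)
      (rowM 0 (mulM Γ R rules (D.f x) (unitM R z.1.1 z.1.2 z.2)) ++
      rowM 1 (mulM Γ R rules (unitM R z.1.1 z.1.2 z.2) (D.f y))) = FillSystem.dH K (D.map h) x y
        (h.keyHom 0 (D.b x) (D.a y) (0 :: z.1.1.1 :: z.1.2.1 :: z.2)) := fun z => by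
    rw [evalL_keySquare, h.homM_mulM hR, h.homM_mulM hR, h.homM_unitM hR 0]
    rfl
  ext v
  constructor
  · rintro ⟨r, hr, rfl⟩
    obtain ⟨z, hz, rfl⟩ := List.mem_map.1 hr
    obtain ⟨j, rfl⟩ := List.get_of_mem hz
    exact ⟨j, (key _).symm⟩
  · rintro ⟨j, rfl⟩
    exact ⟨_, List.mem_map_of_mem (List.get_mem (slots Γ (D.b x) (D.a y)) j), key _⟩

lemma allRows_eq (x y : Fin n) :
    Set.range (fun i : Fin (D.allRows Γ R rules Γ' x y).length =>
      evalL ev (D.keySquare h x y) ((D.allRows Γ R rules Γ' x y).get i)) =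
    Set.range (Sum.elim (fun j => FillSystem.dH K (D.map h) x y (slotHom h (D.b x) (D.a y) j))
      fun i : Fin (Γ'.bas x y).length => D.wordSquare h Γ' R x y ((Γ'.bas x y).get i)) := by
  have h₁ : Set.range (fun i : Fin (D.allRows Γ R rules Γ' x y).length =>
      evalL ev (D.keySquare h x y) ((D.allRows Γ R rules Γ' x y).get i)) =
      {v | ∃ r ∈ D.allRows Γ R rules Γ' x y, evalL ev (D.keySquare h x y) r = v} := by
    ext v
    constructor
    · rintro ⟨i, rfl⟩
      exact ⟨_, List.get_mem _ _, rfl⟩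
    · rintro ⟨r, hr, rfl⟩
      obtain ⟨i, rfl⟩ := List.get_of_mem hr
      exact ⟨i, rfl⟩
  rw [h₁, Set.Sum.elim_range, ← D.htpyRows_eq hR h x y]
  ext v
  simp only [allRows, List.mem_append, Set.mem_union, Set.mem_ofPred_eq, or_and_right, exists_or]
  refine or_congr Iff.rfl ⟨?_, ?_⟩
  · rintro ⟨r, hr, rfl⟩
    obtain ⟨w, hw, rfl⟩ := List.mem_map.1 hr
    obtain ⟨i, rfl⟩ := List.get_of_mem hw
    exact ⟨i, (D.evalL_keySquare h x y _ _).symm⟩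
  · rintro ⟨i, rfl⟩
    exact ⟨_, List.mem_map_of_mem (List.get_mem (Γ'.bas x y) i), D.evalL_keySquare h x y _ _⟩

lemma length_allRows (x y : Fin n) : (D.allRows Γ R rules Γ' x y).length =
    (slots Γ (D.b x) (D.a y)).length + (Γ'.bas x y).length := by
  rw [allRows, List.length_append, htpyRows, List.length_map, List.length_map]

variable {D Γ'} in
lemma linearIndependent_of_basisCheck {x y : Fin n}
    (hc : D.basisCheck Γ R rules Γ' x y = true) :
    LinearIndependent K (Sum.elim
      (fun j => FillSystem.dH K (D.map h) x y (slotHom h (D.b x) (D.a y) j))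
      fun i : Fin (Γ'.bas x y).length => D.wordSquare h Γ' R x y ((Γ'.bas x y).get i)) := by
  simp only [basisCheck, Bool.and_eq_true] at hc
  have h₁ := length_echL_le_finrank hR _ (D.squareBasis_keys h x y).1 _ hc.1.1.1.1
  rw [Nat.eq_of_beq_eq_true hc.1.1.2, D.allRows_eq hR h Γ', D.length_allRows hR (ev := ev)] at h₁
  rw [linearIndependent_iff_card_le_finrank_span, Fintype.card_sum, Fintype.card_fin,
    Fintype.card_fin]
  exact h₁

variable {D Γ'} in
lemma cobRows_of_basisCheck {x y : Fin n} (hc : D.basisCheck Γ R rules Γ' x y = true) :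
    LinearMap.range (FillSystem.dC K (D.map h) x y) = ⊤ ∧
    (keysM Γ 0 (D.a x) (D.b y)).length ≤
      Module.finrank K (listSum Q (D.a x) ⟶ listSum Q (D.b y)) := by
  simp only [basisCheck, Bool.and_eq_true] at hc
  have hk := keys_basis (h.matBasis (D.a x) (D.b y)) (h.matBasis_apply 0)
    (fun k => HasType.mem_keysM)
  have hfin : Module.Finite K (listSum Q (D.a x) ⟶ listSum Q (D.b y)) :=
    Module.Finite.of_basis (h.matBasis (D.a x) (D.b y))
  have h₁ := length_echL_le_finrank hR _ hk.1 _ hc.1.1.1.2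
  have h₂ := Nat.le_of_ble_eq_true hc.1.2
  have hle : Submodule.span K (Set.range fun i : Fin (D.cobRows Γ R rules x y).length =>
      evalL ev (h.keyHom 0 (D.a x) (D.b y)) ((D.cobRows Γ R rules x y).get i)) ≤
      LinearMap.range (FillSystem.dC K (D.map h) x y) := by
    refine Submodule.span_le.2 ?_
    rintro _ ⟨i, rfl⟩
    have hi := List.get_mem (D.cobRows Γ R rules x y) i
    change evalL ev _ ((D.cobRows Γ R rules x y).get i) ∈ LinearMap.range _
    generalize (D.cobRows Γ R rules x y).get i = r at hi ⊢
    rw [cobRows, List.mem_append] at hi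
    rcases hi with hi | hi
    · obtain ⟨z, -, hz⟩ := List.mem_map.1 hi
      refine ⟨(h.homM (unitM R z.1.1 z.1.2 z.2), 0), ?_⟩
      rw [← hz, h.evalL_keyHom_rowM, h.homM_mulM hR, FillSystem.dC_apply]
      simp [map]
    · obtain ⟨z, -, hz⟩ := List.mem_map.1 hi
      refine ⟨(0, -h.homM (unitM R z.1.1 z.1.2 z.2)), ?_⟩
      rw [← hz, h.evalL_keyHom_rowM, h.homM_mulM hR, FillSystem.dC_apply]
      simp [map]
  have h₃ := Submodule.finrank_mono hle
  have h₄ := Submodule.finrank_le (LinearMap.range (FillSystem.dC K (D.map h) x y))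
  exact ⟨Submodule.eq_top_of_finrank_eq (by have := hk.2; omega), by omega⟩

include h in
variable {D Γ'} in
lemma finrank_of_basisCheck {x y : Fin n} (hc : D.basisCheck Γ R rules Γ' x y = true) :
    Module.finrank K
      ((listSum Q (D.a x) ⟶ listSum Q (D.a y)) × (listSum Q (D.b x) ⟶ listSum Q (D.b y))) ≤
      Fintype.card (Fin (slots Γ (D.b x) (D.a y)).length) + Fintype.card (Fin (Γ'.bas x y).length) +
        Module.finrank K (listSum Q (D.a x) ⟶ listSum Q (D.b y)) := by
  have h₁ := (D.squareBasis_keys h x y).2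
  have h₂ := (cobRows_of_basisCheck hR h hc).2
  simp only [basisCheck, Bool.and_eq_true] at hc
  have h₃ := Nat.le_of_ble_eq_true hc.2
  rw [D.length_allRows hR (ev := ev)] at h₃
  rw [List.length_append] at h₁
  rw [Fintype.card_fin, Fintype.card_fin]
  omega

end MutData

namespace MutData

variable {K : Type w} [Field K] {C : Type u} [Category.{v} C] [Preadditive C] [Linear K C]
  [HasZeroObject C] [HasShift C ℤ] [∀ n : ℤ, (shiftFunctor C n).Additive]
  [∀ n : ℤ, (shiftFunctor C n).Linear K] [Pretriangulated C] {n : ℕ}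
  {α : Type} {R : Coef α} {ev : α → K} (hR : R.IsEval ev) {rules : List (Word × LC α)} {Γ : Quiv n}
  {Q : Fin n → C} (h : HasType K Γ (mapRules ev rules) Q) {D : MutData α n} {Γ' : Quiv n}
  (F : FillSystem K (D.map h))

open Classical in
/-- A morphism of cones induced by the square attached to an arrow. -/
def arrowHom (k : ℕ) (x y : Fin n) : F.X x ⟶ F.X y :=
  if hc : ∃ φ, F.G x y (h.homM (D.p k x y)) (h.homM (D.q k x y)) φ then hc.choose else 0

include hR in
lemma comm_of_commCheck {k : ℕ} (hc : D.commCheck Γ R rules Γ' k = true) :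
    D.map h (Γ'.src k) ≫ h.homM (D.q k (Γ'.src k) (Γ'.tgt k)) =
      h.homM (D.p k (Γ'.src k) (Γ'.tgt k)) ≫ D.map h (Γ'.tgt k) := by
  have h₁ : ∀ p : LC α, allZero R p = true →
      evalL ev (h.keyHom 0 (D.a (Γ'.src k)) (D.b (Γ'.tgt k))) p = 0 := fun p hp => by
    rw [allZero, List.all_eq_true] at hp
    refine (Submodule.mem_bot K).1 ?_
    induction p with
    | nil => exact Submodule.zero_mem _
    | cons t p ih =>
      rw [evalL_cons, hR.isz _ (hp t List.mem_cons_self), zero_smul, zero_add]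
      exact ih fun t ht => hp t (List.mem_cons_of_mem _ ht)
  have h₂ := h₁ _ hc
  rw [evalL_normL _ hR, evalL_append, evalL_scaleL _ hR, h.evalL_keyHom_rowM, h.evalL_keyHom_rowM,
    hR.neg, hR.one, neg_one_smul, h.homM_mulM hR, h.homM_mulM hR, ← sub_eq_add_neg] at h₂
  exact sub_eq_zero.1 h₂

lemma G_arrowHom {k : ℕ} {x y : Fin n} (hc : D.map h x ≫ h.homM (D.q k x y) =
      h.homM (D.p k x y) ≫ D.map h y) :
    F.G x y (h.homM (D.p k x y)) (h.homM (D.q k x y)) (arrowHom h F k x y) := by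
  have := F.total _ _ hc
  rw [arrowHom, dif_pos this]
  exact this.choose_spec

include hR in
lemma G_wordHom (hc : ∀ k, D.map h (Γ'.src k) ≫ h.homM (D.q k (Γ'.src k) (Γ'.tgt k)) =
      h.homM (D.p k (Γ'.src k) (Γ'.tgt k)) ≫ D.map h (Γ'.tgt k)) {x y : Fin n} {w : Word}
    (hw : Γ'.isPath x y w = true) :
    F.G x y (D.wordSquare h Γ' R x y w).1 (D.wordSquare h Γ' R x y w).2
      (wordHom Γ' (arrowHom h F) x y w) := by
  induction w generalizing x with
  | nil =>
    obtain rfl := Γ'.isPath_nil.1 hw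
    rw [wordHom_nil]
    have := F.id x
    rwa [← h.homM_idM hR, ← h.homM_idM hR] at this
  | cons k w ih =>
    obtain ⟨rfl, hw'⟩ := Γ'.isPath_cons.1 hw
    rw [wordHom, if_pos rfl]
    have := F.comp (G_arrowHom h F (hc k)) (ih hw')
    rw [wordSquare, ← h.homM_mulM hR, ← h.homM_mulM hR] at this
    exact this

include h in
lemma homZero_listSum (a b : List (Fin n)) {k : ℤ} (hk : k ≠ 0) :
    HomZero (listSum Q a) (listSum Q b) k :=
  HomZero.biproduct_left fun _ => HomZero.biproduct_right fun _ => h.vanish _ _ k hk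

include hR in
lemma wordHom_rule {x y : Fin n} {r : Word × LC α}
    (hc : ∀ k, D.map h (Γ'.src k) ≫ h.homM (D.q k (Γ'.src k) (Γ'.tgt k)) =
      h.homM (D.p k (Γ'.src k) (Γ'.tgt k)) ≫ D.map h (Γ'.tgt k))
    (hr : D.ruleCheck Γ R rules Γ' r x y = true) (hp : Γ'.isPath x y r.1 = true) :
    wordHom Γ' (arrowHom h F) x y r.1 = evalL ev (wordHom Γ' (arrowHom h F) x y) r.2 := by
  rw [ruleCheck, hp] at hr
  have h₁ := mem_span_of_reduceL hR (D.keySquare h x y) _ _ hr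
  rw [D.htpyRows_eq hR h, FillSystem.mem_span_dH (f := D.map h) (x := x) (y := y)
    (span_slotHom h (D.b x) (D.a y)), evalL_normL _ hR,
    evalL_append, evalL_flatMap] at h₁
  obtain ⟨w, hw⟩ := h₁
  rw [wordRow, D.evalL_keySquare] at hw
  have key : ∀ l : LC α, F.G x y
      (l.map fun t => evalL ev (D.keySquare h x y) (match Γ'.isPath x y t.2 with
        | true => scaleL R (R.neg t.1) (D.wordRow Γ R rules Γ' x y t.2)
        | false => [])).sum.1
      (l.map fun t => evalL ev (D.keySquare h x y) (match Γ'.isPath x y t.2 with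
        | true => scaleL R (R.neg t.1) (D.wordRow Γ R rules Γ' x y t.2)
        | false => [])).sum.2 (-evalL ev (wordHom Γ' (arrowHom h F) x y) l) := by
    intro l
    induction l with
    | nil => simpa using F.G_zero x y
    | cons t l ih =>
      rw [List.map_cons, List.sum_cons, evalL_cons, neg_add]
      refine F.add ?_ ih
      split
      · rename_i ht
        rw [evalL_scaleL _ hR, wordRow, D.evalL_keySquare, hR.neg, ← neg_smul]
        exact F.smul (-ev t.1) (G_wordHom hR h F hc ht)
      · rename_i ht
        rw [wordHom_zero Γ' _ x y t.2 (by rw [ht]; exact Bool.false_ne_true), smul_zero, neg_zero]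
        exact F.G_zero x y
  have h₂ := F.add (G_wordHom hR h F hc hp) (key r.2)
  have h₃ := F.eq_zero_of_dH (w := w) (homZero_listSum h _ _ (by norm_num)) (by
    rw [hw]
    exact h₂)
  rwa [← sub_eq_add_neg, sub_eq_zero] at h₃

/-- The mutated family has the type verified by `check`. -/
def hasType {rules' : List (Word × LC α)} {N : ℕ} (hc : D.check Γ R rules Γ' rules' N = true)
    (hN : ∀ k, N ≤ k → ∀ x y s u, D.p k x y s u = []) (hN' : ∀ k, N ≤ k → ∀ x y s u, D.q k x y s u = []) :
    HasType K Γ' (mapRules ev rules') F.X :=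
  have hb : ∀ x y, D.basisCheck Γ R rules Γ' x y = true := fun x y => by
    simp only [check, Bool.and_eq_true, List.all_eq_true] at hc
    exact (hc.2 x (List.mem_finRange x) y (List.mem_finRange y)).1
  have hr : ∀ x y, ∀ r ∈ rules', D.ruleCheck Γ R rules Γ' r x y = true := fun x y => by
    simp only [check, Bool.and_eq_true, List.all_eq_true] at hc
    exact (hc.2 x (List.mem_finRange x) y (List.mem_finRange y)).2
  have hcomm : ∀ k, D.map h (Γ'.src k) ≫ h.homM (D.q k (Γ'.src k) (Γ'.tgt k)) =
      h.homM (D.p k (Γ'.src k) (Γ'.tgt k)) ≫ D.map h (Γ'.tgt k) := fun k => by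
    simp only [check, Bool.and_eq_true, List.all_eq_true] at hc
    by_cases hk : k < N
    · exact comm_of_commCheck hR h (hc.1 k (List.mem_range.2 hk))
    · have h₁ : h.homM (D.q k (Γ'.src k) (Γ'.tgt k)) = 0 := by
        have : D.q k (Γ'.src k) (Γ'.tgt k) = fun _ _ => [] :=
          funext fun s => funext fun u => hN' k (not_lt.1 hk) _ _ s u
        rw [HasType.homM, this]
        exact map_zero (matEquiv K Q _ _)
      have h₂ : h.homM (D.p k (Γ'.src k) (Γ'.tgt k)) = 0 := by
        have : D.p k (Γ'.src k) (Γ'.tgt k) = fun _ _ => [] :=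
          funext fun s => funext fun u => hN k (not_lt.1 hk) _ _ s u
        rw [HasType.homM, this]
        exact map_zero (matEquiv K Q _ _)
      rw [h₁, h₂, comp_zero, zero_comp]
  have key := fun x y : Fin n =>
    have : Module.Finite K (listSum Q (D.a x) ⟶ listSum Q (D.a y)) :=
      Module.Finite.of_basis (h.matBasis _ _)
    have : Module.Finite K (listSum Q (D.b x) ⟶ listSum Q (D.b y)) :=
      Module.Finite.of_basis (h.matBasis _ _)
    F.basis_of_squares (x := x) (y := y) (homZero_listSum h _ _ one_ne_zero)
      (homZero_listSum h _ _ (by norm_num)) (span_slotHom h _ _)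
      (fun i => G_wordHom hR h F hcomm (Γ'.isPath_of_mem_bas (List.get_mem (Γ'.bas x y) i)))
      (linearIndependent_of_basisCheck hR h (hb x y)) (cobRows_of_basisCheck hR h (hb x y)).1
      (finrank_of_basisCheck hR h (hb x y))
  { β := wordHom Γ' (arrowHom h F)
    nil := wordHom_nil Γ' _
    zero := wordHom_zero Γ' _
    mul := fun x y z u v hu _ => wordHom_mul Γ' _ x y z u v hu
    rule := by
      intro r hr' x y hp
      obtain ⟨r, hr'', rfl⟩ := List.mem_map.1 hr'
      refine (wordHom_rule hR h F hcomm (hr x y r hr'') hp).trans ?_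
      rw [evalL, List.map_map]
      rfl
    indep := fun x y => (key x y).1
    span := fun x y => (key x y).2.1
    vanish := fun x y k hk => F.homZero (fun k hk => homZero_listSum h _ _ hk)
      (fun k hk => homZero_listSum h _ _ hk) (fun k hk => homZero_listSum h _ _ hk)
      (fun k hk => homZero_listSum h _ _ hk)
      (fun r => by
        obtain ⟨z, hz⟩ := LinearMap.range_eq_top.1 (cobRows_of_basisCheck hR h (hb x y)).1 r
        exact ⟨z.1, z.2, hz.symm⟩) (key x y).2.2 k hk }

end MutData

section MkMut

variable {K : Type w} [Field K] {C : Type u} [Category.{v} C] [Preadditive C] [Linear K C]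
  [HasZeroObject C] [HasShift C ℤ] [∀ n : ℤ, (shiftFunctor C n).Additive]
  [∀ n : ℤ, (shiftFunctor C n).Linear K] [Pretriangulated C] {n : ℕ}
  {α : Type} {R : Coef α} {ev : α → K} {rules : List (Word × LC α)} {Γ : Quiv n}
  {Q : Fin n → C} (h : HasType K Γ (mapRules ev rules) Q)

/-- The cones of the maps defined by mutation data form a mutation. -/
lemma isMutation_of_fillSystem {D : MutData α n} (F : FillSystem K (D.map h)) {i : Fin n}
    (ha : ∀ x, ∀ c ∈ D.a x, c = i) (hb : ∀ x, ∀ c ∈ D.b x, c ≠ i)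
    (ho : ∀ c, c ≠ i → ∃ y, D.a y = [] ∧ D.b y = [c]) (hn : ∃ x, D.a x = [i]) :
    IsMutation Q F.X i D.a D.b where
  tri x := ⟨_, _, _, F.dist x⟩
  src := ha
  tgt := hb
  old c hc := by
    obtain ⟨y, h₁, h₂⟩ := ho c hc
    refine ⟨y, ⟨?_⟩⟩
    have hz : IsZero (listSum Q (D.a y)) := by
      rw [h₁]
      rw [IsZero.iff_id_eq_zero]
      exact biproduct.hom_ext _ _ fun s => s.elim0
    have hiso : IsIso (F.g y) :=
      (Triangle.isZero₁_iff_isIso₂ _ (F.dist y)).1 hz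
    refine (asIso (F.g y)).symm ≪≫ eqToIso (by rw [h₂]) ≪≫
      (?_ : listSum Q [c] ≅ Q c)
    letI : Unique (Fin [c].length) := inferInstanceAs (Unique (Fin 1))
    exact biproductUniqueIso fun s : Fin [c].length => Q ([c].get s)
  new := hn

end MkMut

/-! ### Tables of mutations -/

/-- The data of one mutation: the index of the new type, the renumbering of the vertices, the
approximation, and the images of the arrows. -/
structure MutEntry (α : Type) (n m : ℕ) where
  /-- the new type -/
  nxt : Fin m
  /-- the renumbering -/
  perm : List (Fin n)
  /-- the left approximation -/
  app : List (Fin n × Word)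
  /-- source components of the images of the arrows -/
  p : List (LC α)
  /-- target components of the images of the arrows -/
  q : List (List (List (LC α)))
  /-- the rewriting rules of the new type -/
  rules : List (Word × LC α)

/-- A finite collection of types closed under mutation. -/
structure MutTable (α : Type) (n m : ℕ) where
  /-- the quivers -/
  Γ : Fin m → Quiv n
  /-- the rewriting rules -/
  rules : Fin m → List (Word × LC α)
  /-- weights of arrows -/
  wt : Fin m → ℕ → ℕ
  /-- a multiple of the inverse Cartan matrix -/
  inv : Fin m → Fin n → Fin n → ℤ
  /-- the mutations -/
  edge : Fin m → Fin n → MutEntry α n m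

/-- The sum of a family of integers. -/
def sumF {n : ℕ} (f : Fin n → ℤ) : ℤ := (List.finRange n).foldr (fun i s => Int.add (f i) s) 0

lemma sumF_eq {n : ℕ} (f : Fin n → ℤ) : sumF f = ∑ i, f i := by
  rw [Fin.sum_univ_def, sumF, List.sum_eq_foldr, List.foldr_map]
  rfl

/-- The sum of a function over a list. -/
def sumOver {ι : Type} (l : List ι) (f : ι → ℤ) : ℤ := l.foldr (fun i s => Int.add (f i) s) 0

/-- Test for non-positive integers. -/
def nonpos : ℤ → Bool
  | Int.ofNat k => Nat.beq k 0
  | Int.negSucc _ => true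

lemma nonpos_iff {z : ℤ} : nonpos z = true ↔ z ≤ 0 := by
  cases z with
  | ofNat k => simp [nonpos]
  | negSucc k => simp [nonpos, Int.negSucc_le_zero]

/-- Equality test for integers. -/
def zeq : ℤ → ℤ → Bool
  | Int.ofNat k, Int.ofNat l => Nat.beq k l
  | Int.negSucc k, Int.negSucc l => Nat.beq k l
  | _, _ => false

lemma eq_of_zeq {x y : ℤ} (h : zeq x y = true) : x = y := by
  cases x <;> cases y
  · exact congrArg Int.ofNat (Nat.eq_of_beq_eq_true h)
  · cases h
  · cases h
  · exact congrArg Int.negSucc (Nat.eq_of_beq_eq_true h)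

/-- Equality test for lists of integers. -/
def zseq : List ℤ → List ℤ → Bool
  | [], [] => true
  | x :: l, y :: l' => match zeq x y with
    | true => zseq l l'
    | false => false
  | _, _ => false

lemma eq_of_zseq : ∀ {l l' : List ℤ}, zseq l l' = true → l = l'
  | [], [], _ => rfl
  | x :: l, y :: l', h => by
    rw [zseq] at h
    split at h
    · rename_i h'
      rw [eq_of_zeq h', eq_of_zseq h]
    · cases h
  | [], _ :: _, h => by cases h
  | _ :: _, [], h => by cases h

namespace MutTable

variable {α : Type} {n m : ℕ} (T : MutTable α n m) (R : Coef α)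

/-- The mutation data of an entry. -/
def D (s : Fin m) (i : Fin n) : MutData α n :=
  mkMut i (fun x => (T.edge s i).perm.getD x.1 i) R (T.edge s i).app (T.edge s i).p (T.edge s i).q

/-- The matrix of the action of a mutation on coordinates. -/
def actMat (s : Fin m) (i y d : Fin n) : ℤ :=
  match (T.edge s i).perm.getD y.1 i with
  | c => match Nat.beq c.1 i.1 with
    | true => match Nat.beq d.1 i.1 with
      | true => -1
      | false => 0
    | false => match Nat.beq d.1 c.1 with
      | true => 1
      | false => match Nat.beq d.1 i.1 with
        | true => sumOver (T.edge s i).app fun z => match Nat.beq z.1.1 c.1 with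
          | true => 1
          | false => 0
        | false => 0

/-- The combinatorial mutation system of a table. -/
def system : MutSystem n (Fin m) where
  cart s a b := ((T.Γ s).bas a b).length
  nxt s i := (T.edge s i).nxt
  src s i := (T.D R s i).a
  tgt s i := (T.D R s i).b
  act s i v y := sumF fun d => Int.mul (T.actMat s i y d) (v d)

/-- The Cartan matrix is invertible. -/
def invCheck (s : Fin m) : Bool :=
  (List.finRange n).all fun a => (List.finRange n).all fun b =>
    match sumF fun c => Int.mul (T.inv s a c) (Int.ofNat ((T.Γ s).bas c b).length) with
    | z => match Nat.beq a.1 b.1 with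
      | true => !zeq z 0
      | false => zeq z 0

/-- The mutation acts on coordinates by the given matrix. -/
def actCheck (s : Fin m) (i : Fin n) : Bool :=
  (List.finRange n).all fun x => (List.finRange n).all fun d =>
    zeq (sumF fun y => Int.mul (Int.ofNat ((T.Γ (T.edge s i).nxt).bas x y).length)
        (T.actMat s i y d))
      (Int.sub (sumOver ((T.D R s i).b x) fun c => Int.ofNat ((T.Γ s).bas c d).length)
        (sumOver ((T.D R s i).a x) fun c => Int.ofNat ((T.Γ s).bas c d).length))

/-- Insertion into a list without duplicates. -/
def insState (s : Fin m) (v : List ℤ) : List (Fin m × List ℤ) → List (Fin m × List ℤ)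
  | [] => [(s, v)]
  | t :: L => match Nat.beq s.1 t.1.1 && zseq v t.2 with
    | true => t :: L
    | false => t :: insState s v L

lemma mem_insState {s : Fin m} {v : List ℤ} {L : List (Fin m × List ℤ)} {t : Fin m × List ℤ}
    (h : t = (s, v) ∨ t ∈ L) : t ∈ insState s v L := by
  induction L with
  | nil =>
    rcases h with rfl | h
    · exact List.mem_cons_self
    · cases h
  | cons t' L ih =>
    rw [insState]
    split
    · rename_i h'
      rw [Bool.and_eq_true] at h'
      rcases h with rfl | h
      · have : (s, v) = t' :=
          Prod.ext (Fin.ext (Nat.eq_of_beq_eq_true h'.1)) (eq_of_zseq h'.2)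
        rw [this]
        exact List.mem_cons_self
      · exact h
    · rcases h with h | h
      · exact List.mem_cons_of_mem _ (ih (Or.inl h))
      · rcases List.mem_cons.1 h with rfl | h
        · exact List.mem_cons_self
        · exact List.mem_cons_of_mem _ (ih (Or.inr h))

/-- The coordinates stored in a list. -/
def ofList (v : List ℤ) (x : Fin n) : ℤ := v.getD x.1 0

/-- The states reached from a list of states by mutations at non-positive coordinates. -/
def stepStates (L : List (Fin m × List ℤ)) : List (Fin m × List ℤ) :=
  L.foldr (fun t acc => (List.finRange n).foldr (fun i acc => match nonpos (ofList t.2 i) with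
    | true => insState (T.edge t.1 i).nxt
        ((List.finRange n).map fun y => sumF fun d => Int.mul (T.actMat t.1 i y d)
          (ofList t.2 d)) acc
    | false => acc) acc) []

/-- All mutation sequences stop. -/
def stopCheck : ℕ → List (Fin m × List ℤ) → Bool
  | 0, L => match L with
    | [] => true
    | _ :: _ => false
  | N + 1, L => stopCheck N (T.stepStates L)

lemma mem_stepStates {L : List (Fin m × List ℤ)} {t : Fin m × List ℤ} (ht : t ∈ L) {i : Fin n}
    (hi : nonpos (ofList t.2 i) = true) : ((T.edge t.1 i).nxt, (List.finRange n).map fun y =>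
      sumF fun d => Int.mul (T.actMat t.1 i y d) (ofList t.2 d)) ∈ T.stepStates L := by
  have inner : ∀ (t' : Fin m × List ℤ) (I : List (Fin n)) (acc : List (Fin m × List ℤ))
      (z : Fin m × List ℤ), (z ∈ acc ∨ ∃ j ∈ I, nonpos (ofList t'.2 j) = true ∧
        z = ((T.edge t'.1 j).nxt, (List.finRange n).map fun y =>
          sumF fun d => Int.mul (T.actMat t'.1 j y d) (ofList t'.2 d))) →
      z ∈ I.foldr (fun i acc => match nonpos (ofList t'.2 i) with
        | true => insState (T.edge t'.1 i).nxt
            ((List.finRange n).map fun y => sumF fun d => Int.mul (T.actMat t'.1 i y d)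
              (ofList t'.2 d)) acc
        | false => acc) acc := by
    intro t' I acc z hz
    induction I with
    | nil =>
      rcases hz with hz | ⟨j, hj, -⟩
      · exact hz
      · cases hj
    | cons k I ih =>
      rw [List.foldr_cons]
      split
      · rename_i hk
        rcases hz with hz | ⟨j, hj, hj', hz⟩
        · exact mem_insState (Or.inr (ih (Or.inl hz)))
        · rcases List.mem_cons.1 hj with rfl | hj
          · exact mem_insState (Or.inl hz)
          · exact mem_insState (Or.inr (ih (Or.inr ⟨j, hj, hj', hz⟩)))
      · rename_i hk
        rcases hz with hz | ⟨j, hj, hj', hz⟩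
        · exact ih (Or.inl hz)
        · rcases List.mem_cons.1 hj with rfl | hj
          · rw [hk] at hj'; cases hj'
          · exact ih (Or.inr ⟨j, hj, hj', hz⟩)
  induction L with
  | nil => cases ht
  | cons t' L ih =>
    rw [stepStates, List.foldr_cons]
    refine inner _ _ _ _ ?_
    rcases List.mem_cons.1 ht with rfl | ht
    · exact Or.inr ⟨i, List.mem_finRange i, hi, rfl⟩
    · exact Or.inl (ih ht)

lemma stops_of_stopCheck {N : ℕ} {L : List (Fin m × List ℤ)} (h : T.stopCheck N L = true)
    {t : Fin m × List ℤ} (ht : t ∈ L) : (T.system R).Stops N t.1 (ofList t.2) := by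
  induction N generalizing L t with
  | zero =>
    cases L with
    | nil => cases ht
    | cons _ _ => cases h
  | succ N ih =>
    intro i hi
    have := ih h (T.mem_stepStates ht (nonpos_iff.2 hi))
    have e : (T.system R).act t.1 i (ofList t.2) = ofList ((List.finRange n).map fun y =>
        sumF fun d => Int.mul (T.actMat t.1 i y d) (ofList t.2 d)) := by
      funext y
      simp [ofList, system]
    rw [e]
    exact this

/-- Verification of a type. -/
def typeCheck (s : Fin m) : Bool :=
  HasType.wtCheck (T.Γ s) R (T.rules s) (T.wt s) 20 && T.invCheck s &&
    T.stopCheck 15 [(s, List.replicate n (-1))]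

/-- Verification of a mutation. -/
def edgeCheck (s : Fin m) (i : Fin n) : Bool :=
  (T.D R s i).check (T.Γ s) R (T.rules s) (T.Γ (T.edge s i).nxt) (T.edge s i).rules 12 &&
  T.actCheck R s i &&
  (List.finRange n).all (fun c => (List.finRange n).any fun y =>
    Nat.beq ((T.edge s i).perm.getD y.1 i).1 c.1) &&
  (T.edge s i).app.all (fun z => !Nat.beq z.1.1 i.1) &&
  Nat.ble (n + (T.edge s i).p.length) 12 && Nat.ble (n + (T.edge s i).q.length) 12

/-- Verification of a table. -/
def check : Bool :=
  (List.finRange m).all fun s => T.typeCheck R s && (List.finRange n).all fun i => T.edgeCheck R s i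

variable {T R}

lemma hinj_of_check (h : T.check R = true) (s : Fin m) (v : Fin n → ℤ)
    (hv : ∀ a, ∑ b, ((T.system R).cart s a b : ℤ) * v b = 0) : v = 0 := by
  simp only [check, typeCheck, Bool.and_eq_true, List.all_eq_true, invCheck] at h
  have h := (h s (List.mem_finRange s)).1.1.2
  have key : ∀ a b, ∑ c, T.inv s a c * (((T.Γ s).bas c b).length : ℤ) =
      if a = b then ∑ c, T.inv s a c * (((T.Γ s).bas c a).length : ℤ) else 0 := fun a b => by
    by_cases e : a = b
    · subst e; rw [if_pos rfl]
    · have := h a (List.mem_finRange a) b (List.mem_finRange b)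
      split at this
      · rename_i h'
        exact absurd (Fin.ext (Nat.eq_of_beq_eq_true h')) e
      · rw [if_neg e]
        exact (sumF_eq _).symm.trans (eq_of_zeq this)
  have hne : ∀ a, ∑ c, T.inv s a c * (((T.Γ s).bas c a).length : ℤ) ≠ 0 := fun a => by
    have := h a (List.mem_finRange a) a (List.mem_finRange a)
    split at this
    · intro h0
      rw [show (sumF fun c => Int.mul (T.inv s a c) (Int.ofNat ((T.Γ s).bas c a).length)) = 0 from
        (sumF_eq _).trans h0] at this
      cases this
    · rename_i h'
      rw [Nat.beq_refl] at h'
      cases h'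
  funext a
  have h₁ : ∑ c, T.inv s a c * ∑ b, (((T.Γ s).bas c b).length : ℤ) * v b = 0 :=
    Finset.sum_eq_zero fun c _ => by
      rw [show ∑ b, (((T.Γ s).bas c b).length : ℤ) * v b = 0 from hv c, mul_zero]
  simp only [Finset.mul_sum] at h₁
  rw [Finset.sum_comm] at h₁
  have h₂ : ∑ b, (∑ c, T.inv s a c * (((T.Γ s).bas c b).length : ℤ)) * v b = 0 := by
    rw [← h₁]
    refine Finset.sum_congr rfl fun b _ => ?_
    rw [Finset.sum_mul]
    exact Finset.sum_congr rfl fun c _ => mul_assoc _ _ _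
  rw [Finset.sum_congr rfl fun b _ => congrArg (· * v b) (key a b)] at h₂
  simp only [ite_mul, zero_mul, Finset.sum_ite_eq, Finset.mem_univ, if_true] at h₂
  exact (mul_eq_zero.1 h₂).resolve_left (hne a)

lemma hact_of_check (h : T.check R = true) (s : Fin m) (i : Fin n) (v : Fin n → ℤ) (x : Fin n) :
    ∑ y, ((T.system R).cart ((T.system R).nxt s i) x y : ℤ) * (T.system R).act s i v y =
      (((T.system R).tgt s i x).map fun c => ∑ d, ((T.system R).cart s c d : ℤ) * v d).sum -
      (((T.system R).src s i x).map fun c => ∑ d, ((T.system R).cart s c d : ℤ) * v d).sum := by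
  simp only [check, edgeCheck, Bool.and_eq_true, List.all_eq_true, actCheck] at h
  have h := fun d => eq_of_zeq
    (((h s (List.mem_finRange s)).2 i (List.mem_finRange i)).1.1.1.1.2 x (List.mem_finRange x) d
      (List.mem_finRange d))
  have lin : ∀ L : List (Fin n), (L.map fun c => ∑ d, ((T.system R).cart s c d : ℤ) * v d).sum =
      ∑ d, sumOver L (fun c => Int.ofNat ((T.Γ s).bas c d).length) * v d := fun L => by
    induction L with
    | nil => simp [sumOver]
    | cons c L ih =>
      rw [List.map_cons, List.sum_cons, ih, ← Finset.sum_add_distrib]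
      exact Finset.sum_congr rfl fun d _ => (add_mul _ _ _).symm
  rw [lin, lin, ← Finset.sum_sub_distrib]
  simp only [← sub_mul]
  change ∑ y, (((T.Γ (T.edge s i).nxt).bas x y).length : ℤ) *
    (sumF fun d => T.actMat s i y d * v d) = _
  simp only [sumF_eq, Finset.mul_sum]
  rw [Finset.sum_comm]
  refine Finset.sum_congr rfl fun d _ => ?_
  simp only [← mul_assoc]
  rw [← Finset.sum_mul]
  congr 1
  exact (sumF_eq _).symm.trans (h d)

section

variable {K : Type w} [Field K] {V : Type u} [Category.{v} V] [Preadditive V] [HasZeroObject V]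
  [HasBinaryBiproducts V] [Linear K V]

lemma getD_replicate_append {β : Type} (n N k : ℕ) (d : β) (l : List β) (h : n + l.length ≤ N)
    (hk : N ≤ k) : (List.replicate n d ++ l).getD k d = d := by
  rw [List.getD_eq_getElem?_getD, List.getElem?_eq_none (by simp; omega)]
  rfl

/-- A verified table of mutations bounds the number of presilting objects. -/
theorem finIso {Θ : Type w} (ev : Θ → α → K) (hev : ∀ θ, R.IsEval (ev θ))
    (h : T.check R = true) (hsub : ∀ s i θ, ∃ θ', mapRules (ev θ) (T.edge s i).rules =
      mapRules (ev θ') (T.rules (T.edge s i).nxt)) (l : ℕ) {s : Fin m} {θ : Θ}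
    {Q : Fin n → HomotopyCategory V (ComplexShape.up ℤ)}
    (hQ : HasType K (T.Γ s) (mapRules (ev θ) (T.rules s)) Q) :
    FinIso fun X => Below K Q l X ∧ IsPresiltingObj X ∧ IsBasicObj X := by
  refine finIso_of_mutSystem (T.system R)
    (fun s Q => ∃ θ, Nonempty (HasType K (T.Γ s) (mapRules (ev θ) (T.rules s)) Q))
    ?_ ?_ (hinj_of_check h) ?_ (hact_of_check h) ?_ l s Q ⟨θ, ⟨hQ⟩⟩
  · rintro s Q ⟨θ, ⟨hQ⟩⟩
    simp only [check, typeCheck, Bool.and_eq_true, List.all_eq_true] at h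
    exact ⟨hQ.tiltingFamily (hev θ) (h s (List.mem_finRange s)).1.1.1⟩
  · rintro s Q ⟨θ, ⟨hQ⟩⟩ a b
    exact hQ.finrank_eq a b
  · rintro s Q ⟨θ, ⟨hQ⟩⟩ i
    simp only [check, edgeCheck, Bool.and_eq_true, List.all_eq_true, List.any_eq_true] at h
    obtain ⟨⟨⟨⟨⟨hc, -⟩, hs⟩, ha⟩, hp⟩, hq⟩ := (h s (List.mem_finRange s)).2 i (List.mem_finRange i)
    have hs : ∀ c, ∃ y : Fin n, (T.edge s i).perm.getD y.1 i = c := fun c => by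
      obtain ⟨y, -, hy⟩ := hs c (List.mem_finRange c)
      exact ⟨y, Fin.ext (Nat.eq_of_beq_eq_true hy)⟩
    let F := homotopyFillSystem K ((T.D R s i).map hQ)
    obtain ⟨θ', hθ⟩ := hsub s i θ
    refine ⟨F.X, ⟨θ', ⟨hθ ▸ MutData.hasType (hev θ) hQ F hc (fun k hk x y _ _ => ?_)
      (fun k hk x y _ _ => ?_)⟩⟩, isMutation_of_fillSystem hQ F (i := i) ?_ ?_ ?_ ?_⟩
    · exact getD_replicate_append n 12 k [] _ (Nat.le_of_ble_eq_true hp) hk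
    · change List.getD (List.getD (List.getD _ _ _) _ _) _ _ = _
      rw [getD_replicate_append n 12 k [] _ (Nat.le_of_ble_eq_true hq) hk]
      rfl
    · intro x c hc
      change c ∈ (match Nat.beq _ _ with | true => [i] | false => []) at hc
      split at hc
      · exact List.mem_singleton.1 hc
      · cases hc
    · rintro x c hc rfl
      change c ∈ (match Nat.beq ((T.edge s c).perm.getD x.1 c).1 c.1 with
        | true => (T.edge s c).app.map Prod.fst | false => [(T.edge s c).perm.getD x.1 c]) at hc
      split at hc
      · obtain ⟨z, hz, rfl⟩ := List.mem_map.1 hc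
        have := ha z hz
        rw [Nat.beq_refl] at this
        cases this
      · rename_i h'
        rw [← List.mem_singleton.1 hc, Nat.beq_refl] at h'
        cases h'
    · intro c hc
      obtain ⟨y, hy⟩ := hs c
      have hne : Nat.beq c.1 i.1 = false := by
        rw [Bool.eq_false_iff]
        exact fun e => hc (Fin.ext (Nat.eq_of_beq_eq_true e))
      refine ⟨y, ?_, ?_⟩
      · change (match Nat.beq ((T.edge s i).perm.getD y.1 i).1 i.1 with
          | true => [i] | false => []) = _
        rw [hy, hne]
      · change (match Nat.beq ((T.edge s i).perm.getD y.1 i).1 i.1 with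
          | true => (T.edge s i).app.map Prod.fst | false => [(T.edge s i).perm.getD y.1 i]) = _
        rw [hy, hne]
    · obtain ⟨y, hy⟩ := hs i
      refine ⟨y, ?_⟩
      change (match Nat.beq ((T.edge s i).perm.getD y.1 i).1 i.1 with
          | true => [i] | false => []) = _
      rw [hy, Nat.beq_refl]
  · intro s
    simp only [check, typeCheck, Bool.and_eq_true, List.all_eq_true] at h
    have := T.stops_of_stopCheck R (h s (List.mem_finRange s)).1.2 List.mem_cons_self
    refine ⟨15, ?_⟩
    convert this using 1
    funext x
    simp [ofList]

end

end MutTable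

/-! ### The mutation tables with integer coefficients -/

/-- The quiver of `A3` and a basis. -/
def quivA3 : Quiv 4 where
  src k := [0,0,0,0,0,1,1,2,1,3].getD k 0
  tgt k := [0,0,0,0,1,0,2,1,3,1].getD k 0
  basis := [[4],[5],[6],[7],[8],[9],[4,6],[4,8],[5,4],[6,7],[7,5],[7,8],[9,5],[9,6],[4,6,7],
    [5,4,6],[5,4,8],[6,7,5],[7,5,4],[9,5,4],[4,6,7,5],[5,4,6,7],[7,5,4,6],[9,5,4,8]]

/-- Rewriting rules for `A3`. -/
def rulesA3 : List (Word × LC ℤ) :=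
  [([4,5],[]),([7,6],[]),([8,9],[(-1,[6,7]),(-1,[5,4])]),([9,8],[]),([6,7,8],[(-1,[5,4,8])]),
    ([9,6,7],[(-1,[9,5,4])]),([6,7,5,4],[(-1,[5,4,6,7])]),([7,5,4,8],[]),([9,5,4,6],[]),
    ([5,4,6,7,5],[]),([7,5,4,6,7],[])]

/-- The mutations of `A3`. -/
def edgeA3 (i : Fin 4) : MutEntry ℤ 4 1 :=
  match i.1 with
  | 0 => ⟨0, [0,1,2,3], [(1,[4])], [[],[],[],[],[],[]],
    [[[[(1,[5,4])]]],[[[(1,[])]]],[[[(1,[6])]]],[[[(1,[7])]]],[[[(1,[8])]]],[[[(1,[9])]]]],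
     rulesA3⟩
  | 1 => ⟨0, [0,1,2,3], [(0,[5]),(2,[6]),(3,[8])], [[],[],[],[],[],[]],
    [[[[(1,[])],[],[]]],[[[]],[[(1,[7,5])]],[[(1,[9,5])]]],[[[(1,[4,6])]],[[]],[[(1,[9,6])]]],
    [[[],[(1,[])],[]]],[[[(1,[4,8])]],[[(1,[7,8])]],[[]]],[[[],[],[(1,[])]]]], rulesA3⟩
  | 2 => ⟨0, [0,1,2,3], [(1,[7])], [[],[],[],[],[],[]],
    [[[[(1,[4])]]],[[[(1,[5])]]],[[[(1,[])]]],[[[(1,[6,7])]]],[[[(1,[8])]]],[[[(1,[9])]]]],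
     rulesA3⟩
  | _ => ⟨0, [0,1,2,3], [(1,[9])], [[],[],[],[],[],[]],
    [[[[(1,[4])]]],[[[(1,[5])]]],[[[(1,[6])]]],[[[(1,[7])]]],[[[(1,[])]]],[[[(-1,[5,4]),
    (-1,[6,7])]]]], rulesA3⟩

/-- The mutation table of `A3`. -/
def tableA : MutTable ℤ 4 1 where
  Γ _ := quivA3
  rules _ := rulesA3
  wt _ _ := 1
  inv _ a b := ([[2,-1,0,0],[-1,2,-1,-1],[0,-1,2,0],[0,-1,0,2]].getD a.1 []).getD b.1 0
  edge _ i := edgeA3 i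

set_option maxRecDepth 100000 in
lemma tableA_check : tableA.check intCoef = true := by decide +kernel

/-- The quiver of `A4` and a basis. -/
def quivA4 : Quiv 4 where
  src k := [0,0,0,0,0,1,1,2,1,3].getD k 0
  tgt k := [0,0,0,0,1,0,2,1,3,1].getD k 0
  basis := [[4],[5],[6],[7],[8],[9],[4,6],[4,8],[5,4],[6,7],[7,5],[7,6],[9,5],[9,8],[4,6,7],
    [5,4,6],[5,4,8],[6,7,5],[7,5,4],[9,5,4],[4,6,7,5],[5,4,6,7],[7,5,4,6],[9,5,4,8]]

/-- Rewriting rules for `A4`. -/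
def rulesA4 : List (Word × LC ℤ) :=
  [([4,5],[]),([7,8],[]),([8,9],[(-1,[6,7]),(-1,[5,4])]),([9,6],[]),([6,7,6],[(-1,[5,4,6])]),
    ([7,6,7],[(-1,[7,5,4])]),([6,7,5,4],[(1,[5,4,6,7])]),([7,5,4,8],[]),([9,5,4,6],[]),
    ([5,4,6,7,5],[]),([7,5,4,6,7],[])]

/-- The quiver of `A7` and a basis. -/
def quivA7 : Quiv 4 where
  src k := [0,0,0,0,0,1,1,2,2,3].getD k 0
  tgt k := [0,0,0,0,1,0,2,1,3,2].getD k 0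
  basis := [[4],[5],[6],[7],[8],[9],[4,5],[4,6],[5,4],[6,8],[7,5],[7,6],[9,7],[9,8],[4,5,4],
    [5,4,5],[5,4,6],[7,5,4],[7,6,8],[9,7,6],[4,5,4,5],[5,4,5,4],[7,5,4,6],[9,7,6,8]]

/-- Rewriting rules for `A7`. -/
def rulesA7 : List (Word × LC ℤ) :=
  [([6,7],[(1,[5,4])]),([8,9],[(1,[7,6])]),([4,6,8],[]),([9,7,5],[]),([4,5,4,6],[]),([7,5,4,5],
    []),([4,5,4,5,4],[]),([5,4,5,4,5],[])]

/-- The quiver of `A8` and a basis. -/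
def quivA8 : Quiv 4 where
  src k := [0,0,0,0,0,1,2,3,0,2].getD k 0
  tgt k := [0,0,0,0,1,2,3,0,2,0].getD k 0
  basis := [[4],[5],[6],[7],[8],[9],[4,5],[5,9],[6,7],[7,8],[8,6],[8,9],[9,4],[9,8],[4,5,9],
    [5,9,4],[6,7,8],[7,8,6]]

/-- Rewriting rules for `A8`. -/
def rulesA8 : List (Word × LC ℤ) :=
  [([5,6],[]),([7,4],[]),([5,9,8],[]),([7,8,9],[]),([8,9,4],[]),([8,9,8],[(1,[4,5])]),([9,8,6],
    []),([9,8,9],[(1,[6,7])]),([8,6,7],[(1,[4,5,9])]),([9,4,5],[(1,[6,7,8])]),([4,5,9,4],[]),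
    ([6,7,8,6],[])]

/-- The quiver of `A9` and a basis. -/
def quivA9 : Quiv 4 where
  src k := [0,0,0,0,0,1,2,2,3,3].getD k 0
  tgt k := [0,0,0,0,1,2,1,3,2,0].getD k 0
  basis := [[4],[5],[6],[7],[8],[9],[4,5],[5,6],[5,7],[6,5],[7,9],[8,6],[8,7],[4,5,7],[5,6,5],
    [5,7,9],[6,5,6],[6,5,7],[8,6,5],[4,5,7,9],[5,6,5,6],[6,5,6,5],[8,6,5,7]]

/-- Rewriting rules for `A9`. -/
def rulesA9 : List (Word × LC ℤ) :=
  [([7,8],[(1,[6,5])]),([9,4],[(1,[8,6])]),([4,5,6],[]),([8,7,9],[]),([5,6,5,7],[]),([6,5,7,9],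
    []),([8,6,5,6],[]),([5,6,5,6,5],[]),([6,5,6,5,6],[])]

/-- The quiver of `A10` and a basis. -/
def quivA10 : Quiv 4 where
  src k := [0,0,0,0,0,1,1,2,3].getD k 0
  tgt k := [0,0,0,0,1,0,2,3,1].getD k 0
  basis := [[4],[5],[6],[7],[8],[4,6],[5,4],[6,7],[7,8],[8,5],[8,6],[4,6,7],[5,4,6],[6,7,8],
    [7,8,5],[7,8,6],[8,5,4],[8,6,7],[4,6,7,8],[5,4,6,7],[6,7,8,5],[7,8,5,4],[7,8,6,7],[8,5,4,6],
    [4,6,7,8,5],[5,4,6,7,8],[7,8,5,4,6],[8,5,4,6,7]]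

/-- Rewriting rules for `A10`. -/
def rulesA10 : List (Word × LC ℤ) :=
  [([4,5],[]),([6,7,8,6],[(1,[5,4,6])]),([8,6,7,8],[(1,[8,5,4])]),([6,7,8,5,4],[(1,[5,4,6,7,8])]),
    ([5,4,6,7,8,5],[]),([8,5,4,6,7,8],[]),([7,8,5,4,6,7],[])]

/-- The quiver of `A11` and a basis. -/
def quivA11 : Quiv 4 where
  src k := [0,0,0,0,0,1,1,2,2,3].getD k 0
  tgt k := [0,0,0,0,1,0,2,1,3,2].getD k 0
  basis := [[4],[5],[6],[7],[8],[9],[4,6],[5,4],[6,7],[7,5],[7,6],[8,9],[9,8],[4,6,7],[5,4,6],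
    [6,7,5],[7,5,4],[4,6,7,5],[5,4,6,7]]

/-- Rewriting rules for `A11`. -/
def rulesA11 : List (Word × LC ℤ) :=
  [([4,5],[]),([6,8],[]),([9,7],[]),([6,7,6],[(1,[5,4,6])]),([7,6,7],[(1,[7,5,4])]),([6,7,5,4],
    [(1,[5,4,6,7])]),([7,5,4,6],[(1,[8,9])]),([8,9,8],[]),([9,8,9],[]),([5,4,6,7,5],[])]

/-- The mutations of `A4`. -/
def edgeA4 (i : Fin 4) : MutEntry ℤ 4 6 :=
  match i.1 with
  | 0 => ⟨0, [0,1,2,3], [(1,[4])], [[],[],[],[],[],[]],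
    [[[[(1,[5,4])]]],[[[(1,[])]]],[[[(1,[6])]]],[[[(1,[7])]]],[[[(1,[8])]]],[[[(1,[9])]]]],
     rulesA4⟩
  | 1 => ⟨0, [0,1,2,3], [(0,[5]),(2,[6]),(3,[8])], [[],[],[],[],[],[]],
    [[[[(1,[])],[],[]]],[[[]],[[(1,[7,5])]],[[(1,[9,5])]]],[[[(1,[4,6])]],[[(1,[7,6])]],[[]]],
    [[[],[(1,[])],[]]],[[[(1,[4,8])]],[[]],[[(1,[9,8])]]],[[[],[],[(1,[])]]]], rulesA4⟩
  | 2 => ⟨4, [0,1,2,3], [(1,[7])], [[],[],[],[],[]],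
    [[[[(1,[4])]]],[[[(1,[5])]]],[[[(1,[])]]],[[[(1,[8])]]],[[[(-1,[9])]]]], rulesA10⟩
  | _ => ⟨4, [0,1,3,2], [(1,[9])], [[],[],[],[],[]],
    [[[[(1,[4])]]],[[[(1,[5])]]],[[[(1,[])]]],[[[(1,[6])]]],[[[(-1,[7])]]]], rulesA10⟩

/-- The mutations of `A7`. -/
def edgeA7 (i : Fin 4) : MutEntry ℤ 4 6 :=
  match i.1 with
  | 0 => ⟨3, [0,3,2,1], [(1,[4])], [[],[],[],[],[],[]],
    [[[[(1,[6,8])]]],[[[(1,[9])]]],[[[(1,[8])]]],[[[(1,[7])]]],[[[(1,[6])]]],[[[(1,[])]]]],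
     rulesA9⟩
  | 1 => ⟨1, [0,1,2,3], [(0,[5]),(2,[6])], [[],[],[],[],[],[]],
    [[[[(1,[])],[]]],[[[(1,[4,5])]],[[(-1,[7,5])]]],[[[(1,[4,6])]],[[(-1,[7,6])]]],[[[],
    [(-1,[])]]],[[[(1,[8])]]],[[[(1,[9])]]]], rulesA7⟩
  | 2 => ⟨1, [0,1,2,3], [(1,[7]),(3,[8])], [[],[],[],[],[],[]],
    [[[[(1,[4])]]],[[[(1,[5])]]],[[[(1,[])],[]]],[[[(1,[5,4])]],[[(-1,[9,7])]]],[[[(1,[6,8])]],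
    [[(-1,[9,8])]]],[[[],[(-1,[])]]]], rulesA7⟩
  | _ => ⟨3, [3,0,1,2], [(2,[9])], [[],[],[],[],[],[]],
    [[[[(1,[7,5])]]],[[[(1,[4])]]],[[[(1,[5])]]],[[[(1,[6])]]],[[[(1,[7])]]],[[[(1,[])]]]],
     rulesA9⟩

/-- The mutations of `A8`. -/
def edgeA8 (i : Fin 4) : MutEntry ℤ 4 6 :=
  match i.1 with
  | 0 => ⟨5, [1,0,2,3], [(1,[4]),(2,[8])], [[],[],[],[],[],[]],
    [[[[(1,[])],[]]],[[[]],[[(1,[9,4])]]],[[[(1,[5])]],[[(-1,[9,8])]]],[[[],[(1,[])]]],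
    [[[(1,[6])]]],[[[(1,[7,8])]]]], rulesA11⟩
  | 1 => ⟨3, [3,0,2,1], [(2,[5])], [[],[],[],[],[],[]],
    [[[[(1,[7])]]],[[[(1,[8])]]],[[[(1,[9])]]],[[[(1,[])]]],[[[(1,[9,8])]]],[[[(1,[6])]]]],
     rulesA9⟩
  | 2 => ⟨5, [3,2,0,1], [(0,[9]),(3,[6])], [[],[],[],[],[],[]],
    [[[[],[(1,[])]]],[[[(1,[8,6])]],[[]]],[[[(1,[8,9])]],[[(-1,[7])]]],[[[(-1,[])],[]]],
    [[[(1,[4])]]],[[[(1,[5,9])]]]], rulesA11⟩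
  | _ => ⟨3, [1,2,0,3], [(0,[7])], [[],[],[],[],[],[]],
    [[[[(1,[5])]]],[[[(1,[9])]]],[[[(1,[8])]]],[[[(1,[])]]],[[[(1,[8,9])]]],[[[(1,[4])]]]],
     rulesA9⟩

/-- The mutations of `A9`. -/
def edgeA9 (i : Fin 4) : MutEntry ℤ 4 6 :=
  match i.1 with
  | 0 => ⟨1, [0,1,2,3], [(1,[4])], [[],[],[],[],[],[]],
    [[[[(1,[5,6])]]],[[[(1,[])]]],[[[(1,[5])]]],[[[(1,[6])]]],[[[(1,[7])]]],[[[(1,[8])]]]],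
     rulesA7⟩
  | 1 => ⟨2, [2,1,3,0], [(2,[5])], [[],[],[],[],[],[]],
    [[[[(1,[])]]],[[[(1,[6,5,7])]]],[[[(1,[9])]]],[[[(1,[4,5])]]],[[[(1,[7])]]],[[[(1,[8])]]]],
     rulesA8⟩
  | 2 => ⟨3, [0,1,2,3], [(1,[6]),(3,[7])], [[],[],[],[],[],[]],
    [[[[(1,[4])]]],[[[(1,[])],[]]],[[[(1,[5,6])]],[[(-1,[8,6])]]],[[[(1,[5,7])]],[[(-1,[8,7])]]],
    [[[],[(-1,[])]]],[[[(1,[9])]]]], rulesA9⟩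
  | _ => ⟨4, [0,3,1,2], [(0,[9]),(2,[8])], [[],[],[],[],[]],
    [[[[(1,[])],[]]],[[[]],[[(1,[7,9])]]],[[[(1,[4])]],[[(-1,[6])]]],[[[(1,[5])]]],[[[],
    [(1,[])]]]], rulesA10⟩

/-- The mutations of `A10`. -/
def edgeA10 (i : Fin 4) : MutEntry ℤ 4 6 :=
  match i.1 with
  | 0 => ⟨4, [0,1,2,3], [(1,[4])], [[],[],[],[],[]],
    [[[[(1,[5,4])]]],[[[(1,[])]]],[[[(1,[6])]]],[[[(1,[7])]]],[[[(1,[8])]]]], rulesA10⟩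
  | 1 => ⟨3, [0,1,2,3], [(0,[5]),(2,[6])], [[],[],[],[],[],[]],
    [[[[(1,[])],[]]],[[[(1,[4,6])]],[[(-1,[7,8,6])]]],[[[],[(1,[])]]],[[[(1,[7])]]],
    [[[(-1,[8,6])]]],[[[(1,[8,5])]]]], rulesA9⟩
  | 2 => ⟨5, [0,1,3,2], [(3,[7])], [[],[],[],[],[],[]],
    [[[[(1,[4])]]],[[[(1,[5])]]],[[[(1,[6,7])]]],[[[(1,[8])]]],[[[(1,[])]]],
    [[[(1,[8,5,4,6,7])]]]], rulesA11⟩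
  | _ => ⟨0, [0,1,2,3], [(1,[8])], [[],[],[],[],[],[]],
    [[[[(1,[4])]]],[[[(1,[5])]]],[[[(1,[6])]]],[[[(-1,[7,8])]]],[[[(1,[])]]],[[[(-1,[5,4]),
    (1,[6,7,8])]]]], rulesA4⟩

/-- The mutations of `A11`. -/
def edgeA11 (i : Fin 4) : MutEntry ℤ 4 6 :=
  match i.1 with
  | 0 => ⟨5, [0,1,2,3], [(1,[4])], [[],[],[],[],[],[]],
    [[[[(1,[5,4])]]],[[[(1,[])]]],[[[(1,[6])]]],[[[(1,[7])]]],[[[(1,[8])]]],[[[(1,[9])]]]],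
     rulesA11⟩
  | 1 => ⟨2, [1,3,2,0], [(0,[5]),(2,[6])], [[],[],[],[],[],[]],
    [[[[]],[[(1,[8])]]],[[[(1,[9])]]],[[[(1,[7,5])]]],[[[(1,[])],[]]],[[[(1,[4,6])]],
    [[(-1,[7,6])]]],[[[],[(1,[])]]]], rulesA8⟩
  | 2 => ⟨5, [0,1,2,3], [(1,[7]),(3,[8])], [[],[],[],[],[],[]],
    [[[[(1,[4])]]],[[[(1,[5])]]],[[[(1,[])],[]]],[[[(1,[5,4]),(-1,[6,7])]],[[]]],[[[]],
    [[(1,[9,8])]]],[[[],[(-1,[])]]]], rulesA11⟩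
  | _ => ⟨4, [0,1,2,3], [(2,[9])], [[],[],[],[],[]],
    [[[[(1,[4])]]],[[[(1,[5])]]],[[[(1,[6])]]],[[[(1,[])]]],[[[(1,[7])]]]], rulesA10⟩

/-- The mutation table of `A4`, `A7`, `A8`, `A9`, `A10`, `A11`. -/
def tableB : MutTable ℤ 4 6 where
  Γ s := match s.1 with
    | 0 => quivA4
    | 1 => quivA7
    | 2 => quivA8
    | 3 => quivA9
    | 4 => quivA10
    | _ => quivA11
  rules s := match s.1 with
    | 0 => rulesA4
    | 1 => rulesA7
    | 2 => rulesA8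
    | 3 => rulesA9
    | 4 => rulesA10
    | _ => rulesA11
  wt s k := match s.1 with
    | 0 => 1
    | 1 => 1
    | 2 => [1,1,1,1,1,2,1,2,1,1].getD k 1
    | 3 => 1
    | 4 => [1,1,1,1,1,2].getD k 1
    | _ => [1,1,1,1,1,1,1,1,1,3].getD k 1
  inv s a b := match s.1 with
    | 0 => ([[6,-3,0,0],[-3,6,-3,-3],[0,-3,4,2],[0,-3,2,4]].getD a.1 []).getD b.1 0
    | 1 => ([[4,-3,0,1],[-3,6,-3,0],[0,-3,6,-3],[1,0,-3,4]].getD a.1 []).getD b.1 0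
    | 2 => ([[4,-1,-2,-1],[-1,4,-1,1],[-2,-1,4,-1],[-1,1,-1,4]].getD a.1 []).getD b.1 0
    | 3 => ([[4,-1,0,-1],[-1,4,-3,1],[0,-3,6,-3],[-1,1,-3,4]].getD a.1 []).getD b.1 0
    | 4 => ([[6,-3,0,0],[-3,4,-1,-1],[0,-1,4,-2],[0,-1,-2,4]].getD a.1 []).getD b.1 0
    | _ => ([[6,-3,0,0],[-3,4,-2,1],[0,-2,4,-2],[0,1,-2,4]].getD a.1 []).getD b.1 0
  edge s i := match s.1 with
    | 0 => edgeA4 i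
    | 1 => edgeA7 i
    | 2 => edgeA8 i
    | 3 => edgeA9 i
    | 4 => edgeA10 i
    | _ => edgeA11 i

set_option maxRecDepth 100000 in
lemma tableB_check : tableB.check intCoef = true := by decide +kernel

/-- The quiver of `A5` and a basis. -/
def quivA5 : Quiv 2 where
  src k := [0,0,0,0,1].getD k 0
  tgt k := [0,0,0,1,0].getD k 0
  basis := [[2],[3],[4],[2,2],[2,3],[4,2],[4,3],[2,2,2],[2,2,3],[4,2,2],[2,2,2,2],[4,2,2,3]]

/-- Rewriting rules for `A5`. -/
def rulesA5 : List (Word × LC ℤ) :=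
  [([3,4],[(1,[2,2])]),([4,2,3],[]),([2,2,2,3],[]),([4,2,2,2],[]),([2,2,2,2,2],[])]

/-- The quiver of `A6` and a basis. -/
def quivA6 : Quiv 2 where
  src k := [0,0,0,0,1].getD k 0
  tgt k := [0,0,0,1,0].getD k 0
  basis := [[2],[3],[4],[2,2],[2,3],[3,4],[4,2],[2,3,4],[4,2,3]]

/-- Rewriting rules for `A6`. -/
def rulesA6 : List (Word × LC ℤ) :=
  [([4,3],[]),([2,2,2],[(1,[3,4])]),([2,2,3],[]),([4,2,2],[]),([3,4,2],[(1,[2,3,4])]),([4,2,3,4],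
    [])]

/-- The mutations of `A5`. -/
def edgeA5 (i : Fin 2) : MutEntry ℤ 2 2 :=
  match i.1 with
  | 0 => ⟨0, [0,1], [(1,[3]),(1,[2,3])], [[(1,[2])],[],[]],
    [[[[],[(1,[4,3])]],[[(1,[])],[]]],[[[]],[[(1,[4,3])]]],[[[],[(1,[])]]]], rulesA5⟩
  | _ => ⟨1, [0,1], [(0,[4])], [[],[],[]],
    [[[[(1,[2])]]],[[[(1,[])]]],[[[(1,[2,2,2])]]]], rulesA6⟩

/-- The mutations of `A6`. -/
def edgeA6 (i : Fin 2) : MutEntry ℤ 2 2 :=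
  match i.1 with
  | 0 => ⟨1, [0,1], [(1,[3]),(1,[2,3])], [[(1,[2])],[],[]],
    [[[[],[]],[[(1,[])],[]]],[[[(1,[4,2,3])]],[[]]],[[[],[(-1,[])]]]], rulesA6⟩
  | _ => ⟨0, [0,1], [(0,[4])], [[],[],[]],
    [[[[(1,[2])]]],[[[(1,[])]]],[[[(1,[2,2])]]]], rulesA5⟩

/-- The mutation table of `A5`, `A6`. -/
def tableC : MutTable ℤ 2 2 where
  Γ s := match s.1 with
    | 0 => quivA5
    | _ => quivA6
  rules s := match s.1 with
    | 0 => rulesA5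
    | _ => rulesA6
  wt s k := match s.1 with
    | 0 => 1
    | _ => [1,1,1,1,2].getD k 1
  inv s a b := match s.1 with
    | 0 => ([[3,-3],[-3,5]].getD a.1 []).getD b.1 0
    | _ => ([[2,-2],[-2,5]].getD a.1 []).getD b.1 0
  edge s i := match s.1 with
    | 0 => edgeA5 i
    | _ => edgeA6 i

set_option maxRecDepth 100000 in
lemma tableC_check : tableC.check intCoef = true := by decide +kernel

/-- The quiver of `A12` and a basis. -/
def quivA12 : Quiv 3 where
  src k := [0,0,0,0,1,2,0].getD k 0
  tgt k := [0,0,0,1,2,0,2].getD k 0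
  basis := [[3],[4],[5],[6],[3,4],[4,5],[5,3],[5,6],[6,5],[3,4,5],[4,5,6],[5,3,4],[5,6,5],[6,5,3],
    [3,4,5,6],[4,5,6,5],[5,3,4,5],[5,6,5,3],[3,4,5,6,5],[4,5,6,5,3],[5,3,4,5,6]]

/-- Rewriting rules for `A12`. -/
def rulesA12 : List (Word × LC ℤ) :=
  [([4,5,3],[]),([6,5,6],[(1,[3,4])]),([6,5,3,4],[(1,[3,4,5,6])]),([3,4,5,6,5,3],[]),
    ([5,3,4,5,6,5],[])]

/-- The quiver of `A13` and a basis. -/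
def quivA13 : Quiv 3 where
  src k := [0,0,0,1,0,1,1,2].getD k 0
  tgt k := [0,0,0,1,1,0,2,1].getD k 0
  basis := [[3],[4],[5],[6],[7],[3,3],[3,5],[4,3],[6,7],[7,6],[4,3,5]]

/-- Rewriting rules for `A13`. -/
def rulesA13 : List (Word × LC ℤ) :=
  [([3,6],[]),([4,5],[]),([4,6],[]),([5,4],[(1,[3,3])]),([7,3],[]),([7,5],[]),([3,3,3],
    [(1,[6,7])]),([3,3,5],[]),([4,3,3],[]),([6,7,6],[]),([7,6,7],[])]

/-- The quiver of `A14` and a basis. -/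
def quivA14 : Quiv 3 where
  src k := [0,0,0,0,1,1,2].getD k 0
  tgt k := [0,0,0,1,0,2,1].getD k 0
  basis := [[3],[4],[5],[6],[3,5],[4,3],[5,6],[6,4],[6,5],[3,5,6],[4,3,5],[5,6,4],[5,6,5],[6,4,3],
    [6,5,6],[3,5,6,4],[4,3,5,6],[6,4,3,5],[6,5,6,5]]

/-- Rewriting rules for `A14`. -/
def rulesA14 : List (Word × LC ℤ) :=
  [([3,4],[]),([3,5,6,5],[]),([5,6,5,6],[(1,[4,3])]),([6,5,6,4],[]),([5,6,4,3],[(1,[4,3,5,6])]),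
    ([4,3,5,6,4],[]),([6,4,3,5,6],[])]

/-- The quiver of `A15` and a basis. -/
def quivA15 : Quiv 3 where
  src k := [0,0,0,0,0,1,2,0].getD k 0
  tgt k := [0,0,0,0,1,2,0,2].getD k 0
  basis := [[3],[4],[5],[6],[7],[3,3],[3,7],[5,6],[6,3],[6,4],[3,3,3],[5,6,4],[6,3,7]]

/-- Rewriting rules for `A15`. -/
def rulesA15 : List (Word × LC ℤ) :=
  [([3,4],[]),([4,5],[(1,[3,7])]),([6,7],[]),([7,6],[(1,[3,3])]),([3,3,7],[]),([5,6,3],[]),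
    ([6,3,3],[]),([3,3,3,3],[])]

/-- The quiver of `A16` and a basis. -/
def quivA16 : Quiv 3 where
  src k := [0,0,0,0,1,2,0,2].getD k 0
  tgt k := [0,0,0,0,0,1,2,0].getD k 0
  basis := [[3],[4],[5],[6],[7],[3,3],[3,6],[4,6],[5,4],[6,5],[3,3,3],[4,6,5],[5,4,6]]

/-- Rewriting rules for `A16`. -/
def rulesA16 : List (Word × LC ℤ) :=
  [([4,3],[]),([6,7],[(1,[3,3])]),([7,3],[(1,[5,4])]),([7,6],[]),([3,3,6],[]),([3,6,5],[]),
    ([6,5,4],[(1,[3,3,3])]),([3,3,3,3],[]),([5,4,6,5],[])]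

/-- The mutations of `A12`. -/
def edgeA12 (i : Fin 3) : MutEntry ℤ 3 5 :=
  match i.1 with
  | 0 => ⟨0, [2,1,0], [(1,[3]),(2,[6])], [[],[],[],[]],
    [[[[(1,[5,3])]]],[[[(1,[])],[]]],[[[(1,[4])]],[[(-1,[5,6])]]],[[[],[(1,[])]]]], rulesA12⟩
  | 1 => ⟨2, [1,2,0], [(2,[4])], [[],[],[],[]],
    [[[[(1,[5,3,4])]]],[[[(1,[])]]],[[[(1,[5])]]],[[[(1,[6])]]]], rulesA14⟩
  | _ => ⟨1, [1,0,2], [(0,[5])], [[],[],[],[],[]],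
    [[[[(1,[6,5])]]],[[[(1,[4,5])]]],[[[(1,[3])]]],[[[(1,[])]]],[[[(1,[3,4,5,6,5])]]]], rulesA13⟩

/-- The mutations of `A13`. -/
def edgeA13 (i : Fin 3) : MutEntry ℤ 3 5 :=
  match i.1 with
  | 0 => ⟨4, [1,2,0], [(1,[4])], [[],[],[],[],[]],
    [[[[(1,[3])]]],[[[(1,[7])]]],[[[(1,[6])]]],[[[(1,[])]]],[[[(1,[3,3])]]]], rulesA16⟩
  | 1 => ⟨1, [0,1,2], [(0,[5]),(0,[3,5]),(2,[6])], [[(1,[3])],[],[],[],[]],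
    [[[[],[],[]],[[(1,[])],[],[]],[[],[],[]]],[[[],[(1,[])],[]]],[[[(-1,[4,3,5])]],[[]],[[]]],
    [[[]],[[]],[[(1,[7,6])]]],[[[],[],[(-1,[])]]]], rulesA13⟩
  | _ => ⟨0, [2,0,1], [(1,[7])], [[],[],[],[]],
    [[[[(1,[5])]]],[[[(1,[4])]]],[[[(1,[])]]],[[[(1,[3])]]]], rulesA12⟩

/-- The mutations of `A14`. -/
def edgeA14 (i : Fin 3) : MutEntry ℤ 3 5 :=
  match i.1 with
  | 0 => ⟨0, [1,0,2], [(1,[3])], [[],[],[],[]],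
    [[[[(1,[])]]],[[[(1,[5,6,5])]]],[[[(1,[6])]]],[[[(1,[5])]]]], rulesA12⟩
  | 1 => ⟨3, [2,0,1], [(0,[4]),(2,[5])], [[],[],[],[],[]],
    [[[[(1,[6,5])]]],[[[(1,[6,4])]]],[[[(1,[])],[]]],[[[(1,[3,5])]],[[(-1,[6,5,6,5])]]],[[[],
    [(-1,[])]]]], rulesA15⟩
  | _ => ⟨3, [1,2,0], [(1,[6])], [[],[],[],[],[]],
    [[[[(1,[5,6])]]],[[[(1,[])]]],[[[(1,[5,6,4])]]],[[[(1,[3])]]],[[[(1,[4])]]]], rulesA15⟩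

/-- The mutations of `A15`. -/
def edgeA15 (i : Fin 3) : MutEntry ℤ 3 5 :=
  match i.1 with
  | 0 => ⟨4, [0,2,1], [(1,[4]),(2,[7])], [[(1,[3])],[],[],[],[]],
    [[[[],[(1,[5])]],[[],[]]],[[[],[(1,[])]]],[[[(1,[5])]]],[[[]],[[(-1,[6,4])]]],[[[(1,[])],
    []]]], rulesA16⟩
  | 1 => ⟨4, [0,1,2], [(2,[5])], [[],[],[],[],[]],
    [[[[(1,[3])]]],[[[(1,[6,3])]]],[[[(1,[])]]],[[[(1,[7])]]],[[[(1,[6])]]]], rulesA16⟩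
  | _ => ⟨1, [2,0,1], [(0,[6])], [[],[],[],[],[]],
    [[[[(1,[3])]]],[[[(1,[3,3])]]],[[[(1,[])]]],[[[(1,[4])]]],[[[(1,[5,6])]]]], rulesA13⟩

/-- The mutations of `A16`. -/
def edgeA16 (i : Fin 3) : MutEntry ℤ 3 5 :=
  match i.1 with
  | 0 => ⟨3, [0,1,2], [(2,[6]),(2,[3,6])], [[(1,[3])],[],[],[],[]],
    [[[[],[]],[[(1,[])],[]]],[[[]],[[(1,[5])]]],[[[(1,[4,6])]]],[[[],[(-1,[])]]],[[[(1,[5,4,6])]],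
    [[]]]], rulesA15⟩
  | 1 => ⟨2, [2,0,1], [(0,[4])], [[],[],[],[]],
    [[[[(1,[7])]]],[[[(1,[6])]]],[[[(1,[])]]],[[[(1,[3])]]]], rulesA14⟩
  | _ => ⟨2, [1,2,0], [(0,[7]),(1,[5])], [[],[],[],[]],
    [[[[],[(1,[])]]],[[[(-1,[6,5])]],[[]]],[[[(1,[3])]],[[(-1,[4])]]],[[[(1,[])],[]]]], rulesA14⟩

/-- The mutation table of `A12`, `A13`, `A14`, `A15`, `A16`. -/
def tableD : MutTable ℤ 3 5 where
  Γ s := match s.1 with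
    | 0 => quivA12
    | 1 => quivA13
    | 2 => quivA14
    | 3 => quivA15
    | _ => quivA16
  rules s := match s.1 with
    | 0 => rulesA12
    | 1 => rulesA13
    | 2 => rulesA14
    | 3 => rulesA15
    | _ => rulesA16
  wt s k := match s.1 with
    | 0 => [1,1,1,1,2].getD k 1
    | 1 => [1,1,1,1,1,1,1,2].getD k 1
    | 2 => [1,1,1,1,3].getD k 1
    | 3 => 1
    | _ => 1
  inv s a b := match s.1 with
    | 0 => ([[4,-2,-2],[-2,7,-2],[-2,-2,4]].getD a.1 []).getD b.1 0
    | 1 => ([[7,-4,2],[-4,4,-2],[2,-2,4]].getD a.1 []).getD b.1 0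
    | 2 => ([[7,-5,2],[-5,7,-4],[2,-4,4]].getD a.1 []).getD b.1 0
    | 3 => ([[3,0,-3],[0,4,-2],[-3,-2,7]].getD a.1 []).getD b.1 0
    | _ => ([[3,0,-3],[0,4,-2],[-3,-2,7]].getD a.1 []).getD b.1 0
  edge s i := match s.1 with
    | 0 => edgeA12 i
    | 1 => edgeA13 i
    | 2 => edgeA14 i
    | 3 => edgeA15 i
    | _ => edgeA16 i

set_option maxRecDepth 100000 in
lemma tableD_check : tableD.check intCoef = true := by decide +kernel


/-! ### The mutation tables with a parameter -/

/-- Polynomials over `α` in one variable, as lists of coefficients. -/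
def Coef.poly {α : Type} (R : Coef α) : Coef (List α) where
  one := [R.one]
  add := addP
  mul x y := x.foldr (fun c s => addP (y.map (R.mul c)) (zero :: s)) []
  neg x := x.map R.neg
  nz _ := false
  isz x := x.all R.isz
where
  /-- zero -/
  zero : α := R.add R.one (R.neg R.one)
  /-- addition of polynomials -/
  addP : List α → List α → List α
    | [], y => y
    | x, [] => x
    | a :: x, b :: y => R.add a b :: addP x y

/-- Evaluation of polynomials. -/
def evalP {α : Type} {K : Type w} [Field K] (ev : α → K) (t : K) (x : List α) : K :=
  x.foldr (fun c s => ev c + t * s) 0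

lemma evalP_addP {α : Type} {R : Coef α} {K : Type w} [Field K] {ev : α → K} (h : R.IsEval ev)
    (t : K) : ∀ x y, evalP ev t (Coef.poly.addP R x y) = evalP ev t x + evalP ev t y
  | [], y => by simp [Coef.poly.addP, evalP]
  | _ :: _, [] => by simp [Coef.poly.addP, evalP]
  | a :: x, b :: y => by
    have := evalP_addP h t x y
    simp only [evalP, Coef.poly.addP, List.foldr_cons, h.add] at this ⊢
    rw [this]
    ring

lemma Coef.IsEval.poly {α : Type} {R : Coef α} {K : Type w} [Field K] {ev : α → K}
    (h : R.IsEval ev) (t : K) : R.poly.IsEval (evalP ev t) where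
  one := by simp [Coef.poly, evalP, h.one]
  add := evalP_addP h t
  mul x y := by
    have hs : ∀ c, evalP ev t (y.map (R.mul c)) = ev c * evalP ev t y := fun c => by
      induction y with
      | nil => simp [evalP]
      | cons b y ih =>
        simp only [evalP, List.map_cons, List.foldr_cons, h.mul] at ih ⊢
        rw [ih]
        ring
    have hz : ev (Coef.poly.zero R) = 0 := by simp [Coef.poly.zero, h.add, h.neg]
    induction x with
    | nil => simp [Coef.poly, evalP]
    | cons a x ih =>
      change evalP ev t (Coef.poly.addP R _ (_ :: R.poly.mul x y)) = _
      rw [evalP_addP h, hs]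
      change _ + (ev _ + t * evalP ev t (R.poly.mul x y)) = (ev a + t * evalP ev t x) * _
      rw [ih, hz]
      ring
  neg x := by
    induction x with
    | nil => simp [Coef.poly, evalP]
    | cons a x ih =>
      change ev (R.neg a) + t * evalP ev t (R.poly.neg x) = -(ev a + t * evalP ev t x)
      rw [ih, h.neg]
      ring
  nz _ h := by cases h
  isz x hx := by
    induction x with
    | nil => rfl
    | cons a x ih =>
      simp only [Coef.poly, List.all_cons, Bool.and_eq_true] at hx ih
      change ev a + t * evalP ev t x = 0
      rw [ih hx.2, h.isz a hx.1, mul_zero, add_zero]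

lemma intCoef_isEval (K : Type w) [Field K] : intCoef.IsEval (fun z : ℤ => (z : K)) where
  one := Int.cast_one
  add x y := Int.cast_add x y
  mul x y := Int.cast_mul x y
  neg x := Int.cast_neg x
  nz x hx := by
    rcases x with m | m
    · have : m = 1 := Nat.eq_of_beq_eq_true hx
      subst this
      simp
    · have : m = 0 := Nat.eq_of_beq_eq_true hx
      subst this
      simp
  isz x hx := by
    rcases x with m | m
    · have : m = 0 := Nat.eq_of_beq_eq_true hx
      subst this
      simp
    · cases hx

/-- Integer polynomials in two variables. -/
abbrev Poly := List (List ℤ)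

/-- Arithmetic of integer polynomials in two variables. -/
def polyCoef₀ : Coef Poly := intCoef.poly.poly

/-- The first variable. -/
def polyU : Poly := [[0, 1]]

/-- The second variable. -/
def polyW : Poly := [[], [1]]

/-- The difference of the variables. -/
def polyD : Poly := [[0, 1], [-1]]

/-- Powers of polynomials. -/
def polyPow (x : Poly) : ℕ → Poly
  | 0 => [[1]]
  | k + 1 => polyCoef₀.mul x (polyPow x k)

/-- Arithmetic of integer polynomials in two distinct non-zero variables. -/
def polyCoef : Coef Poly where
  one := [[1]]
  add := polyCoef₀.add
  mul := polyCoef₀.mul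
  neg := polyCoef₀.neg
  nz x := [0, 1, 2, 3].any fun i => [0, 1, 2, 3].any fun j => [0, 1, 2].any fun k =>
    match polyCoef₀.mul (polyPow polyU i) (polyCoef₀.mul (polyPow polyW j) (polyPow polyD k)) with
    | m => polyCoef₀.isz (polyCoef₀.add x m) || polyCoef₀.isz (polyCoef₀.add x (polyCoef₀.neg m))
  isz := polyCoef₀.isz

/-- Pairs of distinct non-zero parameters. -/
abbrev Param (K : Type w) [Field K] := {t : K × K // t.1 ≠ 0 ∧ t.2 ≠ 0 ∧ t.1 - t.2 ≠ 0}

/-- Evaluation of polynomials in two variables. -/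
def evalPoly {K : Type w} [Field K] (t : Param K) : Poly → K :=
  evalP (evalP (fun z : ℤ => (z : K)) t.1.1) t.1.2

lemma polyCoef_isEval {K : Type w} [Field K] (t : Param K) : polyCoef.IsEval (evalPoly t) := by
  have h : polyCoef₀.IsEval (evalPoly t) := ((intCoef_isEval K).poly t.1.1).poly t.1.2
  refine ⟨h.one, h.add, h.mul, h.neg, fun x hx => ?_, h.isz⟩
  have hp : ∀ y, evalPoly t y ≠ 0 → ∀ k, evalPoly t (polyPow y k) ≠ 0 := fun y hy k => by
    induction k with
    | zero =>
      rw [polyPow, show evalPoly t [[1]] = 1 from h.one]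
      exact one_ne_zero
    | succ k ih =>
      rw [polyPow, h.mul]
      exact mul_ne_zero hy ih
  simp only [polyCoef, List.any_eq_true, Bool.or_eq_true] at hx
  obtain ⟨i, -, j, -, k, -, hx⟩ := hx
  have hne : evalPoly t (polyCoef₀.mul (polyPow polyU i)
      (polyCoef₀.mul (polyPow polyW j) (polyPow polyD k))) ≠ 0 := by
    rw [h.mul, h.mul]
    refine mul_ne_zero (hp _ ?_ i) (mul_ne_zero (hp _ ?_ j) (hp _ ?_ k))
    · simpa [evalPoly, evalP, polyU] using t.2.1
    · simpa [evalPoly, evalP, polyW] using t.2.2.1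
    · simpa [evalPoly, evalP, polyD, sub_eq_add_neg] using t.2.2.2
  intro h0
  rcases hx with hx | hx
  · have := h.isz _ hx
    rw [h.add, h0, zero_add] at this
    exact hne this
  · have := h.isz _ hx
    rw [h.add, h0, zero_add, h.neg, neg_eq_zero] at this
    exact hne this

/-- The quiver of `A1` and a basis. -/
def quivA1 : Quiv 3 where
  src k := [0,0,0,0,1,1,2].getD k 0
  tgt k := [0,0,0,1,0,2,1].getD k 0
  basis := [[3],[4],[5],[6],[3,4],[4,3],[3,5],[5,6],[6,4],[6,5],[3,5,6],[5,6,4],[5,6,5],[6,5,6],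
    [3,5,6,4],[5,6,5,6],[6,5,6,5]]

/-- Rewriting rules for `A1` with parameters. -/
def rulesA1 (x y : Poly) : List (Word × LC Poly) :=
  [([3,4,3],[(y,[3,5,6])]),([4,3,4],[(y,[5,6,4])]),([4,3,5],[(x,[5,6,5])]),
    ([6,4,3],[(x,[6,5,6])]),([3,5,6,5],[]),([6,5,6,4],[]),([5,6,5,6,5],[]),([6,5,6,5,6],[])]

/-- The quiver of `A2` and a basis. -/
def quivA2 : Quiv 2 where
  src k := [0,0,0,1,0,1].getD k 0
  tgt k := [0,0,0,1,1,0].getD k 0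
  basis := [[2],[3],[4],[5],[2,2],[3,3],[2,4],[3,5],[2,2,2],[3,3,3]]

/-- Rewriting rules for `A2` with parameters. -/
def rulesA2 (x y : Poly) : List (Word × LC Poly) :=
  [([4,5],[(x,[2,2])]),([5,4],[(y,[3,3])]),([5,2],[([[1]],[3,5])]),([4,3],[([[1]],[2,4])]),
    ([2,2,4],[]),([3,3,5],[]),([2,2,2,2],[]),([3,3,3,3],[])]

/-- The mutation table of `A1`. -/
def tableA1 : MutTable Poly 3 1 where
  Γ _ := quivA1
  rules _ := rulesA1 polyU polyW
  wt _ _ := 1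
  inv _ a b := ([[2,-1,0],[-1,2,-1],[0,-1,2]].getD a.1 []).getD b.1 0
  edge _ i := match i.1 with
    | 0 => ⟨0, [0,1,2], [(1,[3])], [],
      [[[[([[1]],[4,3]),([[],[-1]],[5,6])]]],[[[([[1]],[])]]],[[[([[1]],[5])]]],[[[([[1]],[6])]]]],
      rulesA1 polyD [[],[-1]]⟩
    | 1 => ⟨0, [0,1,2], [(0,[4]),(2,[5])], [],
      [[[[([[1]],[])],[]]],[[[([[0,-1]],[3,4])]],[[([[],[0,1]],[6,4])]]],
      [[[([[1]],[3,5])]],[[([[0,-1]],[6,5])]]],[[[],[([[1]],[])]]]], rulesA1 polyW polyU⟩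
    | _ => ⟨0, [0,1,2], [(1,[6])], [],
      [[[[([[1]],[3])]]],[[[([[0,-1],[1]],[4])]]],[[[([[1]],[])]]],
      [[[([[1]],[4,3]),([[0,-1]],[5,6])]]]], rulesA1 [[0,-1],[1]] polyW⟩

/-- The mutation table of `A2`. -/
def tableA2 : MutTable Poly 2 1 where
  Γ _ := quivA2
  rules _ := rulesA2 polyU polyW
  wt _ _ := 1
  inv _ a b := ([[2,-1],[-1,2]].getD a.1 []).getD b.1 0
  edge _ i := match i.1 with
    | 0 => ⟨0, [0,1], [(1,[4])], [[([[1]],[2])]],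
      [[[[([[1]],[3])]]],[[[([[1]],[3])]]],[[[(polyD,[3,3])]]],[[[([[1]],[])]]]],
      rulesA2 polyU polyD⟩
    | _ => ⟨0, [0,1], [(0,[5])], [[],[([[1]],[3])]],
      [[[[([[1]],[2])]]],[[[([[1]],[2])]]],[[[([[1]],[])]]],[[[([[0,-1],[1]],[2,2])]]]],
      rulesA2 [[0,-1],[1]] polyW⟩

set_option maxRecDepth 100000 in
lemma tableA1_check : tableA1.check polyCoef = true := by decide +kernel

set_option maxRecDepth 100000 in
lemma tableA2_check : tableA2.check polyCoef = true := by decide +kernel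

section

variable {K : Type w} [Field K]

lemma mapRules_rulesA1 {t t' : Param K} {x y : Poly} (hx : evalPoly t x = t'.1.1)
    (hy : evalPoly t y = t'.1.2) :
    mapRules (evalPoly t) (rulesA1 x y) = mapRules (evalPoly t') (rulesA1 polyU polyW) := by
  have hu : evalPoly t' polyU = t'.1.1 := by simp [evalPoly, evalP, polyU]
  have hw : evalPoly t' polyW = t'.1.2 := by simp [evalPoly, evalP, polyW]
  simp only [mapRules, rulesA1, List.map_cons, List.map_nil, hx, hy, hu, hw]

lemma mapRules_rulesA2 {t t' : Param K} {x y : Poly} (hx : evalPoly t x = t'.1.1)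
    (hy : evalPoly t y = t'.1.2) :
    mapRules (evalPoly t) (rulesA2 x y) = mapRules (evalPoly t') (rulesA2 polyU polyW) := by
  have hu : evalPoly t' polyU = t'.1.1 := by simp [evalPoly, evalP, polyU]
  have hw : evalPoly t' polyW = t'.1.2 := by simp [evalPoly, evalP, polyW]
  simp only [mapRules, rulesA2, List.map_cons, List.map_nil, hx, hy, hu, hw,
    (polyCoef_isEval t).one, (polyCoef_isEval t').one, show ([[1]] : Poly) = polyCoef.one from rfl]

lemma tableA1_param (s : Fin 1) (i : Fin 3) (t : Param K) : ∃ t',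
    mapRules (evalPoly t) (tableA1.edge s i).rules =
      mapRules (evalPoly t') (tableA1.rules (tableA1.edge s i).nxt) := by
  obtain ⟨⟨u, w⟩, hu, hw, hd⟩ := t
  have hu' : -u ≠ 0 := neg_ne_zero.2 hu
  have hw' : -w ≠ 0 := neg_ne_zero.2 hw
  have hd' : w - u ≠ 0 := fun h => hd (by rw [← neg_sub, h, neg_zero])
  fin_cases i
  · exact ⟨⟨(u - w, -w), hd, hw', by simpa using hu⟩, mapRules_rulesA1
      (by simp [evalPoly, evalP, polyD, sub_eq_add_neg]) (by simp [evalPoly, evalP])⟩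
  · exact ⟨⟨(w, u), hw, hu, hd'⟩, mapRules_rulesA1
      (by simp [evalPoly, evalP, polyW]) (by simp [evalPoly, evalP, polyU])⟩
  · exact ⟨⟨(w - u, w), hd', hw, by simpa using hu⟩, mapRules_rulesA1
      (by simp [evalPoly, evalP]; ring) (by simp [evalPoly, evalP, polyW])⟩

lemma tableA2_param (s : Fin 1) (i : Fin 2) (t : Param K) : ∃ t',
    mapRules (evalPoly t) (tableA2.edge s i).rules =
      mapRules (evalPoly t') (tableA2.rules (tableA2.edge s i).nxt) := by
  obtain ⟨⟨u, w⟩, hu, hw, hd⟩ := t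
  have hd' : w - u ≠ 0 := fun h => hd (by rw [← neg_sub, h, neg_zero])
  fin_cases i
  · exact ⟨⟨(u, u - w), hu, hd, by simpa using hw⟩, mapRules_rulesA2
      (by simp [evalPoly, evalP, polyU]) (by simp [evalPoly, evalP, polyD, sub_eq_add_neg])⟩
  · exact ⟨⟨(w - u, w), hd', hw, by simpa using hu⟩, mapRules_rulesA2
      (by simp [evalPoly, evalP]; ring) (by simp [evalPoly, evalP, polyW])⟩

end


/-! ### Algebras presented by quivers with relations -/

section Presentation

/-- The product along a word. -/
def prodW {B : Type*} [Monoid B] (x : ℕ → B) (w : Word) : B := (w.map x).prod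

@[simp] lemma prodW_nil {B : Type*} [Monoid B] (x : ℕ → B) : prodW x [] = 1 := rfl

lemma prodW_cons {B : Type*} [Monoid B] (x : ℕ → B) (k : ℕ) (w : Word) :
    prodW x (k :: w) = x k * prodW x w := by simp [prodW]

lemma prodW_append {B : Type*} [Monoid B] (x : ℕ → B) (u v : Word) :
    prodW x (u ++ v) = prodW x u * prodW x v := by simp [prodW]

variable {n : ℕ}

/-- Complete orthogonal idempotents and elements attached to the arrows of a quiver. -/
structure IsQuivRep {B : Type*} [Ring B] (q : Quiv n) (e : Fin n → B) (x : ℕ → B) : Prop where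
  idem : ∀ a b, e a * e b = if a = b then e a else 0
  sum : ∑ a, e a = 1
  arrow : ∀ k, e (q.src k) * x k * e (q.tgt k) = x k

namespace IsQuivRep

variable {B : Type*} [Ring B] {q : Quiv n} {e : Fin n → B} {x : ℕ → B} (h : IsQuivRep q e x)
include h

lemma idem_self (a : Fin n) : e a * e a = e a := by rw [h.idem, if_pos rfl]

lemma src_mul (k : ℕ) : e (q.src k) * x k = x k := by
  rw [← h.arrow k, ← mul_assoc, ← mul_assoc, h.idem_self]

lemma mul_tgt (k : ℕ) : x k * e (q.tgt k) = x k := by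
  rw [← h.arrow k, mul_assoc, h.idem_self]

lemma eq_sum (y : B) : y = ∑ a, ∑ b, e a * y * e b := by
  simp only [← Finset.mul_sum, h.sum, mul_one, ← Finset.sum_mul, one_mul]

lemma mul_prodW {a c : Fin n} {u : Word} (hu : q.isPath a c u = true) :
    e a * prodW x u = prodW x u * e c := by
  induction u generalizing a with
  | nil => rw [q.isPath_nil.1 hu, prodW_nil, mul_one, one_mul]
  | cons k u ih =>
    obtain ⟨rfl, hu'⟩ := q.isPath_cons.1 hu
    rw [prodW_cons, mul_assoc, ← ih hu', ← mul_assoc, h.src_mul, ← mul_assoc, h.mul_tgt]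

lemma eq_zero_of_not_isPath {a b : Fin n} {u : Word} (hu : ¬ q.isPath a b u = true) :
    e a * prodW x u * e b = 0 := by
  induction u generalizing a with
  | nil =>
    rw [prodW_nil, mul_one, h.idem, if_neg]
    exact fun e => hu (q.isPath_nil.2 e)
  | cons k u ih =>
    rw [prodW_cons]
    by_cases hk : q.src k = a
    · have : ¬ q.isPath (q.tgt k) b u = true := fun h' => hu (q.isPath_cons.2 ⟨hk, h'⟩)
      rw [← h.mul_tgt k, mul_assoc, mul_assoc, mul_assoc, ← mul_assoc (e (q.tgt k)), ih this,
        mul_zero, mul_zero]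
    · rw [← h.src_mul k, ← mul_assoc, ← mul_assoc, h.idem, if_neg (Ne.symm hk), zero_mul, zero_mul,
        zero_mul]

lemma comp_of_left {a c b : Fin n} {u : Word} (hu : q.isPath a c u = true) (v : Word) :
    (e a * prodW x u * e c) * (e c * prodW x v * e b) = e a * prodW x (u ++ v) * e b := by
  rw [h.mul_prodW hu, prodW_append, ← mul_assoc (e a), h.mul_prodW hu]
  simp only [mul_assoc]
  rw [← mul_assoc (e c) (e c), h.idem_self, ← mul_assoc (e c) (e c), h.idem_self]

end IsQuivRep

variable {K : Type} [Field K]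

/-- A representation of a quiver satisfying relations. -/
structure IsRep {B : Type*} [Ring B] [Algebra K B] (q : Quiv n) (ar : List ℕ)
    (rel : List (List (K × Word))) (e : Fin n → B) (x : ℕ → B) : Prop extends IsQuivRep q e x where
  junk : ∀ k, k ∉ ar → x k = 0
  relations : ∀ r ∈ rel, evalL id (prodW x) r = 0

/-- An algebra presented by a quiver with relations. -/
structure IsPres {A : Type} [Ring A] [Algebra K A] (q : Quiv n) (ar : List ℕ)
    (rel : List (List (K × Word))) (e : Fin n → A) (x : ℕ → A) : Prop
    extends IsRep q ar rel e x where
  gen : Algebra.adjoin K (Set.range e ∪ Set.range x) = ⊤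
  lift : ∀ {B : Type} [Ring B] [Algebra K B] (e' : Fin n → B) (x' : ℕ → B),
    IsRep q ar rel e' x' → ∃ φ : A →ₐ[K] B, (∀ a, φ (e a) = e' a) ∧ ∀ k, φ (x k) = x' k

variable {α : Type} (R : Coef α)

/-- Verification that rewriting rules follow from relations. -/
def certCheck : List (LC α) → List (Word × LC α) → List (α × List (α × Word × ℕ × Word)) → Bool
  | _, [], _ => true
  | _, _ :: _, [] => false
  | known, r :: rules, c :: certs =>
    R.nz c.1 &&
    (match normL R ((c.1, r.1) :: (scaleL R (R.neg c.1) r.2 ++ c.2.flatMap fun t =>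
        scaleL R (R.neg t.1) ((known.getD t.2.2.1 []).map fun s =>
          (s.1, t.2.1 ++ s.2 ++ t.2.2.2)))) with
      | [] => true
      | _ :: _ => false) &&
    certCheck (known ++ [(R.one, r.1) :: scaleL R (R.neg R.one) r.2]) rules certs

/-- Evaluation of the coefficients of a linear combination. -/
def mapLC (ev : α → K) (p : LC α) : List (K × Word) := p.map fun t => (ev t.1, t.2)

lemma evalL_mapLC {M : Type*} [AddCommGroup M] [Module K M] (ev : α → K) (β : Word → M) (p : LC α) :
    evalL id β (mapLC ev p) = evalL ev β p := by
  simp [evalL, mapLC, List.map_map, Function.comp_def]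

variable {R} {ev : α → K} (hR : R.IsEval ev)
include hR

lemma evalL_eq_zero {M : Type*} [AddCommGroup M] [Module K M] (β : Word → M) {p : LC α}
    (h : normL R p = []) : evalL ev β p = 0 := by
  rw [← evalL_normL β hR, h, evalL_nil]

lemma rules_of_certCheck {B : Type*} [Ring B] [Algebra K B] {x : ℕ → B} {known : List (LC α)}
    {rules : List (Word × LC α)} {certs : List (α × List (α × Word × ℕ × Word))}
    (hc : certCheck R known rules certs = true) (hk : ∀ p ∈ known, evalL ev (prodW x) p = 0) :
    ∀ r ∈ rules, prodW x r.1 = evalL ev (prodW x) r.2 := by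
  induction rules generalizing known certs with
  | nil => simp
  | cons r rules ih =>
    cases certs with
    | nil => cases hc
    | cons c certs =>
      rw [certCheck, Bool.and_eq_true, Bool.and_eq_true] at hc
      obtain ⟨⟨hc₁, hc₂⟩, hc₃⟩ := hc
      have hr : prodW x r.1 = evalL ev (prodW x) r.2 := by
        split at hc₂
        · rename_i h'
          have h₁ := evalL_eq_zero hR (prodW x) h'
          have h₂ : ∀ l : List (α × Word × ℕ × Word), evalL ev (prodW x) (l.flatMap fun t =>
              scaleL R (R.neg t.1) ((known.getD t.2.2.1 []).map fun s =>
                (s.1, t.2.1 ++ s.2 ++ t.2.2.2))) = 0 := fun l => by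
            induction l with
            | nil => rfl
            | cons t l ih' =>
              rw [List.flatMap_cons, evalL_append, ih', add_zero, evalL_scaleL _ hR]
              have h₃ : evalL ev (prodW x) (known.getD t.2.2.1 []) = 0 := by
                by_cases hl : t.2.2.1 < known.length
                · rw [List.getD_eq_getElem _ _ hl]
                  exact hk _ (List.getElem_mem hl)
                · rw [List.getD_eq_default _ _ (by omega)]
                  rfl
              have h₄ : ∀ p : LC α, evalL ev (prodW x) (p.map fun s =>
                  (s.1, t.2.1 ++ s.2 ++ t.2.2.2)) =
                  prodW x t.2.1 * evalL ev (prodW x) p * prodW x t.2.2.2 := fun p => by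
                induction p with
                | nil => simp
                | cons s p ih'' =>
                  rw [List.map_cons, evalL_cons, ih'', evalL_cons, prodW_append, prodW_append,
                    mul_add, add_mul, mul_smul_comm, smul_mul_assoc]
              rw [h₄, h₃, mul_zero, zero_mul, smul_zero]
          rw [evalL_cons, evalL_append, h₂, add_zero, evalL_scaleL _ hR, hR.neg, neg_smul,
            ← sub_eq_add_neg, ← smul_sub] at h₁
          exact sub_eq_zero.1 ((smul_eq_zero.1 h₁).resolve_left (hR.nz _ hc₁))
        · cases hc₂
      intro r' hr'
      rcases List.mem_cons.1 hr' with rfl | hr'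
      · exact hr
      · refine ih hc₃ (fun p hp => ?_) r' hr'
        rcases List.mem_append.1 hp with hp | hp
        · exact hk p hp
        · rw [List.mem_singleton.1 hp, evalL_cons, evalL_scaleL _ hR, hR.neg, hR.one, hr, one_smul,
            neg_one_smul, add_neg_cancel]

lemma IsQuivRep.evalL_nfW {B : Type*} [Ring B] [Algebra K B] {q : Quiv n} {e : Fin n → B}
    {x : ℕ → B} (h : IsQuivRep q e x) {rules : List (Word × LC α)}
    (hr : ∀ r ∈ rules, prodW x r.1 = evalL ev (prodW x) r.2) (a b : Fin n) (k : ℕ) (w : Word) :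
    evalL ev (fun w => e a * prodW x w * e b) (nfW q R rules a b k w) = e a * prodW x w * e b := by
  induction k generalizing w with
  | zero => simp [nfW, hR.one]
  | succ k ih =>
    rw [nfW]
    split
    · rename_i hw
      rw [h.eq_zero_of_not_isPath (by rw [hw]; exact Bool.false_ne_true)]; rfl
    · split
      · simp [hR.one]
      · rename_i p hp
        obtain ⟨l, r, u, v, h₁, rfl, rfl⟩ := stepW_eq hp
        rw [prodW_append, prodW_append, hr _ h₁, evalL_flatMap]
        generalize r = r
        induction r with
        | nil => simp
        | cons t r ih' =>
          rw [List.map_cons, List.map_cons, List.sum_cons, ih', evalL_scaleL _ hR, ih, evalL_cons,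
            prodW_append, prodW_append, mul_add, add_mul, mul_add, add_mul, mul_smul_comm,
            smul_mul_assoc, mul_smul_comm, smul_mul_assoc]

end Presentation


section Basis

variable {n : ℕ} {K : Type} [Field K] {α : Type} (q : Quiv n) (R : Coef α)
  (rules : List (Word × LC α))

/-- Verification that the basis words span. -/
def spanCheck (ar : List ℕ) : Bool :=
  ar.all fun k => (List.finRange n).all fun a => (q.bas a (q.src k)).all fun w =>
    (nfW q R rules a (q.tgt k) 20 (w ++ [k])).all fun t => (q.bas a (q.tgt k)).any (weq t.2)

/-- Left multiplication by an arrow on linear combinations of basis words. -/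
def opL (k : ℕ) (b : Fin n) (p : LC α) : LC α :=
  p.flatMap fun t => match (q.bas (q.tgt k) b).any (weq t.2) with
    | true => scaleL R t.1 (nfW q R rules (q.src k) b 20 (k :: t.2))
    | false => []

/-- Left multiplication by a word on linear combinations of basis words. -/
def actL (b : Fin n) : Word → LC α → LC α
  | [], p => p
  | k :: u, p => opL q R rules k b (actL b u p)

/-- Test for lists without repetition. -/
def nodupW : List Word → Bool
  | [] => true
  | w :: l => !l.any (weq w) && nodupW l

/-- Verification that the basis words are independent. -/
def repCheck (ar : List ℕ) (rel : List (LC α)) : Bool :=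
  (List.finRange n).all fun a => (List.finRange n).all fun b =>
    nodupW (q.bas a b) &&
    (q.bas a b).all (fun w => w.all (fun k => ar.any (Nat.beq k)) &&
      (match normL R ((R.neg R.one, w) :: actL q R rules b w [(R.one, [])]) with
        | [] => true
        | _ :: _ => false)) &&
    rel.all fun r => (List.finRange n).all fun c => (q.bas a b).all fun w =>
      match normL R (r.flatMap fun t => match q.isPath c a t.2 with
          | true => scaleL R t.1 (actL q R rules b t.2 [(R.one, w)])
          | false => []) with
        | [] => true
        | _ :: _ => false

variable {q R rules}

lemma nodup_of_nodupW {l : List Word} (h : nodupW l = true) : l.Nodup := by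
  induction l with
  | nil => exact List.nodup_nil
  | cons w l ih =>
    rw [nodupW, Bool.and_eq_true, Bool.not_eq_true'] at h
    refine List.nodup_cons.2 ⟨fun hw => ?_, ih h.2⟩
    rw [List.any_eq_true.2 ⟨w, hw, weq_iff.2 rfl⟩] at h
    cases h.1

lemma any_weq_iff {l : List Word} {w : Word} : l.any (weq w) = true ↔ w ∈ l := by
  rw [List.any_eq_true]
  exact ⟨fun ⟨v, hv, h⟩ => weq_iff.1 h ▸ hv, fun h => ⟨w, h, weq_iff.2 rfl⟩⟩

variable {ev : α → K} (hR : R.IsEval ev)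
include hR

/-- The elements of a Peirce component are combinations of basis words. -/
lemma IsPres.mem_span {A : Type} [Ring A] [Algebra K A] {ar : List ℕ}
    {rel : List (List (K × Word))} {e : Fin n → A} {x : ℕ → A} (h : IsPres q ar rel e x)
    (hr : ∀ r ∈ rules, prodW x r.1 = evalL ev (prodW x) r.2)
    (hs : spanCheck q R rules ar = true) (a b : Fin n) (y : A) :
    e a * y * e b ∈ Submodule.span K
      (Set.range fun i : Fin (q.bas a b).length => e a * prodW x ((q.bas a b).get i) * e b) := by
  let W : Submodule K A := Submodule.span K
    {y | ∃ a b, ∃ w ∈ q.bas a b, y = e a * prodW x w * e b}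
  have hW : ∀ {a b w}, w ∈ q.bas a b → e a * prodW x w * e b ∈ W := fun hw =>
    Submodule.subset_span ⟨_, _, _, hw, rfl⟩
  let S : Subalgebra K A :=
    { carrier := {y | ∀ z ∈ W, z * y ∈ W}
      mul_mem' := fun {y y'} hy hy' z hz => by
        rw [← mul_assoc]
        exact hy' _ (hy _ hz)
      add_mem' := fun {y y'} hy hy' z hz => by
        rw [mul_add]
        exact W.add_mem (hy z hz) (hy' z hz)
      algebraMap_mem' := fun c z hz => by
        rw [← Algebra.commutes, ← Algebra.smul_def]
        exact W.smul_mem _ hz }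
  have hS : S = ⊤ := by
    rw [eq_top_iff, ← h.gen, Algebra.adjoin_le_iff]
    rintro _ (⟨c, rfl⟩ | ⟨k, rfl⟩) z hz
    · induction hz using Submodule.span_induction with
      | mem z hz =>
        obtain ⟨a, b, w, hw, rfl⟩ := hz
        rw [mul_assoc, h.idem]
        split_ifs
        · exact hW hw
        · rw [mul_zero]; exact W.zero_mem
      | zero => rw [zero_mul]; exact W.zero_mem
      | add y z _ _ hy hz => rw [add_mul]; exact W.add_mem hy hz
      | smul c y _ hy => rw [smul_mul_assoc]; exact W.smul_mem c hy
    · induction hz using Submodule.span_induction with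
      | mem z hz =>
        obtain ⟨a, b, w, hw, rfl⟩ := hz
        by_cases hk : k ∈ ar
        · by_cases hb : b = q.src k
          · subst hb
            have e₁ : x k = e (q.src k) * prodW x [k] * e (q.tgt k) := by
              rw [prodW_cons, prodW_nil, mul_one, h.arrow]
            rw [e₁, h.comp_of_left (q.isPath_of_mem_bas hw), ← h.evalL_nfW hR hr _ _ 20]
            refine evalL_mem _ _ _ fun t ht => hW ?_
            simp only [spanCheck, List.all_eq_true] at hs
            exact any_weq_iff.1 (hs k hk a (List.mem_finRange a) w hw t ht)
          · rw [← h.src_mul k, mul_assoc, ← mul_assoc (e b), h.idem, if_neg hb, zero_mul, mul_zero]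
            exact W.zero_mem
        · rw [h.junk k hk, mul_zero]; exact W.zero_mem
      | zero => rw [zero_mul]; exact W.zero_mem
      | add y z _ _ hy hz => rw [add_mul]; exact W.add_mem hy hz
      | smul c y _ hy => rw [smul_mul_assoc]; exact W.smul_mem c hy
  have h1 : (1 : A) ∈ W := by
    rw [← h.sum]
    refine W.sum_mem fun a _ => ?_
    have := hW (q.nil_mem_bas a)
    rwa [prodW_nil, mul_one, h.idem_self] at this
  have hy : y ∈ W := by
    have : y ∈ S := hS ▸ Algebra.mem_top
    simpa using this 1 h1
  induction hy using Submodule.span_induction with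
  | mem z hz =>
    obtain ⟨a', b', w, hw, rfl⟩ := hz
    have e₁ : e a * (e a' * prodW x w * e b') * e b =
        (e a * e a') * prodW x w * (e b' * e b) := by simp only [mul_assoc]
    rw [e₁, h.idem, h.idem]
    split_ifs with h₁ h₂
    · subst h₁ h₂
      obtain ⟨i, hi⟩ := List.mem_iff_get.1 hw
      exact Submodule.subset_span ⟨i, congrArg (fun w => e a * prodW x w * e _) hi⟩
    · rw [mul_zero]; exact Submodule.zero_mem _
    · rw [zero_mul, zero_mul]; exact Submodule.zero_mem _
    · rw [zero_mul, zero_mul]; exact Submodule.zero_mem _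
  | zero => rw [mul_zero, zero_mul]; exact Submodule.zero_mem _
  | add y z _ _ hy hz => rw [mul_add, add_mul]; exact Submodule.add_mem _ hy hz
  | smul c y _ hy => rw [mul_smul_comm, smul_mul_assoc]; exact Submodule.smul_mem _ c hy

omit hR

variable (q) in
/-- The index set of the basis words. -/
abbrev BasIdx := {z : Fin n × Fin n × Word // z.2.2 ∈ q.bas z.1 z.2.1}

variable (K) in
open Classical in
/-- The basis vector of a basis word. -/
def basVec (q : Quiv n) (a b : Fin n) (w : Word) : BasIdx q →₀ K :=
  if h : w ∈ q.bas a b then Finsupp.single ⟨(a, b, w), h⟩ 1 else 0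

variable (K) in
/-- The projection on the words starting at a vertex. -/
def idemOp (q : Quiv n) (c : Fin n) : Module.End K (BasIdx q →₀ K) :=
  Finsupp.linearCombination K fun z => if z.1.1 = c then basVec K q z.1.1 z.1.2.1 z.1.2.2 else 0

variable (q R rules ev) in
/-- Left multiplication by an arrow. -/
def arrowOp (ar : List ℕ) (k : ℕ) : Module.End K (BasIdx q →₀ K) :=
  Finsupp.linearCombination K fun z => if k ∈ ar ∧ z.1.1 = q.tgt k then
    evalL ev (basVec K q (q.src k) z.1.2.1) (nfW q R rules (q.src k) z.1.2.1 20 (k :: z.1.2.2)) else 0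

lemma basVec_self (z : BasIdx q) : basVec K q z.1.1 z.1.2.1 z.1.2.2 = Finsupp.single z 1 :=
  dif_pos z.2

lemma idemOp_basVec (c a b : Fin n) (w : Word) :
    idemOp K q c (basVec K q a b w) = if a = c then basVec K q a b w else 0 := by
  by_cases h : w ∈ q.bas a b
  · have e : basVec K q a b w = Finsupp.single ⟨(a, b, w), h⟩ 1 := dif_pos h
    rw [e, idemOp, Finsupp.linearCombination_single, one_smul, ← e]
  · have e : basVec K q a b w = 0 := dif_neg h
    rw [e, map_zero, ite_self]

lemma arrowOp_basVec (ar : List ℕ) (k : ℕ) (a b : Fin n) (w : Word) :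
    arrowOp q R rules ev ar k (basVec K q a b w) = if k ∈ ar ∧ a = q.tgt k ∧ w ∈ q.bas a b then
      evalL ev (basVec K q (q.src k) b) (nfW q R rules (q.src k) b 20 (k :: w)) else 0 := by
  by_cases h : w ∈ q.bas a b
  · have e : basVec K q a b w = Finsupp.single ⟨(a, b, w), h⟩ 1 := dif_pos h
    rw [e, arrowOp, Finsupp.linearCombination_single, one_smul]
    simp only [h, and_true]
  · have e : basVec K q a b w = 0 := dif_neg h
    rw [e, map_zero, if_neg (fun h' => h h'.2.2)]

lemma basVec_ext {M : Type*} [AddCommGroup M] [Module K M] {f g : (BasIdx q →₀ K) →ₗ[K] M}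
    (h : ∀ a b w, w ∈ q.bas a b → f (basVec K q a b w) = g (basVec K q a b w)) : f = g := by
  refine Finsupp.lhom_ext' fun z => LinearMap.ext_ring ?_
  have := h _ _ _ z.2
  rw [basVec_self] at this
  exact this

lemma isQuivRep_op (ar : List ℕ) : IsQuivRep q (idemOp K q) (arrowOp q R rules ev ar) where
  idem a b := basVec_ext fun c d w _ => by
    rw [Module.End.mul_apply, idemOp_basVec]
    by_cases h : c = b
    · subst h
      rw [if_pos rfl, idemOp_basVec]
      by_cases h : a = c
      · subst h; rw [if_pos rfl, if_pos rfl, idemOp_basVec, if_pos rfl]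
      · rw [if_neg (Ne.symm h), if_neg h]; rfl
    · rw [if_neg h, map_zero]
      split_ifs with h'
      · rw [h', idemOp_basVec, if_neg h]
      · rfl
  sum := basVec_ext fun c d w _ => by
    rw [LinearMap.sum_apply]
    simp [idemOp_basVec]
  arrow k := basVec_ext fun c d w hw => by
    rw [Module.End.mul_apply, Module.End.mul_apply, idemOp_basVec]
    by_cases h : c = q.tgt k
    · rw [if_pos h, arrowOp_basVec]
      split_ifs with h'
      · generalize nfW q R rules (q.src k) d 20 (k :: w) = p
        rw [map_evalL]
        exact evalL_congr _ _ fun t _ => by rw [idemOp_basVec, if_pos rfl]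
      · rw [map_zero]
    · rw [if_neg h, map_zero, map_zero, arrowOp_basVec, if_neg (fun h' => h h'.2.1)]

include hR

lemma arrowOp_evalL {ar : List ℕ} {k : ℕ} (hk : k ∈ ar) (b : Fin n) (p : LC α) :
    arrowOp q R rules ev ar k (evalL ev (basVec K q (q.tgt k) b) p) =
      evalL ev (basVec K q (q.src k) b) (opL q R rules k b p) := by
  rw [map_evalL, opL, evalL_flatMap, evalL]
  congr 1
  refine List.map_congr_left fun t _ => ?_
  rw [arrowOp_basVec]
  split_ifs with h₀ <;> split <;> rename_i h
  · rw [evalL_scaleL _ hR]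
  · rw [any_weq_iff.2 h₀.2.2] at h
    cases h
  · exact absurd ⟨hk, rfl, any_weq_iff.1 h⟩ h₀
  · rw [smul_zero, evalL_nil]

lemma prodW_arrowOp {ar : List ℕ} {u : Word} (hu : ∀ k ∈ u, k ∈ ar) {c a : Fin n}
    (hp : q.isPath c a u = true) (b : Fin n) (p : LC α) :
    prodW (arrowOp q R rules ev ar) u (evalL ev (basVec K q a b) p) =
      evalL ev (basVec K q c b) (actL q R rules b u p) := by
  induction u generalizing c with
  | nil => rw [q.isPath_nil.1 hp]; rfl
  | cons k u ih =>
    obtain ⟨rfl, hp'⟩ := q.isPath_cons.1 hp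
    rw [prodW_cons, Module.End.mul_apply, ih (fun k hk => hu k (List.mem_cons_of_mem _ hk)) hp',
      arrowOp_evalL hR (hu k List.mem_cons_self)]
    rfl

/-- The regular representation on the basis words. -/
lemma isRep_op {ar : List ℕ} {rel : List (LC α)} (hc : repCheck q R rules ar rel = true)
    (hrel : ∀ r ∈ rel, ∀ t ∈ r, ∀ k ∈ t.2, k ∈ ar) :
    IsRep q ar (rel.map (mapLC ev)) (idemOp K q) (arrowOp q R rules ev ar) where
  toIsQuivRep := isQuivRep_op ar
  junk k hk := basVec_ext fun a b w _ => by
    rw [arrowOp_basVec, if_neg (fun h => hk h.1)]; rfl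
  relations r hr' := by
    obtain ⟨r, hr, rfl⟩ := List.mem_map.1 hr'
    rw [evalL_mapLC]
    have hq : IsQuivRep q (idemOp K q) (arrowOp q R rules ev ar) := isQuivRep_op ar
    rw [hq.eq_sum (evalL ev _ r)]
    refine Finset.sum_eq_zero fun c _ => Finset.sum_eq_zero fun a _ => basVec_ext fun a' b w hw => ?_
    rw [Module.End.mul_apply, idemOp_basVec]
    by_cases ha : a' = a
    swap
    · rw [if_neg ha, map_zero]; rfl
    subst ha
    rw [if_pos rfl]
    simp only [repCheck, List.all_eq_true, Bool.and_eq_true] at hc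
    have h₁ := (hc a' (List.mem_finRange _) b (List.mem_finRange _)).2 r hr c (List.mem_finRange _)
      w hw
    split at h₁
    swap
    · cases h₁
    rename_i h₂
    have h₃ := evalL_eq_zero hR (basVec K q c b) h₂
    have h₄ : ∀ p : LC α, (∀ t ∈ p, ∀ k ∈ t.2, k ∈ ar) →
        (idemOp K q c * evalL ev (prodW (arrowOp q R rules ev ar)) p) (basVec K q a' b w) =
        evalL ev (basVec K q c b) (p.flatMap fun t => match q.isPath c a' t.2 with
          | true => scaleL R t.1 (actL q R rules b t.2 [(R.one, w)])
          | false => []) := fun p hp => by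
      induction p with
      | nil => simp
      | cons t p ih =>
        rw [evalL_cons, mul_add, LinearMap.add_apply, ih fun t ht => hp t (List.mem_cons_of_mem _ ht),
          List.flatMap_cons, evalL_append, mul_smul_comm, LinearMap.smul_apply]
        congr 1
        have e₁ : (basVec K q a' b w) = idemOp K q a' (basVec K q a' b w) := by
          rw [idemOp_basVec, if_pos rfl]
        split
        · rename_i ht
          have e₂ : basVec K q a' b w = evalL ev (basVec K q a' b) [(R.one, w)] := by
            simp [hR.one]
          rw [evalL_scaleL _ hR, ← prodW_arrowOp hR (hp t List.mem_cons_self) ht, ← e₂,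
            hq.mul_prodW ht, Module.End.mul_apply, ← e₁]
        · rename_i ht
          rw [e₁, ← Module.End.mul_apply, hq.eq_zero_of_not_isPath (by rw [ht]; exact
            Bool.false_ne_true)]
          simp
    rw [h₄ r (hrel r hr), h₃]
    rfl

/-- The basis words are linearly independent. -/
lemma IsPres.linearIndependent {A : Type} [Ring A] [Algebra K A] {ar : List ℕ}
    {rel : List (LC α)} {e : Fin n → A} {x : ℕ → A} (h : IsPres q ar (rel.map (mapLC ev)) e x)
    (hc : repCheck q R rules ar rel = true) (hrel : ∀ r ∈ rel, ∀ t ∈ r, ∀ k ∈ t.2, k ∈ ar)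
    (a b : Fin n) : LinearIndependent K
      fun i : Fin (q.bas a b).length => e a * prodW x ((q.bas a b).get i) * e b := by
  obtain ⟨φ, hφ, hφ'⟩ := h.lift _ _ (isRep_op (K := K) hR hc hrel)
  simp only [repCheck, List.all_eq_true, Bool.and_eq_true] at hc
  obtain ⟨⟨hn, hw⟩, -⟩ := hc a (List.mem_finRange a) b (List.mem_finRange b)
  have hq : IsQuivRep q (idemOp K q) (arrowOp q R rules ev ar) := isQuivRep_op ar
  have hp : ∀ w, φ (prodW x w) = prodW (arrowOp q R rules ev ar) w := fun w => by
    simp only [prodW, map_list_prod, List.map_map]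
    congr 1
    exact List.map_congr_left fun k _ => hφ' k
  refine LinearIndependent.of_comp
    ((LinearMap.applyₗ (basVec K q b b [])).comp φ.toLinearMap) ?_
  have key : ∀ i : Fin (q.bas a b).length,
      ((LinearMap.applyₗ (basVec K q b b [])).comp φ.toLinearMap)
        (e a * prodW x ((q.bas a b).get i) * e b) =
      Finsupp.single (⟨(a, b, (q.bas a b).get i), List.get_mem _ _⟩ : BasIdx q) 1 := fun i => by
    obtain ⟨w, hi, hi'⟩ : ∃ w, ∃ hi : w ∈ q.bas a b, (q.bas a b).get i = w :=
      ⟨_, List.get_mem _ i, rfl⟩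
    simp only [hi']
    have h₁ := hw w hi
    have h₂ := h₁.2
    split at h₂
    swap
    · cases h₂
    rename_i h₃
    have h₄ := evalL_eq_zero hR (basVec K q a b) h₃
    rw [evalL_cons, hR.neg, hR.one, neg_one_smul, neg_add_eq_zero] at h₄
    have har : ∀ k ∈ w, k ∈ ar := fun k hk => by
      obtain ⟨j, hj, hj'⟩ := List.any_eq_true.1 (h₁.1 k hk)
      exact Nat.eq_of_beq_eq_true hj' ▸ hj
    have e₂ : basVec K q b b [] = evalL ev (basVec K q b b) [(R.one, [])] := by simp [hR.one]
    change φ (e a * prodW x w * e b) (basVec K q b b []) = _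
    rw [map_mul, map_mul, hφ, hφ, hp, Module.End.mul_apply, Module.End.mul_apply, idemOp_basVec,
      if_pos rfl, e₂, prodW_arrowOp hR har (q.isPath_of_mem_bas hi), ← h₄, idemOp_basVec, if_pos rfl]
    exact dif_pos hi
  rw [show (_ ∘ _ : Fin (q.bas a b).length → _) = fun i => Finsupp.single
    (⟨(a, b, (q.bas a b).get i), List.get_mem _ _⟩ : BasIdx q) (1 : K) from funext key]
  refine (Finsupp.linearIndependent_single_one K (BasIdx q)).comp _ fun i j hij => ?_
  have : (q.bas a b).get i = (q.bas a b).get j := congrArg (fun z : BasIdx q => z.1.2.2) hij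
  exact (nodup_of_nodupW hn).injective_get this

end Basis


section RingQuot

open MulOpposite

variable {K : Type} [Field K] {n N : ℕ}

/-- A path in the free algebra. -/
def freeW (K : Type) [Field K] : List (Fin N) → FreeAlgebra K (Fin N)
  | [] => 1
  | k :: w => w.foldl (fun s j => s * FreeAlgebra.ι K j) (FreeAlgebra.ι K k)

/-- A path, possibly multiplied by the parameter. -/
def freeT (l : K) : Bool × List (Fin N) → FreeAlgebra K (Fin N)
  | (false, w) => freeW K w
  | (true, w) => algebraMap K (FreeAlgebra K (Fin N)) l * freeW K w

/-- A sum of paths. -/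
def freeS (l : K) : List (Bool × List (Fin N)) → FreeAlgebra K (Fin N)
  | [] => 0
  | t :: L => L.foldl (fun s t => s + freeT l t) (freeT l t)

/-- Arrows with their sources and targets, and relations between paths. -/
structure QuivData (N : ℕ) where
  /-- arrows with sources and targets -/
  arr : List (Fin N × Fin N × Fin N)
  /-- relations -/
  ext : List (List (Bool × List (Fin N)) × List (Bool × List (Fin N)))

/-- The relations of a bound quiver algebra. -/
def QuivData.relList (D : QuivData N) (vs : List (Fin N)) (l : K) :
    List (FreeAlgebra K (Fin N) × FreeAlgebra K (Fin N)) :=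
  (vs.flatMap fun a => vs.map fun b => (FreeAlgebra.ι K a * FreeAlgebra.ι K b,
    match Nat.beq a.1 b.1 with
    | true => FreeAlgebra.ι K a
    | false => 0)) ++ ((freeS l (vs.map fun a => (false, [a])), 1) ::
  (D.arr.map (fun t => (FreeAlgebra.ι K t.1,
    FreeAlgebra.ι K t.2.1 * FreeAlgebra.ι K t.1 * FreeAlgebra.ι K t.2.2)) ++
  D.ext.map fun p => (freeS l p.1, freeS l p.2)))

/-- The reversed and renamed path combination. -/
def toLC (σ : Fin N → Fin N) (l : K) (L : List (Bool × List (Fin N))) : List (K × Word) :=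
  L.map fun t => (match t.1 with
    | true => l
    | false => 1, (t.2.map fun i => (σ i).1).reverse)

/-- The reversed and renamed relations. -/
def QuivData.rel (D : QuivData N) (σ : Fin N → Fin N) (l : K) : List (List (K × Word)) :=
  D.ext.map fun p => toLC σ l p.1 ++ (toLC σ l p.2).map fun t => (-t.1, t.2)

/-- The renaming `σ` identifies the opposite of the quiver of `D` with `q`. -/
structure QuivData.IsOp (D : QuivData N) (q : Quiv n) (σ : Fin N → Fin N) : Prop where
  invol : ∀ i, σ (σ i) = i
  le : ∀ i, n ≤ i.1 → n ≤ (σ i).1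
  lt : ∀ i, i.1 < n → (σ i).1 < n
  arr : ∀ t ∈ D.arr, n ≤ t.1.1 ∧ (q.src (σ t.1).1).1 = (σ t.2.2).1 ∧
    (q.tgt (σ t.1).1).1 = (σ t.2.1).1
  mem : ∀ i : Fin N, n ≤ i.1 → ∃ t ∈ D.arr, t.1 = i
  ext : ∀ p ∈ D.ext, (∀ t ∈ p.1, t.2 ≠ [] ∧ ∀ i ∈ t.2, n ≤ i.1) ∧
    ∀ t ∈ p.2, t.2 ≠ [] ∧ ∀ i ∈ t.2, n ≤ i.1

section Anti

variable {M : Type*} [Ring M] [Algebra K M] {ψ : FreeAlgebra K (Fin N) →ₗ[K] M}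
  (hm : ∀ u v, ψ (u * v) = ψ v * ψ u) {σ : Fin N → Fin N} {X : ℕ → M}
  (hX : ∀ i : Fin N, n ≤ i.1 → ψ (FreeAlgebra.ι K i) = X (σ i).1)
include hm hX

lemma anti_freeW {w : List (Fin N)} (h0 : w ≠ []) (hw : ∀ i ∈ w, n ≤ i.1) :
    ψ (freeW K w) = prodW X (w.map fun i => (σ i).1).reverse := by
  obtain ⟨k, w, rfl⟩ := List.exists_cons_of_ne_nil h0
  rw [freeW]
  have : ∀ (w : List (Fin N)) (s : FreeAlgebra K (Fin N)) (z : M), (∀ i ∈ w, n ≤ i.1) → ψ s = z →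
      ψ (w.foldl (fun s j => s * FreeAlgebra.ι K j) s) =
        prodW X (w.map fun i => (σ i).1).reverse * z := fun w => by
    induction w with
    | nil => intro s z _ hs; simpa using hs
    | cons j w ih =>
      intro s z hw hs
      rw [List.foldl_cons, ih _ (X (σ j).1 * z) (fun i hi => hw i (List.mem_cons_of_mem _ hi))
        (by rw [hm, hs, hX j (hw j List.mem_cons_self)]), List.map_cons, List.reverse_cons,
        prodW_append, prodW_cons, prodW_nil, mul_one, mul_assoc]
  rw [this w _ _ (fun i hi => hw i (List.mem_cons_of_mem _ hi)) (hX k (hw k List.mem_cons_self)),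
    List.map_cons, List.reverse_cons, prodW_append, prodW_cons, prodW_nil, mul_one]

lemma anti_freeS (l : K) {L : List (Bool × List (Fin N))}
    (hL : ∀ t ∈ L, t.2 ≠ [] ∧ ∀ i ∈ t.2, n ≤ i.1) :
    ψ (freeS l L) = evalL id (prodW X) (toLC σ l L) := by
  have hT : ∀ t : Bool × List (Fin N), t.2 ≠ [] → (∀ i ∈ t.2, n ≤ i.1) →
      ψ (freeT l t) = evalL id (prodW X) (toLC σ l [t]) := by
    rintro ⟨b, w⟩ h0 hw
    cases b
    · simp [freeT, toLC, anti_freeW hm hX h0 hw]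
    · simp [freeT, toLC, ← Algebra.smul_def, anti_freeW hm hX h0 hw]
  have hs : ∀ t (L : List (Bool × List (Fin N))), toLC σ l (t :: L) = toLC σ l [t] ++ toLC σ l L :=
    fun t L => rfl
  cases L with
  | nil => simp [freeS, toLC]
  | cons t L =>
    have : ∀ (L : List (Bool × List (Fin N))) (s : FreeAlgebra K (Fin N)),
        (∀ t ∈ L, t.2 ≠ [] ∧ ∀ i ∈ t.2, n ≤ i.1) → ψ (L.foldl (fun s t => s + freeT l t) s) =
          ψ s + evalL id (prodW X) (toLC σ l L) := fun L => by
      induction L with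
      | nil => intro s _; simp [toLC]
      | cons t L ih =>
        intro s hL
        have ht := hL t List.mem_cons_self
        rw [List.foldl_cons, ih _ fun t ht => hL t (List.mem_cons_of_mem _ ht), map_add,
          hT t ht.1 ht.2, hs t L, evalL_append, add_assoc]
    have ht := hL t List.mem_cons_self
    rw [freeS, this L _ fun t ht => hL t (List.mem_cons_of_mem _ ht), hT t ht.1 ht.2, hs t L,
      evalL_append]

end Anti

lemma evalL_neg {M : Type*} [AddCommGroup M] [Module K M] (β : Word → M) (p : List (K × Word)) :
    evalL id β (p.map fun t => (-t.1, t.2)) = - evalL id β p := by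
  induction p with
  | nil => simp
  | cons t p ih => simp [ih, add_comm]

lemma freeS_vertices (l : K) (vs : List (Fin N)) :
    freeS l (vs.map fun a => (false, [a])) = (vs.map (FreeAlgebra.ι K)).sum := by
  cases vs with
  | nil => rfl
  | cons a vs =>
    have : ∀ (vs : List (Fin N)) (s : FreeAlgebra K (Fin N)),
        (vs.map fun a => (false, [a])).foldl (fun s t => s + freeT l t) s =
          s + (vs.map (FreeAlgebra.ι K)).sum := fun vs => by
      induction vs with
      | nil => intro s; simp
      | cons a vs ih =>
        intro s
        rw [List.map_cons, List.foldl_cons, ih, List.map_cons, List.sum_cons, ← add_assoc]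
        rfl
    rw [List.map_cons, freeS, this, List.map_cons, List.sum_cons]
    rfl

/-- The opposite of a bound quiver algebra is presented by the opposite quiver. -/
theorem QuivData.IsOp.exists_isPres {D : QuivData N} {q : Quiv n} {σ : Fin N → Fin N}
    (h : D.IsOp q σ) (hn : n ≤ N) (l : K)
    {r : FreeAlgebra K (Fin N) → FreeAlgebra K (Fin N) → Prop}
    (hr : r = fun u v => (u, v) ∈ D.relList ((List.finRange n).map (Fin.castLE hn)) l) :
    ∃ (e : Fin n → (RingQuot r)ᵐᵒᵖ) (x : ℕ → (RingQuot r)ᵐᵒᵖ),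
      IsPres q (List.range' n (N - n)) (D.rel σ l) e x := by
  have har : ∀ k, k ∈ List.range' n (N - n) ↔ n ≤ k ∧ k < N := fun k => by
    rw [List.mem_range'_1]
    omega
  let v : Fin n → Fin N := Fin.castLE hn
  let ψ : FreeAlgebra K (Fin N) →ₗ[K] (RingQuot r)ᵐᵒᵖ :=
    (opLinearEquiv K).toLinearMap ∘ₗ (RingQuot.mkAlgHom K r).toLinearMap
  have hψm : ∀ u v, ψ (u * v) = ψ v * ψ u := fun u v => by
    change op (RingQuot.mkAlgHom K r (u * v)) = _
    rw [map_mul]; rfl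
  have hψr : ∀ u u', (u, u') ∈ D.relList ((List.finRange n).map v) l → ψ u = ψ u' := fun u u' huv =>
    congrArg op (RingQuot.mkAlgHom_rel K (by rw [hr]; exact huv))
  let e : Fin n → (RingQuot r)ᵐᵒᵖ := fun a => ψ (FreeAlgebra.ι K (σ (v a)))
  let x : ℕ → (RingQuot r)ᵐᵒᵖ := fun k => if hk : n ≤ k ∧ k < N then
    ψ (FreeAlgebra.ι K (σ ⟨k, hk.2⟩)) else 0
  have hx : ∀ i : Fin N, n ≤ i.1 → ψ (FreeAlgebra.ι K i) = x (σ i).1 := fun i hi => by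
    change _ = dite _ _ _
    rw [dif_pos ⟨h.le i hi, (σ i).2⟩, Fin.eta, h.invol]
  have hv : ∀ i : Fin N, i.1 < n → ∃ a, v a = i := fun i hi => ⟨⟨i, hi⟩, Fin.ext rfl⟩
  have hve : ∀ i : Fin N, ∀ hi : (σ i).1 < n, ψ (FreeAlgebra.ι K i) = e ⟨_, hi⟩ := fun i hi => by
    change _ = ψ (FreeAlgebra.ι K (σ ⟨(σ i).1, _⟩))
    rw [Fin.eta, h.invol]
  have hσ : Function.Injective σ := fun i j hij => by rw [← h.invol i, hij, h.invol]
  have hvi : Function.Injective v := Fin.castLE_injective hn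
  have hmem : ∀ a : Fin n, σ (v a) ∈ (List.finRange n).map v := fun a => by
    obtain ⟨b, hb⟩ := hv _ (h.lt (v a) a.2)
    exact List.mem_map.2 ⟨b, List.mem_finRange b, hb⟩
  refine ⟨e, x, ⟨⟨⟨?_, ?_, ?_⟩, ?_, ?_⟩, ?_, ?_⟩⟩
  · intro a b
    change ψ _ * ψ _ = _
    rw [← hψm]
    refine (hψr _ _ (List.mem_append_left _ (List.mem_flatMap.2 ⟨_, hmem b, List.mem_map.2
      ⟨_, hmem a, rfl⟩⟩))).trans ?_
    split_ifs with hab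
    · subst hab
      rw [Nat.beq_refl]
    · have : Nat.beq (σ (v b)).1 (σ (v a)).1 = false := by
        rw [Bool.eq_false_iff]
        intro e'
        have := hσ (Fin.ext (Nat.eq_of_beq_eq_true e'))
        exact hab (hvi this).symm
      rw [this]
      exact map_zero ψ
  · have h₁ := hψr _ _ (List.mem_append_right _ List.mem_cons_self)
    rw [freeS_vertices, List.map_map, ← Fin.sum_univ_def, map_sum] at h₁
    have h₂ : ψ 1 = 1 := congrArg op (map_one (RingQuot.mkAlgHom K r))
    rw [← h₂, ← h₁]
    refine Fintype.sum_bijective (fun a : Fin n => (⟨(σ (v a)).1, h.lt _ a.2⟩ : Fin n))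
      (Finite.injective_iff_bijective.1 fun a b hab => ?_) _ _ fun a => rfl
    have := hσ (Fin.ext (Fin.mk.inj hab) : σ (v a) = σ (v b))
    exact hvi this
  · intro k
    by_cases hk : n ≤ k ∧ k < N
    · have e₁ : x k = ψ (FreeAlgebra.ι K (σ ⟨k, hk.2⟩)) := dif_pos hk
      obtain ⟨⟨i, s, t⟩, ht, rfl : i = _⟩ := h.mem (σ ⟨k, hk.2⟩) (h.le _ hk.1)
      obtain ⟨-, h₂, h₃⟩ := h.arr _ ht
      simp only [h.invol] at h₂ h₃
      have h₄ := hψr _ _ (List.mem_append_right _ (List.mem_cons_of_mem _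
        (List.mem_append_left _ (List.mem_map_of_mem ht))))
      simp only [hψm] at h₄
      rw [e₁]
      refine Eq.trans ?_ h₄.symm
      have h₅ : ψ (FreeAlgebra.ι K t) = e (q.src k) := by
        rw [hve t (h₂ ▸ (q.src k).2)]
        exact congrArg e (Fin.ext h₂.symm)
      have h₆ : ψ (FreeAlgebra.ι K s) = e (q.tgt k) := by
        rw [hve s (h₃ ▸ (q.tgt k).2)]
        exact congrArg e (Fin.ext h₃.symm)
      rw [h₅, h₆, mul_assoc]
    · rw [show x k = 0 from dif_neg hk, mul_zero, zero_mul]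
  · intro k hk
    exact dif_neg fun h' => hk ((har k).2 h')
  · intro p hp'
    obtain ⟨p, hp, rfl⟩ := List.mem_map.1 hp'
    rw [evalL_append, evalL_neg, ← sub_eq_add_neg, sub_eq_zero,
      ← anti_freeS hψm hx l (h.ext p hp).1, ← anti_freeS hψm hx l (h.ext p hp).2]
    exact hψr _ _ (List.mem_append_right _ (List.mem_cons_of_mem _
      (List.mem_append_right _ (List.mem_map_of_mem hp))))
  · rw [eq_top_iff]
    rintro y -
    obtain ⟨z, hz⟩ := RingQuot.mkAlgHom_surjective K r y.unop
    have hy : y = ψ z := by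
      change y = op (RingQuot.mkAlgHom K r z)
      rw [hz]; rfl
    rw [hy]
    clear hy hz y
    induction z using FreeAlgebra.induction with
    | grade0 c =>
      have : ψ (algebraMap K _ c) = algebraMap K _ c := congrArg op (AlgHom.commutes _ c)
      rw [this]
      exact Subalgebra.algebraMap_mem _ c
    | grade1 i =>
      by_cases hi : i.1 < n
      · rw [hve i (h.lt i hi)]
        exact Algebra.subset_adjoin (Or.inl ⟨_, rfl⟩)
      · rw [hx i (by omega)]
        exact Algebra.subset_adjoin (Or.inr ⟨_, rfl⟩)
    | mul u v hu hv => rw [hψm]; exact Subalgebra.mul_mem _ hv hu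
    | add u v hu hv => rw [map_add]; exact Subalgebra.add_mem _ hu hv
  · intro B _ _ e' x' hrep
    let g : Fin N → Bᵐᵒᵖ := fun i => if hi : i.1 < n then op (e' ⟨(σ i).1, h.lt i hi⟩) else
      op (x' (σ i).1)
    let ψ' : FreeAlgebra K (Fin N) →ₗ[K] B :=
      (opLinearEquiv K).symm.toLinearMap ∘ₗ (FreeAlgebra.lift K g).toLinearMap
    have hψ'm : ∀ u v, ψ' (u * v) = ψ' v * ψ' u := fun u v => by
      change unop (FreeAlgebra.lift K g (u * v)) = _
      rw [map_mul]; rfl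
    have hg : ∀ i, ψ' (FreeAlgebra.ι K i) = (g i).unop := fun i => by
      change unop (FreeAlgebra.lift K g _) = _
      rw [FreeAlgebra.lift_ι_apply]
    have hx' : ∀ i : Fin N, n ≤ i.1 → ψ' (FreeAlgebra.ι K i) = x' (σ i).1 := fun i hi => by
      rw [hg]
      exact congrArg unop (dif_neg (by omega))
    have he' : ∀ i : Fin N, ∀ hi : i.1 < n, ψ' (FreeAlgebra.ι K i) = e' ⟨(σ i).1, h.lt i hi⟩ :=
      fun i hi => by
        rw [hg]
        exact congrArg unop (dif_pos hi)
    have hψ'r : ∀ u u', (u, u') ∈ D.relList ((List.finRange n).map v) l → ψ' u = ψ' u' := by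
      intro u₁ u₂ hu
      rcases List.mem_append.1 hu with hu | hu
      · obtain ⟨_, ha, hu⟩ := List.mem_flatMap.1 hu
        obtain ⟨a, -, rfl⟩ := List.mem_map.1 ha
        obtain ⟨_, hb, hu⟩ := List.mem_map.1 hu
        obtain ⟨b, -, rfl⟩ := List.mem_map.1 hb
        obtain ⟨rfl, rfl⟩ := Prod.mk.inj hu
        rw [hψ'm, he' (v a) a.2, he' (v b) b.2, hrep.idem]
        split_ifs with hab
        · have : v a = v b := hσ (Fin.ext (Fin.mk.inj hab).symm)
          rw [this, Nat.beq_refl, he' (v b) b.2]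
        · have : Nat.beq (v a).1 (v b).1 = false := by
            rw [Bool.eq_false_iff]
            intro e₁
            have : v a = v b := Fin.ext (Nat.eq_of_beq_eq_true e₁)
            exact hab (Fin.ext (congrArg (fun i => (σ i).1) this.symm))
          rw [this]
          exact (map_zero ψ').symm
      rcases List.mem_cons.1 hu with hu | hu
      · obtain ⟨rfl, rfl⟩ := Prod.mk.inj hu
        rw [freeS_vertices, List.map_map, ← Fin.sum_univ_def, map_sum,
          show ψ' 1 = 1 from congrArg unop (map_one (FreeAlgebra.lift K g)), ← hrep.sum]
        refine Fintype.sum_bijective (fun a : Fin n => (⟨(σ (v a)).1, h.lt _ a.2⟩ : Fin n))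
          (Finite.injective_iff_bijective.1 fun a b hab => ?_) _ _ fun a => he' (v a) a.2
        have := hσ (Fin.ext (Fin.mk.inj hab) : σ (v a) = σ (v b))
        exact hvi this
      rcases List.mem_append.1 hu with hu | hu
      · obtain ⟨⟨i, s, t⟩, ht, hu⟩ := List.mem_map.1 hu
        obtain ⟨rfl, rfl⟩ := Prod.mk.inj hu
        obtain ⟨h₁, h₂, h₃⟩ := h.arr _ ht
        have hlt : ∀ i : Fin N, (σ i).1 < n → i.1 < n := fun i hi => by
          have := h.lt _ hi
          rwa [h.invol] at this
        have hs := hlt s (h₃ ▸ (q.tgt _).2)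
        have ht' := hlt t (h₂ ▸ (q.src _).2)
        dsimp only at h₁ h₂ h₃ ⊢
        rw [hψ'm, hψ'm, hx' i h₁, he' s hs, he' t ht', ← mul_assoc]
        refine (hrep.arrow (σ i).1).symm.trans ?_
        rw [show q.src (σ i).1 = ⟨(σ t).1, h.lt t ht'⟩ from Fin.ext h₂,
          show q.tgt (σ i).1 = ⟨(σ s).1, h.lt s hs⟩ from Fin.ext h₃]
      · obtain ⟨p, hp, hu⟩ := List.mem_map.1 hu
        obtain ⟨rfl, rfl⟩ := Prod.mk.inj hu
        rw [anti_freeS hψ'm hx' l (h.ext p hp).1, anti_freeS hψ'm hx' l (h.ext p hp).2,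
          ← sub_eq_zero, sub_eq_add_neg, ← evalL_neg, ← evalL_append]
        exact hrep.relations _ (List.mem_map_of_mem hp)
    let φ₀ : RingQuot r →ₐ[K] Bᵐᵒᵖ := RingQuot.liftAlgHom K ⟨FreeAlgebra.lift K g, fun u₁ u₂ hu => by
      rw [hr] at hu
      exact unop_injective (hψ'r _ _ hu)⟩
    have hφ₀ : ∀ z, φ₀ (RingQuot.mkAlgHom K r z) = FreeAlgebra.lift K g z := fun z =>
      RingQuot.liftAlgHom_mkAlgHom_apply K _ _ z
    refine ⟨(AlgEquiv.opOp K B).symm.toAlgHom.comp (AlgHom.op φ₀), fun a => ?_, fun k => ?_⟩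
    · change unop (φ₀ (RingQuot.mkAlgHom K r (FreeAlgebra.ι K (σ (v a))))) = _
      rw [hφ₀]
      refine (he' _ (h.lt _ a.2)).trans (congrArg e' (Fin.ext ?_))
      change (σ (σ (v a))).1 = _
      rw [h.invol]; rfl
    · by_cases hk : n ≤ k ∧ k < N
      · rw [show x k = ψ (FreeAlgebra.ι K (σ ⟨k, hk.2⟩)) from dif_pos hk]
        change unop (φ₀ (RingQuot.mkAlgHom K r (FreeAlgebra.ι K (σ ⟨k, hk.2⟩)))) = _
        rw [hφ₀]
        refine (hx' _ (h.le _ hk.1)).trans ?_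
        rw [h.invol]
      · rw [show x k = 0 from dif_neg hk, map_zero, hrep.junk k fun h' => hk ((har k).1 h')]

end RingQuot


/-! ### Presentations of the algebras -/

/-- Verification of the rewriting rules and the basis of a presented algebra. -/
def presCheck {α : Type} {n : ℕ} (q : Quiv n) (R : Coef α) (rules : List (Word × LC α))
    (ar : List ℕ) (rel : List (LC α)) (certs : List (α × List (α × Word × ℕ × Word))) : Bool :=
  certCheck R rel rules certs && spanCheck q R rules ar && repCheck q R rules ar rel &&
    rel.all fun r => r.all fun t => t.2.all fun k => ar.any (Nat.beq k)

/-- The reversed and renamed relations with formal coefficients. -/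
def QuivData.relL {α : Type} {N : ℕ} (D : QuivData N) (R : Coef α) (σ : Fin N → Fin N) :
    List (LC α) :=
  D.ext.map fun p => p.1.map (fun t => (R.one, (t.2.map fun i => (σ i).1).reverse)) ++
    p.2.map fun t => (R.neg R.one, (t.2.map fun i => (σ i).1).reverse)

lemma QuivData.map_relL {α : Type} {R : Coef α} {K : Type} [Field K] {ev : α → K}
    (hR : R.IsEval ev) {N : ℕ} (D : QuivData N) (σ : Fin N → Fin N) (l : K)
    (h : ∀ p ∈ D.ext, (∀ t ∈ p.1, t.1 = false) ∧ ∀ t ∈ p.2, t.1 = false) :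
    (D.relL R σ).map (mapLC ev) = D.rel σ l := by
  rw [QuivData.relL, QuivData.rel, List.map_map]
  refine List.map_congr_left fun p hp => ?_
  simp only [Function.comp_apply, mapLC, toLC, List.map_append, List.map_map]
  congr 1
  · exact List.map_congr_left fun t ht => by simp [(h p hp).1 t ht, hR.one]
  · exact List.map_congr_left fun t ht => by simp [(h p hp).2 t ht, hR.one, hR.neg]

/-- The quiver and relations of `A3`. -/
def dataA3 : QuivData 10 where
  arr := [(4,0,1),(5,1,0),(6,1,2),(7,2,1),(8,1,3),(9,3,1)]
  ext := [([(false,[5,4]),(false,[6,7]),(false,[8,9])],[]),([(false,[4,5])],[]),([(false,[7,6])],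
    []),([(false,[9,8])],[])]

/-- The isomorphism of the quiver of `A3` with the opposite quiver. -/
def opA3 (i : Fin 10) : Fin 10 := [0,1,2,3,5,4,7,6,9,8].getD i.1 0

/-- Derivation of the rewriting rules for the opposite of `A3`. -/
def certA3 : List (ℤ × List (ℤ × Word × ℕ × Word)) :=
  [(1,[(1,[],1,[])]),(1,[(1,[],2,[])]),(1,[(1,[],0,[])]),(1,[(1,[],3,[])]),(1,[(1,[],0,[8]),
    (-1,[8],3,[])]),(1,[(1,[9],0,[]),(-1,[],3,[9])]),(1,[(1,[],0,[5,4]),(1,[],0,[6,7]),(-1,[8],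
    9,[]),(-1,[6],2,[7]),(-1,[5],1,[4])]),(1,[(1,[7],8,[]),(-1,[],2,[7,8])]),(1,[(1,[],9,[6]),
    (-1,[9,6],2,[])]),(1,[(1,[],10,[5]),(-1,[6,7,5],1,[])]),(1,[(1,[7],10,[]),(-1,[],
    2,[7,5,4])])]

lemma isOpA3 : dataA3.IsOp quivA3 opA3 := by constructor <;> decide +kernel

lemma presA3 : presCheck quivA3 intCoef rulesA3 (List.range' 4 6)
    (dataA3.relL intCoef opA3) certA3 = true := by decide +kernel

/-- The quiver and relations of `A4`. -/
def dataA4 : QuivData 10 where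
  arr := [(4,0,1),(5,1,0),(6,1,2),(7,2,1),(8,1,3),(9,3,1)]
  ext := [([(false,[5,4]),(false,[6,7]),(false,[8,9])],[]),([(false,[4,5])],[]),([(false,[7,8])],
    []),([(false,[9,6])],[])]

/-- The isomorphism of the quiver of `A4` with the opposite quiver. -/
def opA4 (i : Fin 10) : Fin 10 := [0,1,2,3,5,4,7,6,9,8].getD i.1 0

/-- Derivation of the rewriting rules for the opposite of `A4`. -/
def certA4 : List (ℤ × List (ℤ × Word × ℕ × Word)) :=
  [(1,[(1,[],1,[])]),(1,[(1,[],3,[])]),(1,[(1,[],0,[])]),(1,[(1,[],2,[])]),(1,[(1,[],0,[6]),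
    (-1,[8],2,[])]),(1,[(1,[7],0,[]),(-1,[],3,[9])]),(1,[(1,[6],9,[]),(-1,[],8,[7])]),(1,[(1,[],
    9,[8]),(-1,[7,6],3,[])]),(1,[(1,[9],8,[]),(-1,[],2,[7,6])]),(1,[(-1,[],10,[5]),(1,[6,7,5],
    1,[])]),(1,[(1,[],9,[5,4]),(-1,[7],10,[]),(-1,[7,5],1,[4])])]

lemma isOpA4 : dataA4.IsOp quivA4 opA4 := by constructor <;> decide +kernel

lemma presA4 : presCheck quivA4 intCoef rulesA4 (List.range' 4 6)
    (dataA4.relL intCoef opA4) certA4 = true := by decide +kernel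

/-- The quiver and relations of `A5`. -/
def dataA5 : QuivData 5 where
  arr := [(2,0,0),(3,0,1),(4,1,0)]
  ext := [([(false,[2,2])],[(false,[3,4])]),([(false,[4,2,3])],[])]

/-- The isomorphism of the quiver of `A5` with the opposite quiver. -/
def opA5 (i : Fin 5) : Fin 5 := [0,1,2,4,3].getD i.1 0

/-- Derivation of the rewriting rules for the opposite of `A5`. -/
def certA5 : List (ℤ × List (ℤ × Word × ℕ × Word)) :=
  [(1,[(-1,[],0,[])]),(1,[(1,[],1,[])]),(1,[(1,[],0,[2,3]),(1,[3],1,[])]),(1,[(1,[4,2],0,[]),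
    (1,[],1,[4])]),(1,[(1,[],0,[2,2,2]),(1,[3],5,[])])]

lemma isOpA5 : dataA5.IsOp quivA5 opA5 := by constructor <;> decide +kernel

lemma presA5 : presCheck quivA5 intCoef rulesA5 (List.range' 2 3)
    (dataA5.relL intCoef opA5) certA5 = true := by decide +kernel

/-- The quiver and relations of `A6`. -/
def dataA6 : QuivData 5 where
  arr := [(2,0,0),(3,0,1),(4,1,0)]
  ext := [([(false,[2,2,2])],[(false,[3,4])]),([(false,[4,3])],[]),([(false,[4,2,2])],[]),
    ([(false,[2,2,3])],[])]

/-- The isomorphism of the quiver of `A6` with the opposite quiver. -/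
def opA6 (i : Fin 5) : Fin 5 := [0,1,2,4,3].getD i.1 0

/-- Derivation of the rewriting rules for the opposite of `A6`. -/
def certA6 : List (ℤ × List (ℤ × Word × ℕ × Word)) :=
  [(1,[(1,[],1,[])]),(1,[(1,[],0,[])]),(1,[(1,[],2,[])]),(1,[(1,[],3,[])]),(1,[(-1,[],0,[2]),
    (1,[2],0,[])]),(1,[(-1,[4],8,[]),(1,[],1,[4,2])])]

lemma isOpA6 : dataA6.IsOp quivA6 opA6 := by constructor <;> decide +kernel

lemma presA6 : presCheck quivA6 intCoef rulesA6 (List.range' 2 3)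
    (dataA6.relL intCoef opA6) certA6 = true := by decide +kernel

/-- The quiver and relations of `A7`. -/
def dataA7 : QuivData 10 where
  arr := [(4,0,1),(5,1,0),(6,1,2),(7,2,1),(8,2,3),(9,3,2)]
  ext := [([(false,[5,4])],[(false,[6,7])]),([(false,[7,6])],[(false,[8,9])]),([(false,[4,6,8])],
    []),([(false,[9,7,5])],[])]

/-- The isomorphism of the quiver of `A7` with the opposite quiver. -/
def opA7 (i : Fin 10) : Fin 10 := [0,1,2,3,5,4,7,6,9,8].getD i.1 0

/-- Derivation of the rewriting rules for the opposite of `A7`. -/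
def certA7 : List (ℤ × List (ℤ × Word × ℕ × Word)) :=
  [(1,[(-1,[],0,[])]),(1,[(-1,[],1,[])]),(1,[(1,[],3,[])]),(1,[(1,[],2,[])]),(1,[(1,[4,6],1,[]),
    (1,[],3,[9]),(1,[4],0,[6])]),(1,[(1,[],1,[7,5]),(1,[8],2,[]),(1,[7],0,[5])]),(1,[(1,[4,5,4],
    0,[]),(1,[],8,[7])]),(1,[(1,[],0,[5,4,5]),(1,[6],9,[])])]

lemma isOpA7 : dataA7.IsOp quivA7 opA7 := by constructor <;> decide +kernel

lemma presA7 : presCheck quivA7 intCoef rulesA7 (List.range' 4 6)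
    (dataA7.relL intCoef opA7) certA7 = true := by decide +kernel

/-- The quiver and relations of `A8`. -/
def dataA8 : QuivData 10 where
  arr := [(4,0,1),(5,1,2),(6,2,3),(7,3,0),(8,0,2),(9,2,0)]
  ext := [([(false,[8,9,8])],[(false,[4,5])]),([(false,[9,8,9])],[(false,[6,7])]),
    ([(false,[5,9,8])],[]),([(false,[7,8,9])],[]),([(false,[9,8,6])],[]),([(false,[8,9,4])],[]),
    ([(false,[5,6])],[]),([(false,[7,4])],[])]

/-- The isomorphism of the quiver of `A8` with the opposite quiver. -/
def opA8 (i : Fin 10) : Fin 10 := [2,1,0,3,5,4,7,6,8,9].getD i.1 0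

/-- Derivation of the rewriting rules for the opposite of `A8`. -/
def certA8 : List (ℤ × List (ℤ × Word × ℕ × Word)) :=
  [(1,[(1,[],7,[])]),(1,[(1,[],6,[])]),(1,[(1,[],5,[])]),(1,[(1,[],4,[])]),(1,[(1,[],2,[])]),
    (1,[(1,[],0,[])]),(1,[(1,[],3,[])]),(1,[(1,[],1,[])]),(1,[(-1,[8],1,[]),(1,[],0,[9])]),
    (1,[(-1,[9],0,[]),(1,[],1,[8])]),(1,[(-1,[],16,[4]),(1,[8,6],6,[])]),(1,[(-1,[],17,[6]),
    (1,[9,4],7,[])])]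

lemma isOpA8 : dataA8.IsOp quivA8 opA8 := by constructor <;> decide +kernel

lemma presA8 : presCheck quivA8 intCoef rulesA8 (List.range' 4 6)
    (dataA8.relL intCoef opA8) certA8 = true := by decide +kernel

/-- The quiver and relations of `A9`. -/
def dataA9 : QuivData 10 where
  arr := [(4,0,1),(5,1,2),(6,2,1),(7,2,3),(8,3,2),(9,3,0)]
  ext := [([(false,[9,4])],[(false,[8,6])]),([(false,[7,8])],[(false,[6,5])]),([(false,[4,5,6])],
    []),([(false,[8,7,9])],[]),([(false,[5,7,8,7])],[])]

/-- The isomorphism of the quiver of `A9` with the opposite quiver. -/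
def opA9 (i : Fin 10) : Fin 10 := [0,3,2,1,9,7,8,5,6,4].getD i.1 0

/-- Derivation of the rewriting rules for the opposite of `A9`. -/
def certA9 : List (ℤ × List (ℤ × Word × ℕ × Word)) :=
  [(1,[(-1,[],1,[])]),(1,[(1,[],0,[])]),(1,[(1,[],3,[])]),(1,[(1,[],2,[])]),(1,[(1,[],4,[])]),
    (1,[(1,[],1,[7,9]),(1,[7],2,[])]),(1,[(-1,[],0,[5,6]),(1,[9],3,[])]),(1,[(1,[5,6,5],1,[]),
    (1,[],4,[8])]),(1,[(1,[],1,[6,5,6]),(1,[7],11,[])])]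

lemma isOpA9 : dataA9.IsOp quivA9 opA9 := by constructor <;> decide +kernel

lemma presA9 : presCheck quivA9 intCoef rulesA9 (List.range' 4 6)
    (dataA9.relL intCoef opA9) certA9 = true := by decide +kernel

/-- The quiver and relations of `A10`. -/
def dataA10 : QuivData 9 where
  arr := [(4,0,1),(5,1,0),(6,1,2),(7,2,3),(8,3,1)]
  ext := [([(false,[8,5,4])],[(false,[8,6,7,8])]),([(false,[5,4,6])],[(false,[6,7,8,6])]),
    ([(false,[4,5])],[]),([(false,[7,8,6,7,8,6,7])],[])]

/-- The isomorphism of the quiver of `A10` with the opposite quiver. -/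
def opA10 (i : Fin 9) : Fin 9 := [0,1,3,2,5,4,8,7,6].getD i.1 0

/-- Derivation of the rewriting rules for the opposite of `A10`. -/
def certA10 : List (ℤ × List (ℤ × Word × ℕ × Word)) :=
  [(1,[(1,[],2,[])]),(1,[(-1,[],0,[])]),(1,[(-1,[],1,[])]),(1,[(1,[6,7],1,[]),(-1,[],0,[7,8])]),
    (1,[(-1,[],7,[5]),(1,[6,7,8,5],2,[])]),(1,[(-1,[],1,[5,4]),(-1,[8],7,[]),(1,[8,5],2,[4])]),
    (1,[(1,[7,8],0,[7]),(1,[],3,[])])]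

lemma isOpA10 : dataA10.IsOp quivA10 opA10 := by constructor <;> decide +kernel

lemma presA10 : presCheck quivA10 intCoef rulesA10 (List.range' 4 5)
    (dataA10.relL intCoef opA10) certA10 = true := by decide +kernel

/-- The quiver and relations of `A11`. -/
def dataA11 : QuivData 10 where
  arr := [(4,0,1),(5,1,0),(6,1,2),(7,2,1),(8,2,3),(9,3,2)]
  ext := [([(false,[7,5,4])],[(false,[7,6,7])]),([(false,[5,4,6])],[(false,[6,7,6])]),
    ([(false,[4,5])],[]),([(false,[9,7])],[]),([(false,[6,8])],[]),([(false,[7,6,7,6])],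
    [(false,[8,9])])]

/-- The isomorphism of the quiver of `A11` with the opposite quiver. -/
def opA11 (i : Fin 10) : Fin 10 := [0,1,2,3,5,4,7,6,9,8].getD i.1 0

/-- Derivation of the rewriting rules for the opposite of `A11`. -/
def certA11 : List (ℤ × List (ℤ × Word × ℕ × Word)) :=
  [(1,[(1,[],2,[])]),(1,[(1,[],3,[])]),(1,[(1,[],4,[])]),(1,[(-1,[],0,[])]),(1,[(-1,[],1,[])]),
    (1,[(1,[6],1,[]),(-1,[],0,[7])]),(1,[(1,[7],0,[]),(1,[],5,[])]),(1,[(-1,[],5,[8]),(1,[7,6,7],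
    3,[])]),(1,[(-1,[9],5,[]),(1,[],4,[6,7,6])]),(1,[(-1,[],11,[5]),(1,[6,7,5],2,[])])]

lemma isOpA11 : dataA11.IsOp quivA11 opA11 := by constructor <;> decide +kernel

lemma presA11 : presCheck quivA11 intCoef rulesA11 (List.range' 4 6)
    (dataA11.relL intCoef opA11) certA11 = true := by decide +kernel

/-- The quiver and relations of `A12`. -/
def dataA12 : QuivData 7 where
  arr := [(3,0,1),(4,1,2),(5,2,0),(6,0,2)]
  ext := [([(false,[6,5,6])],[(false,[3,4])]),([(false,[4,5,3])],[]),([(false,[5,6,5,6,5,6,5])],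
    [])]

/-- The isomorphism of the quiver of `A12` with the opposite quiver. -/
def opA12 (i : Fin 7) : Fin 7 := [2,1,0,4,3,5,6].getD i.1 0

/-- Derivation of the rewriting rules for the opposite of `A12`. -/
def certA12 : List (ℤ × List (ℤ × Word × ℕ × Word)) :=
  [(1,[(1,[],1,[])]),(1,[(1,[],0,[])]),(1,[(-1,[6,5],0,[]),(1,[],0,[5,6])]),(1,[(-1,[],5,[5,3]),
    (1,[6,5,3],1,[])]),(1,[(-1,[5],0,[5,6,5]),(1,[],2,[])])]

lemma isOpA12 : dataA12.IsOp quivA12 opA12 := by constructor <;> decide +kernel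

lemma presA12 : presCheck quivA12 intCoef rulesA12 (List.range' 3 4)
    (dataA12.relL intCoef opA12) certA12 = true := by decide +kernel

/-- The quiver and relations of `A13`. -/
def dataA13 : QuivData 8 where
  arr := [(3,1,1),(4,0,1),(5,1,0),(6,1,2),(7,2,1)]
  ext := [([(false,[3,3])],[(false,[5,4])]),([(false,[4,6])],[]),([(false,[4,5])],[]),
    ([(false,[7,5])],[]),([(false,[7,3])],[]),([(false,[3,6])],[]),([(false,[3,3,3])],
    [(false,[6,7])])]

/-- The isomorphism of the quiver of `A13` with the opposite quiver. -/
def opA13 (i : Fin 8) : Fin 8 := [0,1,2,3,5,4,7,6].getD i.1 0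

/-- Derivation of the rewriting rules for the opposite of `A13`. -/
def certA13 : List (ℤ × List (ℤ × Word × ℕ × Word)) :=
  [(1,[(1,[],4,[])]),(1,[(1,[],2,[])]),(1,[(1,[],3,[])]),(1,[(-1,[],0,[])]),(1,[(1,[],5,[])]),
    (1,[(1,[],1,[])]),(1,[(1,[],6,[])]),(1,[(1,[],0,[5]),(1,[5],2,[])]),(1,[(1,[4],0,[]),(1,[],
    2,[4])]),(1,[(-1,[],6,[6]),(1,[3,3],4,[])]),(1,[(-1,[7],6,[]),(1,[],5,[3,3])])]

lemma isOpA13 : dataA13.IsOp quivA13 opA13 := by constructor <;> decide +kernel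

lemma presA13 : presCheck quivA13 intCoef rulesA13 (List.range' 3 5)
    (dataA13.relL intCoef opA13) certA13 = true := by decide +kernel

/-- The quiver and relations of `A14`. -/
def dataA14 : QuivData 7 where
  arr := [(3,0,1),(4,1,0),(5,1,2),(6,2,1)]
  ext := [([(false,[4,3])],[(false,[5,6,5,6])]),([(false,[3,5,6,5])],[]),([(false,[6,5,6,4])],[]),
    ([(false,[3,4])],[])]

/-- The isomorphism of the quiver of `A14` with the opposite quiver. -/
def opA14 (i : Fin 7) : Fin 7 := [0,1,2,4,3,6,5].getD i.1 0

/-- Derivation of the rewriting rules for the opposite of `A14`. -/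
def certA14 : List (ℤ × List (ℤ × Word × ℕ × Word)) :=
  [(1,[(1,[],3,[])]),(1,[(1,[],2,[])]),(1,[(-1,[],0,[])]),(1,[(1,[],1,[])]),(1,[(1,[5,6],0,[]),
    (-1,[],0,[5,6])]),(1,[(-1,[],8,[4]),(1,[5,6,4],3,[])]),(1,[(-1,[6],8,[]),(1,[],1,[3])])]

lemma isOpA14 : dataA14.IsOp quivA14 opA14 := by constructor <;> decide +kernel

lemma presA14 : presCheck quivA14 intCoef rulesA14 (List.range' 3 4)
    (dataA14.relL intCoef opA14) certA14 = true := by decide +kernel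

/-- The quiver and relations of `A15`. -/
def dataA15 : QuivData 8 where
  arr := [(3,0,0),(4,0,1),(5,1,2),(6,2,0),(7,0,2)]
  ext := [([(false,[5,6,3])],[]),([(false,[3,3])],[(false,[7,6])]),([(false,[6,7])],[]),
    ([(false,[3,4])],[]),([(false,[3,7])],[(false,[4,5])])]

/-- The isomorphism of the quiver of `A15` with the opposite quiver. -/
def opA15 (i : Fin 8) : Fin 8 := [0,1,2,3,4,5,6,7].getD i.1 0

/-- Derivation of the rewriting rules for the opposite of `A15`. -/
def certA15 : List (ℤ × List (ℤ × Word × ℕ × Word)) :=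
  [(1,[(1,[],3,[])]),(1,[(-1,[],1,[])]),(1,[(1,[],4,[])]),(1,[(1,[],2,[])]),(1,[(1,[],1,[6]),
    (1,[6],2,[])]),(1,[(1,[],0,[])]),(1,[(-1,[6],4,[]),(-1,[],1,[3])]),(1,[(1,[3,3],1,[]),(1,[],
    9,[7])]),(1,[(-1,[],4,[6,5]),(1,[7],0,[])])]

lemma isOpA15 : dataA15.IsOp quivA16 opA15 := by constructor <;> decide +kernel

lemma presA15 : presCheck quivA16 intCoef rulesA16 (List.range' 3 5)
    (dataA15.relL intCoef opA15) certA15 = true := by decide +kernel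

/-- The quiver and relations of `A16`. -/
def dataA16 : QuivData 8 where
  arr := [(3,0,0),(4,1,0),(5,2,1),(6,0,2),(7,2,0)]
  ext := [([(false,[3,6,5])],[]),([(false,[3,3])],[(false,[6,7])]),([(false,[7,6])],[]),
    ([(false,[4,3])],[]),([(false,[7,3])],[(false,[5,4])])]

/-- The isomorphism of the quiver of `A16` with the opposite quiver. -/
def opA16 (i : Fin 8) : Fin 8 := [0,1,2,3,4,5,6,7].getD i.1 0

/-- Derivation of the rewriting rules for the opposite of `A16`. -/
def certA16 : List (ℤ × List (ℤ × Word × ℕ × Word)) :=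
  [(1,[(1,[],3,[])]),(1,[(-1,[],4,[])]),(1,[(1,[],2,[])]),(1,[(-1,[],1,[])]),(1,[(1,[],1,[7]),
    (1,[7],2,[])]),(1,[(1,[],0,[])]),(1,[(1,[6],1,[]),(1,[],2,[6])]),(1,[(1,[],1,[3,3]),(1,[7],
    11,[])])]

lemma isOpA16 : dataA16.IsOp quivA15 opA16 := by constructor <;> decide +kernel

lemma presA16 : presCheck quivA15 intCoef rulesA15 (List.range' 3 5)
    (dataA16.relL intCoef opA16) certA16 = true := by decide +kernel

/-- The quiver and relations of `A1`. -/
def dataA1 : QuivData 7 where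
  arr := [(3,0,1),(4,1,0),(5,1,2),(6,2,1)]
  ext := [([(false,[3,4,3])],[(false,[3,5,6])]),([(false,[6,4,3])],[(true,[6,5,6])]),
    ([(false,[4,3,4])],[(false,[5,6,4])]),([(false,[4,3,5])],[(true,[5,6,5])])]

/-- The isomorphism of the quiver of `A1` with the opposite quiver. -/
def opA1 (i : Fin 7) : Fin 7 := [0,1,2,4,3,6,5].getD i.1 0

/-- The relations of the opposite of `A1`, with formal parameters. -/
def relA1 : List (LC Poly) :=
  [[([[1]],[4,3,4]),([[],[-1]],[5,6,4])],[([[1]],[4,3,5]),([[0,-1]],[5,6,5])],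
    [([[1]],[3,4,3]),([[],[-1]],[3,5,6])],[([[1]],[6,4,3]),([[0,-1]],[6,5,6])]]

/-- Derivation of the rewriting rules for the opposite of `A1`. -/
def certA1 : List (Poly × List (Poly × Word × ℕ × Word)) :=
  [([[1]],[([[1]],[],2,[])]),([[1]],[([[1]],[],0,[])]),([[1]],[([[1]],[],1,[])]),
    ([[1]],[([[1]],[],3,[])]),(polyD,[([[1]],[],2,[5]),([[-1]],[3],1,[])]),
    (polyD,[([[1]],[6],0,[]),([[-1]],[],3,[4])]),(polyU,[([[1]],[4],8,[]),([[-1]],[],1,[6,5])]),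
    (polyU,[([[1]],[],9,[3]),([[-1]],[6,5],3,[])])]

lemma isOpA1 : dataA1.IsOp quivA1 opA1 := by constructor <;> decide +kernel

lemma presA1 : presCheck quivA1 polyCoef (rulesA1 polyU polyW) (List.range' 3 4) relA1 certA1 =
    true := by decide +kernel

/-- The quiver and relations of `A2`. -/
def dataA2 : QuivData 6 where
  arr := [(2,0,0),(3,1,1),(4,0,1),(5,1,0)]
  ext := [([(false,[2,2])],[(false,[4,5])]),([(true,[3,3])],[(false,[5,4])]),
    ([(false,[5,2])],[(false,[3,5])]),([(false,[4,3])],[(false,[2,4])])]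

/-- The isomorphism of the quiver of `A2` with the opposite quiver. -/
def opA2 (i : Fin 6) : Fin 6 := [0,1,2,3,5,4].getD i.1 0

/-- The relations of the opposite of `A2`, with formal parameters. -/
def relA2 : List (LC Poly) :=
  [[(polyU,[2,2]),([[-1]],[4,5])],[(polyW,[3,3]),([[-1]],[5,4])],
    [([[1]],[2,4]),([[-1]],[4,3])],[([[1]],[3,5]),([[-1]],[5,2])]]

/-- Derivation of the rewriting rules for the opposite of `A2`. -/
def certA2 : List (Poly × List (Poly × Word × ℕ × Word)) :=
  [([[1]],[([[-1]],[],0,[])]),([[1]],[([[-1]],[],1,[])]),([[1]],[([[-1]],[],3,[])]),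
    ([[1]],[([[-1]],[],2,[])]),
    ([[0,-1],[1]],[([[1]],[],4,[4]),([[-1]],[4],5,[]),([[],[-1]],[],7,[3]),([[],[-1]],[2],7,[])]),
    (polyD,[([[1]],[],5,[5]),([[-1]],[5],4,[]),([[0,-1]],[],6,[2]),([[0,-1]],[3],6,[])]),
    (polyU,[([[1]],[],8,[5]),([[-1]],[2,2],4,[])]),(polyW,[([[1]],[],9,[4]),([[-1]],[3,3],5,[])])]

lemma isOpA2 : dataA2.IsOp quivA2 opA2 := by constructor <;> decide +kernel

lemma presA2 : presCheck quivA2 polyCoef (rulesA2 polyU polyW) (List.range' 2 4) relA2 certA2 =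
    true := by decide +kernel

lemma map_relA1 {K : Type} [Field K] {l : K} {t : Param K} (ht : t.1 = (l, 1)) :
    relA1.map (mapLC (evalPoly t)) = dataA1.rel opA1 l := by
  simp [relA1, mapLC, dataA1, QuivData.rel, toLC, opA1, evalPoly, evalP, ht]

lemma map_relA2 {K : Type} [Field K] {l : K} {t : Param K} (ht : t.1 = (1, l)) :
    relA2.map (mapLC (evalPoly t)) = dataA2.rel opA2 l := by
  simp [relA2, mapLC, dataA2, QuivData.rel, toLC, opA2, evalPoly, evalP, ht, polyU, polyW]


/-! ### Morphisms in the homotopy category -/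

section Homotopy

open CochainComplex.HomComplex

variable {V : Type u} [Category.{v} V] [Preadditive V] [HasZeroObject V] [HasBinaryBiproducts V]

lemma homZero_quotient_iff (X Y : CochainComplex V ℤ) (k : ℤ) :
    HomZero ((HomotopyCategory.quotient V (ComplexShape.up ℤ)).obj X)
      ((HomotopyCategory.quotient V (ComplexShape.up ℤ)).obj Y) k ↔
      ∀ z : Cocycle X Y k, z ∈ coboundaries X Y k := by
  let e := ((HomotopyCategory.quotient V (ComplexShape.up ℤ)).commShiftIso k).app Y
  refine ⟨fun h z => ?_, fun h f => ?_⟩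
  · rw [← CohomologyClass.toHom_mk_eq_zero_iff]
    have := h (CohomologyClass.toHom (CohomologyClass.mk z) ≫ e.hom)
    rw [← cancel_mono e.hom, this, zero_comp]
  · obtain ⟨x, hx⟩ := (CohomologyClass.toHom_bijective X Y k).2 (f ≫ e.inv)
    obtain ⟨z, rfl⟩ := x.mk_surjective
    rw [(CohomologyClass.toHom_mk_eq_zero_iff z).2 (h z)] at hx
    rw [← cancel_mono e.inv, ← hx, zero_comp]

lemma homZero_quotient_of_isZero {X Y : CochainComplex V ℤ} {k : ℤ}
    (h : ∀ i, IsZero (X.X i) ∨ IsZero (Y.X (i + k))) :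
    HomZero ((HomotopyCategory.quotient V (ComplexShape.up ℤ)).obj X)
      ((HomotopyCategory.quotient V (ComplexShape.up ℤ)).obj Y) k := by
  rw [homZero_quotient_iff]
  intro z
  have : z = 0 := by
    ext p q hpq
    subst hpq
    rcases h p with h | h
    · exact h.eq_of_src _ _
    · exact h.eq_of_tgt _ _
  rw [this]
  exact zero_mem _

/-- A stalk complex in degree zero, as an object of the homotopy category. -/
abbrev stalk (V : Type u) [Category.{v} V] [Preadditive V] [HasZeroObject V] :
    V ⥤ HomotopyCategory V (ComplexShape.up ℤ) :=
  CochainComplex.singleFunctor V 0 ⋙ HomotopyCategory.quotient V (ComplexShape.up ℤ)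

lemma isZero_single (M : V) {i : ℤ} (hi : i ≠ 0) :
    IsZero (((CochainComplex.singleFunctor V 0).obj M).X i) :=
  HomologicalComplex.isZero_single_obj_X _ _ _ _ hi

lemma homZero_stalk (M N : V) {k : ℤ} (hk : k ≠ 0) :
    HomZero ((stalk V).obj M) ((stalk V).obj N) k :=
  homZero_quotient_of_isZero fun i => by
    by_cases hi : i = 0
    · exact Or.inr (isZero_single N (by omega))
    · exact Or.inl (isZero_single M hi)

instance : (stalk V).Faithful where
  map_injective {M N f g} h := by
    refine (CochainComplex.singleFunctor V 0).map_injective ?_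
    have h' := HomotopyCategory.homotopyOfEq _ _ h
    refine HomologicalComplex.from_single_hom_ext ?_
    have := h'.comm 0
    rwa [dNext_eq _ (show (ComplexShape.up ℤ).Rel 0 1 from rfl),
      prevD_eq _ (show (ComplexShape.up ℤ).Rel (-1) 0 from rfl),
      CochainComplex.singleFunctor_obj_d, CochainComplex.singleFunctor_obj_d, zero_comp, comp_zero,
      zero_add, zero_add] at this

lemma homZero_stalk_iff (M : V) (Y : CochainComplex V ℤ) (k : ℤ) :
    HomZero ((stalk V).obj M) ((HomotopyCategory.quotient V (ComplexShape.up ℤ)).obj Y) k ↔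
      ∀ f : M ⟶ Y.X k, f ≫ Y.d k (k + 1) = 0 → ∃ g : M ⟶ Y.X (k - 1), g ≫ Y.d (k - 1) k = f := by
  refine (homZero_quotient_iff _ _ _).trans ⟨fun h f hf => ?_, fun h z => ?_⟩
  · exact (Cocycle.fromSingleMk_mem_coboundaries_iff f (zero_add k) _ rfl hf _
      (sub_add_cancel k 1)).1 (h _)
  · obtain ⟨f, hf, rfl⟩ := Cocycle.fromSingleMk_surjective z k (zero_add k) _ rfl
    exact (Cocycle.fromSingleMk_mem_coboundaries_iff f (zero_add k) _ rfl hf _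
      (sub_add_cancel k 1)).2 (h f hf)

/-- Morphisms from a bounded complex of projectives to a complex which is exact in the relevant
degrees vanish. -/
lemma homZero_of_projective {X Y : CochainComplex V ℤ} {k : ℤ} (m : ℕ)
    (hX : ∀ i : ℤ, 0 < i ∨ i ≤ -(m : ℤ) → IsZero (X.X i)) (hk : (m : ℤ) ≤ k)
    (h : ∀ (i j : ℤ), 0 < j → ∀ f : X.X i ⟶ Y.X j, f ≫ Y.d j (j + 1) = 0 →
      ∃ g : X.X i ⟶ Y.X (j - 1), g ≫ Y.d (j - 1) j = f) :
    HomZero ((HomotopyCategory.quotient V (ComplexShape.up ℤ)).obj X)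
      ((HomotopyCategory.quotient V (ComplexShape.up ℤ)).obj Y) k := by
  rw [homZero_quotient_iff]
  intro z
  rw [mem_coboundaries_iff _ (k - 1) (sub_add_cancel k 1)]
  have key : ∀ j : ℕ, j ≤ m → ∃ c : Cochain X Y (k - 1), ∀ (p q : ℤ) (hpq : p + k = q),
      -(j : ℤ) < p → (z.1 - δ (k - 1) k c).v p q hpq = 0 := fun j => by
    induction j with
    | zero => exact fun _ => ⟨0, fun p q hpq hp => (hX p (Or.inl (by simpa using hp))).eq_of_src _ _⟩
    | succ j ih =>
      intro hj
      obtain ⟨c, hc⟩ := ih (by omega)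
      have hδ : δ k (k + 1) (z.1 - δ (k - 1) k c) = 0 := by
        rw [δ_sub, z.δ_eq_zero, δ_δ, sub_zero]
      have h₁ := Cochain.congr_v hδ (-(j : ℤ)) (-(j : ℤ) + k + 1) (by omega)
      rw [δ_v k (k + 1) rfl _ _ _ _ (-(j : ℤ) + k) (-(j : ℤ) + 1) (by omega) rfl,
        hc (-(j : ℤ) + 1) _ _ (by omega), comp_zero, smul_zero, add_zero, Cochain.zero_v] at h₁
      obtain ⟨g, hg⟩ := h _ _ (by omega) _ h₁
      refine ⟨c + Cochain.single g (k - 1), fun p q hpq hp => ?_⟩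
      rw [δ_add, ← sub_sub, Cochain.sub_v, Cochain.δ_single g (k - 1) k (by omega)
        (-(j : ℤ) - 1) (-(j : ℤ) + k) (by omega) (by omega), Cochain.add_v, Cochain.units_smul_v,
        Cochain.single_v_eq_zero (X.d _ _ ≫ g) _ _ _ hpq (by omega), smul_zero, add_zero]
      by_cases hpj : p = -(j : ℤ)
      · subst hpj hpq
        rw [Cochain.single_v, hg, sub_self]
      · rw [hc _ _ _ (by omega), Cochain.single_v_eq_zero _ _ _ _ _ hpj, sub_zero]
  obtain ⟨c, hc⟩ := key m le_rfl
  refine ⟨c, (sub_eq_zero.1 ?_).symm⟩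
  ext p q hpq
  by_cases hp : -(m : ℤ) < p
  · rw [hc _ _ _ hp, Cochain.zero_v]
  · exact (hX p (Or.inr (by omega))).eq_of_src _ _

variable {K : Type w} [Field K] [Linear K V]

lemma finHom_stalk {M : V} {Y : CochainComplex V ℤ} (h : ∀ k, Module.Finite K (M ⟶ Y.X k)) :
    FinHom K ((stalk V).obj M) ((HomotopyCategory.quotient V (ComplexShape.up ℤ)).obj Y) := fun k => by
  let e := ((HomotopyCategory.quotient V (ComplexShape.up ℤ)).commShiftIso k).app Y
  let φ : ((CochainComplex.singleFunctor V 0).obj M ⟶ Y⟦k⟧) →ₗ[K] (M ⟶ Y.X (0 + k)) :=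
    { toFun := fun f => (HomologicalComplex.singleObjXSelf (ComplexShape.up ℤ) 0 M).inv ≫ f.f 0
      map_add' := fun f g => Preadditive.comp_add _ _ _ _ _ _
      map_smul' := fun c f => Linear.comp_smul _ _ _ _ _ _ }
  have hφ : Function.Injective φ := fun f g hfg => by
    refine HomologicalComplex.from_single_hom_ext ?_
    exact (cancel_epi (HomologicalComplex.singleObjXSelf (ComplexShape.up ℤ) 0 M).inv).1 hfg
  have := h (0 + k)
  have : Module.Finite K ((CochainComplex.singleFunctor V 0).obj M ⟶ Y⟦k⟧) :=
    FiniteDimensional.of_injective φ hφ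
  refine Module.Finite.of_surjective ((Linear.rightComp K _ e.hom).comp
    ((HomotopyCategory.quotient V (ComplexShape.up ℤ)).mapLinearMap K
      (X := (CochainComplex.singleFunctor V 0).obj M) (Y := Y⟦k⟧))) fun f => ?_
  obtain ⟨g, hg⟩ := (HomotopyCategory.quotient V (ComplexShape.up ℤ)).map_surjective (f ≫ e.inv)
  exact ⟨g, (congrArg (· ≫ e.hom) hg).trans ((Category.assoc _ _ _).trans
    ((congrArg (f ≫ ·) e.inv_hom_id).trans (Category.comp_id f)))⟩

end Homotopy


/-! ### The indecomposable projective modules of a presented algebra -/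

section Projectives

open scoped ModuleCat

variable {K : Type} [Field K] {A : Type} [Ring A] [Algebra K A]

/-- The module `A y`. -/
def cyc (y : A) : ModuleCat.{0} A := ModuleCat.of A (Submodule.span A {y})

/-- The inclusion of `A y` into `A`. -/
def cycVal (y : A) : cyc y →ₗ[A] A := (Submodule.span A {y}).subtype

lemma cycVal_injective (y : A) : Function.Injective (cycVal y) := Subtype.val_injective

/-- The generator of `A y`. -/
def gen (y : A) : cyc y :=
  (⟨y, Submodule.mem_span_singleton_self y⟩ : Submodule.span A {y})

lemma exists_smul_gen {y : A} (m : cyc y) : ∃ c : A, c • gen y = m := by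
  obtain ⟨c, hc⟩ := Submodule.mem_span_singleton.1 (Subtype.property
    (show Submodule.span A {y} from m))
  exact ⟨c, cycVal_injective y ((map_smul (cycVal y) c (gen y)).trans hc)⟩

lemma cyc_hom_ext {y : A} {M : ModuleCat.{0} A} {f g : cyc y ⟶ M} (h : f (gen y) = g (gen y)) :
    f = g := by
  ext m
  obtain ⟨c, rfl⟩ := exists_smul_gen m
  rw [map_smul, map_smul, h]

/-- The morphism from `A y` given by an element. -/
def cycHom (y : A) {M : ModuleCat.{0} A} (m : M) : cyc y ⟶ M :=
  ModuleCat.ofHom ((LinearMap.toSpanSingleton A M m).comp (cycVal y))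

lemma cycHom_apply (y : A) {M : ModuleCat.{0} A} (m : M) (t : cyc y) :
    cycHom y m t = cycVal y t • m := rfl

lemma smul_apply_gen {y : A} (hy : y * y = y) {M : ModuleCat.{0} A} (f : cyc y ⟶ M) :
    y • f (gen y) = f (gen y) := by
  rw [← map_smul]
  exact congrArg f (cycVal_injective y ((map_smul (cycVal y) y (gen y)).trans hy))

lemma finite_cyc_hom (y : A) (M : ModuleCat.{0} A) [Module.Finite K A] [Module.Finite A M] :
    Module.Finite K (cyc y ⟶ M) := by
  have : Module.Finite K M := Module.Finite.trans A M
  let φ : (cyc y ⟶ M) →ₗ[K] M :=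
    { toFun := fun f => f (gen y), map_add' := fun f g => rfl, map_smul' := fun c f => rfl }
  exact FiniteDimensional.of_injective φ fun f g h => cyc_hom_ext h

/-- Right multiplication as a morphism `A y ⟶ A z`. -/
def mulHom (y z : A) : A →ₗ[K] (cyc y ⟶ cyc z) where
  toFun r := cycHom y (r • gen z)
  map_add' r s := cyc_hom_ext (by
    change y • ((r + s) • gen z) = y • r • gen z + y • s • gen z
    rw [add_smul, smul_add])
  map_smul' c r := cyc_hom_ext (by
    change y • (c • r) • gen z = (algebraMap K A c) • (y • r • gen z)
    rw [← mul_smul, ← mul_smul, ← mul_smul, mul_smul_comm, Algebra.smul_def, mul_assoc])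

lemma mulHom_gen (y z r : A) : cycVal z (mulHom (K := K) y z r (gen y)) = y * r * z :=
  (mul_assoc y r z).symm

lemma mulHom_eq {y z : A} (hy : y * y = y) (hz : z * z = z) (r : A) :
    mulHom (K := K) y z (y * r * z) = mulHom (K := K) y z r :=
  cyc_hom_ext (cycVal_injective z (by
    rw [mulHom_gen, mulHom_gen]; simp only [mul_assoc, hz]; rw [← mul_assoc y y, hy]))

lemma mulHom_surjective {y z : A} (hy : y * y = y) (f : cyc y ⟶ cyc z) :
    ∃ r, mulHom (K := K) y z r = f := by
  obtain ⟨r, hr⟩ := exists_smul_gen (f (gen y))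
  exact ⟨r, cyc_hom_ext ((congrArg (y • ·) hr).trans (smul_apply_gen hy f))⟩

lemma mulHom_comp (y z t r s : A) :
    mulHom (K := K) y z r ≫ mulHom (K := K) z t s = mulHom (K := K) y t (r * z * s) := by
  refine cyc_hom_ext (cycVal_injective t ?_)
  rw [mulHom_gen]
  change (y * (r * z)) * (s * t) = _
  simp only [mul_assoc]

lemma mulHom_self {y : A} (hy : y * y = y) : mulHom (K := K) y y y = 𝟙 (cyc y) :=
  cyc_hom_ext (cycVal_injective y (by rw [mulHom_gen, hy, hy]; rfl))

/-- The projective modules of a presented algebra, as stalk complexes. -/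
def projFamily {n : ℕ} (e : Fin n → A) (a : Fin n) : HtpyCat A := (stalk (ModuleCat.{0} A)).obj (cyc (e a))

/-- Right multiplication, as a morphism of stalk complexes. -/
def stalkHom {n : ℕ} (e : Fin n → A) (a b : Fin n) : A →ₗ[K] (projFamily e a ⟶ projFamily e b) :=
  (((HomotopyCategory.quotient (ModuleCat.{0} A) (ComplexShape.up ℤ)).mapLinearMap K
    (X := (CochainComplex.singleFunctor _ 0).obj (cyc (e a)))
    (Y := (CochainComplex.singleFunctor _ 0).obj (cyc (e b)))).comp
    ((CochainComplex.singleFunctor (ModuleCat.{0} A) 0).mapLinearMap K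
      (X := cyc (e a)) (Y := cyc (e b)))).comp (mulHom (e a) (e b))

variable {n : ℕ} {q : Quiv n} {e : Fin n → A} {x : ℕ → A}

lemma stalkHom_apply (a b : Fin n) (r : A) :
    stalkHom (K := K) e a b r = (stalk (ModuleCat.{0} A)).map (mulHom (K := K) (e a) (e b) r) := rfl

lemma eq_zero_of_stalkHom {a b : Fin n} {r : A} (h : stalkHom (K := K) e a b r = 0) :
    e a * r * e b = 0 := by
  rw [stalkHom_apply] at h
  have h' := (stalk (ModuleCat.{0} A)).map_injective (h.trans (Functor.map_zero _ _ _).symm)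
  rw [← mulHom_gen (K := K), h']
  rfl

/-- The projective modules of a presented algebra have the type given by the presentation. -/
def hasTypeOfPres {α : Type} {R : Coef α} {ev : α → K} (hR : R.IsEval ev) {ar : List ℕ}
    {rel : List (LC α)} {rules : List (Word × LC α)}
    {certs : List (α × List (α × Word × ℕ × Word))}
    (h : IsPres q ar (rel.map (mapLC ev)) e x) (hc : presCheck q R rules ar rel certs = true) :
    HasType K q (mapRules ev rules) (projFamily e) := by
  have hrep := h.toIsQuivRep
  have hi := hrep.idem_self
  simp only [presCheck, Bool.and_eq_true, List.all_eq_true] at hc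
  obtain ⟨⟨⟨hc₁, hc₂⟩, hc₃⟩, hc₄⟩ := hc
  have hr : ∀ r ∈ rules, prodW x r.1 = evalL ev (prodW x) r.2 :=
    rules_of_certCheck hR hc₁ fun p hp => by
      rw [← evalL_mapLC]
      exact h.relations _ (List.mem_map_of_mem hp)
  have hrel : ∀ r ∈ rel, ∀ t ∈ r, ∀ k ∈ t.2, k ∈ ar := fun r hr t ht k hk => by
    have := hc₄ r hr t ht k hk
    rw [List.any_eq_true] at this
    obtain ⟨k', hk', h'⟩ := this
    rwa [Nat.eq_of_beq_eq_true h']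
  have hH : ∀ a b r, stalkHom (K := K) e a b (e a * r * e b) = stalkHom (K := K) e a b r :=
    fun a b r => by rw [stalkHom_apply, mulHom_eq (hi a) (hi b), stalkHom_apply]
  have hcomp : ∀ a b c r s, stalkHom (K := K) e a b r ≫ stalkHom (K := K) e b c s =
      stalkHom (K := K) e a c (r * e b * s) := fun a b c r s => by
    rw [stalkHom_apply, stalkHom_apply, stalkHom_apply, ← mulHom_comp]
    exact (Functor.map_comp _ _ _).symm
  refine
    { β := fun a b w => stalkHom (K := K) e a b (e a * prodW x w * e b)
      nil := fun a => ?_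
      zero := fun a b w hw => ?_
      mul := fun a b c u v hu hv => ?_
      rule := fun r hr' a b _ => ?_
      indep := fun a b => ?_
      span := fun a b f _ => ?_
      vanish := fun a b k hk => homZero_stalk _ _ hk }
  · rw [prodW_nil, mul_one, hi, stalkHom_apply, mulHom_self (hi a)]
    exact CategoryTheory.Functor.map_id _ _
  · rw [hrep.eq_zero_of_not_isPath hw, map_zero]
  · rw [hcomp, ← hrep.comp_of_left hu]
    congr 1
    simp only [mul_assoc, hi]
  · obtain ⟨r, hr'', rfl⟩ := List.mem_map.1 hr'
    rw [hr _ hr'', hH]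
    dsimp only
    rw [List.map_map, evalL, map_list_sum, List.map_map]
    congr 1
    refine List.map_congr_left fun t _ => ?_
    simp only [Function.comp_apply, map_smul]
    rw [hH]
  · refine (h.linearIndependent hR hc₃ hrel a b).map (f := stalkHom (K := K) e a b) ?_
    rw [Submodule.disjoint_def]
    intro y hy
    have h₁ : e a * y * e b = y := by
      induction hy using Submodule.span_induction with
      | mem y hy =>
        obtain ⟨i, rfl⟩ := hy
        simp only [mul_assoc, hi]
        rw [← mul_assoc (e a) (e a), hi]
      | zero => simp
      | add y z _ _ hy hz => rw [mul_add, add_mul, hy, hz]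
      | smul c y _ hy => rw [mul_smul_comm, smul_mul_assoc, hy]
    intro hy'
    rw [← h₁]
    exact eq_zero_of_stalkHom hy'
  · obtain ⟨f, rfl⟩ : ∃ g, (stalk (ModuleCat.{0} A)).map g = f := (stalk (ModuleCat.{0} A)).map_surjective f
    obtain ⟨r, rfl⟩ := mulHom_surjective (K := K) (hi a) f
    rw [← stalkHom_apply, ← hH]
    have := Submodule.mem_map_of_mem (f := stalkHom (K := K) e a b) (h.mem_span hR hr hc₂ a b r)
    rwa [Submodule.map_span, ← Set.range_comp] at this

lemma finite_of_pres {α : Type} {R : Coef α} {ev : α → K} (hR : R.IsEval ev) {ar : List ℕ}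
    {rel : List (LC α)} {rules : List (Word × LC α)}
    {certs : List (α × List (α × Word × ℕ × Word))}
    (h : IsPres q ar (rel.map (mapLC ev)) e x) (hc : presCheck q R rules ar rel certs = true) :
    Module.Finite K A := by
  simp only [presCheck, Bool.and_eq_true] at hc
  have hr : ∀ r ∈ rules, prodW x r.1 = evalL ev (prodW x) r.2 :=
    rules_of_certCheck hR hc.1.1.1 fun p hp => by
      rw [← evalL_mapLC]
      exact h.relations _ (List.mem_map_of_mem hp)
  refine ⟨Submodule.fg_def.2 ⟨Set.range fun t : Σ p : Fin n × Fin n, Fin (q.bas p.1 p.2).length =>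
    e t.1.1 * prodW x ((q.bas t.1.1 t.1.2).get t.2) * e t.1.2, Set.finite_range _,
    eq_top_iff.2 fun y _ => ?_⟩⟩
  rw [h.toIsQuivRep.eq_sum y]
  refine Submodule.sum_mem _ fun a _ => Submodule.sum_mem _ fun b _ => ?_
  refine Submodule.span_mono ?_ (h.mem_span hR hr hc.1.1.2 a b y)
  rintro _ ⟨i, rfl⟩
  exact ⟨⟨(a, b), i⟩, rfl⟩

/-- A complex receiving no morphisms of positive degree from the projectives is exact in positive
degrees. -/
lemma exact_of_ge (hs : ∑ a, e a = 1)
    {Z : CochainComplex (ModuleCat.{0} A) ℤ}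
    (hZ : Ge (projFamily e) ((HomotopyCategory.quotient _ _).obj Z)) {k : ℤ} (hk : 0 < k)
    (z : Z.X k) (hz : Z.d k (k + 1) z = 0) : ∃ y, Z.d (k - 1) k y = z := by
  have h : ∀ a, ∃ y, Z.d (k - 1) k y = e a • z := fun a => by
    obtain ⟨g, hg⟩ := (homZero_stalk_iff _ _ _).1 (hZ a k hk) (cycHom (e a) z) (cyc_hom_ext (by
      rw [ModuleCat.comp_apply, cycHom_apply, map_smul, hz, smul_zero]
      rfl))
    refine ⟨g (gen (e a)), ?_⟩
    rw [← ModuleCat.comp_apply, hg]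
    rfl
  choose y hy using h
  refine ⟨∑ a, y a, ?_⟩
  rw [map_sum, Finset.sum_congr rfl fun a _ => hy a, ← Finset.sum_smul, hs, one_smul]

/-- A bounded complex of finitely generated projectives lies below the projectives. -/
lemma below_of_isMTermObj [Module.Finite K A] (hs : ∑ a, e a = 1) {m : ℕ}
    {X : HtpyCat A} (hX : IsMTermObj A m X) : Below K (projFamily e) (m : ℤ) X := by
  obtain ⟨T, hT, hT', ⟨i⟩⟩ := hX
  have hfin : ∀ a, FinHom K (projFamily e a) (ofComplex A T) := fun a =>
    finHom_stalk fun k => by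
      have := (hT k).2
      exact finite_cyc_hom (e a) (T.X k)
  refine ⟨fun a k hk => ?_, fun a k => ?_, fun a k hk => ?_, m, fun Z hZ k hk => ?_⟩
  · refine HomZero.of_iso_right i.symm (homZero_quotient_of_isZero fun j => ?_)
    by_cases hj : j = 0
    · exact Or.inr (hT' _ (Or.inl (by omega)))
    · exact Or.inl (isZero_single _ hj)
  · have := hfin a k
    refine Module.Finite.equiv (M := (projFamily e a ⟶ (ofComplex A T)⟦k⟧)) ?_
    exact LinearEquiv.ofBijective (Linear.rightComp K _ ((shiftFunctor _ k).map i.inv))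
      ⟨fun f g hfg => (cancel_mono ((shiftFunctor _ k).map i.inv)).1 hfg,
        fun f => ⟨f ≫ (shiftFunctor _ k).map i.hom, by simp [← Functor.map_comp]⟩⟩
  · refine HomZero.of_iso_left i.symm (homZero_quotient_of_isZero fun j => ?_)
    by_cases hj : j ≤ -(m : ℤ)
    · exact Or.inl (hT' _ (Or.inr hj))
    · exact Or.inr (isZero_single _ (by omega))
  · obtain ⟨Z, rfl⟩ := HomotopyCategory.quotient_obj_surjective Z
    refine HomZero.of_iso_left i.symm (homZero_of_projective m hT' hk fun i j hj f hf => ?_)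
    have := (hT i).1
    have : Module.Projective A (T.X i) := (IsProjective.iff_projective _).2 this
    let D := (Z.d (j - 1) j).hom
    have hr : ∀ t, f.hom t ∈ LinearMap.range D := fun t =>
      exact_of_ge hs hZ hj _ (by rw [← ModuleCat.comp_apply, hf]; rfl)
    obtain ⟨g, hg⟩ := Module.projective_lifting_property D.rangeRestrict
      (f.hom.codRestrict _ hr) (LinearMap.surjective_rangeRestrict D)
    refine ⟨ModuleCat.ofHom g, ?_⟩
    ext t
    exact congrArg Subtype.val (LinearMap.congr_fun hg t)

/-- There are only finitely many basic presilting objects of each length. -/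
def IsPresiltingDiscrete (A : Type) [Ring A] : Prop :=
  ∀ m : ℕ, FinIso fun X : HtpyCat A => IsMTermObj A m X ∧ IsPresiltingObj X ∧ IsBasicObj X

/-- An algebra whose presentation occurs in a verified table of mutations has only finitely many
basic presilting objects of each length. -/
theorem isPresiltingDiscrete_of_table {α : Type} {R : Coef α} {m : ℕ} {T : MutTable α n m}
    {Θ : Type} (ev : Θ → α → K) (hev : ∀ θ, R.IsEval (ev θ)) (ht : T.check R = true)
    (hsub : ∀ s i θ, ∃ θ', mapRules (ev θ) (T.edge s i).rules =
      mapRules (ev θ') (T.rules (T.edge s i).nxt)) {s : Fin m} {θ : Θ} {ar : List ℕ}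
    {rel : List (LC α)} {certs : List (α × List (α × Word × ℕ × Word))}
    (h : IsPres (T.Γ s) ar (rel.map (mapLC (ev θ))) e x)
    (hc : presCheck (T.Γ s) R (T.rules s) ar rel certs = true) : IsPresiltingDiscrete A := by
  intro l
  have := finite_of_pres (hev θ) h hc
  refine FinIso.mono (T.finIso ev hev ht hsub l (hasTypeOfPres (hev θ) h hc)) ?_
  exact fun X hX => ⟨below_of_isMTermObj h.toIsQuivRep.sum hX.1, hX.2⟩

end Projectives


/-! ### Morita invariance -/

section Morita

variable {R S : Type} [Ring R] [Ring S]

lemma isNoetherian_of_equivalence (F : ModuleCat.{0} R ≌ ModuleCat.{0} S) (M : ModuleCat.{0} R)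
    [IsNoetherian R M] : IsNoetherian S (F.functor.obj M) := by
  rw [isNoetherian_iff']
  let e : Submodule R M ≃o Submodule S (F.functor.obj M) :=
    (ModuleCat.subobjectModule M).symm.trans
      (((MonoOver.congr M F).trans (ThinSkeleton.equivalence _).symm).thinSkeletonOrderIso.trans
        (ModuleCat.subobjectModule _))
  exact e.symm.toOrderEmbedding.wellFoundedGT

variable (F : ModuleCat.{0} R ≌ ModuleCat.{0} S)

instance : F.functor.Additive := Functor.additive_of_preserves_binary_products _

instance : F.inverse.Additive := Functor.additive_of_preserves_binary_products _

instance : (F.functor.mapHomotopyCategory (ComplexShape.up ℤ)).EssSurj where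
  mem_essImage Y := by
    obtain ⟨Z, rfl⟩ := HomotopyCategory.quotient_obj_surjective Y
    exact ⟨(HomotopyCategory.quotient _ _).obj ((F.inverse.mapHomologicalComplex _).obj Z),
      ⟨(HomotopyCategory.quotient _ _).mapIso (((Functor.mapHomologicalComplexCompIso
        (Iso.refl _) (ComplexShape.up ℤ)).app Z) ≪≫
        ((NatIso.mapHomologicalComplex F.counitIso (ComplexShape.up ℤ)).app Z) ≪≫
        (Functor.mapHomologicalComplexIdIso _ _).app Z)⟩⟩

lemma isMTermObj_map [IsNoetherianRing R] {m : ℕ} {X : HtpyCat R} (h : IsMTermObj R m X) :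
    IsMTermObj S m ((F.functor.mapHomotopyCategory (ComplexShape.up ℤ)).obj X) := by
  obtain ⟨P, hP, hP', ⟨i⟩⟩ := h
  refine ⟨(F.functor.mapHomologicalComplex _).obj P, fun j => ⟨?_, ?_⟩, fun j hj => ?_,
    ⟨(F.functor.mapHomotopyCategory (ComplexShape.up ℤ)).mapIso i⟩⟩
  · exact (F.map_projective_iff _).2 (hP j).1
  · have := (hP j).2
    have := isNoetherian_of_equivalence F (P.X j)
    exact Module.IsNoetherian.finite S (F.functor.obj (P.X j))
  · exact F.functor.map_isZero (hP' j hj)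

lemma isPresiltingObj_map {X : HtpyCat R} (h : IsPresiltingObj X) :
    IsPresiltingObj ((F.functor.mapHomotopyCategory (ComplexShape.up ℤ)).obj X) := fun n hn f => by
  let G := F.functor.mapHomotopyCategory (ComplexShape.up ℤ)
  let e := (G.commShiftIso n).app X
  obtain ⟨g, hg⟩ := G.map_surjective (f ≫ e.inv)
  have h₁ : f ≫ e.inv = 0 := hg.symm.trans ((congrArg G.map (h n hn g)).trans (G.map_zero _ _))
  rw [← cancel_mono e.inv, h₁, zero_comp]

lemma isBasicObj_map {X : HtpyCat R} (h : IsBasicObj X) :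
    IsBasicObj ((F.functor.mapHomotopyCategory (ComplexShape.up ℤ)).obj X) := by
  let G := F.functor.mapHomotopyCategory (ComplexShape.up ℤ)
  intro Y i₁ i₂ p₁ p₂ h₁₁ h₂₂ h₁₂ h₂₁
  let e := G.objObjPreimageIso Y
  have key : ∀ (i : Y ⟶ G.obj X) (p : G.obj X ⟶ Y),
      G.map (G.preimage (e.hom ≫ i) ≫ G.preimage (p ≫ e.inv)) = e.hom ≫ (i ≫ p) ≫ e.inv :=
    fun i p => by simp
  refine IsZero.of_iso (G.map_isZero (h (G.objPreimage Y) (G.preimage (e.hom ≫ i₁))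
    (G.preimage (e.hom ≫ i₂)) (G.preimage (p₁ ≫ e.inv)) (G.preimage (p₂ ≫ e.inv)) ?_ ?_ ?_ ?_))
    e.symm <;> apply G.map_injective <;> rw [key]
  · rw [h₁₁]; simp
  · rw [h₂₂]; simp
  · rw [h₁₂]; simp
  · rw [h₂₁]; simp

theorem IsPresiltingDiscrete.of_equivalence [IsNoetherianRing R]
    (F : ModuleCat.{0} R ≌ ModuleCat.{0} S) (h : IsPresiltingDiscrete S) :
    IsTiltingDiscreteRing R := by
  let G := F.functor.mapHomotopyCategory (ComplexShape.up ℤ)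
  intro m _
  obtain ⟨k, f, hf⟩ := h m
  refine ⟨k, fun i => G.objPreimage (f i), fun X hX hm hb => ?_⟩
  obtain ⟨i, ⟨e⟩⟩ := hf (G.obj X) ⟨isMTermObj_map F hm,
    isPresiltingObj_map F fun n hn => hX.2.1 n hn.ne', isBasicObj_map F hb⟩
  exact ⟨i, ⟨G.preimageIso (e ≪≫ (G.objObjPreimageIso (f i)).symm)⟩⟩

theorem IsPresiltingDiscrete.of_moritaEquivalent (K : Type) {Λ Γ : Type} [Field K] [Ring Λ]
    [Algebra K Λ] [FiniteDimensional K Λ] [Ring Γ] (h : IsPresiltingDiscrete Γᵐᵒᵖ) (e : MoritaEquivalent Λ Γ) :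
    IsTiltingDiscrete Λ := by
  have : IsNoetherianRing Λᵐᵒᵖ := isNoetherian_of_tower K inferInstance
  obtain ⟨F⟩ := e
  exact h.of_equivalence F

end Morita


/-! ### The weakly symmetric algebras of tubular type -/

section Cases

variable {K : Type} [Field K]

lemma isPresiltingDiscrete_of_intTable {n m N : ℕ} (T : MutTable ℤ n m)
    (ht : T.check intCoef = true)
    (hsub : ∀ s i, (T.edge s i).rules = T.rules (T.edge s i).nxt) (s : Fin m) (hn : n ≤ N)
    {D : QuivData N} {σ : Fin N → Fin N} (hop : D.IsOp (T.Γ s) σ)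
    (hD : ∀ p ∈ D.ext, (∀ t ∈ p.1, t.1 = false) ∧ ∀ t ∈ p.2, t.1 = false)
    {certs : List (ℤ × List (ℤ × Word × ℕ × Word))}
    (hc : presCheck (T.Γ s) intCoef (T.rules s) (List.range' n (N - n)) (D.relL intCoef σ) certs =
      true)
    {r : FreeAlgebra K (Fin N) → FreeAlgebra K (Fin N) → Prop}
    (hr : r = fun u v => (u, v) ∈ D.relList ((List.finRange n).map (Fin.castLE hn)) (0 : K)) :
    IsPresiltingDiscrete (RingQuot r)ᵐᵒᵖ := by
  obtain ⟨e, x, h⟩ := hop.exists_isPres hn (0 : K) hr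
  rw [← QuivData.map_relL (intCoef_isEval K) D σ 0 hD] at h
  exact isPresiltingDiscrete_of_table (R := intCoef) (T := T) (Θ := Unit) (θ := ())
    (fun _ z => (z : K))
    (fun _ => intCoef_isEval K) ht (fun s i θ => ⟨θ, by rw [hsub]⟩) h hc

lemma tableA_rules (s : Fin 1) (i : Fin 4) :
    (tableA.edge s i).rules = tableA.rules (tableA.edge s i).nxt := by
  fin_cases s; fin_cases i <;> rfl

lemma tableB_rules (s : Fin 6) (i : Fin 4) :
    (tableB.edge s i).rules = tableB.rules (tableB.edge s i).nxt := by
  fin_cases s <;> fin_cases i <;> rfl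

lemma tableC_rules (s : Fin 2) (i : Fin 2) :
    (tableC.edge s i).rules = tableC.rules (tableC.edge s i).nxt := by
  fin_cases s <;> fin_cases i <;> rfl

lemma tableD_rules (s : Fin 5) (i : Fin 3) :
    (tableD.edge s i).rules = tableD.rules (tableD.edge s i).nxt := by
  fin_cases s <;> fin_cases i <;> rfl

lemma isPresiltingDiscrete_A1 {l : K} (h₀ : l ≠ 0) (h₁ : l ≠ 1) :
    IsPresiltingDiscrete (A1 K l)ᵐᵒᵖ := by
  let t : Param K := ⟨(l, 1), h₀, one_ne_zero, sub_ne_zero.2 h₁⟩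
  obtain ⟨e, x, h⟩ := isOpA1.exists_isPres (by decide) l (r := A1Rel K l) rfl
  rw [← map_relA1 (t := t) rfl] at h
  exact isPresiltingDiscrete_of_table (T := tableA1) (s := 0) (θ := t) evalPoly polyCoef_isEval
    tableA1_check tableA1_param h presA1

lemma isPresiltingDiscrete_A2 {l : K} (h₀ : l ≠ 0) (h₁ : l ≠ 1) :
    IsPresiltingDiscrete (A2 K l)ᵐᵒᵖ := by
  let t : Param K := ⟨(1, l), one_ne_zero, h₀, sub_ne_zero.2 h₁.symm⟩
  obtain ⟨e, x, h⟩ := isOpA2.exists_isPres (by decide) l (r := A2Rel K l) rfl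
  rw [← map_relA2 (t := t) rfl] at h
  exact isPresiltingDiscrete_of_table (T := tableA2) (s := 0) (θ := t) evalPoly polyCoef_isEval
    tableA2_check tableA2_param h presA2

variable (K)

lemma isPresiltingDiscrete_A3 : IsPresiltingDiscrete (A3 K)ᵐᵒᵖ :=
  isPresiltingDiscrete_of_intTable (r := A3Rel K) tableA tableA_check tableA_rules 0 (by decide)
    isOpA3 (by decide +kernel) presA3 rfl

lemma isPresiltingDiscrete_A4 : IsPresiltingDiscrete (A4 K)ᵐᵒᵖ :=
  isPresiltingDiscrete_of_intTable (r := A4Rel K) tableB tableB_check tableB_rules 0 (by decide)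
    isOpA4 (by decide +kernel) presA4 rfl

lemma isPresiltingDiscrete_A5 : IsPresiltingDiscrete (A5 K)ᵐᵒᵖ :=
  isPresiltingDiscrete_of_intTable (r := A5Rel K) tableC tableC_check tableC_rules 0 (by decide)
    isOpA5 (by decide +kernel) presA5 rfl

lemma isPresiltingDiscrete_A6 : IsPresiltingDiscrete (A6 K)ᵐᵒᵖ :=
  isPresiltingDiscrete_of_intTable (r := A6Rel K) tableC tableC_check tableC_rules 1 (by decide)
    isOpA6 (by decide +kernel) presA6 rfl

lemma isPresiltingDiscrete_A7 : IsPresiltingDiscrete (A7 K)ᵐᵒᵖ :=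
  isPresiltingDiscrete_of_intTable (r := A7Rel K) tableB tableB_check tableB_rules 1 (by decide)
    isOpA7 (by decide +kernel) presA7 rfl

lemma isPresiltingDiscrete_A8 : IsPresiltingDiscrete (A8 K)ᵐᵒᵖ :=
  isPresiltingDiscrete_of_intTable (r := A8Rel K) tableB tableB_check tableB_rules 2 (by decide)
    isOpA8 (by decide +kernel) presA8 rfl

lemma isPresiltingDiscrete_A9 : IsPresiltingDiscrete (A9 K)ᵐᵒᵖ :=
  isPresiltingDiscrete_of_intTable (r := A9Rel K) tableB tableB_check tableB_rules 3 (by decide)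
    isOpA9 (by decide +kernel) presA9 rfl

lemma isPresiltingDiscrete_A10 : IsPresiltingDiscrete (A10 K)ᵐᵒᵖ :=
  isPresiltingDiscrete_of_intTable (r := A10Rel K) tableB tableB_check tableB_rules 4 (by decide)
    isOpA10 (by decide +kernel) presA10 rfl

lemma isPresiltingDiscrete_A11 : IsPresiltingDiscrete (A11 K)ᵐᵒᵖ :=
  isPresiltingDiscrete_of_intTable (r := A11Rel K) tableB tableB_check tableB_rules 5 (by decide)
    isOpA11 (by decide +kernel) presA11 rfl

lemma isPresiltingDiscrete_A12 : IsPresiltingDiscrete (A12 K)ᵐᵒᵖ :=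
  isPresiltingDiscrete_of_intTable (r := A12Rel K) tableD tableD_check tableD_rules 0 (by decide)
    isOpA12 (by decide +kernel) presA12 rfl

lemma isPresiltingDiscrete_A13 : IsPresiltingDiscrete (A13 K)ᵐᵒᵖ :=
  isPresiltingDiscrete_of_intTable (r := A13Rel K) tableD tableD_check tableD_rules 1 (by decide)
    isOpA13 (by decide +kernel) presA13 rfl

lemma isPresiltingDiscrete_A14 : IsPresiltingDiscrete (A14 K)ᵐᵒᵖ :=
  isPresiltingDiscrete_of_intTable (r := A14Rel K) tableD tableD_check tableD_rules 2 (by decide)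
    isOpA14 (by decide +kernel) presA14 rfl

lemma isPresiltingDiscrete_A15 : IsPresiltingDiscrete (A15 K)ᵐᵒᵖ :=
  isPresiltingDiscrete_of_intTable (r := A15Rel K) tableD tableD_check tableD_rules 4 (by decide)
    isOpA15 (by decide +kernel) presA15 rfl

lemma isPresiltingDiscrete_A16 : IsPresiltingDiscrete (A16 K)ᵐᵒᵖ :=
  isPresiltingDiscrete_of_intTable (r := A16Rel K) tableD tableD_check tableD_rules 3 (by decide)
    isOpA16 (by decide +kernel) presA16 rfl

end Cases

/-- Corollary 3.3 of the paper.  Every weakly symmetric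
algebra of tubular type with non-singular Cartan matrix over an algebraically
closed field `K` is tilting-discrete. -/
theorem weakly_symmetric_tubular_algebras_tilting_discrete
    (K Λ : Type) [Field K] [IsAlgClosed K] [Ring Λ] [Algebra K Λ] [FiniteDimensional K Λ]
    (h : IsWeaklySymmetricTubularNonsingular K Λ) :
    IsTiltingDiscrete Λ := by
  rcases h with ⟨l, h₀, h₁, e⟩ | ⟨l, h₀, h₁, e⟩ | e | e | e | e | e | e | e | e | e | e | e | e | e | e
  · exact (isPresiltingDiscrete_A1 h₀ h₁).of_moritaEquivalent K e
  · exact (isPresiltingDiscrete_A2 h₀ h₁).of_moritaEquivalent K e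
  · exact (isPresiltingDiscrete_A3 K).of_moritaEquivalent K e
  · exact (isPresiltingDiscrete_A4 K).of_moritaEquivalent K e
  · exact (isPresiltingDiscrete_A5 K).of_moritaEquivalent K e
  · exact (isPresiltingDiscrete_A6 K).of_moritaEquivalent K e
  · exact (isPresiltingDiscrete_A7 K).of_moritaEquivalent K e
  · exact (isPresiltingDiscrete_A8 K).of_moritaEquivalent K e
  · exact (isPresiltingDiscrete_A9 K).of_moritaEquivalent K e
  · exact (isPresiltingDiscrete_A10 K).of_moritaEquivalent K e
  · exact (isPresiltingDiscrete_A11 K).of_moritaEquivalent K e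
  · exact (isPresiltingDiscrete_A12 K).of_moritaEquivalent K e
  · exact (isPresiltingDiscrete_A13 K).of_moritaEquivalent K e
  · exact (isPresiltingDiscrete_A14 K).of_moritaEquivalent K e
  · exact (isPresiltingDiscrete_A15 K).of_moritaEquivalent K e
  · exact (isPresiltingDiscrete_A16 K).of_moritaEquivalent K e

end PaperSilting
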